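/- (Koenigsmann's Lemma, p-adic case.) Let p be a prime and k a finite field extension of ℚ_p. Let X be an integral scheme of finite type over k such that k is relatively algebraically closed in the function field K = k(X) (this expresses geometric irreducibility in characteristic zero). If there exists a birational Galois section s : Gal_k → Gal_K, then X has a k-rational point, i.e., there exists a morphism Spec k → X over k. -/

import Mathlib

/-!
Koenigsmann's Lemma (p-adic case): if a geometrically irreducible variety `X` over a
finite extension `k/ℚ_p` admits a birational Galois section, then `X` has a `k`-rational
point.
-/

open AlgebraicGeometry CategoryTheory

/-- The restriction homomorphism `Gal(Kbar/F) →* Gal(kbar/k)`, where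
`kbar = algebraicClosure k Kbar` is the relative algebraic closure of `k` in `Kbar`. -/
noncomputable def resHom (k F Kbar : Type*) [Field k] [Field F] [Field Kbar]
    [Algebra k F] [Algebra F Kbar] [Algebra k Kbar] [IsScalarTower k F Kbar]
    [IsAlgClosed Kbar] :
    (Kbar ≃ₐ[F] Kbar) →* ((algebraicClosure k Kbar) ≃ₐ[k] (algebraicClosure k Kbar)) :=
  (AlgEquiv.restrictNormalHom (F := k) (K₁ := Kbar) (algebraicClosure k Kbar)).comp
    { toFun := fun σ => σ.restrictScalars k
      map_one' := rfl
      map_mul' := fun _ _ => rfl }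

/-- A subset of a field which is the set of elements of a subgroup of the unit group. -/
structure IsMulSubgroup {F : Type*} [Field F] (S : Set F) : Prop where
  one_mem : (1 : F) ∈ S
  mul_mem : ∀ {x y : F}, x ∈ S → y ∈ S → x * y ∈ S
  inv_mem : ∀ {x : F}, x ∈ S → x⁻¹ ∈ S
  ne_zero : ∀ {x : F}, x ∈ S → x ≠ 0

namespace IsMulSubgroup
variable {F : Type*} [Field F] {S : Set F}

theorem div_mem (hS : IsMulSubgroup S) {x y : F} (hx : x ∈ S) (hy : y ∈ S) : x / y ∈ S := by
  rw [div_eq_mul_inv]; exact hS.mul_mem hx (hS.inv_mem hy)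

theorem pow_mem (hS : IsMulSubgroup S) {x : F} (hx : x ∈ S) (n : ℕ) : x ^ n ∈ S := by
  induction n with
  | zero => simpa using hS.one_mem
  | succ n ih => rw [pow_succ]; exact hS.mul_mem ih hx

theorem mul_mem_iff_left (hS : IsMulSubgroup S) {x y : F} (hx : x ∈ S) :
    x * y ∈ S ↔ y ∈ S := by
  refine ⟨fun h => ?_, hS.mul_mem hx⟩
  have := hS.mul_mem (hS.inv_mem hx) h
  rwa [inv_mul_cancel_left₀ (hS.ne_zero hx)] at this

theorem mul_mem_iff_right (hS : IsMulSubgroup S) {x y : F} (hy : y ∈ S) :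
    x * y ∈ S ↔ x ∈ S := by
  rw [mul_comm, hS.mul_mem_iff_left hy]

theorem div_mem_iff_right (hS : IsMulSubgroup S) {x y : F} (hy : y ∈ S) :
    x / y ∈ S ↔ x ∈ S := by
  rw [div_eq_mul_inv, hS.mul_mem_iff_right (hS.inv_mem hy)]

theorem inv_mem_iff (hS : IsMulSubgroup S) {x : F} : x⁻¹ ∈ S ↔ x ∈ S :=
  ⟨fun h => by simpa using hS.inv_mem h, hS.inv_mem⟩

theorem mem_of_pow_mem_of_coprime (hS : IsMulSubgroup S) {x : F} {m n : ℕ} (h : m.Coprime n)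
    (hx : x ≠ 0) (hm : x ^ m ∈ S) (hn : x ^ n ∈ S) : x ∈ S := by
  have hz : ∀ {y : F}, y ∈ S → ∀ j : ℤ, y ^ j ∈ S := by
    intro y hy j
    cases j with
    | ofNat j => simpa using hS.pow_mem hy j
    | negSucc j => rw [zpow_negSucc]; exact hS.inv_mem (hS.pow_mem hy _)
  have hbez := Nat.gcd_eq_gcd_ab m n
  rw [h] at hbez
  have := hS.mul_mem (hz hm (m.gcdA n)) (hz hn (m.gcdB n))
  rwa [← zpow_natCast, ← zpow_natCast, ← zpow_mul, ← zpow_mul, ← zpow_add₀ hx, ← hbez,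
    Nat.cast_one, zpow_one] at this

end IsMulSubgroup

/-- The data from which a valuation ring is built out of a pair of multiplicative subgroups
`S ⊆ T` of a field, where `x ∉ T` forces `1 + x ∈ S ∪ x S`. -/
structure RigidPair {F : Type*} [Field F] (S T U : Set F) : Prop where
  hS : IsMulSubgroup S
  hT : IsMulSubgroup T
  hU : IsMulSubgroup U
  S_le : S ⊆ T
  U_le : U ⊆ T
  neg_one_mem : (-1 : F) ∈ S
  neg_one_mem_U : (-1 : F) ∈ U
  rigid : ∀ {x : F}, x ≠ 0 → x ∉ T → 1 + x ∈ S ∨ (1 + x) / x ∈ S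
  one_add_mem : ∀ {t : F}, t ∈ T → t ∉ S → 1 + t ∈ T
  exists_U : ∃ u ∈ U, u ∉ S
  pow_U : ∀ {u : F}, u ∈ U → u ∉ S → ∃ m : ℕ, 1 ≤ m ∧
    1 - ((1 - u) ^ m)⁻¹ ∈ T ∧ 1 - ((1 - u) ^ m)⁻¹ ∉ S

namespace RigidPair
variable {F : Type*} [Field F] {S T U : Set F}

/-- The elements outside `T` lying in the valuation ring attached to `S ⊆ T`. -/
def small (S T : Set F) : Set F := {x | x ≠ 0 ∧ x ∉ T ∧ 1 + x ∈ S}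

/-- The elements of `T` lying in the valuation ring attached to `S ⊆ T`. -/
def stable (S T : Set F) : Set F := {t | t ∈ T ∧ ∀ z ∈ small S T, t * z ∈ small S T}

theorem of_not_small (h : RigidPair S T U) {x : F} (h0 : x ≠ 0) (hx : x ∉ T)
    (hs : x ∉ small S T) : (1 + x) / x ∈ S := by
  rcases h.rigid h0 hx with h1 | h1
  · exact absurd ⟨h0, hx, h1⟩ hs
  · exact h1

theorem inv_not_mem_T (h : RigidPair S T U) {x : F} (hx : x ∉ T) : x⁻¹ ∉ T :=
  fun h' => hx (h.hT.inv_mem_iff.1 h')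

theorem inv_small_of_not_small (h : RigidPair S T U) {x : F} (h0 : x ≠ 0) (hx : x ∉ T)
    (hs : x ∉ small S T) : x⁻¹ ∈ small S T := by
  refine ⟨inv_ne_zero h0, h.inv_not_mem_T hx, ?_⟩
  have := h.of_not_small h0 hx hs
  convert this using 1
  field_simp
  ring

theorem neg_mem_T (h : RigidPair S T U) {x : F} : -x ∈ T ↔ x ∈ T := by
  rw [← h.hT.mul_mem_iff_left (h.S_le h.neg_one_mem) (y := x), neg_one_mul]

theorem neg_mem_S (h : RigidPair S T U) {x : F} : -x ∈ S ↔ x ∈ S := by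
  rw [← h.hS.mul_mem_iff_left h.neg_one_mem (y := x), neg_one_mul]

/-- `x ∉ T` where `x = a * t`, `t ∈ T`. -/
theorem mul_not_mem_T (h : RigidPair S T U) {x t : F} (hx : x ∉ T) (ht : t ∈ T) :
    x * t ∉ T := fun h' => hx ((h.hT.mul_mem_iff_right ht).1 h')

theorem div_not_mem_T (h : RigidPair S T U) {x t : F} (hx : x ∉ T) (ht : t ∈ T) :
    x / t ∉ T := fun h' => hx ((h.hT.div_mem_iff_right ht).1 h')

theorem key_mul (h : RigidPair S T U) {x y : F} (hx : x ∈ small S T) (hy : y ∈ small S T)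
    (hxy : x * y ∉ S) : y * (1 + x) ∈ small S T ∧ 1 + x * y / (1 + y) ∈ S := by
  obtain ⟨x0, xT, xS⟩ := hx
  obtain ⟨y0, yT, yS⟩ := hy
  have hx1 := h.hS.ne_zero xS
  have hy1 := h.hS.ne_zero yS
  have e : 1 + y * (1 + x) = (1 + y) * (1 + x * y / (1 + y)) := by field_simp; ring
  have hT : y * (1 + x) ∉ T := h.mul_not_mem_T yT (h.S_le xS)
  have key : 1 + y * (1 + x) ∈ S := by
    rcases h.rigid (mul_ne_zero y0 hx1) hT with h1 | h1
    · exact h1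
    exfalso
    have h1' : (1 + y * (1 + x)) / y ∈ S := by
      have := h.hS.mul_mem h1 xS
      convert this using 1; field_simp
    by_cases hxyT : x * y ∈ T
    · have h2 : 1 + x * y / (1 + y) ∈ T := h.one_add_mem (h.hT.div_mem hxyT (h.S_le yS))
        (fun h' => hxy ((h.hS.div_mem_iff_right yS).1 h'))
      have h3 : 1 + y * (1 + x) ∈ T := e ▸ h.hT.mul_mem (h.S_le yS) h2
      apply yT
      have := h.hT.div_mem h3 (h.S_le h1')
      have h4 := h.hT.ne_zero h3
      convert this using 1
      field_simp
    · have h2 : x * y / (1 + y) ∉ T := h.div_not_mem_T hxyT (h.S_le yS)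
      rcases h.rigid (div_ne_zero (mul_ne_zero x0 y0) hy1) h2 with h3 | h3
      · have h4 : 1 + y * (1 + x) ∈ S := e ▸ h.hS.mul_mem yS h3
        apply yT
        have := h.hT.div_mem (h.S_le h4) (h.S_le h1')
        have h4 := h.hS.ne_zero h4
        convert this using 1
        field_simp
      · have h5 : (1 + y * (1 + x)) / (x * y) ∈ S := by
          rw [e]
          convert h3 using 1
          field_simp
        have h6 : (1 + y * (1 + x)) ≠ 0 := fun h' => h.hS.ne_zero h5 (by simp [h'])
        apply xT
        have := h.S_le (h.hS.div_mem h1' h5)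
        convert this using 1
        field_simp
  refine ⟨⟨mul_ne_zero y0 hx1, hT, key⟩, ?_⟩
  rw [e] at key
  exact (h.hS.mul_mem_iff_left yS).1 key

theorem one_add_mul_mem (h : RigidPair S T U) {x y : F} (hx : x ∈ small S T)
    (hy : y ∈ small S T) (hxy : x * y ∉ S) : 1 + x * y ∈ S := by
  have h1 := (h.key_mul hy hx (by rwa [mul_comm])).1
  have hy1 := h.hS.ne_zero hy.2.2
  have := (h.key_mul h1 hy ?_).2
  · convert this using 2
    field_simp
  · intro h'
    apply hxy
    rw [← h.hS.mul_mem_iff_right hy.2.2]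
    convert h' using 1; ring

theorem div_small (h : RigidPair S T U) {t z : F} (ht : t ∈ T) (htS : t ∉ S)
    (ht1 : 1 + t ∈ S) (hz : z ∈ small S T) : t * z / (1 + z) ∈ small S T := by
  obtain ⟨z0, zT, zS⟩ := hz
  have t0 := h.hT.ne_zero ht
  have hz1 := h.hS.ne_zero zS
  have ht1' := h.hS.ne_zero ht1
  have hT : z * (1 + t) ∉ T := h.mul_not_mem_T zT (h.S_le ht1)
  have htz : t * z ∉ T := by rw [mul_comm]; exact h.mul_not_mem_T zT ht
  have hT2 : t * z / (1 + z) ∉ T := h.div_not_mem_T htz (h.S_le zS)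
  have e : 1 + z * (1 + t) = (1 + z) * (1 + t * z / (1 + z)) := by field_simp; ring
  refine ⟨div_ne_zero (mul_ne_zero t0 z0) hz1, hT2, ?_⟩
  by_contra hn
  have h3 := (h.rigid (div_ne_zero (mul_ne_zero t0 z0) hz1) hT2).resolve_left hn
  have h5 : (1 + z * (1 + t)) / (t * z) ∈ S := by
    rw [e]
    convert h3 using 1
    field_simp
  have h6 : (1 + z * (1 + t)) ≠ 0 := fun h' => h.hS.ne_zero h5 (by simp [h'])
  rcases h.rigid (mul_ne_zero z0 ht1') hT with h1 | h1
  · apply htz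
    have := h.S_le (h.hS.div_mem h1 h5)
    convert this using 1
    field_simp
  · apply htS
    have := h.hS.div_mem (h.hS.mul_mem h1 ht1) h5
    convert this using 1
    field_simp

theorem small_of_one_add (h : RigidPair S T U) {t z : F} (ht : t ∈ T) (htS : t ∉ S)
    (ht1 : 1 + t ∈ S) (hz : z ∈ small S T) : t * z ∈ small S T := by
  have hz' := hz
  obtain ⟨z0, zT, zS⟩ := hz'
  have t0 := h.hT.ne_zero ht
  have hz1 := h.hS.ne_zero zS
  have ht1' := h.hS.ne_zero ht1
  have htz : t * z ∉ T := by rw [mul_comm]; exact h.mul_not_mem_T zT ht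
  have h1 : t * (1 + z) ∈ T := h.hT.mul_mem ht (h.S_le zS)
  have h2 : t * (1 + z) ∉ S := fun h' => htS ((h.hS.mul_mem_iff_right zS).1 h')
  have h3 : 1 + t * (1 + z) ∈ S := by
    have hT1 : 1 + t * (1 + z) ∈ T := h.one_add_mem h1 h2
    have hT2 : t * z / (1 + t) ∉ T := h.div_not_mem_T htz (h.S_le ht1)
    have e : 1 + t * (1 + z) = (1 + t) * (1 + t * z / (1 + t)) := by field_simp; ring
    rcases h.rigid (div_ne_zero (mul_ne_zero t0 z0) ht1') hT2 with h4 | h4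
    · exact e ▸ h.hS.mul_mem ht1 h4
    · exfalso
      apply htz
      have := h.hT.div_mem hT1 (h.S_le h4)
      rw [e] at this
      have h5 : 1 + t * z / (1 + t) ≠ 0 := fun h' => h.hS.ne_zero h4 (by simp [h'])
      rw [mul_div_assoc, h.hT.mul_mem_iff_left (h.S_le ht1), div_div_cancel₀ h5] at this
      exact (h.hT.div_mem_iff_right (h.S_le ht1)).1 this
  have := h.div_small h1 h2 h3 hz
  convert this using 1
  field_simp

theorem stable_mul (h : RigidPair S T U) {x y : F} (hx : x ∈ stable S T)
    (hy : y ∈ stable S T) : x * y ∈ stable S T :=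
  ⟨h.hT.mul_mem hx.1 hy.1, fun z hz => by
    rw [mul_assoc]; exact hx.2 _ (hy.2 _ hz)⟩

theorem stable_one (h : RigidPair S T U) : (1 : F) ∈ stable S T :=
  ⟨h.hT.one_mem, fun z hz => by rwa [one_mul]⟩

theorem stable_pow (h : RigidPair S T U) {x : F} (hx : x ∈ stable S T) (n : ℕ) :
    x ^ n ∈ stable S T := by
  induction n with
  | zero => simpa using h.stable_one
  | succ n ih => rw [pow_succ]; exact h.stable_mul ih hx

theorem inv_one_sub_stable (h : RigidPair S T U) {v : F} (hv : v ∈ T) (hvS : v ∉ S) :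
    (1 - v)⁻¹ ∈ stable S T := by
  have h1 : 1 - v ∈ T := by
    rw [sub_eq_add_neg]
    exact h.one_add_mem (h.neg_mem_T.2 hv) (fun h' => hvS (h.neg_mem_S.1 h'))
  have v1 := h.hT.ne_zero h1
  refine ⟨h.hT.inv_mem h1, fun z hz => ?_⟩
  obtain ⟨z0, zT, zS⟩ := hz
  have z1 := h.hS.ne_zero zS
  by_contra hn
  have huz : (1 - v)⁻¹ * z ∉ T := by
    rw [mul_comm]; exact h.mul_not_mem_T zT (h.hT.inv_mem h1)
  have h2 := h.of_not_small (mul_ne_zero (inv_ne_zero v1) z0) huz hn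
  set r := (1 - v) * (1 + (1 - v)⁻¹ * z) / (1 + z) with hr
  have hrz : r / z ∈ S := by
    have := h.hS.div_mem h2 zS
    convert this using 1
    rw [hr]; field_simp
  have e : 1 + -r = v / (1 + z) := by rw [hr]; field_simp; ring
  have hrT : r ∉ T := by
    have := h.mul_not_mem_T zT (h.S_le hrz)
    rwa [mul_div_cancel₀ _ z0] at this
  have r0 : r ≠ 0 := fun h' => h.hS.ne_zero hrz (by simp [h'])
  rcases h.rigid (neg_ne_zero.2 r0) (fun h' => hrT (h.neg_mem_T.1 h')) with h3 | h3
  · rw [e, h.hS.div_mem_iff_right zS] at h3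
    exact hvS h3
  · rw [e, div_neg, h.neg_mem_S] at h3
    apply hrT
    have h4 := h.hT.div_mem (h.hT.div_mem hv (h.S_le zS)) (h.S_le h3)
    have v0 := h.hT.ne_zero hv
    rwa [div_div_cancel₀ (div_ne_zero v0 z1)] at h4

theorem one_sub_stable (h : RigidPair S T U) {u : F} (hu : u ∈ U) (huS : u ∉ S) :
    1 - u ∈ stable S T := by
  obtain ⟨m, hm, hmT, hmS⟩ := h.pow_U hu huS
  have h1 := h.inv_one_sub_stable (h.U_le hu) huS
  have h2 := h.inv_one_sub_stable hmT hmS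
  have u1 : 1 - u ≠ 0 := fun h' => h.hT.ne_zero h1.1 (by simp [h'])
  have h3 : (1 - u) ^ m ∈ stable S T := by simpa using h2
  have h4 := h.stable_mul h3 (h.stable_pow h1 (m - 1))
  convert h4 using 1
  obtain ⟨n, rfl⟩ := Nat.exists_eq_add_of_le' hm
  simp only [Nat.add_sub_cancel, inv_pow]
  field_simp
  rw [pow_succ']

theorem U_stable (h : RigidPair S T U) {u : F} (hu : u ∈ U) : u ∈ stable S T := by
  have key : ∀ {u : F}, u ∈ U → u ∉ S → u ∈ stable S T := by
    intro u hu huS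
    have hn : -u ∈ U := by rw [← neg_one_mul]; exact h.hU.mul_mem h.neg_one_mem_U hu
    have hnS : -u ∉ S := fun h' => huS (h.neg_mem_S.1 h')
    have hi := h.hU.inv_mem hn
    have hiS : (-u)⁻¹ ∉ S := fun h' => hnS (h.hS.inv_mem_iff.1 h')
    have h1 := h.one_sub_stable hn hnS
    have h2 := h.inv_one_sub_stable (h.U_le hi) hiS
    have u0 : u ≠ 0 := h.hU.ne_zero hu
    have u1 : 1 - (-u) ≠ 0 := h.hT.ne_zero h1.1
    have := h.stable_mul h1 h2
    convert this using 1
    rw [← div_eq_mul_inv, eq_div_iff (fun h' => h.hT.ne_zero h2.1 (by rw [h', inv_zero]))]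
    field_simp
    ring
  by_cases huS : u ∈ S
  · obtain ⟨ε, hε, hεS⟩ := h.exists_U
    have h1 := key (h.hU.mul_mem hε hu) (fun h' => hεS ((h.hS.mul_mem_iff_right huS).1 h'))
    have h2 := key (h.hU.inv_mem hε) (fun h' => hεS (h.hS.inv_mem_iff.1 h'))
    have := h.stable_mul h2 h1
    rwa [inv_mul_cancel_left₀ (h.hU.ne_zero hε)] at this
  · exact key hu huS

/-- Every product can be moved out of `S` by a unit. -/
theorem exists_scale (h : RigidPair S T U) (a : F) : ∃ ε ∈ U, ε * a ∉ S := by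
  by_cases ha : a ∈ S
  · obtain ⟨ε, hε, hεS⟩ := h.exists_U
    exact ⟨ε, hε, fun h' => hεS ((h.hS.mul_mem_iff_right ha).1 h')⟩
  · exact ⟨1, h.hU.one_mem, by simpa⟩

theorem U_mul_small (h : RigidPair S T U) {u x : F} (hu : u ∈ U) :
    u * x ∈ small S T ↔ x ∈ small S T := by
  refine ⟨fun hx => ?_, (h.U_stable hu).2 x⟩
  have := (h.U_stable (h.hU.inv_mem hu)).2 _ hx
  rwa [inv_mul_cancel_left₀ (h.hU.ne_zero hu)] at this

theorem small_mul_small (h : RigidPair S T U) {x y : F} (hx : x ∈ small S T)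
    (hy : y ∈ small S T) (hxy : x * y ∉ T) : x * y ∈ small S T :=
  ⟨mul_ne_zero hx.1 hy.1, hxy, h.one_add_mul_mem hx hy (fun h' => hxy (h.S_le h'))⟩

theorem small_mul_stable (h : RigidPair S T U) {x y : F} (hx : x ∈ small S T)
    (hy : y ∈ small S T) (hxy : x * y ∈ T) : x * y ∈ stable S T := by
  refine ⟨hxy, fun z hz => ?_⟩
  obtain ⟨ε, hε, hεS⟩ := h.exists_scale (x * y)
  rw [← h.U_mul_small hε, ← mul_assoc]
  refine h.small_of_one_add (h.hT.mul_mem (h.U_le hε) hxy) hεS ?_ hz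
  rw [← mul_assoc] at hεS ⊢
  exact h.one_add_mul_mem ((h.U_mul_small hε).2 hx) hy hεS

/-- The carrier of the valuation ring attached to `S ⊆ T`. -/
def carrier (S T : Set F) : Set F := {x | x = 0 ∨ x ∈ small S T ∨ x ∈ stable S T}

theorem inv_stable_of_not_stable (h : RigidPair S T U) {t : F} (ht : t ∈ T)
    (hts : t ∉ stable S T) : t⁻¹ ∈ stable S T := by
  have : ∃ x ∈ small S T, t * x ∉ small S T := by
    by_contra! hc
    exact hts ⟨ht, hc⟩
  obtain ⟨x, hx, htx⟩ := this
  have t0 := h.hT.ne_zero ht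
  have h1 := h.inv_small_of_not_small (mul_ne_zero t0 hx.1)
    (by rw [mul_comm]; exact h.mul_not_mem_T hx.2.1 ht) htx
  have e : x * (t * x)⁻¹ = t⁻¹ := by have := hx.1; field_simp
  have := h.small_mul_stable hx h1 (e ▸ h.hT.inv_mem ht)
  rwa [e] at this

theorem mul_mem_carrier (h : RigidPair S T U) {x y : F} (hx : x ∈ carrier S T)
    (hy : y ∈ carrier S T) : x * y ∈ carrier S T := by
  rcases hx with rfl | hx | hx
  · left; simp
  · rcases hy with rfl | hy | hy
    · left; simp
    · by_cases hxy : x * y ∈ T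
      · exact Or.inr (Or.inr (h.small_mul_stable hx hy hxy))
      · exact Or.inr (Or.inl (h.small_mul_small hx hy hxy))
    · rw [mul_comm]
      exact Or.inr (Or.inl (hy.2 _ hx))
  · rcases hy with rfl | hy | hy
    · left; simp
    · exact Or.inr (Or.inl (hx.2 _ hy))
    · exact Or.inr (Or.inr (h.stable_mul hx hy))

theorem inv_one_add_stable (h : RigidPair S T U) {y : F} (hy : y ∈ small S T) :
    (1 + y)⁻¹ ∈ stable S T := by
  obtain ⟨y0, yT, yS⟩ := id hy
  have hy1 := h.hS.ne_zero yS
  refine ⟨h.hT.inv_mem (h.S_le yS), fun z hz => ?_⟩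
  obtain ⟨ε, hε, hεS⟩ := h.exists_scale (z / y)
  rw [← h.U_mul_small hε, ← mul_assoc, mul_comm ε, mul_assoc]
  replace hz := (h.U_mul_small hε).2 hz
  rw [← mul_div_assoc] at hεS
  generalize ε * z = z at hz hεS
  obtain ⟨z0, zT, zS⟩ := id hz
  have hz1 := h.hS.ne_zero zS
  by_contra hn
  rw [mul_comm, ← div_eq_mul_inv] at hn
  have h1 := h.of_not_small (div_ne_zero z0 hy1) (h.div_not_mem_T zT (h.S_le yS)) hn
  have h2 : (1 + y + z) / z ∈ S := by
    convert h1 using 1; field_simp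
  have h3 : (1 + y + z) ≠ 0 := fun h' => h.hS.ne_zero h2 (by simp [h'])
  rcases h.rigid (div_ne_zero y0 hz1) (h.div_not_mem_T yT (h.S_le zS)) with h4 | h4
  · apply zT
    have := h.S_le (h.hS.div_mem (h.hS.mul_mem h4 zS) h2)
    convert this using 1
    field_simp
    ring
  · apply hεS
    have := h.hS.div_mem (h.hS.mul_mem h4 h.hS.one_mem) h2
    have e : (1 + y / (1 + z)) / (y / (1 + z)) = (1 + y + z) / y := by
      field_simp; ring
    rw [e] at this
    convert this using 1
    field_simp

theorem one_add_mem_carrier (h : RigidPair S T U) {x : F} (hx : x ∈ carrier S T) :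
    1 + x ∈ carrier S T := by
  rcases hx with rfl | hx | hx
  · right; right; simpa using h.stable_one
  · right; right
    refine ⟨h.S_le hx.2.2, fun y hy => ?_⟩
    obtain ⟨ε, hε, hεS⟩ := h.exists_scale (x * y)
    have hy' := (h.U_mul_small hε).2 hy
    rw [← h.U_mul_small hε]
    have := (h.key_mul hx hy' (by rwa [mul_left_comm])).1
    convert this using 1; ring
  · have key : ∀ y ∈ small S T, 1 + y * (1 + x) ∈ S := by
      intro y hy
      have h1 := (h.inv_one_add_stable hy).2 _ (hx.2 _ hy)
      have hy1 := h.hS.ne_zero hy.2.2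
      have := h.hS.mul_mem hy.2.2 h1.2.2
      convert this using 1
      field_simp; ring
    by_cases h0 : 1 + x = 0
    · exact Or.inl h0
    by_cases hT : 1 + x ∈ T
    · right; right
      refine ⟨hT, fun y hy => ?_⟩
      rw [mul_comm]
      exact ⟨mul_ne_zero hy.1 h0, h.mul_not_mem_T hy.2.1 hT, key y hy⟩
    · right; left
      by_contra hn
      have h1 := h.inv_small_of_not_small h0 hT hn
      have h2 := (h.U_mul_small h.neg_one_mem_U).2 h1
      have := h.hS.ne_zero (key _ h2)
      apply this
      field_simp
      ring

theorem inv_mem_carrier (h : RigidPair S T U) (x : F) :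
    x ∈ carrier S T ∨ x⁻¹ ∈ carrier S T := by
  by_cases h0 : x = 0
  · exact Or.inl (Or.inl h0)
  by_cases hT : x ∈ T
  · by_cases hs : x ∈ stable S T
    · exact Or.inl (Or.inr (Or.inr hs))
    · exact Or.inr (Or.inr (Or.inr (h.inv_stable_of_not_stable hT hs)))
  · by_cases hs : x ∈ small S T
    · exact Or.inl (Or.inr (Or.inl hs))
    · exact Or.inr (Or.inr (Or.inl (h.inv_small_of_not_small h0 hT hs)))

/-- The valuation ring attached to a rigid pair of subgroups. -/
def valuationSubring (h : RigidPair S T U) : ValuationSubring F where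
  carrier := carrier S T
  mul_mem' := h.mul_mem_carrier
  one_mem' := Or.inr (Or.inr h.stable_one)
  zero_mem' := Or.inl rfl
  add_mem' := by
    have key : ∀ {a b : F}, a ∈ carrier S T → b ∈ carrier S T → b / a ∈ carrier S T →
        a + b ∈ carrier S T := by
      intro a b ha hb hba
      by_cases h0 : a = 0
      · simpa [h0] using hb
      have := h.mul_mem_carrier ha (h.one_add_mem_carrier hba)
      convert this using 1; field_simp
    intro a b ha hb
    rcases h.inv_mem_carrier (b / a) with h1 | h1
    · exact key ha hb h1
    · rw [add_comm]
      rw [inv_div] at h1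
      exact key hb ha h1
  neg_mem' := by
    intro x hx
    rw [← neg_one_mul]
    exact h.mul_mem_carrier (Or.inr (Or.inr (h.U_stable h.neg_one_mem_U))) hx
  mem_or_inv_mem' := h.inv_mem_carrier

theorem mem_valuationSubring_iff (h : RigidPair S T U) {x : F} (h0 : x ≠ 0) (hx : x ∉ T) :
    x ∈ h.valuationSubring ↔ 1 + x ∈ S := by
  refine ⟨fun hm => ?_, fun hm => Or.inr (Or.inl ⟨h0, hx, hm⟩)⟩
  rcases hm with h1 | h1 | h1
  · exact absurd h1 h0
  · exact h1.2.2
  · exact absurd h1.1 hx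

theorem U_mem_valuationSubring (h : RigidPair S T U) {x : F} (hx : x ∈ U) :
    x ∈ h.valuationSubring := Or.inr (Or.inr (h.U_stable hx))

end RigidPair

section Norm
variable (p : ℕ) [Fact p.Prime] {Ω : Type*} [Field Ω] [Algebra ℚ_[p] Ω]

/-- The field of elements of `Ω` algebraic over `ℚ_[p]`. -/
noncomputable abbrev Qbar (Ω : Type*) [Field Ω] [Algebra ℚ_[p] Ω] : IntermediateField ℚ_[p] Ω :=
  algebraicClosure ℚ_[p] Ω

/-- The extension of the `p`-adic norm to the elements algebraic over `ℚ_[p]`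
(a junk value elsewhere). -/
noncomputable def nrm (x : Ω) : ℝ := spectralNorm ℚ_[p] Ω x

variable {p}

theorem nrm_coe (x : Qbar p Ω) : nrm p (x : Ω) = spectralNorm ℚ_[p] (Qbar p Ω) x :=
  (spectralNorm.eq_of_tower (K := ℚ_[p]) (L := Ω) x).symm

theorem nrm_zero : nrm p (0 : Ω) = 0 := spectralNorm_zero

theorem nrm_one : nrm p (1 : Ω) = 1 := spectralNorm_one

theorem nrm_nonneg (x : Ω) : 0 ≤ nrm p x := spectralNorm_nonneg x

theorem nrm_algebraMap (x : ℚ_[p]) : nrm p (algebraMap ℚ_[p] Ω x) = ‖x‖ := spectralNorm_extends x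

theorem nrm_map (σ : Ω ≃ₐ[ℚ_[p]] Ω) (x : Ω) : nrm p (σ x) = nrm p x :=
  (spectralNorm_eq_of_equiv σ x).symm

theorem nrm_mul {x y : Ω} (hx : x ∈ Qbar p Ω) (hy : y ∈ Qbar p Ω) :
    nrm p (x * y) = nrm p x * nrm p y := by
  lift x to Qbar p Ω using hx
  lift y to Qbar p Ω using hy
  rw [← MulMemClass.coe_mul, nrm_coe, nrm_coe, nrm_coe]
  exact map_mul (spectralMulAlgNorm ℚ_[p] (Qbar p Ω)) x y

theorem nrm_neg (x : Ω) (hx : x ∈ Qbar p Ω) : nrm p (-x) = nrm p x :=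
  spectralNorm_neg (mem_algebraicClosure_iff.1 hx)

theorem nrm_add_le {x y : Ω} (hx : x ∈ Qbar p Ω) (hy : y ∈ Qbar p Ω) :
    nrm p (x + y) ≤ max (nrm p x) (nrm p y) := by
  lift x to Qbar p Ω using hx
  lift y to Qbar p Ω using hy
  rw [← AddMemClass.coe_add, nrm_coe, nrm_coe, nrm_coe]
  exact isNonarchimedean_spectralNorm x y

theorem nrm_sub_le {x y : Ω} (hx : x ∈ Qbar p Ω) (hy : y ∈ Qbar p Ω) :
    nrm p (x - y) ≤ max (nrm p x) (nrm p y) := by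
  rw [sub_eq_add_neg, ← nrm_neg y hy]
  exact nrm_add_le hx (neg_mem hy)

theorem nrm_pos {x : Ω} (hx : x ∈ Qbar p Ω) (h0 : x ≠ 0) : 0 < nrm p x :=
  spectralNorm_zero_lt h0 (mem_algebraicClosure_iff.1 hx)

theorem nrm_inv {x : Ω} (hx : x ∈ Qbar p Ω) : nrm p x⁻¹ = (nrm p x)⁻¹ := by
  by_cases h0 : x = 0
  · simp [h0, nrm_zero]
  · apply eq_inv_of_mul_eq_one_left
    rw [← nrm_mul (inv_mem hx) hx, inv_mul_cancel₀ h0, nrm_one]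

theorem nrm_div {x y : Ω} (hx : x ∈ Qbar p Ω) (hy : y ∈ Qbar p Ω) :
    nrm p (x / y) = nrm p x / nrm p y := by
  rw [div_eq_mul_inv, nrm_mul hx (inv_mem hy), nrm_inv hy, div_eq_mul_inv]

theorem nrm_pow {x : Ω} (hx : x ∈ Qbar p Ω) (n : ℕ) : nrm p (x ^ n) = nrm p x ^ n := by
  induction n with
  | zero => simp [nrm_one]
  | succ n ih => rw [pow_succ, nrm_mul (pow_mem hx n) hx, ih, pow_succ]

theorem nrm_zpow {x : Ω} (hx : x ∈ Qbar p Ω) (n : ℤ) : nrm p (x ^ n) = nrm p x ^ n := by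
  cases n with
  | ofNat n => simpa using nrm_pow hx n
  | negSucc n => rw [zpow_negSucc, zpow_negSucc, nrm_inv (pow_mem hx _), nrm_pow hx]

theorem nrm_sum_le {ι : Type*} (s : Finset ι) {f : ι → Ω} {C : ℝ} (hC : 0 ≤ C)
    (hf : ∀ i ∈ s, f i ∈ Qbar p Ω) (hfC : ∀ i ∈ s, nrm p (f i) ≤ C) :
    nrm p (∑ i ∈ s, f i) ≤ C := by
  classical
  induction s using Finset.induction_on with
  | empty => simpa [nrm_zero]
  | insert a s ha ih =>
    rw [Finset.sum_insert ha]
    refine (nrm_add_le (hf _ (by simp)) (sum_mem fun i hi => hf i (by simp [hi]))).trans ?_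
    exact max_le (hfC _ (by simp))
      (ih (fun i hi => hf i (by simp [hi])) (fun i hi => hfC i (by simp [hi])))

theorem nrm_prod {ι : Type*} (s : Finset ι) {f : ι → Ω}
    (hf : ∀ i ∈ s, f i ∈ Qbar p Ω) : nrm p (∏ i ∈ s, f i) = ∏ i ∈ s, nrm p (f i) := by
  classical
  induction s using Finset.induction_on with
  | empty => simpa using nrm_one
  | insert a s ha ih =>
    rw [Finset.prod_insert ha, Finset.prod_insert ha, nrm_mul (hf _ (by simp))
      (prod_mem fun i hi => hf i (by simp [hi])), ih (fun i hi => hf i (by simp [hi]))]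

theorem nrm_add_eq_left {x y : Ω} (hx : x ∈ Qbar p Ω) (hy : y ∈ Qbar p Ω)
    (h : nrm p y < nrm p x) : nrm p (x + y) = nrm p x := by
  refine le_antisymm ((nrm_add_le hx hy).trans (max_le le_rfl h.le)) ?_
  have h1 := nrm_sub_le (add_mem hx hy) hy
  rw [add_sub_cancel_right] at h1
  exact (le_max_iff.1 h1).resolve_right (not_le.2 h)

theorem nrm_sub_comm {x y : Ω} (hx : x ∈ Qbar p Ω) (hy : y ∈ Qbar p Ω) :
    nrm p (x - y) = nrm p (y - x) := by
  rw [← nrm_neg _ (sub_mem hx hy), neg_sub]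

theorem nrm_eq_of_sub_lt {x y : Ω} (hx : x ∈ Qbar p Ω) (hy : y ∈ Qbar p Ω)
    (h : nrm p (x - y) < nrm p y) : nrm p x = nrm p y := by
  have := nrm_add_eq_left hy (sub_mem hx hy) h
  rwa [add_sub_cancel] at this

theorem natCast_mem_Qbar (n : ℕ) : (n : Ω) ∈ Qbar p Ω := natCast_mem _ n

theorem nrm_natCast (n : ℕ) : nrm p (n : Ω) = ‖(n : ℚ_[p])‖ := by
  rw [← nrm_algebraMap (Ω := Ω), map_natCast]

theorem nrm_natCast_eq_one {n : ℕ} (h : p.Coprime n) : nrm p (n : Ω) = 1 := by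
  rw [nrm_natCast]
  simpa using (Padic.norm_natCast_eq_one_iff (p := p) (n := n)).2 h

theorem nrm_p_lt_one : nrm p (p : Ω) < 1 := by
  rw [nrm_natCast]; exact Padic.norm_p_lt_one

theorem nrm_p_pos : 0 < nrm p (p : Ω) := by
  rw [nrm_natCast, Padic.norm_p]
  exact inv_pos.2 (by exact_mod_cast (Fact.out : p.Prime).pos)

theorem mem_Qbar_of_pow_mem {x : Ω} {n : ℕ} (hn : n ≠ 0) (h : x ^ n ∈ Qbar p Ω) :
    x ∈ Qbar p Ω := by
  rw [mem_algebraicClosure_iff] at h ⊢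
  exact IsAlgebraic.of_pow (Nat.pos_of_ne_zero hn) h

theorem nrm_eq_one_of_pow_eq_one {x : Ω} {n : ℕ} (hn : n ≠ 0) (h : x ^ n = 1) :
    nrm p x = 1 := by
  have hx : x ∈ Qbar p Ω := mem_Qbar_of_pow_mem hn (h ▸ one_mem _)
  have := nrm_pow hx n
  rw [h, nrm_one] at this
  exact (pow_eq_one_iff_of_nonneg (nrm_nonneg _) hn).1 this.symm

/-- The integers of `Qbar`. -/
theorem nrm_pow_sub_le {x y : Ω} (hx : x ∈ Qbar p Ω) (hy : y ∈ Qbar p Ω)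
    (hx1 : nrm p x ≤ 1) (hy1 : nrm p y ≤ 1) (n : ℕ) :
    nrm p (x ^ n - y ^ n) ≤ nrm p (x - y) := by
  rw [← (Commute.all x y).mul_geom_sum₂, nrm_mul (sub_mem hx hy)
    (sum_mem fun i _ => mul_mem (pow_mem hx _) (pow_mem hy _))]
  refine mul_le_of_le_one_right (nrm_nonneg _) (nrm_sum_le _ zero_le_one
    (fun i _ => mul_mem (pow_mem hx _) (pow_mem hy _)) fun i _ => ?_)
  rw [nrm_mul (pow_mem hx _) (pow_mem hy _), nrm_pow hx, nrm_pow hy]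
  exact mul_le_one₀ (pow_le_one₀ (nrm_nonneg _) hx1) (pow_nonneg (nrm_nonneg _) _)
    (pow_le_one₀ (nrm_nonneg _) hy1)

end Norm

section Good
variable {p : ℕ} [Fact p.Prime] {Ω : Type*} [Field Ω] [Algebra ℚ_[p] Ω]

/-- `σ` fixes the subfield `E` pointwise. -/
def Fixes (E : IntermediateField ℚ_[p] Ω) (σ : Ω ≃ₐ[ℚ_[p]] Ω) : Prop := ∀ x ∈ E, σ x = x

theorem Fixes.mono {E E' : IntermediateField ℚ_[p] Ω} {σ : Ω ≃ₐ[ℚ_[p]] Ω} (h : Fixes E' σ)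
    (hE : E ≤ E') : Fixes E σ := fun x hx => h x (hE hx)

theorem Fixes.sup {E E' : IntermediateField ℚ_[p] Ω} {σ : Ω ≃ₐ[ℚ_[p]] Ω} (h : Fixes E σ)
    (h' : Fixes E' σ) : Fixes (E ⊔ E') σ := by
  have : E ⊔ E' ≤ IntermediateField.fixedField (Subgroup.zpowers σ) := by
    have key : ∀ E : IntermediateField ℚ_[p] Ω, Fixes E σ →
        E ≤ IntermediateField.fixedField (Subgroup.zpowers σ) := by
      intro E h
      rw [IntermediateField.le_iff_le, Subgroup.zpowers_le]
      exact (IntermediateField.mem_fixingSubgroup_iff _ _).2 h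
    exact sup_le (key _ h) (key _ h')
  rw [IntermediateField.le_iff_le, Subgroup.zpowers_le] at this
  exact (IntermediateField.mem_fixingSubgroup_iff _ _).1 this

theorem Fixes.symm {L : IntermediateField ℚ_[p] Ω} {σ : Ω ≃ₐ[ℚ_[p]] Ω} (hσ : Fixes L σ) :
    Fixes L σ.symm := by
  intro x hx
  rw [AlgEquiv.symm_apply_eq, hσ x hx]

/-- `L` has the same absolute Galois group as its subfield `k` of elements algebraic
over `ℚ_[p]`. -/
structure Good (k L : IntermediateField ℚ_[p] Ω) : Prop where
  le : k ≤ L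
  le_Qbar : k ≤ Qbar p Ω
  sup_eq : L ⊔ Qbar p Ω = ⊤
  isAlgebraic : ∀ x : Ω, IsAlgebraic L x
  exists_lift : ∀ τ : Qbar p Ω ≃ₐ[ℚ_[p]] Qbar p Ω, (∀ x : Qbar p Ω, (x : Ω) ∈ k → τ x = x) →
    ∃ σ : Ω ≃ₐ[ℚ_[p]] Ω, Fixes L σ ∧ ∀ x : Qbar p Ω, σ x = τ x

theorem map_mem_Qbar (σ : Ω ≃ₐ[ℚ_[p]] Ω) {x : Ω} (hx : x ∈ Qbar p Ω) : σ x ∈ Qbar p Ω := by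
  rw [mem_algebraicClosure_iff] at hx ⊢
  exact hx.algHom σ.toAlgHom

theorem charZero_of_padic (p : ℕ) [Fact p.Prime] (Ω : Type*) [Field Ω] [Algebra ℚ_[p] Ω] :
    CharZero Ω :=
  charZero_of_injective_algebraMap (algebraMap ℚ_[p] Ω).injective

namespace Good
variable {k L : IntermediateField ℚ_[p] Ω}

/-- The pair obtained by a finite extension of constants is again good. -/
theorem extend (h : Good k L) {k' : IntermediateField ℚ_[p] Ω} (hk : k ≤ k')
    (hk' : k' ≤ Qbar p Ω) : Good k' (L ⊔ k') where
  le := le_sup_right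
  le_Qbar := hk'
  sup_eq := by
    rw [sup_assoc, sup_eq_right.2 hk', h.sup_eq]
  isAlgebraic x := by
    obtain ⟨f, hf, hfx⟩ := h.isAlgebraic x
    refine ⟨f.map (IntermediateField.inclusion (le_sup_left : L ≤ L ⊔ k')).toRingHom,
      (Polynomial.map_ne_zero_iff (RingHom.injective _)).2 hf, ?_⟩
    rw [Polynomial.aeval_def, Polynomial.eval₂_map]
    exact hfx
  exists_lift τ hτ := by
    obtain ⟨σ, hσ, hστ⟩ := h.exists_lift τ fun x hx => hτ x (hk hx)
    exact ⟨σ, hσ.sup fun x hx => by rw [hστ ⟨x, hk' hx⟩, hτ ⟨x, hk' hx⟩ hx], hστ⟩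

/-- Every element of `Ω` is a sum of products of elements of `L` and elements of `Qbar`. -/
theorem exists_sum (h : Good k L) (y : Ω) : ∃ s : List (Ω × Ω),
    (∀ a ∈ s, a.1 ∈ L ∧ a.2 ∈ Qbar p Ω) ∧ y = (s.map fun a => a.1 * a.2).sum := by
  have h1 : (L ⊔ Qbar p Ω).toSubalgebra = L.toSubalgebra ⊔ (Qbar p Ω).toSubalgebra :=
    IntermediateField.sup_toSubalgebra_of_isAlgebraic_right _ _
  have h2 : y ∈ Subalgebra.toSubmodule (L.toSubalgebra ⊔ (Qbar p Ω).toSubalgebra) := by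
    rw [← h1, h.sup_eq]; trivial
  rw [← Subalgebra.mul_toSubmodule] at h2
  induction h2 using Submodule.mul_induction_on' with
  | mem_mul_mem m hm n hn => exact ⟨[(m, n)], by simpa using ⟨hm, hn⟩, by simp⟩
  | add x hx y hy ihx ihy =>
    obtain ⟨s, hs, rfl⟩ := ihx
    obtain ⟨t, ht, rfl⟩ := ihy
    exact ⟨s ++ t, fun a ha => (List.mem_append.1 ha).elim (hs a) (ht a), by simp⟩

theorem map_sum_eq (σ : Ω ≃ₐ[ℚ_[p]] Ω) (hσ : Fixes L σ) (s : List (Ω × Ω))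
    (hs : ∀ a ∈ s, a.1 ∈ L) : σ (s.map fun a => a.1 * a.2).sum =
      (s.map fun a => a.1 * σ a.2).sum := by
  induction s with
  | nil => simp
  | cons a s ih =>
    simp only [List.map_cons, List.sum_cons, map_add, map_mul]
    rw [ih (fun b hb => hs b (List.mem_cons_of_mem _ hb)), hσ _ (hs a List.mem_cons_self)]

end Good

variable [IsAlgClosed Ω]

namespace Good
variable {k L : IntermediateField ℚ_[p] Ω}

theorem mem_of_fixed (h : Good k L) {x : Ω}
    (hx : ∀ σ : Ω ≃ₐ[ℚ_[p]] Ω, Fixes L σ → σ x = x) : x ∈ L := by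
  have : Algebra.IsAlgebraic L Ω := ⟨h.isAlgebraic⟩
  have : CharZero Ω := charZero_of_padic p Ω
  have : CharZero L := charZero_of_injective_algebraMap (algebraMap ℚ_[p] L).injective
  have : IsAlgClosure L Ω := ⟨inferInstance, inferInstance⟩
  have : IsGalois L Ω := IsAlgClosure.isGalois L Ω
  have h1 : x ∈ (⊥ : IntermediateField L Ω) := by
    rw [InfiniteGalois.mem_bot_iff_fixed]
    intro σ
    exact hx (σ.restrictScalars ℚ_[p]) fun y hy => σ.commutes ⟨y, hy⟩
  obtain ⟨y, hy⟩ := IntermediateField.mem_bot.1 h1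
  rw [← hy]
  exact y.2

theorem mem_k (h : Good k L) {x : Ω} (hxL : x ∈ L) (hx : x ∈ Qbar p Ω) : x ∈ k := by
  let k' : IntermediateField ℚ_[p] (Qbar p Ω) := k.comap (Qbar p Ω).val
  have : IsGalois ℚ_[p] (Qbar p Ω) := IsAlgClosure.isGalois _ _
  have : IsGalois k' (Qbar p Ω) := IsGalois.tower_top_intermediateField k'
  have h1 : (⟨x, hx⟩ : Qbar p Ω) ∈ (⊥ : IntermediateField k' (Qbar p Ω)) := by
    rw [InfiniteGalois.mem_bot_iff_fixed]
    intro τ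
    obtain ⟨σ, hσ, hστ⟩ := h.exists_lift (τ.restrictScalars ℚ_[p])
      (fun y hy => τ.commutes ⟨y, hy⟩)
    apply Subtype.ext
    have := hστ ⟨x, hx⟩
    rw [hσ x hxL] at this
    exact this.symm
  obtain ⟨y, hy⟩ := IntermediateField.mem_bot.1 h1
  have h2 := congrArg Subtype.val hy
  have := y.2
  change x ∈ k
  rw [← show ((y : Qbar p Ω) : Ω) = x from h2]
  exact this

theorem mem_k_of_fixed (h : Good k L) {x : Ω} (hx : x ∈ Qbar p Ω)
    (hf : ∀ σ : Ω ≃ₐ[ℚ_[p]] Ω, Fixes L σ → σ x = x) : x ∈ k :=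
  h.mem_k (h.mem_of_fixed hf) hx

theorem exists_eq_mul_of_map_eq (h : Good k L) (n : ℕ) : ∀ (y : Ω) (s : List (Ω × Ω)), y ≠ 0 →
    s.length = n → (∀ a ∈ s, a.1 ∈ L ∧ a.2 ∈ Qbar p Ω) → y = (s.map fun a => a.1 * a.2).sum →
    (∀ σ : Ω ≃ₐ[ℚ_[p]] Ω, Fixes L σ → ∃ κ ∈ Qbar p Ω, σ y = κ * y) →
    ∃ e ∈ Qbar p Ω, e ≠ 0 ∧ ∃ l ∈ L, y = e * l := by
  induction n with
  | zero =>
    intro y s y0 hs _ hy _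
    rw [List.length_eq_zero_iff.1 hs] at hy
    exact absurd hy y0
  | succ n ih =>
    intro y s y0 hs hmem hy hκ
    obtain ⟨⟨l, e⟩, s, rfl⟩ := List.exists_cons_of_length_eq_add_one hs
    obtain ⟨hl, he⟩ := hmem (l, e) List.mem_cons_self
    have hmem' : ∀ a ∈ s, a.1 ∈ L ∧ a.2 ∈ Qbar p Ω := fun a ha =>
      hmem a (List.mem_cons_of_mem _ ha)
    simp only [List.length_cons, Nat.add_right_cancel_iff] at hs
    simp only [List.map_cons, List.sum_cons] at hy
    by_cases e0 : e = 0
    · rw [e0, mul_zero, zero_add] at hy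
      exact ih y s y0 hs hmem' hy hκ
    set s' := s.map fun a => (a.1, a.2 / e) with hs'
    have hmem'' : ∀ a ∈ s', a.1 ∈ L ∧ a.2 ∈ Qbar p Ω := by
      intro a ha
      obtain ⟨b, hb, rfl⟩ := List.mem_map.1 ha
      exact ⟨(hmem' b hb).1, div_mem (hmem' b hb).2 he⟩
    have hy' : y / e = l + (s'.map fun a => a.1 * a.2).sum := by
      rw [hy, add_div, mul_div_cancel_right₀ _ e0, hs', List.map_map, div_eq_mul_inv,
        ← List.sum_map_mul_right]
      simp only [Function.comp_def, div_eq_mul_inv, mul_assoc]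
    have y0' : y / e ≠ 0 := div_ne_zero y0 e0
    have hκ' : ∀ σ : Ω ≃ₐ[ℚ_[p]] Ω, Fixes L σ → ∃ κ ∈ Qbar p Ω, σ (y / e) = κ * (y / e) := by
      intro σ hσ
      obtain ⟨κ, hκm, hκy⟩ := hκ σ hσ
      refine ⟨κ * e / σ e, div_mem (mul_mem hκm he) (map_mem_Qbar σ he), ?_⟩
      have : σ e ≠ 0 := by simpa using e0
      rw [map_div₀, hκy]
      field_simp
    by_cases hfix : ∀ σ : Ω ≃ₐ[ℚ_[p]] Ω, Fixes L σ → σ (y / e) = y / e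
    · exact ⟨e, he, e0, y / e, h.mem_of_fixed hfix, by field_simp⟩
    push Not at hfix
    obtain ⟨σ, hσ, hne⟩ := hfix
    obtain ⟨κ, hκm, hκy⟩ := hκ' σ hσ
    have hκ1 : 1 - κ ≠ 0 := by
      intro h'
      apply hne
      rw [hκy, ← sub_eq_zero.1 h', one_mul]
    set t := s'.map fun a => (a.1, (κ * a.2 - σ a.2) / (1 - κ) + a.2) with ht
    have hyt : y / e = (t.map fun a => a.1 * a.2).sum := by
      have h1 : σ (y / e) = l + (s'.map fun a => a.1 * σ a.2).sum := by
        rw [hy', map_add, hσ l hl, map_sum_eq σ hσ s' fun a ha => (hmem'' a ha).1]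
      have h2 : (t.map fun a => a.1 * a.2).sum = (κ * (s'.map fun a => a.1 * a.2).sum -
          (s'.map fun a => a.1 * σ a.2).sum) / (1 - κ) + (s'.map fun a => a.1 * a.2).sum := by
        rw [ht, List.map_map]
        clear_value s'
        clear hy' hmem'' hs' ht h1
        induction s' with
        | nil => simp
        | cons a s ih =>
          simp only [List.map_cons, List.sum_cons, ih, Function.comp_apply]
          field_simp
          ring
      rw [h2, hy']
      rw [h1, hy'] at hκy
      rw [eq_comm, ← eq_sub_iff_add_eq, div_eq_iff hκ1]
      linear_combination -hκy
    obtain ⟨e', he', e0', l', hl', hel⟩ := ih (y / e) t y0' (by simp [ht, hs', hs]) (by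
      intro a ha
      obtain ⟨b, hb, rfl⟩ := List.mem_map.1 ha
      have := hmem'' b hb
      exact ⟨this.1, add_mem (div_mem (sub_mem (mul_mem hκm this.2) (map_mem_Qbar σ this.2))
        (sub_mem (one_mem _) hκm)) this.2⟩) hyt hκ'
    refine ⟨e * e', mul_mem he he', mul_ne_zero e0 e0', l', hl', ?_⟩
    rw [mul_assoc, ← hel]
    field_simp

/-- Kummer theory: modulo `n`-th powers, every element of `L` is a constant. -/
theorem exists_eq_mul_pow (h : Good k L) {x : Ω} (hx : x ∈ L) (hx0 : x ≠ 0) {n : ℕ}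
    (hn : n ≠ 0) : ∃ c ∈ k, ∃ l ∈ L, c ≠ 0 ∧ l ≠ 0 ∧ x = c * l ^ n := by
  obtain ⟨y, hy⟩ := IsAlgClosed.exists_pow_nat_eq x (Nat.pos_of_ne_zero hn)
  have y0 : y ≠ 0 := by
    rintro rfl
    exact hx0 (by rw [← hy, zero_pow hn])
  obtain ⟨s, hs, hys⟩ := h.exists_sum y
  obtain ⟨e, he, e0, l, hl, hel⟩ := h.exists_eq_mul_of_map_eq s.length y s y0 rfl hs hys (by
    intro σ hσ
    refine ⟨σ y / y, ?_, by field_simp⟩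
    refine mem_Qbar_of_pow_mem hn ?_
    rw [div_pow, ← map_pow, hy, hσ x hx, div_self hx0]
    exact one_mem _)
  have l0 : l ≠ 0 := by
    rintro rfl
    exact y0 (by simpa using hel)
  have hxe : x = e ^ n * l ^ n := by rw [← hy, hel, mul_pow]
  refine ⟨e ^ n, h.mem_k ?_ (pow_mem he n), l, hl, pow_ne_zero n e0, l0, hxe⟩
  rw [eq_div_of_mul_eq (pow_ne_zero n l0) hxe.symm]
  exact div_mem hx (pow_mem hl n)

end Good
end Good

section LocalField
variable {p : ℕ} [Fact p.Prime] {Ω : Type*} [Field Ω] [Algebra ℚ_[p] Ω]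

/-- Two `ℓ`-th roots close to `1` of the same element coincide. -/
theorem eq_of_pow_eq_of_nrm_sub_one_lt {ℓ : ℕ} (hℓ : p.Coprime ℓ) {x y : Ω}
    (hx : x ∈ Qbar p Ω) (hy : y ∈ Qbar p Ω) (hx1 : nrm p (x - 1) < 1) (hy1 : nrm p (y - 1) < 1)
    (h : x ^ ℓ = y ^ ℓ) : x = y := by
  have hnx : nrm p x = 1 := by
    rw [nrm_eq_of_sub_lt hx (one_mem _) (by rwa [nrm_one]), nrm_one]
  have hny : nrm p y = 1 := by
    rw [nrm_eq_of_sub_lt hy (one_mem _) (by rwa [nrm_one]), nrm_one]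
  have hone : ∀ {z : Ω}, z ∈ Qbar p Ω → nrm p (z - 1) < 1 → nrm p z = 1 → ∀ n : ℕ,
      nrm p (z ^ n - 1) < 1 := by
    intro z hz hz1 hnz n
    refine lt_of_le_of_lt ?_ hz1
    simpa using nrm_pow_sub_le hz (one_mem _) hnz.le nrm_one.le n
  by_contra hne
  have h1 : (∑ i ∈ Finset.range ℓ, x ^ i * y ^ (ℓ - 1 - i)) = 0 := by
    have := (Commute.all x y).mul_geom_sum₂ ℓ
    rw [h, sub_self, mul_eq_zero] at this
    exact this.resolve_left (sub_ne_zero.2 hne)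
  have h2 : (ℓ : Ω) = -∑ i ∈ Finset.range ℓ, (x ^ i * y ^ (ℓ - 1 - i) - 1) := by
    rw [Finset.sum_sub_distrib, h1]
    simp
  have hmem : ∀ i ∈ Finset.range ℓ, x ^ i * y ^ (ℓ - 1 - i) - 1 ∈ Qbar p Ω := fun i _ =>
    sub_mem (mul_mem (pow_mem hx _) (pow_mem hy _)) (one_mem _)
  have hterm : ∀ i ∈ Finset.range ℓ, nrm p (x ^ i * y ^ (ℓ - 1 - i) - 1) ≤
      max (nrm p (x - 1)) (nrm p (y - 1)) := by
    intro i _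
    have e : x ^ i * y ^ (ℓ - 1 - i) - 1 = (x ^ i - 1) * y ^ (ℓ - 1 - i) +
      (y ^ (ℓ - 1 - i) - 1) := by ring
    rw [e]
    refine (nrm_add_le (mul_mem (sub_mem (pow_mem hx _) (one_mem _)) (pow_mem hy _))
      (sub_mem (pow_mem hy _) (one_mem _))).trans (max_le_max ?_ ?_)
    · rw [nrm_mul (sub_mem (pow_mem hx _) (one_mem _)) (pow_mem hy _), nrm_pow hy, hny,
        one_pow, mul_one]
      simpa using nrm_pow_sub_le hx (one_mem _) hnx.le nrm_one.le i
    · simpa using nrm_pow_sub_le hy (one_mem _) hny.le nrm_one.le (ℓ - 1 - i)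
  have h3 : nrm p (ℓ : Ω) < 1 := by
    rw [h2, nrm_neg _ (sum_mem hmem)]
    exact (nrm_sum_le _ (le_max_of_le_left (nrm_nonneg _)) hmem hterm).trans_lt (max_lt hx1 hy1)
  rw [nrm_natCast_eq_one hℓ] at h3
  exact lt_irrefl _ h3

theorem Good.exists_root_of_nrm_lt [IsAlgClosed Ω] {k L : IntermediateField ℚ_[p] Ω}
    (hG : Good k L) {ℓ : ℕ} (hℓp : p.Coprime ℓ) (hℓ : ℓ ≠ 0) {h : Ω} (hh : h ∈ k)
    (hh1 : nrm p h < 1) : ∃ g ∈ k, g ^ ℓ = 1 + h ∧ nrm p (g - 1) < 1 := by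
  have := charZero_of_padic p Ω
  obtain ⟨y, hy⟩ := IsAlgClosed.exists_pow_nat_eq (1 + h) (Nat.pos_of_ne_zero hℓ)
  have : NeZero (ℓ : Ω) := ⟨by exact_mod_cast hℓ⟩
  have : NeZero ℓ := ⟨hℓ⟩
  obtain ⟨ζ, hζ⟩ := HasEnoughRootsOfUnity.exists_primitiveRoot Ω ℓ
  have hyQ : y ∈ Qbar p Ω :=
    mem_Qbar_of_pow_mem hℓ (hy ▸ add_mem (one_mem _) (hG.le_Qbar hh))
  have hprod := hζ.pow_sub_pow_eq_prod_sub_mul 1 y (Nat.pos_of_ne_zero hℓ)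
  rw [one_pow, hy, sub_add_cancel_left] at hprod
  have hQ : ∀ ζ ∈ Polynomial.nthRootsFinset ℓ (1 : Ω), ζ ∈ Qbar p Ω := by
    intro ζ hζ
    rw [Polynomial.mem_nthRootsFinset (Nat.pos_of_ne_zero hℓ)] at hζ
    exact mem_Qbar_of_pow_mem hℓ (hζ ▸ one_mem _)
  have hn := congrArg (nrm p) hprod
  rw [nrm_neg _ (hG.le_Qbar hh), nrm_prod _ fun ζ hζ => sub_mem (one_mem _)
    (mul_mem (hQ ζ hζ) hyQ)] at hn
  obtain ⟨η, hη, hη1⟩ : ∃ η ∈ Polynomial.nthRootsFinset ℓ (1 : Ω), nrm p (1 - η * y) < 1 := by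
    by_contra! hc
    rw [hn] at hh1
    exact absurd (Finset.one_le_prod hc) (not_le.2 hh1)
  have hgQ := mul_mem (hQ η hη) hyQ
  rw [nrm_sub_comm (one_mem _) hgQ] at hη1
  rw [Polynomial.mem_nthRootsFinset (Nat.pos_of_ne_zero hℓ)] at hη
  have hg : (η * y) ^ ℓ = 1 + h := by rw [mul_pow, hη, hy, one_mul]
  refine ⟨η * y, hG.mem_k_of_fixed hgQ fun σ hσ => ?_, hg, hη1⟩
  refine eq_of_pow_eq_of_nrm_sub_one_lt hℓp (map_mem_Qbar σ hgQ) hgQ ?_ hη1 ?_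
  · rw [← map_one σ, ← map_sub, nrm_map]; exact hη1
  · rw [← map_pow, hg, map_add, map_one, hσ h (hG.le hh)]

variable (k : IntermediateField ℚ_[p] Ω)

theorem nrm_coe_field (x : k) : nrm p (x : Ω) = spectralNorm ℚ_[p] k x :=
  (spectralNorm.eq_of_tower (K := ℚ_[p]) (L := Ω) x).symm

variable [FiniteDimensional ℚ_[p] k]

theorem le_Qbar_of_finiteDimensional : k ≤ Qbar p Ω := fun x hx => by
  rw [mem_algebraicClosure_iff]
  exact (Algebra.IsAlgebraic.isAlgebraic (R := ℚ_[p]) (⟨x, hx⟩ : k)).algHom k.val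

theorem exists_nrm_pow_eq : ∃ n : ℕ, n ≠ 0 ∧ ∀ x ∈ k, x ≠ 0 →
    ∃ j : ℤ, nrm p x ^ n = (p : ℝ) ^ j := by
  refine ⟨Module.finrank ℚ_[p] k, Module.finrank_pos.ne', fun x hx h0 => ?_⟩
  lift x to k using hx
  have h1 : nrm p (x : Ω) = spectralNorm ℚ_[p] k x :=
    (spectralNorm.eq_of_tower (K := ℚ_[p]) (L := Ω) x).symm
  have hint : IsIntegral ℚ_[p] x := IsIntegral.of_finite _ _
  rw [h1, spectralNorm.spectralNorm_eq_norm_coeff_zero_rpow]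
  obtain ⟨m, hm⟩ := minpoly.degree_dvd hint
  have hc : (minpoly ℚ_[p] x).coeff 0 ≠ 0 := by
    rw [Ne, minpoly.coeff_zero_eq_zero hint]
    simpa using h0
  have hj := Padic.norm_eq_zpow_neg_valuation hc
  refine ⟨-((minpoly ℚ_[p] x).coeff 0).valuation * m, ?_⟩
  have hd := (minpoly.natDegree_pos hint).ne'
  have e : ((‖(minpoly ℚ_[p] x).coeff 0‖ ^ (1 / ((minpoly ℚ_[p] x).natDegree : ℝ))) ^
    (minpoly ℚ_[p] x).natDegree) = ‖(minpoly ℚ_[p] x).coeff 0‖ := by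
    rw [one_div, Real.rpow_inv_natCast_pow (norm_nonneg _) hd]
  rw [hm, pow_mul, e, hj]
  rw [zpow_mul, zpow_natCast]

/-- A finite extension of `ℚ_[p]` has a uniformizer. -/
theorem exists_uniformizer : ∃ ϖ ∈ k, ϖ ≠ 0 ∧ nrm p ϖ < 1 ∧
    ∀ x ∈ k, x ≠ 0 → ∃ j : ℤ, nrm p x = nrm p ϖ ^ j := by
  obtain ⟨n, hn, h⟩ := exists_nrm_pow_eq k
  have hp1 : (1 : ℝ) < p := by exact_mod_cast (Fact.out : p.Prime).one_lt
  have hp0 : (0 : ℝ) < p := one_pos.trans hp1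
  have hkQ := le_Qbar_of_finiteDimensional k
  let H : AddSubgroup ℤ :=
    { carrier := {j | ∃ x ∈ k, x ≠ 0 ∧ nrm p x ^ n = (p : ℝ) ^ j}
      zero_mem' := ⟨1, one_mem _, one_ne_zero, by simp [nrm_one]⟩
      add_mem' := by
        rintro a b ⟨x, hx, x0, hxa⟩ ⟨y, hy, y0, hyb⟩
        exact ⟨x * y, mul_mem hx hy, mul_ne_zero x0 y0, by
          rw [nrm_mul (hkQ hx) (hkQ hy), mul_pow, hxa, hyb, zpow_add₀ hp0.ne']⟩
      neg_mem' := by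
        rintro a ⟨x, hx, x0, hxa⟩
        exact ⟨x⁻¹, inv_mem hx, inv_ne_zero x0, by
          rw [nrm_inv (hkQ hx), inv_pow, hxa, zpow_neg]⟩ }
  obtain ⟨d, hd⟩ := Int.subgroup_cyclic H
  have hgen : ∀ j ∈ H, ∃ m : ℤ, j = m * d := by
    intro j hj
    rw [hd, AddSubgroup.mem_closure_singleton] at hj
    obtain ⟨m, hm⟩ := hj
    exact ⟨m, by rw [← hm, smul_eq_mul]⟩
  have hdH : d ∈ H := by rw [hd]; exact AddSubgroup.subset_closure rfl
  have hp : (p : Ω) ≠ 0 := by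
    have := charZero_of_padic p Ω
    exact_mod_cast (Fact.out : p.Prime).ne_zero
  have hd0 : d ≠ 0 := by
    rintro rfl
    obtain ⟨j, hj⟩ := h p (natCast_mem k p) hp
    obtain ⟨m, hm⟩ := hgen j ⟨p, natCast_mem k p, hp, hj⟩
    rw [hm, mul_zero, zpow_zero] at hj
    exact absurd hj (pow_lt_one₀ (nrm_nonneg _) nrm_p_lt_one hn).ne
  have key : ∀ e : ℤ, e ∈ H → e < 0 → (∀ j ∈ H, ∃ m : ℤ, j = m * e) → ∃ ϖ ∈ k, ϖ ≠ 0 ∧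
      nrm p ϖ < 1 ∧ ∀ x ∈ k, x ≠ 0 → ∃ j : ℤ, nrm p x = nrm p ϖ ^ j := by
    rintro e ⟨ϖ, hϖ, ϖ0, hϖe⟩ he hgen
    refine ⟨ϖ, hϖ, ϖ0, ?_, fun x hx x0 => ?_⟩
    · rw [← pow_lt_one_iff_of_nonneg (nrm_nonneg _) hn, hϖe]
      exact zpow_lt_one_of_neg₀ hp1 he
    · obtain ⟨j, hj⟩ := h x hx x0
      obtain ⟨m, hm⟩ := hgen j ⟨x, hx, x0, hj⟩
      refine ⟨m, ?_⟩
      rw [← pow_left_inj₀ (nrm_nonneg _) (zpow_nonneg (nrm_nonneg _) _) hn, hj, hm, mul_comm m,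
        zpow_mul, ← hϖe, ← zpow_natCast, ← zpow_natCast, zpow_comm]
  rcases lt_or_gt_of_ne hd0 with hlt | hgt
  · exact key d hdH hlt hgen
  · refine key (-d) (H.neg_mem hdH) (by omega) fun j hj => ?_
    obtain ⟨m, hm⟩ := hgen j hj
    exact ⟨-m, by rw [hm]; ring⟩

/-- Finiteness of the residue field. -/
theorem exists_residues : ∃ s : Finset Ω, (∀ a ∈ s, a ∈ k ∧ nrm p a ≤ 1) ∧
    ∀ x ∈ k, nrm p x ≤ 1 → ∃ a ∈ s, nrm p (x - a) < 1 := by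
  let : NormedField k := spectralNorm.normedField ℚ_[p] k
  let : NormedSpace ℚ_[p] k := spectralNorm.normedSpace ℚ_[p] k
  have : ProperSpace k := FiniteDimensional.proper ℚ_[p] k
  have hc : IsCompact (Metric.closedBall (0 : k) 1) := isCompact_closedBall _ _
  obtain ⟨t, ht, hcov⟩ := hc.elim_finite_subcover_image (b := Metric.closedBall (0 : k) 1)
    (c := fun a => Metric.ball a 1) (fun _ _ => Metric.isOpen_ball) (fun x hx =>
      Set.mem_biUnion hx (Metric.mem_ball_self one_pos))
  have hnorm : ∀ x : k, ‖x‖ = nrm p (x : Ω) := fun x => (nrm_coe_field k x).symm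
  classical
  refine ⟨hcov.1.toFinset.image Subtype.val, ?_, fun x hx hx1 => ?_⟩
  · intro a ha
    obtain ⟨b, hb, rfl⟩ := Finset.mem_image.1 ha
    refine ⟨b.2, ?_⟩
    have := ht (hcov.1.mem_toFinset.1 hb)
    rwa [mem_closedBall_zero_iff, hnorm] at this
  · have : (⟨x, hx⟩ : k) ∈ Metric.closedBall (0 : k) 1 := by
      rw [mem_closedBall_zero_iff, hnorm]; exact hx1
    obtain ⟨a, ha, hxa⟩ := Set.mem_iUnion₂.1 (hcov.2 this)
    refine ⟨a, Finset.mem_image_of_mem _ (hcov.1.mem_toFinset.2 ha), ?_⟩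
    rw [Metric.mem_ball, dist_eq_norm, hnorm] at hxa
    exact hxa

/-- Completeness of a finite extension of `ℚ_[p]`. -/
theorem exists_limit (u : ℕ → Ω) (hu : ∀ n, u n ∈ k) {r : ℝ} (hr : r < 1)
    (hur : ∀ n, nrm p (u (n + 1) - u n) ≤ r ^ n) :
    ∃ c ∈ k, ∀ n, nrm p (c - u n) ≤ r ^ n := by
  have hkQ := le_Qbar_of_finiteDimensional k
  have hr0 : 0 ≤ r := by simpa using (nrm_nonneg _).trans (hur 1)
  have hmn : ∀ n m, nrm p (u (n + m) - u n) ≤ r ^ n := by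
    intro n m
    induction m with
    | zero => simpa [nrm_zero] using pow_nonneg hr0 n
    | succ m ih =>
      have e : u (n + (m + 1)) - u n = (u (n + m + 1) - u (n + m)) + (u (n + m) - u n) := by
        rw [← add_assoc]; ring
      rw [e]
      refine (nrm_add_le (sub_mem (hkQ (hu _)) (hkQ (hu _)))
        (sub_mem (hkQ (hu _)) (hkQ (hu _)))).trans (max_le ((hur _).trans ?_) ih)
      exact pow_le_pow_of_le_one hr0 hr.le (by omega)
  let : NormedField k := spectralNorm.normedField ℚ_[p] k
  have : CompleteSpace k := spectralNorm.completeSpace ℚ_[p] k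
  have hnorm : ∀ x : k, ‖x‖ = nrm p (x : Ω) := fun x => (nrm_coe_field k x).symm
  let v : ℕ → k := fun n => ⟨u n, hu n⟩
  have hv : CauchySeq v := by
    refine cauchySeq_of_le_geometric r 1 hr fun n => ?_
    rw [dist_comm, dist_eq_norm, hnorm, one_mul]
    exact hur n
  obtain ⟨c, hc⟩ := cauchySeq_tendsto_of_complete hv
  refine ⟨c, c.2, fun n => ?_⟩
  have h1 : Filter.Tendsto (fun m => ‖v (n + m) - v n‖) Filter.atTop (nhds ‖c - v n‖) := by
    have h2 : Filter.Tendsto (fun m => v (n + m)) Filter.atTop (nhds c) :=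
      hc.comp (Filter.tendsto_atTop_mono (fun m => Nat.le_add_left m n) Filter.tendsto_id)
    exact (h2.sub_const _).norm
  have h3 := le_of_tendsto' h1 (b := r ^ n) fun m => by rw [hnorm]; exact hmn n m
  rw [hnorm] at h3
  exact h3

end LocalField

section Kummer
variable {p : ℕ} [Fact p.Prime] {Ω : Type*} [Field Ω] [Algebra ℚ_[p] Ω]

open IntermediateField in
theorem exists_eq_sum_pow {k : IntermediateField ℚ_[p] Ω} {γ : Ω} {n : ℕ} (hn : n ≠ 0)
    (hγ : γ ^ n ∈ k) {e : Ω} (he : e ∈ k ⊔ ℚ_[p]⟮γ⟯) :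
    ∃ a : ℕ → Ω, (∀ i, a i ∈ k) ∧ e = ∑ i ∈ Finset.range n, a i * γ ^ i := by
  have hint : IsIntegral k γ := by
    refine ⟨Polynomial.X ^ n - Polynomial.C ⟨γ ^ n, hγ⟩, Polynomial.monic_X_pow_sub_C _ hn, ?_⟩
    simp
  rw [← restrictScalars_adjoin_eq_sup, mem_restrictScalars,
    ← mem_toSubalgebra, adjoin_simple_toSubalgebra_of_isAlgebraic hint.isAlgebraic,
    Algebra.adjoin_singleton_eq_range_aeval] at he
  obtain ⟨f, rfl⟩ := he
  let q : Polynomial k := Polynomial.X ^ n - Polynomial.C ⟨γ ^ n, hγ⟩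
  have hq : q.Monic := Polynomial.monic_X_pow_sub_C _ hn
  have hqγ : Polynomial.aeval γ q = 0 := by simp [q]
  refine ⟨fun i => ((f %ₘ q).coeff i : Ω), fun i => ((f %ₘ q).coeff i).2, ?_⟩
  have h1 : Polynomial.aeval γ f = Polynomial.aeval γ (f %ₘ q) := by
    conv_lhs => rw [← Polynomial.modByMonic_add_div f q]
    rw [map_add, map_mul, hqγ, zero_mul, add_zero]
  have h2 : (f %ₘ q).natDegree < n := by
    have := Polynomial.natDegree_modByMonic_lt f hq (fun e => by
      have := congrArg Polynomial.natDegree e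
      rw [Polynomial.natDegree_X_pow_sub_C, Polynomial.natDegree_one] at this
      exact hn this)
    rwa [Polynomial.natDegree_X_pow_sub_C] at this
  refine h1.trans ?_
  rw [Polynomial.aeval_eq_sum_range' h2]
  exact Finset.sum_congr rfl fun i _ => Algebra.smul_def _ _

theorem Fixes.adjoin_singleton {σ : Ω ≃ₐ[ℚ_[p]] Ω} {γ : Ω} (h : σ γ = γ) :
    Fixes (IntermediateField.adjoin ℚ_[p] {γ}) σ := by
  have : IntermediateField.adjoin ℚ_[p] {γ} ≤
      IntermediateField.fixedField (Subgroup.zpowers σ) := by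
    rw [IntermediateField.adjoin_simple_le_iff]
    have h1 : Subgroup.zpowers σ ≤ MulAction.stabilizer (Ω ≃ₐ[ℚ_[p]] Ω) γ := by
      rw [Subgroup.zpowers_le]
      exact h
    exact fun g => h1 g.2
  rw [IntermediateField.le_iff_le, Subgroup.zpowers_le] at this
  exact (IntermediateField.mem_fixingSubgroup_iff _ _).1 this

/-- The norm of a cyclic Kummer extension of prime degree, as a product of conjugates. -/
theorem Good.exists_norm [IsAlgClosed Ω] {k L : IntermediateField ℚ_[p] Ω} (h : Good k L)
    {n : ℕ} (hn : n.Prime) {ζ : Ω} (hζ : IsPrimitiveRoot ζ n) (hζk : ζ ∈ k) {γ : Ω}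
    (hγ : γ ^ n ∈ k) (hγk : γ ∉ k) :
    ∃ (N : Ω →* Ω) (σ : Ω ≃ₐ[ℚ_[p]] Ω) (ξ : Ω), Fixes L σ ∧ ξ ∈ k ∧ IsPrimitiveRoot ξ n ∧
      σ γ = ξ * γ ∧ (∀ x, N x = ∏ j ∈ Finset.range n, (σ ^ j) x) ∧
      (∀ x ∈ L ⊔ IntermediateField.adjoin ℚ_[p] {γ}, N x ∈ L) ∧
      (∀ x ∈ k ⊔ IntermediateField.adjoin ℚ_[p] {γ}, N x ∈ k) ∧
      (∀ x ∈ L, N x = x ^ n) ∧ (∀ x, x ≠ 0 → N x ≠ 0) ∧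
      (∀ x ∈ L, ∀ y ∈ L, N (x - γ * y) = x ^ n - γ ^ n * y ^ n) ∧
      (∀ x ∈ Qbar p Ω, nrm p (N x) = nrm p x ^ n) := by
  have n0 := hn.ne_zero
  have : NeZero n := ⟨n0⟩
  have hγQ : γ ∈ Qbar p Ω := mem_Qbar_of_pow_mem n0 (h.le_Qbar hγ)
  have hγ0 : γ ≠ 0 := fun e => hγk (e ▸ zero_mem k)
  have hroot : ∀ τ : Ω ≃ₐ[ℚ_[p]] Ω, Fixes L τ → ∃ j, τ γ = ζ ^ j * γ := by
    intro τ hτ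
    have : (τ γ / γ) ^ n = 1 := by
      rw [div_pow, ← map_pow, hτ _ (h.le hγ), div_self (pow_ne_zero _ hγ0)]
    obtain ⟨j, -, hj⟩ := hζ.eq_pow_of_pow_eq_one this
    exact ⟨j, by rw [hj]; field_simp⟩
  obtain ⟨σ, hσ, hσγ⟩ : ∃ σ : Ω ≃ₐ[ℚ_[p]] Ω, Fixes L σ ∧ σ γ ≠ γ := by
    by_contra! hc
    exact hγk (h.mem_k_of_fixed hγQ hc)
  obtain ⟨j, hj⟩ := hroot σ hσ
  have hξ : IsPrimitiveRoot (ζ ^ j) n := by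
    refine hζ.pow_of_coprime _ (Nat.Coprime.symm ((Nat.Prime.coprime_iff_not_dvd hn).2 ?_))
    rintro ⟨m, rfl⟩
    rw [pow_mul, hζ.pow_eq_one, one_pow, one_mul] at hj
    exact hσγ hj
  have hξk : ζ ^ j ∈ k := pow_mem hζk _
  generalize ζ ^ j = ξ at *
  have hroot : ∀ τ : Ω ≃ₐ[ℚ_[p]] Ω, Fixes L τ → ∃ j, τ γ = ξ ^ j * γ := by
    intro τ hτ
    have : (τ γ / γ) ^ n = 1 := by
      rw [div_pow, ← map_pow, hτ _ (h.le hγ), div_self (pow_ne_zero _ hγ0)]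
    obtain ⟨j, -, hj⟩ := hξ.eq_pow_of_pow_eq_one this
    exact ⟨j, by rw [hj]; field_simp⟩
  have hσj : ∀ j, Fixes L (σ ^ j) := by
    intro j
    induction j with
    | zero => intro x _; rfl
    | succ j ih =>
      intro x hx
      rw [pow_succ', AlgEquiv.mul_apply, ih x hx, hσ x hx]
  have hσjγ : ∀ j, (σ ^ j) γ = ξ ^ j * γ := by
    intro j
    induction j with
    | zero => simp
    | succ j ih =>
      rw [pow_succ', AlgEquiv.mul_apply, ih, map_mul, map_pow, hσ _ (h.le hξk), hj]
      ring
  have hext : ∀ τ τ' : Ω ≃ₐ[ℚ_[p]] Ω, Fixes L τ → Fixes L τ' → τ γ = τ' γ →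
      ∀ x ∈ L ⊔ IntermediateField.adjoin ℚ_[p] {γ}, τ x = τ' x := by
    intro τ τ' hτ hτ' he x hx
    have h1 : Fixes L (τ.trans τ'.symm) := fun x hx => by
      rw [AlgEquiv.trans_apply, hτ x hx, hτ'.symm x hx]
    have h2 : (τ.trans τ'.symm) γ = γ := by
      rw [AlgEquiv.trans_apply, he, AlgEquiv.symm_apply_apply]
    have := (h1.sup (Fixes.adjoin_singleton h2)) x hx
    rwa [AlgEquiv.trans_apply, AlgEquiv.symm_apply_eq] at this
  have hN : ∀ x, (∏ j ∈ Finset.range n, ((σ ^ j : Ω ≃ₐ[ℚ_[p]] Ω) : Ω →* Ω)) x =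
      ∏ j ∈ Finset.range n, (σ ^ j) x := fun x => by
    rw [MonoidHom.finsetProd_apply]
    rfl
  have hcyc : ∀ x ∈ L ⊔ IntermediateField.adjoin ℚ_[p] {γ},
      σ (∏ j ∈ Finset.range n, (σ ^ j) x) = ∏ j ∈ Finset.range n, (σ ^ j) x := by
    intro x hx
    have h1 : (σ ^ n) x = x := hext (σ ^ n) AlgEquiv.refl (hσj n) (fun _ _ => rfl)
      (by rw [hσjγ, hξ.pow_eq_one, one_mul]; rfl) x hx
    rw [map_prod]
    have h2 : ∀ j, σ ((σ ^ j) x) = (σ ^ (j + 1)) x := fun j => by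
      rw [pow_succ', AlgEquiv.mul_apply]
    simp only [h2]
    have h3 := Finset.prod_range_succ (fun j => (σ ^ j) x) n
    rw [Finset.prod_range_succ' (fun j => (σ ^ j) x) n, h1, pow_zero, AlgEquiv.one_apply] at h3
    by_cases x0 : x = 0
    · subst x0
      simp [hn.ne_zero]
    · exact mul_right_cancel₀ x0 h3
  have hNL : ∀ x ∈ L ⊔ IntermediateField.adjoin ℚ_[p] {γ},
      ∏ j ∈ Finset.range n, (σ ^ j) x ∈ L := by
    intro x hx
    refine h.mem_of_fixed fun τ hτ => ?_
    obtain ⟨i, hi⟩ := hroot τ hτ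
    have hcyc' : ∀ i, (σ ^ i) (∏ j ∈ Finset.range n, (σ ^ j) x) =
        ∏ j ∈ Finset.range n, (σ ^ j) x := by
      intro i
      induction i with
      | zero => rfl
      | succ i ih => rw [pow_succ, AlgEquiv.mul_apply, hcyc x hx, ih]
    have h4 : ∀ j, τ ((σ ^ j) x) = (σ ^ i) ((σ ^ j) x) := by
      intro j
      refine hext (τ * σ ^ j) (σ ^ i * σ ^ j) ?_ ?_ ?_ x hx
      · intro x hx
        rw [AlgEquiv.mul_apply, hσj j x hx, hτ x hx]
      · intro x hx
        rw [AlgEquiv.mul_apply, hσj j x hx, hσj i x hx]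
      · rw [AlgEquiv.mul_apply, AlgEquiv.mul_apply, hσjγ, map_mul, map_mul, hi, hσjγ,
          hτ _ (h.le (pow_mem hξk _)), hσj i _ (h.le (pow_mem hξk _))]
    rw [map_prod, Finset.prod_congr rfl fun j _ => h4 j, ← map_prod, hcyc' i]
  refine ⟨∏ j ∈ Finset.range n, ((σ ^ j : Ω ≃ₐ[ℚ_[p]] Ω) : Ω →* Ω), σ, ξ, hσ, hξk, hξ, hj, hN,
    fun x hx => by rw [hN]; exact hNL x hx, fun x hx => ?_, fun x hx => ?_, fun x hx => ?_,
    fun x hx y hy => ?_, fun x hx => ?_⟩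
  · rw [hN]
    refine h.mem_k (hNL x (sup_le_sup_right h.le _ hx)) ?_
    have hx' : x ∈ Qbar p Ω := (sup_le h.le_Qbar
      ((IntermediateField.adjoin_simple_le_iff).2 hγQ)) hx
    exact prod_mem fun j _ => map_mem_Qbar _ hx'
  · rw [hN, Finset.prod_congr rfl fun j _ => hσj j x hx]
    simp
  · rw [hN]
    exact Finset.prod_ne_zero_iff.2 fun j _ => (map_ne_zero _).2 hx
  · rw [hN]
    have hprod := hξ.pow_sub_pow_eq_prod_sub_mul x (γ * y) hn.pos
    rw [← mul_pow, hprod]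
    refine Finset.prod_nbij (fun j => ξ ^ j) (fun j _ => ?_) (fun i hi j hj e => ?_)
      (fun z hz => ?_) (fun j _ => ?_)
    · rw [Polynomial.mem_nthRootsFinset hn.pos, ← pow_mul, mul_comm, pow_mul, hξ.pow_eq_one,
        one_pow]
    · exact hξ.pow_inj (Finset.mem_range.1 hi) (Finset.mem_range.1 hj) e
    · obtain ⟨j, hj, e⟩ := hξ.eq_pow_of_pow_eq_one
        ((Polynomial.mem_nthRootsFinset hn.pos _).1 hz)
      exact ⟨j, Finset.mem_coe.2 (Finset.mem_range.2 hj), e⟩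
    · rw [map_sub, map_mul, hσj j x hx, hσj j y hy, hσjγ, mul_assoc]
  · rw [hN, nrm_prod _ fun j _ => map_mem_Qbar _ hx]
    rw [Finset.prod_congr rfl fun j _ => nrm_map (σ ^ j) x]
    simp
end Kummer

section Rigid
variable {p : ℕ} [Fact p.Prime] {Ω : Type*} [Field Ω] [Algebra ℚ_[p] Ω]

/-- Nonzero `n`-th powers of elements of `L`. -/
def powSet (L : IntermediateField ℚ_[p] Ω) (n : ℕ) : Set Ω := {x | ∃ l ∈ L, l ≠ 0 ∧ l ^ n = x}

/-- Products of a unit of `k` and a nonzero `n`-th power of an element of `L`. -/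
def unitPowSet (k L : IntermediateField ℚ_[p] Ω) (n : ℕ) : Set Ω :=
  {x | ∃ c ∈ k, ∃ l ∈ L, l ≠ 0 ∧ nrm p c = 1 ∧ c * l ^ n = x}

/-- An element whose absolute value is not among those of `k` times those of `n`-th powers. -/
theorem exists_nrm_eq_pow {k : IntermediateField ℚ_[p] Ω} (hk : k ≤ Qbar p Ω) {n : ℕ}
    (hn : n.Prime) {γ : Ω} (hγQ : γ ∈ Qbar p Ω) (hγ0 : γ ≠ 0)
    (hγ : ∃ d ∈ k, d ≠ 0 ∧ nrm p γ ^ n = nrm p d) {i : ℕ} (hi0 : 0 < i) (hi : i < n)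
    {b : Ω} (hb : b ∈ k) (hb0 : b ≠ 0) (h : nrm p γ ^ i = nrm p b) :
    ∃ d ∈ k, d ≠ 0 ∧ nrm p γ = nrm p d := by
  obtain ⟨d, hd, hd0, hdγ⟩ := hγ
  have hco : (Nat.gcd i n : ℤ) = 1 := by
    have : Nat.Coprime n i := (Nat.Prime.coprime_iff_not_dvd hn).2 fun hd =>
      absurd (Nat.le_of_dvd hi0 hd) (not_le.2 hi)
    exact_mod_cast this.symm
  have hbez := Nat.gcd_eq_gcd_ab i n
  rw [hco] at hbez
  refine ⟨b ^ (i.gcdA n) * d ^ (i.gcdB n), mul_mem (zpow_mem hb _) (zpow_mem hd _),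
    mul_ne_zero (zpow_ne_zero _ hb0) (zpow_ne_zero _ hd0), ?_⟩
  have hγ1 : nrm p γ ≠ 0 := (nrm_pos hγQ hγ0).ne'
  rw [nrm_mul (hk (zpow_mem hb _)) (hk (zpow_mem hd _)), nrm_zpow (hk hb), nrm_zpow (hk hd),
    ← hdγ, ← h, ← zpow_natCast, ← zpow_natCast, ← zpow_mul, ← zpow_mul, ← zpow_add₀ hγ1,
    ← hbez, zpow_one]

/-- In a ramified extension by a radical, any sum is dominated by one of its terms. -/
theorem exists_dominant {k : IntermediateField ℚ_[p] Ω} (hk : k ≤ Qbar p Ω) {n : ℕ}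
    (hn : n.Prime) {γ : Ω} (hγQ : γ ∈ Qbar p Ω) (hγ0 : γ ≠ 0)
    (hγ : ∃ d ∈ k, d ≠ 0 ∧ nrm p γ ^ n = nrm p d)
    (hγv : ∀ d ∈ k, d ≠ 0 → nrm p γ ≠ nrm p d) {a : ℕ → Ω} (ha : ∀ i, a i ∈ k)
    (h0 : ∃ i < n, a i ≠ 0) :
    ∃ i < n, a i ≠ 0 ∧ nrm p (∑ j ∈ Finset.range n, a j * γ ^ j - a i * γ ^ i) <
      nrm p (a i * γ ^ i) ∧ ∀ j < n, nrm p (a j * γ ^ j) ≤ nrm p (a i * γ ^ i) := by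
  have hQ : ∀ i, a i * γ ^ i ∈ Qbar p Ω := fun i => mul_mem (hk (ha i)) (pow_mem hγQ i)
  obtain ⟨i, hi, hmax⟩ := Finset.exists_max_image (Finset.range n) (fun i => nrm p (a i * γ ^ i))
    ⟨0, Finset.mem_range.2 hn.pos⟩
  have hpos : 0 < nrm p (a i * γ ^ i) := by
    obtain ⟨j, hj, haj⟩ := h0
    exact (nrm_pos (hQ j) (mul_ne_zero haj (pow_ne_zero _ hγ0))).trans_le
      (hmax j (Finset.mem_range.2 hj))
  have hai : a i ≠ 0 := by
    intro e
    rw [e, zero_mul, nrm_zero] at hpos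
    exact lt_irrefl _ hpos
  have hdist : ∀ j ∈ Finset.range n, j ≠ i → nrm p (a j * γ ^ j) < nrm p (a i * γ ^ i) := by
    intro j hj hji
    refine lt_of_le_of_ne (hmax j hj) fun e => ?_
    have haj : a j ≠ 0 := by
      intro e'
      rw [e', zero_mul, nrm_zero] at e
      exact hpos.ne e
    have key : ∀ i j, i < j → j < n → a i ≠ 0 → a j ≠ 0 →
        nrm p (a j * γ ^ j) ≠ nrm p (a i * γ ^ i) := by
      intro i j hij hj hai haj e
      rw [nrm_mul (hk (ha _)) (pow_mem hγQ _), nrm_mul (hk (ha _)) (pow_mem hγQ _), nrm_pow hγQ,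
        nrm_pow hγQ, ← Nat.sub_add_cancel hij.le, pow_add, ← mul_assoc, Nat.sub_add_cancel hij.le] at e
      have e1 := mul_right_cancel₀ (pow_ne_zero _ (nrm_pos hγQ hγ0).ne') e
      obtain ⟨d, hd, hd0, hγd⟩ := exists_nrm_eq_pow hk hn hγQ hγ0 hγ (Nat.sub_pos_of_lt hij)
        ((Nat.sub_le _ _).trans_lt hj) (div_mem (ha i) (ha j)) (div_ne_zero hai haj) (by
          rw [nrm_div (hk (ha i)) (hk (ha j)), eq_div_iff (nrm_pos (hk (ha _)) haj).ne', ← e1,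
            mul_comm])
      exact hγv d hd hd0 hγd
    rcases lt_or_gt_of_ne hji with hlt | hlt
    · exact key _ _ hlt (Finset.mem_range.1 hi) haj hai e.symm
    · exact key _ _ hlt (Finset.mem_range.1 hj) hai haj e
  refine ⟨i, Finset.mem_range.1 hi, hai, ?_, fun j hj => hmax j (Finset.mem_range.2 hj)⟩
  rw [← Finset.sum_erase_add _ _ hi, add_sub_cancel_right]
  by_cases hne : ((Finset.range n).erase i).Nonempty
  · obtain ⟨j, hj, hjmax⟩ := Finset.exists_max_image _ (fun i => nrm p (a i * γ ^ i)) hne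
    refine lt_of_le_of_lt (nrm_sum_le _ (nrm_nonneg _) (fun m _ => hQ m) hjmax) ?_
    exact hdist j (Finset.mem_of_mem_erase hj) (Finset.ne_of_mem_erase hj)
  · rw [Finset.not_nonempty_iff_eq_empty.1 hne, Finset.sum_empty, nrm_zero]
    exact hpos

theorem Good.exists_one_sub_eq [IsAlgClosed Ω] {k L : IntermediateField ℚ_[p] Ω}
    (h : Good k L) {ℓ : ℕ} (hℓ : ℓ.Prime) (hp : p.Coprime ℓ) {ζ : Ω}
    (hζ : IsPrimitiveRoot ζ ℓ) (hζk : ζ ∈ k) (hneg : ∃ ε ∈ k, ε ^ ℓ = -1) {x : Ω} (hx : x ∈ L)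
    (hx0 : x ≠ 0) (hxT : x ∉ unitPowSet k L ℓ) :
    ∃ i : ℕ, ∃ s ∈ powSet L ℓ, 1 - x = x ^ i * s := by
  have ℓ0 := hℓ.ne_zero
  obtain ⟨c, hc, l, hl, hc0, hl0, rfl⟩ := h.exists_eq_mul_pow hx hx0 ℓ0
  obtain ⟨γ, hγ⟩ := IsAlgClosed.exists_pow_nat_eq c hℓ.pos
  have hγ0 : γ ≠ 0 := by
    rintro rfl
    rw [zero_pow ℓ0] at hγ
    exact hc0 hγ.symm
  have hγk : γ ^ ℓ ∈ k := hγ ▸ hc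
  have hγv : ∀ d ∈ k, d ≠ 0 → nrm p γ ≠ nrm p d := by
    intro d hd hd0 e
    refine hxT ⟨c / d ^ ℓ, div_mem hc (pow_mem hd _), d * l, mul_mem (h.le hd) hl,
      mul_ne_zero hd0 hl0, ?_, by rw [mul_pow]; field_simp⟩
    have hγQ : γ ∈ Qbar p Ω := mem_Qbar_of_pow_mem ℓ0 (h.le_Qbar hγk)
    rw [nrm_div (h.le_Qbar hc) (pow_mem (h.le_Qbar hd) _), ← hγ, nrm_pow hγQ,
      nrm_pow (h.le_Qbar hd), e, div_self]
    exact pow_ne_zero _ (nrm_pos (h.le_Qbar hd) hd0).ne'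
  have hγnk : γ ∉ k := fun hm => hγv γ hm hγ0 rfl
  have hγQ : γ ∈ Qbar p Ω := mem_Qbar_of_pow_mem ℓ0 (h.le_Qbar hγk)
  obtain ⟨N, -, -, -, -, -, -, -, hNL, hNk, hNpow, hN0, hNsub, hNnrm⟩ :=
    h.exists_norm hℓ hζ hζk hγk hγnk
  have hx1 : 1 - c * l ^ ℓ ≠ 0 := by
    intro e
    refine hxT ⟨1, one_mem _, 1, one_mem _, one_ne_zero, nrm_one, ?_⟩
    rw [← sub_eq_zero.1 e]
    ring
  have hsub : N (1 - γ * l) = 1 - c * l ^ ℓ := by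
    rw [hNsub 1 (one_mem _) l hl, hγ, one_pow]
  have hadj : IntermediateField.adjoin ℚ_[p] {γ} ≤ Qbar p Ω :=
    IntermediateField.adjoin_simple_le_iff.2 hγQ
  have h' := h.extend (le_sup_left : k ≤ k ⊔ IntermediateField.adjoin ℚ_[p] {γ})
    (sup_le h.le_Qbar hadj)
  have hLL : L ⊔ (k ⊔ IntermediateField.adjoin ℚ_[p] {γ}) =
      L ⊔ IntermediateField.adjoin ℚ_[p] {γ} := by rw [← sup_assoc, sup_eq_left.2 h.le]
  rw [hLL] at h'
  have hγk' : γ ∈ k ⊔ IntermediateField.adjoin ℚ_[p] {γ} :=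
    (le_sup_right : _ ≤ k ⊔ IntermediateField.adjoin ℚ_[p] {γ})
      (IntermediateField.mem_adjoin_simple_self _ _)
  have hw0 : 1 - γ * l ≠ 0 := fun e => hx1 (by rw [← hsub, e, ← zero_mul (0 : Ω), map_mul,
    hNpow 0 (zero_mem _), zero_pow ℓ0, zero_mul])
  obtain ⟨e, he, u, hu, he0, hu0, heu⟩ := h'.exists_eq_mul_pow (x := 1 - γ * l)
    (sub_mem (one_mem _) (mul_mem (h'.le hγk') ((le_sup_left : L ≤ _) hl))) hw0 ℓ0
  obtain ⟨a, ha, hea⟩ := exists_eq_sum_pow ℓ0 hγk he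
  obtain ⟨i, hi, hai, hlt, -⟩ := exists_dominant h.le_Qbar hℓ hγQ hγ0
    ⟨γ ^ ℓ, hγk, pow_ne_zero _ hγ0, (nrm_pow hγQ ℓ).symm⟩ hγv ha (by
      by_contra! hc
      exact he0 (hea.trans (Finset.sum_eq_zero fun i hi => by
        rw [hc i (Finset.mem_range.1 hi), zero_mul])))
  rw [← hea] at hlt
  have hm0 : a i * γ ^ i ≠ 0 := mul_ne_zero hai (pow_ne_zero _ hγ0)
  have hmk : a i * γ ^ i ∈ k ⊔ IntermediateField.adjoin ℚ_[p] {γ} :=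
    mul_mem ((le_sup_left : k ≤ _) (ha i)) (pow_mem hγk' _)
  obtain ⟨g, hg, hge, -⟩ := h'.exists_root_of_nrm_lt hp ℓ0
    (h := (e - a i * γ ^ i) / (a i * γ ^ i)) (div_mem (sub_mem he hmk) hmk) (by
      rw [nrm_div (h'.le_Qbar (sub_mem he hmk)) (h'.le_Qbar hmk),
        div_lt_one (nrm_pos (h'.le_Qbar hmk) hm0)]
      exact hlt)
  have hge' : e = a i * γ ^ i * g ^ ℓ := by
    rw [hge]
    field_simp
    ring
  have hg0 : g ≠ 0 := by
    rintro rfl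
    rw [zero_pow ℓ0, mul_zero] at hge'
    exact he0 hge'
  obtain ⟨ε, hε, hε1⟩ := hneg
  have hNγ : N γ = (-ε) ^ ℓ * c := by
    have e1 := hNsub 0 (zero_mem _) 1 (one_mem _)
    have e2 : (0 : Ω) - γ * 1 = -1 * γ := by ring
    rw [e2, map_mul, hNpow _ (neg_mem (one_mem _)), hγ, zero_pow ℓ0] at e1
    have e3 : ((-1 : Ω) ^ ℓ) * (-1) ^ ℓ = 1 := by rw [← mul_pow]; simp
    rw [neg_pow, hε1]
    linear_combination (-1 : Ω) ^ ℓ * e1 - N γ * e3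
  have hgu : N (g * u) ∈ L := hNL _ (mul_mem (by rw [← hLL]; exact
    (le_sup_right : _ ≤ L ⊔ (k ⊔ IntermediateField.adjoin ℚ_[p] {γ})) hg) hu)
  refine ⟨i, (a i * (-ε / l) ^ i * N (g * u)) ^ ℓ, ⟨_, mul_mem (mul_mem (h.le (ha i)) (pow_mem
    (div_mem (neg_mem (h.le hε)) hl) _)) hgu, mul_ne_zero (mul_ne_zero hai (pow_ne_zero _
    (div_ne_zero (neg_ne_zero.2 ?_) hl0))) (hN0 _ (mul_ne_zero hg0 hu0)), rfl⟩, ?_⟩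
  · rintro rfl
    rw [zero_pow ℓ0] at hε1
    exact one_ne_zero (neg_eq_zero.1 hε1.symm)
  · rw [← hsub, heu, hge']
    have e4 : a i * γ ^ i * g ^ ℓ * u ^ ℓ = a i * γ ^ i * (g * u) ^ ℓ := by ring
    rw [e4, map_mul, map_mul, map_pow, map_pow, hNpow _ (h.le (ha i)), hNγ]
    have e5 : (a i * (-ε / l) ^ i * N (g * u)) ^ ℓ =
        a i ^ ℓ * ((-ε) ^ ℓ / l ^ ℓ) ^ i * N (g * u) ^ ℓ := by
      rw [mul_pow, mul_pow, ← pow_mul, mul_comm i ℓ, pow_mul, div_pow]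
    have hll : l ^ ℓ ≠ 0 := pow_ne_zero _ hl0
    have e6 : (c * l ^ ℓ) ^ i * ((-ε) ^ ℓ / l ^ ℓ) ^ i = ((-ε) ^ ℓ * c) ^ i := by
      rw [← mul_pow]
      congr 1
      field_simp
    rw [e5, ← e6]
    ring
end Rigid

section RigidAlgebra
variable {F : Type*} [Field F] {S T : Set F}

theorem one_add_mem_of_rigid (hS : IsMulSubgroup S) (hT : IsMulSubgroup T) (hST : S ⊆ T)
    (hneg : (-1 : F) ∈ S) {ℓ : ℕ} (hℓ : ℓ.Prime) (hpow : ∀ x : F, x ≠ 0 → x ^ ℓ ∈ S)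
    (hR : ∀ x : F, x ≠ 0 → x ∉ T → ∃ i : ℕ, ∃ s ∈ S, 1 - x = x ^ i * s) {t : F} (ht : t ∈ T)
    (htS : t ∉ S) : 1 + t ∈ T := by
  by_contra hc
  have h0 : 1 + t ≠ 0 := fun e => htS (by rwa [← eq_neg_of_add_eq_zero_right e] at hneg)
  obtain ⟨i, s, hs, hi⟩ := hR _ h0 hc
  have hi' : (1 + t) ^ i * s = -1 * t := by rw [← hi]; ring
  by_cases hd : ℓ ∣ i
  · obtain ⟨j, rfl⟩ := hd
    rw [mul_comm ℓ j, pow_mul] at hi'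
    have := hS.mul_mem (hpow _ (pow_ne_zero j h0)) hs
    rw [hi', hS.mul_mem_iff_left hneg] at this
    exact htS this
  · have h1 : (1 + t) ^ i ∈ T := by
      rw [← hT.mul_mem_iff_right (hST hs), hi', hT.mul_mem_iff_left (hST hneg)]
      exact ht
    exact hc (hT.mem_of_pow_mem_of_coprime ((Nat.Prime.coprime_iff_not_dvd hℓ).2 hd) h0
      (hST (hpow _ h0)) h1)

theorem rigid_two (hS : IsMulSubgroup S) (hT : IsMulSubgroup T) (hST : S ⊆ T)
    (hneg : (-1 : F) ∈ S) (hpow : ∀ x : F, x ≠ 0 → x ^ 2 ∈ S)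
    (hR : ∀ x : F, x ≠ 0 → x ∉ T → ∃ i : ℕ, ∃ s ∈ S, 1 - x = x ^ i * s) {x : F} (hx0 : x ≠ 0)
    (hx : x ∉ T) : 1 + x ∈ S ∨ (1 + x) / x ∈ S := by
  obtain ⟨i, s, hs, hi⟩ := hR (-x) (neg_ne_zero.2 hx0) (fun h => hx (by
    rw [← neg_one_mul, hT.mul_mem_iff_left (hST hneg)] at h
    exact h))
  rw [sub_neg_eq_add] at hi
  rcases Nat.even_or_odd' i with ⟨j, rfl | rfl⟩
  · left
    rw [hi, mul_comm 2 j, pow_mul]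
    exact hS.mul_mem (hpow _ (pow_ne_zero _ (neg_ne_zero.2 hx0))) hs
  · right
    rw [hi]
    have : (-x) ^ (2 * j + 1) * s / x = -1 * (((-x) ^ j) ^ 2 * s) := by
      field_simp
      ring
    rw [this]
    exact hS.mul_mem hneg (hS.mul_mem (hpow _ (pow_ne_zero _ (neg_ne_zero.2 hx0))) hs)

theorem rigid_three (hS : IsMulSubgroup S) (hT : IsMulSubgroup T) (hST : S ⊆ T)
    (hneg : (-1 : F) ∈ S) (hpow : ∀ x : F, x ≠ 0 → x ^ 3 ∈ S)
    (hR : ∀ x : F, x ≠ 0 → x ∉ T → ∃ i : ℕ, ∃ s ∈ S, 1 - x = x ^ i * s)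
    {u : F} (hu : u ∈ T) (huS : u ∉ S) (hu1 : (1 - u) / u ^ 2 ∈ S) {x : F} (hx0 : x ≠ 0)
    (hx : x ∉ T) : 1 + x ∈ S ∨ (1 + x) / x ∈ S := by
  have hnegT : ∀ {y : F}, -y ∈ T ↔ y ∈ T := fun {y} => by
    rw [← neg_one_mul, hT.mul_mem_iff_left (hST hneg)]
  have hmod : ∀ {y : F}, y ≠ 0 → ∀ i : ℕ, ∃ s ∈ S, y ^ i = y ^ (i % 3) * s := by
    intro y hy i
    refine ⟨(y ^ (i / 3)) ^ 3, hpow _ (pow_ne_zero _ hy), ?_⟩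
    rw [← pow_mul, ← pow_add, mul_comm (i / 3) 3, Nat.mod_add_div]
  suffices key : ∀ x : F, x ≠ 0 → x ∉ T → (1 - x) / x ^ 2 ∉ S by
    have hx0' := neg_ne_zero.2 hx0
    obtain ⟨i, s, hs, hi⟩ := hR (-x) hx0' (fun h => hx (hnegT.1 h))
    obtain ⟨s', hs', hi'⟩ := hmod hx0' i
    have h3 : i % 3 < 3 := Nat.mod_lt _ (by norm_num)
    rw [hi', sub_neg_eq_add] at hi
    interval_cases hm : i % 3
    · left
      rw [hi, pow_zero, one_mul]
      exact hS.mul_mem hs' hs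
    · right
      have : (1 + x) / x = -1 * (s' * s) := by
        rw [hi]
        field_simp
      rw [this]
      exact hS.mul_mem hneg (hS.mul_mem hs' hs)
    · refine absurd ?_ (key (-x) hx0' (fun h => hx (hnegT.1 h)))
      rw [sub_neg_eq_add, hi, mul_assoc, mul_div_cancel_left₀ _ (pow_ne_zero _ hx0')]
      exact hS.mul_mem hs' hs
  intro x hx0 hx hbad
  have hu0 : u ≠ 0 := hT.ne_zero hu
  have h1u : 1 - u ≠ 0 := fun e => hS.ne_zero hu1 (by rw [e, zero_div])
  have hw0 : x / u ≠ 0 := div_ne_zero hx0 hu0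
  have hw : x / u ∉ T := fun h => hx ((hT.div_mem_iff_right hu).1 h)
  obtain ⟨j, s, hs, hj⟩ := hR (x / u) hw0 hw
  have h1x : 1 - x ≠ 0 := fun e => hS.ne_zero hbad (by rw [e, zero_div])
  have hz0 : (1 - x) / (1 - u) ≠ 0 := div_ne_zero h1x h1u
  have hzS : (1 - x) / (1 - u) / (u / x) ∈ S := by
    have := hS.mul_mem (hS.div_mem hbad hu1) (hpow _ hw0)
    convert this using 1
    field_simp
  have hz : (1 - x) / (1 - u) ∉ T := by
    intro h
    have := hT.div_mem h (hST hzS)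
    rw [div_div_cancel₀ hz0, ← hT.inv_mem_iff, inv_div] at this
    exact hw this
  obtain ⟨i, s', hs', hi⟩ := hR _ hz0 hz
  have e1 : 1 - (1 - x) / (1 - u) = -u * (1 - x / u) / (1 - u) := by field_simp; ring
  rw [e1, hj] at hi
  set r := (1 - x) / (1 - u) / (u / x) with hr
  have e2 : (1 - x) / (1 - u) = r * (x / u)⁻¹ := by rw [hr]; field_simp
  rw [e2] at hi
  set w := x / u with hw'
  have e3 : -u * (w ^ j * s) / (1 - u) = (-1 * s / ((1 - u) / u ^ 2)) * (w ^ j * u⁻¹) := by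
    field_simp
  rw [e3, mul_pow] at hi
  have hmem : w ^ (i + j) / u ∈ S := by
    have : w ^ (i + j) / u = r ^ i * s' / (-1 * s / ((1 - u) / u ^ 2)) := by
      rw [eq_div_iff (div_ne_zero (mul_ne_zero (by norm_num) (hS.ne_zero hs)) (hS.ne_zero hu1))]
      have hwi : w ^ i ≠ 0 := pow_ne_zero _ hw0
      have e5 : (w⁻¹) ^ i * w ^ i = 1 := by rw [← mul_pow, inv_mul_cancel₀ hw0, one_pow]
      have := congrArg (· * w ^ i) hi
      rw [pow_add]
      linear_combination this + r ^ i * s' * e5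
    rw [this]
    exact hS.div_mem (hS.mul_mem (hS.pow_mem hzS _) hs')
      (hS.div_mem (hS.mul_mem hneg hs) hu1)
  by_cases hd : 3 ∣ i + j
  · obtain ⟨m, hm⟩ := hd
    rw [hm, mul_comm 3 m, pow_mul] at hmem
    have := hS.div_mem (hpow _ (pow_ne_zero m hw0)) hmem
    rw [div_div_cancel₀ (pow_ne_zero _ (pow_ne_zero _ hw0))] at this
    exact huS this
  · have : w ^ (i + j) ∈ T := by
      rw [← hT.div_mem_iff_right hu]
      exact hST hmem
    exact hw (hT.mem_of_pow_mem_of_coprime ((Nat.Prime.coprime_iff_not_dvd Nat.prime_three).2 hd)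
      hw0 (hST (hpow _ hw0)) this)

end RigidAlgebra

/-- In a finite field of characteristic two with a nontrivial cube root of unity there is a
non-cube `v` such that `1 + v` is `v ^ 2` times a cube. -/
theorem exists_noncube {κ : Type*} [Field κ] [Finite κ] [CharP κ 2] {ω : κ} (hω : ω ≠ 1)
    (hω3 : ω ^ 3 = 1) : ∃ v w : κ, v ≠ 0 ∧ w ≠ 0 ∧ (∀ y, y ^ 3 ≠ v) ∧ 1 + v = v ^ 2 * w ^ 3 := by
  obtain ⟨g, hg⟩ : ∃ g : κ, ∀ y, y ^ 3 ≠ g := by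
    by_contra! hc
    have hinj : Function.Injective (fun y : κ => y ^ 3) :=
      Finite.injective_iff_surjective.2 hc
    exact hω (hinj (by simpa using hω3))
  have hg0 : g ≠ 0 := fun e => hg 0 (by rw [e]; norm_num)
  have hN : 0 < orderOf (Units.mk0 g hg0) := orderOf_pos _
  have hgN : g ^ orderOf (Units.mk0 g hg0) = 1 := by
    have := congrArg Units.val (pow_orderOf_eq_one (Units.mk0 g hg0))
    rwa [Units.val_pow_eq_pow_val, Units.val_mk0, Units.val_one] at this
  obtain ⟨a, N', hN', hNN⟩ := Nat.exists_eq_pow_mul_and_not_dvd hN.ne' 3 (by norm_num)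
  rw [hNN] at hgN
  have hv0 : g ^ N' ≠ 0 := pow_ne_zero _ hg0
  have hdvd : 3 ^ a ∣ 2 ^ 3 ^ a + 1 := by
    have h1 : ((3 : ℕ) : ℤ) ∣ 2 - (-1) := by norm_num
    have h2 := dvd_sub_pow_of_dvd_sub h1 a
    have h3 : Odd (3 ^ a) := Odd.pow (by decide)
    rw [h3.neg_one_pow, sub_neg_eq_add] at h2
    have h4 : ((3 ^ a : ℕ) : ℤ) ∣ ((2 ^ 3 ^ a + 1 : ℕ) : ℤ) := by
      push_cast
      exact dvd_trans (pow_dvd_pow (3 : ℤ) (Nat.le_succ a)) (by exact_mod_cast h2)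
    exact_mod_cast h4
  have hv1 : (g ^ N') ^ (2 ^ 3 ^ a + 1) = 1 := by
    obtain ⟨m, hm⟩ := hdvd
    rw [hm, ← pow_mul, ← mul_assoc, mul_comm N', pow_mul, hgN, one_pow]
  have hcube : ∀ y, y ^ 3 ≠ g ^ N' := by
    intro y hy
    have hco : Nat.Coprime N' 3 := ((Nat.Prime.coprime_iff_not_dvd Nat.prime_three).2 hN').symm
    have hbez := Nat.gcd_eq_gcd_ab N' 3
    rw [hco] at hbez
    have hy0 : y ≠ 0 := by
      rintro rfl
      exact hv0 (by rw [← hy]; norm_num)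
    refine hg (y ^ (N'.gcdA 3) * g ^ (N'.gcdB 3)) ?_
    rw [mul_pow, ← zpow_natCast, ← zpow_natCast, ← zpow_mul, ← zpow_mul, mul_comm _ ((3 : ℕ) : ℤ),
      zpow_mul, zpow_natCast, hy, ← zpow_natCast, ← zpow_mul, ← zpow_add₀ hg0,
      mul_comm _ ((3 : ℕ) : ℤ), ← hbez]
    simp
  generalize g ^ N' = v at *
  have h1v : 1 + v ≠ 0 := by
    intro e
    refine hcube (-1) ?_
    linear_combination -e
  have hfrob : (1 + v) ^ (2 ^ 3 ^ a) = 1 + v ^ (2 ^ 3 ^ a) := by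
    rw [add_pow_char_pow, one_pow]
  have h5 : v * (1 + v) ^ (2 ^ 3 ^ a) = 1 + v := by
    rw [hfrob, mul_add, ← pow_succ', hv1]
    ring
  obtain ⟨j, hj⟩ : ∃ j, 2 ^ 3 ^ a = 3 * j + 2 := by
    have h3 : Odd (3 ^ a) := Odd.pow (by decide)
    obtain ⟨b, hb⟩ := h3
    have : 2 ^ 3 ^ a % 3 = 2 := by
      rw [hb, pow_succ, pow_mul, Nat.mul_mod, Nat.pow_mod]
      norm_num
    exact ⟨2 ^ 3 ^ a / 3, by omega⟩
  refine ⟨v, (v * (1 + v) ^ j)⁻¹, hv0,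
    inv_ne_zero (mul_ne_zero hv0 (pow_ne_zero _ h1v)), hcube, ?_⟩
  rw [hj] at h5
  have h6 : v * (1 + v) ^ (3 * j) * (1 + v) = 1 := by
    refine mul_right_cancel₀ h1v ?_
    linear_combination h5
  rw [inv_pow, mul_pow, ← pow_mul, eq_mul_inv_iff_mul_eq₀
    (mul_ne_zero (pow_ne_zero _ hv0) (pow_ne_zero _ h1v))]
  linear_combination v ^ 2 * h6

section Residue
universe u
variable {p : ℕ} [Fact p.Prime] {Ω : Type*} [Field Ω] [Algebra ℚ_[p] Ω]

/-- `res` restricts to the reduction map of the ring of integers of `k`. -/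
structure IsResidueMap (k : IntermediateField ℚ_[p] Ω) {κ : Type*} [Field κ] (res : Ω → κ) :
    Prop where
  map_add : ∀ {x y : Ω}, x ∈ k → y ∈ k → nrm p x ≤ 1 → nrm p y ≤ 1 → res (x + y) = res x + res y
  map_mul : ∀ {x y : Ω}, x ∈ k → y ∈ k → nrm p x ≤ 1 → nrm p y ≤ 1 → res (x * y) = res x * res y
  map_one : res 1 = 1
  eq_zero_iff : ∀ {x : Ω}, x ∈ k → nrm p x ≤ 1 → (res x = 0 ↔ nrm p x < 1)
  surj : ∀ a : κ, ∃ x ∈ k, nrm p x ≤ 1 ∧ res x = a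

/-- The ring of integers of a finite extension of `ℚ_[p]`. -/
def intRing (k : IntermediateField ℚ_[p] Ω) (hkQ : k ≤ Qbar p Ω) : ValuationSubring k :=
  { carrier := {x | nrm p (x : Ω) ≤ 1}
    mul_mem' := fun {x y} hx hy => by
      simp only [Set.mem_ofPred_eq, MulMemClass.coe_mul] at *
      rw [nrm_mul (hkQ x.2) (hkQ y.2)]
      exact mul_le_one₀ hx (nrm_nonneg _) hy
    one_mem' := by simp [nrm_one]
    add_mem' := fun {x y} hx hy => by
      simp only [Set.mem_ofPred_eq, AddMemClass.coe_add] at *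
      exact (nrm_add_le (hkQ x.2) (hkQ y.2)).trans (max_le hx hy)
    zero_mem' := by simp [nrm_zero]
    neg_mem' := fun {x} hx => by
      simp only [Set.mem_ofPred_eq, NegMemClass.coe_neg] at *
      rwa [nrm_neg _ (hkQ x.2)]
    mem_or_inv_mem' := fun x => by
      rcases le_or_gt (nrm p (x : Ω)) 1 with h | h
      · exact Or.inl h
      · right
        change nrm p ((x⁻¹ : k) : Ω) ≤ 1
        rw [IntermediateField.coe_inv, nrm_inv (hkQ x.2)]
        exact inv_le_one_of_one_le₀ h.le }

theorem mem_intRing {k : IntermediateField ℚ_[p] Ω} (hkQ : k ≤ Qbar p Ω) {x : k} :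
    x ∈ intRing k hkQ ↔ nrm p (x : Ω) ≤ 1 := Iff.rfl

theorem exists_residueMap {p : ℕ} [Fact p.Prime] {Ω : Type u} [Field Ω] [Algebra ℚ_[p] Ω]
    (k : IntermediateField ℚ_[p] Ω) [FiniteDimensional ℚ_[p] k] :
    ∃ (κ : Type u) (_ : Field κ) (_ : Finite κ) (res : Ω → κ), IsResidueMap k res := by
  classical
  have hkQ := le_Qbar_of_finiteDimensional k
  obtain ⟨A, hA⟩ : ∃ A : ValuationSubring k, ∀ x : k, x ∈ A ↔ nrm p (x : Ω) ≤ 1 :=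
    ⟨intRing k hkQ, fun _ => mem_intRing hkQ⟩
  have hunit : ∀ x : A, IsUnit x ↔ ¬ nrm p ((x : k) : Ω) < 1 := by
    intro x
    have hx := (hA x).1 x.2
    constructor
    · intro hu h
      obtain ⟨y, hy⟩ := hu.exists_right_inv
      have e1 : ((x : k) : Ω) * ((y : k) : Ω) = 1 := by
        have h2 : (x : k) * (y : k) = 1 := congrArg (Subtype.val (p := (· ∈ A))) hy
        exact congrArg (Subtype.val (p := (· ∈ k))) h2
      have e : nrm p ((x : k) : Ω) * nrm p ((y : k) : Ω) = 1 := by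
        rw [← nrm_mul (hkQ (x : k).2) (hkQ (y : k).2), e1, nrm_one]
      have := mul_lt_one_of_nonneg_of_lt_one_left (nrm_nonneg _) h ((hA y).1 y.2)
      exact this.ne e
    · intro h
      have h1 : nrm p ((x : k) : Ω) = 1 := le_antisymm hx (not_lt.1 h)
      have h0 : (x : k) ≠ 0 := by
        intro e
        rw [e, ZeroMemClass.coe_zero, nrm_zero] at h1
        exact zero_ne_one h1
      have hi : (x : k)⁻¹ ∈ A := by
        rw [hA, IntermediateField.coe_inv, nrm_inv (hkQ (x : k).2), h1, inv_one]
      exact IsUnit.of_mul_eq_one ⟨_, hi⟩ (Subtype.ext (mul_inv_cancel₀ h0))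
  let res : Ω → IsLocalRing.ResidueField A := fun x =>
    if h : ∃ hx : x ∈ k, nrm p x ≤ 1 then IsLocalRing.residue A ⟨⟨x, h.1⟩, (hA _).2 h.2⟩ else 0
  have hres : ∀ (x : Ω) (hx : x ∈ k) (h1 : nrm p x ≤ 1),
      res x = IsLocalRing.residue A ⟨⟨x, hx⟩, (hA _).2 h1⟩ := fun x hx h1 => dif_pos ⟨hx, h1⟩
  have hR : IsResidueMap k res :=
    { map_add := fun {x y} hx hy hx1 hy1 => by
        rw [hres x hx hx1, hres y hy hy1, hres _ (add_mem hx hy) ((nrm_add_le (hkQ hx)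
          (hkQ hy)).trans (max_le hx1 hy1))]
        exact (IsLocalRing.residue A).map_add ⟨⟨x, hx⟩, (hA _).2 hx1⟩ ⟨⟨y, hy⟩, (hA _).2 hy1⟩
      map_mul := fun {x y} hx hy hx1 hy1 => by
        rw [hres x hx hx1, hres y hy hy1, hres _ (mul_mem hx hy) (by
          rw [nrm_mul (hkQ hx) (hkQ hy)]
          exact mul_le_one₀ hx1 (nrm_nonneg _) hy1)]
        exact (IsLocalRing.residue A).map_mul ⟨⟨x, hx⟩, (hA _).2 hx1⟩ ⟨⟨y, hy⟩, (hA _).2 hy1⟩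
      map_one := by
        rw [hres 1 (one_mem _) nrm_one.le]
        exact (IsLocalRing.residue A).map_one
      eq_zero_iff := fun {x} hx h1 => by
        rw [hres x hx h1, IsLocalRing.residue_eq_zero_iff, IsLocalRing.mem_maximalIdeal,
          mem_nonunits_iff, hunit, not_not]
      surj := fun a => by
        obtain ⟨x, rfl⟩ := IsLocalRing.residue_surjective a
        exact ⟨(x : k), (x : k).2, (hA _).1 x.2, hres _ (x : k).2 ((hA _).1 x.2)⟩ }
  refine ⟨_, inferInstance, ?_, res, hR⟩
  obtain ⟨s, hs, hcov⟩ := exists_residues k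
  refine Set.finite_univ_iff.1 ((s.finite_toSet.image res).subset fun a _ => ?_)
  obtain ⟨x, hx, hx1, rfl⟩ := hR.surj a
  obtain ⟨b, hb, hxb⟩ := hcov x hx hx1
  refine ⟨b, hb, ?_⟩
  have h2 := hR.map_add (hs b hb).1 (sub_mem hx (hs b hb).1) (hs b hb).2 hxb.le
  rw [add_sub_cancel, (hR.eq_zero_iff (sub_mem hx (hs b hb).1) hxb.le).2 hxb, add_zero] at h2
  exact h2.symm
end Residue

section Residue
variable {p : ℕ} [Fact p.Prime] {Ω : Type*} [Field Ω] [Algebra ℚ_[p] Ω]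

namespace IsResidueMap
variable {k : IntermediateField ℚ_[p] Ω} {κ : Type*} [Field κ] {res : Ω → κ}

theorem map_sub (h : IsResidueMap k res) (hk : k ≤ Qbar p Ω) {x y : Ω} (hx : x ∈ k) (hy : y ∈ k)
    (hx1 : nrm p x ≤ 1) (hy1 : nrm p y ≤ 1) : res (x - y) = res x - res y := by
  rw [eq_sub_iff_add_eq, ← h.map_add (sub_mem hx hy) hy
    ((nrm_sub_le (hk hx) (hk hy)).trans (max_le hx1 hy1)) hy1, sub_add_cancel]

theorem map_pow (h : IsResidueMap k res) (hk : k ≤ Qbar p Ω) {x : Ω} (hx : x ∈ k)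
    (hx1 : nrm p x ≤ 1) (n : ℕ) : res (x ^ n) = res x ^ n := by
  induction n with
  | zero => simpa using h.map_one
  | succ n ih =>
    rw [pow_succ, pow_succ, h.map_mul (pow_mem hx n) hx
      (by rw [nrm_pow (hk hx)]; exact pow_le_one₀ (nrm_nonneg _) hx1) hx1, ih]

theorem ne_zero_iff (h : IsResidueMap k res) {x : Ω} (hx : x ∈ k) (hx1 : nrm p x ≤ 1) :
    res x ≠ 0 ↔ nrm p x = 1 := by
  rw [ne_eq, h.eq_zero_iff hx hx1, not_lt]
  exact ⟨fun h => le_antisymm hx1 h, fun h => h.ge⟩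

end IsResidueMap

/-- `k` is a finite extension of `ℚ_[p]` with the roots of unity needed to work with `ℓ`-th powers,
for an auxiliary prime `ℓ` different from `p`. -/
structure TameRoots (k : IntermediateField ℚ_[p] Ω) (ℓ : ℕ) : Prop where
  finite : FiniteDimensional ℚ_[p] k
  prime : ℓ.Prime
  coprime : p.Coprime ℓ
  exists_root : ∃ ζ ∈ k, IsPrimitiveRoot ζ ℓ
  exists_neg : ∃ ε ∈ k, ε ^ ℓ = -1
  eq_two_or : ℓ = 2 ∨ ℓ = 3 ∧ p = 2

theorem TameRoots.mono {k k' : IntermediateField ℚ_[p] Ω} {ℓ : ℕ} (h : TameRoots k ℓ)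
    (hk : k ≤ k') (hfin : FiniteDimensional ℚ_[p] k') : TameRoots k' ℓ where
  finite := hfin
  prime := h.prime
  coprime := h.coprime
  exists_root := h.exists_root.imp fun _ hx => ⟨hk hx.1, hx.2⟩
  exists_neg := h.exists_neg.imp fun _ hx => ⟨hk hx.1, hx.2⟩
  eq_two_or := h.eq_two_or

variable {k L : IntermediateField ℚ_[p] Ω} {ℓ : ℕ}

theorem isMulSubgroup_powSet : IsMulSubgroup {x : L | (x : Ω) ∈ powSet L ℓ} where
  one_mem := ⟨1, one_mem _, one_ne_zero, by simp⟩
  mul_mem := by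
    rintro x y ⟨a, ha, ha0, hx⟩ ⟨b, hb, hb0, hy⟩
    exact ⟨a * b, mul_mem ha hb, mul_ne_zero ha0 hb0, by simp [mul_pow, hx, hy]⟩
  inv_mem := by
    rintro x ⟨a, ha, ha0, hx⟩
    exact ⟨a⁻¹, inv_mem ha, inv_ne_zero ha0, by simp [hx]⟩
  ne_zero := by
    rintro x ⟨a, ha, ha0, hx⟩ rfl
    exact pow_ne_zero ℓ ha0 (by simpa using hx)

theorem ne_zero_of_nrm_eq_one {c : Ω} (h : nrm p c = 1) : c ≠ 0 := by
  rintro rfl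
  rw [nrm_zero] at h
  exact zero_ne_one h

theorem isMulSubgroup_unitPowSet (hk : k ≤ Qbar p Ω) :
    IsMulSubgroup {x : L | (x : Ω) ∈ unitPowSet k L ℓ} where
  one_mem := ⟨1, one_mem _, 1, one_mem _, one_ne_zero, nrm_one, by simp⟩
  mul_mem := by
    rintro x y ⟨c, hc, a, ha, ha0, hc1, hx⟩ ⟨d, hd, b, hb, hb0, hd1, hy⟩
    refine ⟨c * d, mul_mem hc hd, a * b, mul_mem ha hb, mul_ne_zero ha0 hb0, ?_, ?_⟩
    · rw [nrm_mul (hk hc) (hk hd), hc1, hd1, one_mul]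
    · rw [MulMemClass.coe_mul, ← hx, ← hy, mul_pow]; ring
  inv_mem := by
    rintro x ⟨c, hc, a, ha, ha0, hc1, hx⟩
    refine ⟨c⁻¹, inv_mem hc, a⁻¹, inv_mem ha, inv_ne_zero ha0, ?_, ?_⟩
    · rw [nrm_inv (hk hc), hc1, inv_one]
    · rw [IntermediateField.coe_inv, ← hx, mul_inv, inv_pow]
  ne_zero := by
    rintro x ⟨c, hc, a, ha, ha0, hc1, hx⟩ rfl
    exact mul_ne_zero (ne_zero_of_nrm_eq_one hc1) (pow_ne_zero ℓ ha0) (by simpa using hx)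

theorem isMulSubgroup_units (hk : k ≤ Qbar p Ω) :
    IsMulSubgroup {x : L | (x : Ω) ∈ k ∧ nrm p (x : Ω) = 1} where
  one_mem := ⟨one_mem k, nrm_one⟩
  mul_mem := by
    rintro x y ⟨hx, hx1⟩ ⟨hy, hy1⟩
    refine ⟨mul_mem hx hy, ?_⟩
    rw [MulMemClass.coe_mul, nrm_mul (hk hx) (hk hy), hx1, hy1, one_mul]
  inv_mem := by
    rintro x ⟨hx, hx1⟩
    refine ⟨inv_mem hx, ?_⟩
    rw [IntermediateField.coe_inv, nrm_inv (hk hx), hx1, inv_one]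
  ne_zero := by
    rintro x ⟨hx, hx1⟩ rfl
    exact ne_zero_of_nrm_eq_one hx1 (by simp)

theorem powSet_subset_unitPowSet : powSet L ℓ ⊆ unitPowSet k L ℓ := by
  rintro x ⟨l, hl, hl0, rfl⟩
  exact ⟨1, one_mem _, l, hl, hl0, nrm_one, one_mul _⟩

theorem Good.mem_k_of_pow_mem (h : Good k L) {x : Ω} (hx : x ∈ L) (hℓ : ℓ ≠ 0) [IsAlgClosed Ω]
    (hxk : x ^ ℓ ∈ k) : x ∈ k :=
  h.mem_k hx (mem_Qbar_of_pow_mem hℓ (h.le_Qbar hxk))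

theorem Good.res_root_ne_one (h : Good k L) (hk : TameRoots k ℓ) {κ : Type*} [Field κ]
    {res : Ω → κ} (hres : IsResidueMap k res) {ζ : Ω} (hζ : ζ ∈ k) (hp : IsPrimitiveRoot ζ ℓ) :
    nrm p ζ = 1 ∧ res ζ ≠ 1 ∧ res ζ ^ ℓ = 1 := by
  have h1 : nrm p ζ = 1 := nrm_eq_one_of_pow_eq_one hk.prime.ne_zero hp.pow_eq_one
  refine ⟨h1, fun e => hp.ne_one hk.prime.one_lt ?_, ?_⟩
  · have hd : nrm p (ζ - 1) < 1 := by
      rw [← hres.eq_zero_iff (sub_mem hζ (one_mem k)) ((nrm_sub_le (h.le_Qbar hζ)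
        (one_mem _)).trans (max_le h1.le nrm_one.le)), hres.map_sub h.le_Qbar hζ (one_mem _)
        h1.le nrm_one.le, e, hres.map_one, sub_self]
    exact eq_of_pow_eq_of_nrm_sub_one_lt hk.coprime (h.le_Qbar hζ) (one_mem _) hd
      (by rw [sub_self, nrm_zero]; exact one_pos) (by rw [hp.pow_eq_one, one_pow])
  · rw [← hres.map_pow h.le_Qbar hζ h1.le, hp.pow_eq_one, hres.map_one]

variable [IsAlgClosed Ω]

/-- Units with the same residue differ by an `ℓ`-th power. -/
theorem Good.exists_eq_mul_pow_of_res_eq (h : Good k L) (hk : TameRoots k ℓ) {κ : Type*} [Field κ]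
    {res : Ω → κ} (hres : IsResidueMap k res) {x y : Ω} (hx : x ∈ k) (hy : y ∈ k)
    (hx1 : nrm p x = 1) (hy1 : nrm p y = 1) (hxy : res x = res y) :
    ∃ g ∈ k, g ≠ 0 ∧ x = y * g ^ ℓ := by
  have hy0 := ne_zero_of_nrm_eq_one hy1
  have hd : nrm p (x - y) < 1 := by
    rw [← hres.eq_zero_iff (sub_mem hx hy) ((nrm_sub_le (h.le_Qbar hx) (h.le_Qbar hy)).trans
      (max_le hx1.le hy1.le)), hres.map_sub h.le_Qbar hx hy hx1.le hy1.le, hxy, sub_self]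
  obtain ⟨g, hg, hgℓ, -⟩ := h.exists_root_of_nrm_lt hk.coprime hk.prime.ne_zero
    (h := (x - y) / y) (div_mem (sub_mem hx hy) hy) (by
      rw [nrm_div (h.le_Qbar (sub_mem hx hy)) (h.le_Qbar hy), hy1, div_one]
      exact hd)
  have e : x = y * g ^ ℓ := by
    rw [hgℓ]
    field_simp
    ring
  refine ⟨g, hg, ?_, e⟩
  rintro rfl
  rw [zero_pow hk.prime.ne_zero, mul_zero] at e
  exact ne_zero_of_nrm_eq_one hx1 e

theorem Good.res_pow_ne (h : Good k L) (hk : TameRoots k ℓ) {κ : Type*} [Field κ]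
    {res : Ω → κ} (hres : IsResidueMap k res) {u : Ω} (hu : u ∈ k) (hu1 : nrm p u = 1) :
    u ∉ powSet L ℓ ↔ ∀ y, y ^ ℓ ≠ res u := by
  constructor
  · intro huS y hy
    obtain ⟨b, hb, hb1, rfl⟩ := hres.surj y
    rw [← hres.map_pow h.le_Qbar hb hb1] at hy
    have hbℓ : nrm p (b ^ ℓ) = 1 := by
      rw [← hres.ne_zero_iff (pow_mem hb ℓ) (by
        rw [nrm_pow (h.le_Qbar hb)]; exact pow_le_one₀ (nrm_nonneg _) hb1), hy,
        hres.ne_zero_iff hu hu1.le, hu1]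
    obtain ⟨g, hg, hg0, e⟩ := h.exists_eq_mul_pow_of_res_eq hk hres hu (pow_mem hb ℓ) hu1 hbℓ
      hy.symm
    refine huS ⟨b * g, h.le (mul_mem hb hg), mul_ne_zero ?_ hg0, by rw [e, mul_pow]⟩
    exact ne_zero_pow hk.prime.ne_zero (ne_zero_of_nrm_eq_one hbℓ)
  · rintro hy ⟨l, hl, hl0, rfl⟩
    have hlk := h.mem_k_of_pow_mem hl hk.prime.ne_zero hu
    have hl1 : nrm p l ≤ 1 := by
      rw [nrm_pow (h.le_Qbar hlk)] at hu1
      exact (pow_le_one_iff_of_nonneg (nrm_nonneg _) hk.prime.ne_zero).1 hu1.le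
    exact hy _ (hres.map_pow h.le_Qbar hlk hl1 ℓ).symm

end Residue

section Rigid
variable {p : ℕ} [Fact p.Prime] {Ω : Type*} [Field Ω] [Algebra ℚ_[p] Ω] [IsAlgClosed Ω]
variable {k L : IntermediateField ℚ_[p] Ω} {ℓ : ℕ}

theorem Good.exists_unit_not_mem (h : Good k L) (hk : TameRoots k ℓ) :
    ∃ u ∈ k, nrm p u = 1 ∧ u ∉ powSet L ℓ := by
  have := hk.finite
  obtain ⟨κ, _, _, res, hres⟩ := exists_residueMap k
  obtain ⟨ζ, hζ, hp⟩ := hk.exists_root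
  obtain ⟨-, hζ1, hζℓ⟩ := h.res_root_ne_one hk hres hζ hp
  obtain ⟨a, ha⟩ : ∃ a : κ, ∀ y, y ^ ℓ ≠ a := by
    by_contra! hc
    exact hζ1 (Finite.injective_iff_surjective.2 hc (a₁ := res ζ) (a₂ := 1)
      (by simpa using hζℓ))
  obtain ⟨u, hu, hu1, rfl⟩ := hres.surj a
  have hu1' : nrm p u = 1 := (hres.ne_zero_iff hu hu1).1 fun e =>
    ha 0 (by rw [e, zero_pow hk.prime.ne_zero])
  exact ⟨u, hu, hu1', (h.res_pow_ne hk hres hu hu1').2 ha⟩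

theorem Good.exists_pow_unit (h : Good k L) (hk : TameRoots k ℓ) {u : Ω} (hu : u ∈ k)
    (hu1 : nrm p u = 1) (huS : u ∉ powSet L ℓ) : ∃ m : ℕ, 1 ≤ m ∧ ∃ g ∈ k, g ≠ 0 ∧
      1 - ((1 - u) ^ m)⁻¹ = u * g ^ ℓ := by
  have := hk.finite
  obtain ⟨κ, _, _, res, hres⟩ := exists_residueMap k
  have hkQ := h.le_Qbar
  have hne : res u ≠ 1 := fun e =>
    (h.res_pow_ne hk hres hu hu1).1 huS 1 (by rw [one_pow, e])
  have hle : nrm p (1 - u) ≤ 1 := (nrm_sub_le (one_mem _) (hkQ hu)).trans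
    (max_le nrm_one.le hu1.le)
  have hmem : 1 - u ∈ k := sub_mem (one_mem k) hu
  have hres1 : res (1 - u) = 1 - res u := by
    rw [hres.map_sub hkQ (one_mem k) hu nrm_one.le hu1.le, hres.map_one]
  have h1 : nrm p (1 - u) = 1 := (hres.ne_zero_iff hmem hle).1
    (by rw [hres1]; exact sub_ne_zero.2 hne.symm)
  have : Fintype κ := Fintype.ofFinite κ
  have hq : 2 ≤ Fintype.card κ := Fintype.one_lt_card
  obtain ⟨m, hm⟩ : ∃ m, m + 1 = 2 * (Fintype.card κ - 1) := ⟨2 * (Fintype.card κ - 1) - 1, by omega⟩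
  have hvk : ((1 - u) ^ m)⁻¹ ∈ k := inv_mem (pow_mem hmem m)
  have hv1 : nrm p ((1 - u) ^ m)⁻¹ = 1 := by
    rw [nrm_inv (hkQ (pow_mem hmem m)), nrm_pow (hkQ hmem), h1, one_pow, inv_one]
  have hresv : res ((1 - u) ^ m)⁻¹ = 1 - res u := by
    have e1 : res ((1 - u) ^ m)⁻¹ * res (1 - u) ^ m = 1 := by
      rw [← hres.map_pow hkQ hmem hle, ← hres.map_mul hvk (pow_mem hmem m) hv1.le
        (by rw [nrm_pow (hkQ hmem), h1, one_pow]),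
        inv_mul_cancel₀ (pow_ne_zero _ (ne_zero_of_nrm_eq_one h1)), hres.map_one]
    have e2 : res (1 - u) ^ m * res (1 - u) = 1 := by
      rw [← pow_succ, hm, mul_comm, pow_mul, FiniteField.pow_card_sub_one_eq_one, one_pow]
      rw [hres1]; exact sub_ne_zero.2 hne.symm
    rw [← hres1, ← mul_one (res _⁻¹), ← e2, ← mul_assoc, e1, one_mul]
  have hwk : 1 - ((1 - u) ^ m)⁻¹ ∈ k := sub_mem (one_mem k) hvk
  have hresw : res (1 - ((1 - u) ^ m)⁻¹) = res u := by
    rw [hres.map_sub hkQ (one_mem k) hvk nrm_one.le hv1.le, hres.map_one, hresv, sub_sub_cancel]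
  have hw1 : nrm p (1 - ((1 - u) ^ m)⁻¹) = 1 := by
    rw [← hres.ne_zero_iff hwk ((nrm_sub_le (one_mem _) (hkQ hvk)).trans
      (max_le nrm_one.le hv1.le)), hresw, hres.ne_zero_iff hu hu1.le, hu1]
  exact ⟨m, by omega, h.exists_eq_mul_pow_of_res_eq hk hres hwk hu hw1 hu1 hresw⟩

theorem Good.exists_unit_three (h : Good k L) (hk : TameRoots k 3) (hp : p = 2) :
    ∃ u ∈ k, nrm p u = 1 ∧ u ∉ powSet L 3 ∧ ∃ g ∈ k, g ≠ 0 ∧ 1 - u = u ^ 2 * g ^ 3 := by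
  have := hk.finite
  have hkQ := h.le_Qbar
  obtain ⟨κ, _, _, res, hres⟩ := exists_residueMap k
  obtain ⟨ζ, hζ, hpr⟩ := hk.exists_root
  obtain ⟨-, hζ1, hζℓ⟩ := h.res_root_ne_one hk hres hζ hpr
  have h2 : (2 : κ) = 0 := by
    have e : nrm p (1 + 1 : Ω) < 1 := by
      subst hp
      have := nrm_p_lt_one (p := 2) (Ω := Ω)
      rw [one_add_one_eq_two]
      simpa using this
    rw [← one_add_one_eq_two, ← hres.map_one, ← hres.map_add (one_mem k) (one_mem k) nrm_one.le
      nrm_one.le, hres.eq_zero_iff (add_mem (one_mem k) (one_mem k)) e.le]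
    exact e
  have : CharP κ 2 := CharTwo.of_one_ne_zero_of_two_eq_zero one_ne_zero h2
  obtain ⟨v', w', hv0, hw0, hcube, hvw⟩ := exists_noncube hζ1 hζℓ
  obtain ⟨v, hv, hv1, rfl⟩ := hres.surj v'
  obtain ⟨w, hw, hw1, rfl⟩ := hres.surj w'
  rw [hres.ne_zero_iff hv hv1] at hv0
  rw [hres.ne_zero_iff hw hw1] at hw0
  have hu : -v ∈ k := neg_mem hv
  have hu1 : nrm p (-v) = 1 := by rw [nrm_neg _ (hkQ hv), hv0]
  have hresu : res (-v) = res v := by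
    have : res (0 - v) = res (v - v) - res v := by
      rw [hres.map_sub hkQ (zero_mem k) hv (by rw [nrm_zero]; exact zero_le_one) hv1, sub_self]
    rw [zero_sub, hres.map_sub hkQ hv hv hv1 hv1] at this
    rw [this]
    linear_combination -res v * h2
  have hwu1 : nrm p ((-v) ^ 2 * w ^ 3) = 1 := by
    rw [nrm_mul (hkQ (pow_mem hu 2)) (hkQ (pow_mem hw 3)), nrm_pow (hkQ hu), nrm_pow (hkQ hw), hu1,
      hw0]
    norm_num
  have hres1 : res (1 - -v) = res ((-v) ^ 2 * w ^ 3) := by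
    rw [hres.map_sub hkQ (one_mem k) hu nrm_one.le hu1.le, hres.map_mul (pow_mem hu 2)
      (pow_mem hw 3) (by rw [nrm_pow (hkQ hu), hu1, one_pow])
      (by rw [nrm_pow (hkQ hw), hw0, one_pow]), hres.map_pow hkQ hu hu1.le,
      hres.map_pow hkQ hw hw1, hres.map_one, hresu, ← hvw]
    linear_combination -res v * h2
  have hle : nrm p (1 - -v) ≤ 1 := (nrm_sub_le (one_mem _) (hkQ hu)).trans
    (max_le nrm_one.le hu1.le)
  have hm : 1 - -v ∈ k := sub_mem (one_mem k) hu
  have hm' := mul_mem (pow_mem hu 2) (pow_mem hw 3)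
  have h1 : nrm p (1 - -v) = 1 := by
    rw [← hres.ne_zero_iff hm hle, hres1, hres.ne_zero_iff hm' hwu1.le, hwu1]
  obtain ⟨g, hg, hg0, e⟩ := h.exists_eq_mul_pow_of_res_eq hk hres hm hm' h1 hwu1 hres1
  refine ⟨-v, hu, hu1, (h.res_pow_ne hk hres hu hu1).2 (by rwa [hresu]), w * g,
    mul_mem hw hg, mul_ne_zero (ne_zero_of_nrm_eq_one hw0) hg0, ?_⟩
  rw [e]
  ring

theorem Good.rigidPair (h : Good k L) (hk : TameRoots k ℓ) :
    RigidPair {x : L | (x : Ω) ∈ powSet L ℓ} {x : L | (x : Ω) ∈ unitPowSet k L ℓ}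
      {x : L | (x : Ω) ∈ k ∧ nrm p (x : Ω) = 1} := by
  have hS := isMulSubgroup_powSet (L := L) (ℓ := ℓ)
  have hT := isMulSubgroup_unitPowSet (L := L) (ℓ := ℓ) h.le_Qbar
  have hST : {x : L | (x : Ω) ∈ powSet L ℓ} ⊆ {x : L | (x : Ω) ∈ unitPowSet k L ℓ} :=
    fun x hx => powSet_subset_unitPowSet hx
  have hneg : (-1 : L) ∈ {x : L | (x : Ω) ∈ powSet L ℓ} := by
    obtain ⟨ε, hε, e⟩ := hk.exists_neg
    refine ⟨ε, h.le hε, ?_, by simpa using e⟩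
    rintro rfl
    rw [zero_pow hk.prime.ne_zero] at e
    exact one_ne_zero (neg_eq_zero.1 e.symm)
  have hpow : ∀ x : L, x ≠ 0 → x ^ ℓ ∈ {x : L | (x : Ω) ∈ powSet L ℓ} := fun x hx =>
    ⟨x, x.2, by simpa using hx, by simp⟩
  obtain ⟨ζ, hζk, hζ⟩ := hk.exists_root
  have hR : ∀ x : L, x ≠ 0 → x ∉ {x : L | (x : Ω) ∈ unitPowSet k L ℓ} →
      ∃ i : ℕ, ∃ s ∈ {x : L | (x : Ω) ∈ powSet L ℓ}, 1 - x = x ^ i * s := by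
    intro x hx hxT
    obtain ⟨i, s, hs, e⟩ := h.exists_one_sub_eq hk.prime hk.coprime hζ hζk hk.exists_neg x.2
      (by simpa using hx) hxT
    obtain ⟨l, hl, hl0, rfl⟩ := hs
    exact ⟨i, ⟨l, hl⟩ ^ ℓ, ⟨l, hl, hl0, by simp⟩, Subtype.ext (by simpa using e)⟩
  have hUT : {x : L | (x : Ω) ∈ k ∧ nrm p (x : Ω) = 1} ⊆
      {x : L | (x : Ω) ∈ unitPowSet k L ℓ} := fun x hx =>
    ⟨x, hx.1, 1, one_mem _, one_ne_zero, hx.2, by simp⟩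
  refine
    { hS := hS
      hT := hT
      hU := isMulSubgroup_units h.le_Qbar
      S_le := hST
      U_le := hUT
      neg_one_mem := hneg
      neg_one_mem_U := ⟨neg_mem (one_mem k), ?_⟩
      rigid := fun {x} hx0 hx => ?_
      one_add_mem := fun {t} ht htS => one_add_mem_of_rigid hS hT hST hneg hk.prime hpow hR ht htS
      exists_U := ?_
      pow_U := fun {u} hu huS => ?_ }
  · rw [NegMemClass.coe_neg, OneMemClass.coe_one, nrm_neg _ (one_mem _)]
    exact nrm_one
  · rcases hk.eq_two_or with rfl | ⟨rfl, hp⟩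
    · exact rigid_two hS hT hST hneg hpow hR hx0 hx
    · obtain ⟨u, hu, hu1, huS, g, hg, hg0, e⟩ := h.exists_unit_three hk hp
      have hu0 := ne_zero_of_nrm_eq_one hu1
      refine rigid_three hS hT hST hneg hpow hR (u := ⟨u, h.le hu⟩) (hUT ⟨hu, hu1⟩) huS
        ⟨g, h.le hg, hg0, ?_⟩ hx0 hx
      rw [IntermediateField.coe_div, eq_div_iff (by simpa using hu0)]
      simpa [mul_comm] using e.symm
  · obtain ⟨u, hu, hu1, huS⟩ := h.exists_unit_not_mem hk
    exact ⟨⟨u, h.le hu⟩, ⟨hu, hu1⟩, huS⟩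
  · obtain ⟨m, hm, g, hg, hg0, e⟩ := h.exists_pow_unit hk hu.1 hu.2 huS
    have e' : 1 - ((1 - u) ^ m)⁻¹ = u * ⟨g, h.le hg⟩ ^ ℓ := Subtype.ext (by simpa using e)
    have hgS := hpow ⟨g, h.le hg⟩ (fun e => hg0 (congrArg Subtype.val e))
    refine ⟨m, hm, ?_, ?_⟩
    · rw [e']
      exact hT.mul_mem (hUT hu) (hST hgS)
    · rw [e', hS.mul_mem_iff_right hgS]
      exact huS
end Rigid

section CanonicalRing
variable {p : ℕ} [Fact p.Prime] {Ω : Type*} [Field Ω] [Algebra ℚ_[p] Ω]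

/-- The elements of the canonical valuation ring of `L` which lie outside `unitPowSet k L ℓ`. -/
def oSmall (k L : IntermediateField ℚ_[p] Ω) (ℓ : ℕ) : Set Ω :=
  {x | x ∈ L ∧ x ≠ 0 ∧ x ∉ unitPowSet k L ℓ ∧ 1 + x ∈ powSet L ℓ}

/-- The canonical valuation ring of `L`. -/
def oSet (k L : IntermediateField ℚ_[p] Ω) (ℓ : ℕ) : Set Ω :=
  {x | x ∈ L ∧ (x = 0 ∨ x ∈ oSmall k L ℓ ∨
    x ∈ unitPowSet k L ℓ ∧ ∀ z ∈ oSmall k L ℓ, x * z ∈ oSmall k L ℓ)}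

variable {k L : IntermediateField ℚ_[p] Ω} {ℓ : ℕ}

theorem map_powSet {σ : Ω ≃ₐ[ℚ_[p]] Ω} (hL : ∀ x ∈ L, σ x ∈ L) {x : Ω} (hx : x ∈ powSet L ℓ) :
    σ x ∈ powSet L ℓ := by
  obtain ⟨l, hl, hl0, rfl⟩ := hx
  exact ⟨σ l, hL l hl, by simpa using hl0, by simp⟩

theorem map_unitPowSet {σ : Ω ≃ₐ[ℚ_[p]] Ω} (hL : ∀ x ∈ L, σ x ∈ L) (hk : ∀ x ∈ k, σ x ∈ k)
    {x : Ω} (hx : x ∈ unitPowSet k L ℓ) : σ x ∈ unitPowSet k L ℓ := by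
  obtain ⟨c, hc, l, hl, hl0, hc1, rfl⟩ := hx
  exact ⟨σ c, hk c hc, σ l, hL l hl, by simpa using hl0, by rw [nrm_map, hc1], by simp⟩

theorem map_oSmall {σ : Ω ≃ₐ[ℚ_[p]] Ω} (hL : ∀ x, σ x ∈ L ↔ x ∈ L) (hk : ∀ x, σ x ∈ k ↔ x ∈ k)
    {x : Ω} (hx : x ∈ oSmall k L ℓ) : σ x ∈ oSmall k L ℓ := by
  obtain ⟨hxL, hx0, hxT, hxS⟩ := hx
  refine ⟨(hL x).2 hxL, by simpa using hx0, fun hT => hxT ?_, ?_⟩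
  · rw [← σ.symm_apply_apply x]
    exact map_unitPowSet (fun y hy => by rwa [← hL, σ.apply_symm_apply])
      (fun y hy => by rwa [← hk, σ.apply_symm_apply]) hT
  · rw [← map_one σ, ← map_add]
    exact map_powSet (fun y => (hL y).2) hxS

theorem map_oSet {σ : Ω ≃ₐ[ℚ_[p]] Ω} (hL : ∀ x, σ x ∈ L ↔ x ∈ L) (hk : ∀ x, σ x ∈ k ↔ x ∈ k)
    {x : Ω} (hx : x ∈ oSet k L ℓ) : σ x ∈ oSet k L ℓ := by
  obtain ⟨hxL, hx'⟩ := hx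
  refine ⟨(hL x).2 hxL, ?_⟩
  rcases hx' with rfl | hx | ⟨hT, hz⟩
  · exact Or.inl (map_zero σ)
  · exact Or.inr (Or.inl (map_oSmall hL hk hx))
  · refine Or.inr (Or.inr ⟨map_unitPowSet (fun y => (hL y).2) (fun y => (hk y).2) hT,
      fun z hz' => ?_⟩)
    rw [← σ.apply_symm_apply z, ← map_mul]
    refine map_oSmall hL hk (hz _ (map_oSmall (σ := σ.symm) (fun y => ?_) (fun y => ?_) hz'))
    · rw [← hL, σ.apply_symm_apply]
    · rw [← hk, σ.apply_symm_apply]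

theorem map_oSet_iff {σ : Ω ≃ₐ[ℚ_[p]] Ω} (hL : ∀ x, σ x ∈ L ↔ x ∈ L)
    (hk : ∀ x, σ x ∈ k ↔ x ∈ k) {x : Ω} : σ x ∈ oSet k L ℓ ↔ x ∈ oSet k L ℓ := by
  refine ⟨fun h => ?_, map_oSet hL hk⟩
  have := map_oSet (σ := σ.symm) (fun y => by rw [← hL, σ.apply_symm_apply])
    (fun y => by rw [← hk, σ.apply_symm_apply]) h
  rwa [σ.symm_apply_apply] at this

theorem coe_mem_carrier_iff (x : L) :
    x ∈ RigidPair.carrier {x : L | (x : Ω) ∈ powSet L ℓ} {x : L | (x : Ω) ∈ unitPowSet k L ℓ} ↔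
      (x : Ω) ∈ oSet k L ℓ := by
  have hs : ∀ y : L, y ∈ RigidPair.small {x : L | (x : Ω) ∈ powSet L ℓ}
      {x : L | (x : Ω) ∈ unitPowSet k L ℓ} ↔ (y : Ω) ∈ oSmall k L ℓ := fun y =>
    ⟨fun ⟨h0, h1, h2⟩ => ⟨y.2, by simpa using h0, h1, h2⟩,
      fun ⟨_, h0, h1, h2⟩ => ⟨by simpa using h0, h1, h2⟩⟩
  constructor
  · rintro (rfl | hx | ⟨hT, hz⟩)
    · exact ⟨zero_mem L, Or.inl rfl⟩
    · exact ⟨x.2, Or.inr (Or.inl ((hs x).1 hx))⟩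
    · exact ⟨x.2, Or.inr (Or.inr ⟨hT, fun z hz' =>
        (hs (x * ⟨z, hz'.1⟩)).1 (hz ⟨z, hz'.1⟩ ((hs _).2 hz'))⟩)⟩
  · rintro ⟨-, hx | hx | ⟨hT, hz⟩⟩
    · exact Or.inl (Subtype.ext hx)
    · exact Or.inr (Or.inl ((hs x).2 hx))
    · exact Or.inr (Or.inr ⟨hT, fun z hz' => (hs _).2 (hz z ((hs z).1 hz'))⟩)

/-- A valuation ring of a subfield extends to a valuation ring of the whole field. -/
theorem exists_valuationSubring_extending {F : Type*} [Field F] [Algebra F Ω]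
    (A : ValuationSubring F) :
    ∃ W : ValuationSubring Ω, ∀ x : F, algebraMap F Ω x ∈ W ↔ x ∈ A := by
  let f : A →+* Ω := (algebraMap F Ω).comp A.subtype
  obtain ⟨W, hle, hloc⟩ := (LocalSubring.range f).exists_le_valuationSubring
  have hA : ∀ x ∈ A, algebraMap F Ω x ∈ W := fun x hx => hle ⟨⟨x, hx⟩, rfl⟩
  refine ⟨W, fun x => ⟨fun hx => ?_, hA x⟩⟩
  rcases A.mem_or_inv_mem x with h | h
  · exact h
  by_cases h0 : x = 0
  · rw [h0]; exact zero_mem A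
  have hr : algebraMap F Ω x⁻¹ ∈ (LocalSubring.range f).toSubring := ⟨⟨x⁻¹, h⟩, rfl⟩
  have hu : IsUnit (Subring.inclusion hle ⟨_, hr⟩) := by
    refine IsUnit.of_mul_eq_one ⟨algebraMap F Ω x, hx⟩ (Subtype.ext ?_)
    change algebraMap F Ω x⁻¹ * algebraMap F Ω x = 1
    rw [← map_mul, inv_mul_cancel₀ h0, map_one]
  obtain ⟨⟨y, a, ha⟩, hy⟩ := (hloc.map_nonunit _ hu).exists_right_inv
  have hy' : algebraMap F Ω x⁻¹ * y = 1 := congrArg Subtype.val hy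
  have e : y = algebraMap F Ω x := by
    rw [map_inv₀] at hy'
    exact ((inv_mul_eq_one₀ (by simpa using h0)).1 hy').symm
  have e2 : algebraMap F Ω (a : F) = algebraMap F Ω x := by rw [← e]; exact ha
  rw [← (algebraMap F Ω).injective e2]
  exact a.2

variable [IsAlgClosed Ω]

theorem Good.exists_valuationSubring (h : Good k L) (hk : TameRoots k ℓ) :
    ∃ W : ValuationSubring Ω, ∀ x ∈ L, x ∈ W ↔ x ∈ oSet k L ℓ := by
  obtain ⟨W, hW⟩ := exists_valuationSubring_extending (Ω := Ω) (h.rigidPair hk).valuationSubring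
  exact ⟨W, fun x hx => (hW ⟨x, hx⟩).trans (coe_mem_carrier_iff ⟨x, hx⟩)⟩

theorem Good.mem_oSet_iff (h : Good k L) (hk : TameRoots k ℓ) {x : Ω} (hx : x ∈ L) (h0 : x ≠ 0)
    (hT : x ∉ unitPowSet k L ℓ) : x ∈ oSet k L ℓ ↔ 1 + x ∈ powSet L ℓ :=
  (coe_mem_carrier_iff ⟨x, hx⟩).symm.trans ((h.rigidPair hk).mem_valuationSubring_iff
    (x := ⟨x, hx⟩) (fun e => h0 (congrArg Subtype.val e)) hT)

theorem Good.unit_mem_oSet (h : Good k L) (hk : TameRoots k ℓ) {x : Ω} (hx : x ∈ k)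
    (hx1 : nrm p x = 1) : x ∈ oSet k L ℓ :=
  (coe_mem_carrier_iff ⟨x, h.le hx⟩).1 ((h.rigidPair hk).U_mem_valuationSubring ⟨hx, hx1⟩)

end CanonicalRing

section CanonicalValuation
variable {p : ℕ} [Fact p.Prime] {Ω : Type*} [Field Ω] [Algebra ℚ_[p] Ω]
variable {k L : IntermediateField ℚ_[p] Ω} {ℓ : ℕ} {W : ValuationSubring Ω}

theorem valuation_lt_one_iff_inv_not_mem {F : Type*} [Field F] (W : ValuationSubring F) {x : F}
    (hx : x ≠ 0) : W.valuation x < 1 ↔ x⁻¹ ∉ W := by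
  have h0 : W.valuation x ≠ 0 := by simpa using hx
  rw [← W.valuation_le_one_iff, map_inv₀, not_le, one_lt_inv₀ (zero_lt_iff.2 h0)]

/-- The canonical ring is compatible with radical extensions of degree `p`. -/
theorem Good.oSet_of_oSet_adjoin (h : Good k L) (hk : TameRoots k ℓ) {N : Ω →* Ω} {γ : Ω}
    (hNL : ∀ x ∈ L ⊔ IntermediateField.adjoin ℚ_[p] {γ}, N x ∈ L)
    (hNk : ∀ x ∈ k ⊔ IntermediateField.adjoin ℚ_[p] {γ}, N x ∈ k)
    (hN : ∀ x ∈ L, N x = x ^ p) (hN0 : ∀ x, x ≠ 0 → N x ≠ 0)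
    (hNn : ∀ x ∈ Qbar p Ω, nrm p (N x) = nrm p x ^ p)
    {x : Ω}
    (hG : Good (k ⊔ IntermediateField.adjoin ℚ_[p] {γ}) (L ⊔ IntermediateField.adjoin ℚ_[p] {γ}))
    (hx : x ∈ L) (hxO : x ∈ oSet (k ⊔ IntermediateField.adjoin ℚ_[p] {γ})
      (L ⊔ IntermediateField.adjoin ℚ_[p] {γ}) ℓ) : x ∈ oSet k L ℓ := by
  have hLL : L ≤ L ⊔ IntermediateField.adjoin ℚ_[p] {γ} := le_sup_left
  have hkk : k ≤ k ⊔ IntermediateField.adjoin ℚ_[p] {γ} := le_sup_left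
  generalize hL' : L ⊔ IntermediateField.adjoin ℚ_[p] {γ} = L' at *
  generalize hk' : k ⊔ IntermediateField.adjoin ℚ_[p] {γ} = k' at *
  have hS : ∀ y ∈ L, y ∈ powSet L' ℓ ↔ y ∈ powSet L ℓ := by
    refine fun y hy => ⟨?_, fun ⟨l, hl, hl0, e⟩ => ⟨l, hLL hl, hl0, e⟩⟩
    rintro ⟨l, hl, hl0, e⟩
    have hy0 : y ≠ 0 := by rw [← e]; exact pow_ne_zero _ hl0
    have hSL := isMulSubgroup_powSet (L := L) (ℓ := ℓ)
    refine hSL.mem_of_pow_mem_of_coprime (x := ⟨y, hy⟩) hk.coprime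
      (fun e => hy0 (congrArg Subtype.val e)) ⟨N l, hNL l hl, hN0 l hl0, ?_⟩ ⟨y, hy, hy0, ?_⟩
    · rw [← map_pow, e, hN y hy]; rfl
    · rfl
  have hT : ∀ y ∈ L, y ∈ unitPowSet k' L' ℓ ↔ y ∈ unitPowSet k L ℓ := by
    refine fun y hy => ⟨?_, fun ⟨c, hc, l, hl, e⟩ => ⟨c, hkk hc, l, hLL hl, e⟩⟩
    rintro ⟨c, hc, l, hl, hl0, hc1, e⟩
    have hy0 : y ≠ 0 := by
      rw [← e]; exact mul_ne_zero (ne_zero_of_nrm_eq_one hc1) (pow_ne_zero _ hl0)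
    have hTL := isMulSubgroup_unitPowSet (L := L) (ℓ := ℓ) h.le_Qbar
    refine hTL.mem_of_pow_mem_of_coprime (x := ⟨y, hy⟩) hk.coprime
      (fun e => hy0 (congrArg Subtype.val e))
      ⟨N c, hNk c hc, N l, hNL l hl, hN0 l hl0, ?_, ?_⟩
      (powSet_subset_unitPowSet ⟨y, hy, hy0, rfl⟩)
    · rw [hNn c (hG.le_Qbar hc), hc1, one_pow]
    · rw [← map_pow, ← map_mul, e, hN y hy]; rfl
  have hsm : ∀ y ∈ L, y ∈ oSmall k' L' ℓ ↔ y ∈ oSmall k L ℓ := fun y hy => by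
    simp only [oSmall, Set.mem_ofPred_eq, hT y hy, hS _ (add_mem (one_mem L) hy), hy, hLL hy]
  obtain ⟨-, rfl | hx' | ⟨hxT, hz⟩⟩ := hxO
  · exact ⟨hx, Or.inl rfl⟩
  · exact ⟨hx, Or.inr (Or.inl ((hsm x hx).1 hx'))⟩
  · exact ⟨hx, Or.inr (Or.inr ⟨(hT x hx).1 hxT, fun z hz' => (hsm _ (mul_mem hx hz'.1)).1
      (hz z ((hsm z hz'.1).2 hz'))⟩)⟩

variable [IsAlgClosed Ω]

theorem Good.uniformizer_not_mem (h : Good k L) {n : ℕ} (hn : 1 < n) {ϖ : Ω} (hϖ : ϖ ∈ k)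
    (hϖ0 : ϖ ≠ 0) (hϖ1 : nrm p ϖ < 1) (huni : ∀ x ∈ k, x ≠ 0 → ∃ j : ℤ, nrm p x = nrm p ϖ ^ j) :
    ϖ ∉ unitPowSet k L n := by
  rintro ⟨c, hc, l, hl, hl0, hc1, e⟩
  have hc0 := ne_zero_of_nrm_eq_one hc1
  have hlk : l ∈ k := h.mem_k_of_pow_mem hl (Nat.ne_zero_of_lt hn) (by
    rw [← mul_inv_cancel_left₀ hc0 (l ^ n), mul_left_comm, e]
    exact mul_mem (inv_mem hc) hϖ)
  have hpos : 0 < nrm p ϖ := nrm_pos (h.le_Qbar hϖ) hϖ0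
  obtain ⟨j, hj⟩ := huni l hlk hl0
  have e1 : nrm p ϖ ^ (1 : ℤ) = nrm p ϖ ^ (j * n) := by
    rw [zpow_mul, ← hj, zpow_natCast, ← nrm_pow (h.le_Qbar hlk), zpow_one]
    conv_lhs => rw [← e, nrm_mul (h.le_Qbar hc) (h.le_Qbar (pow_mem hlk n)), hc1, one_mul]
  have e2 := zpow_right_injective₀ hpos hϖ1.ne e1
  have : (n : ℤ) ∣ 1 := ⟨j, by rw [e2]; ring⟩
  exact hn.ne' (by exact_mod_cast Int.eq_one_of_dvd_one (by positivity) this)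

theorem Good.valuation_unit (h : Good k L) (hk : TameRoots k ℓ)
    (hW : ∀ x ∈ L, x ∈ W ↔ x ∈ oSet k L ℓ) {x : Ω} (hx : x ∈ k) (hx1 : nrm p x = 1) :
    W.valuation x = 1 := by
  have h0 := ne_zero_of_nrm_eq_one hx1
  refine le_antisymm ((W.valuation_le_one_iff x).2 ((hW x (h.le hx)).2
    (h.unit_mem_oSet hk hx hx1))) (not_lt.1 fun hc => ?_)
  rw [valuation_lt_one_iff_inv_not_mem _ h0] at hc
  exact hc ((hW _ (inv_mem (h.le hx))).2 (h.unit_mem_oSet hk (inv_mem hx)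
    (by rw [nrm_inv (h.le_Qbar hx), hx1, inv_one])))

theorem Good.valuation_lt_one (h : Good k L) (hk : TameRoots k ℓ)
    (hW : ∀ x ∈ L, x ∈ W ↔ x ∈ oSet k L ℓ) {x : Ω} (hx : x ∈ k) (hx1 : nrm p x < 1) :
    W.valuation x < 1 := by
  by_cases hx0 : x = 0
  · rw [hx0, map_zero]; exact zero_lt_one
  have := hk.finite
  obtain ⟨ϖ, hϖ, hϖ0, hϖ1, huni⟩ := exists_uniformizer k
  have hpos : 0 < nrm p ϖ := nrm_pos (h.le_Qbar hϖ) hϖ0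
  have hT := h.uniformizer_not_mem hk.prime.one_lt hϖ hϖ0 hϖ1 huni
  have hval : W.valuation ϖ < 1 := by
    rw [valuation_lt_one_iff_inv_not_mem _ hϖ0, hW _ (inv_mem (h.le hϖ))]
    have hTi : ϖ⁻¹ ∉ unitPowSet k L ℓ := fun hc => hT (by
      have := (isMulSubgroup_unitPowSet (L := L) (ℓ := ℓ) h.le_Qbar).inv_mem
        (x := ⟨ϖ⁻¹, inv_mem (h.le hϖ)⟩) hc
      simpa using this)
    rw [h.mem_oSet_iff hk (inv_mem (h.le hϖ)) (inv_ne_zero hϖ0) hTi]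
    intro hc
    obtain ⟨g, hg, hgℓ, -⟩ := h.exists_root_of_nrm_lt hk.coprime hk.prime.ne_zero hϖ hϖ1
    have hg0 : g ≠ 0 := by
      rintro rfl
      rw [zero_pow hk.prime.ne_zero] at hgℓ
      have h3 : ϖ = -1 := (neg_eq_of_add_eq_zero_right hgℓ.symm).symm
      rw [h3, nrm_neg _ (one_mem _), nrm_one] at hϖ1
      exact lt_irrefl _ hϖ1
    obtain ⟨l, hl, hl0, e⟩ := hc
    refine hT (powSet_subset_unitPowSet ⟨g / l, div_mem (h.le hg) hl, div_ne_zero hg0 hl0, ?_⟩)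
    rw [div_pow, hgℓ, e]
    have : ϖ + 1 ≠ 0 := by
      rw [add_comm, ← hgℓ]; exact pow_ne_zero _ hg0
    field_simp
    exact add_comm _ _
  obtain ⟨j, hj⟩ := huni x hx hx0
  have hj0 : 0 < j := by
    by_contra! hle
    rw [hj] at hx1
    exact absurd (one_le_zpow_of_nonpos₀ hpos hϖ1.le hle) (not_le.2 hx1)
  have hu : W.valuation (x / ϖ ^ j) = 1 := h.valuation_unit hk hW (div_mem hx (zpow_mem hϖ _)) (by
    rw [nrm_div (h.le_Qbar hx) (h.le_Qbar (zpow_mem hϖ _)), nrm_zpow (h.le_Qbar hϖ), hj,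
      div_self (zpow_ne_zero _ hpos.ne')])
  have hz : (ϖ : Ω) ^ j ≠ 0 := zpow_ne_zero _ hϖ0
  rw [← div_mul_cancel₀ x hz, map_mul, hu, one_mul, map_zpow₀]
  lift j to ℕ using hj0.le
  rw [zpow_natCast]
  exact pow_lt_one₀ zero_le hval (by exact_mod_cast hj0.ne')

/-- `p`-henselianity of the canonical valuation. -/
theorem Good.exists_root_of_valuation_lt (h : Good k L) (hk : TameRoots k ℓ)
    (hW : ∀ x ∈ L, x ∈ W ↔ x ∈ oSet k L ℓ) {ζ : Ω} (hζ : IsPrimitiveRoot ζ p) (hζk : ζ ∈ k)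
    {a : Ω} (ha : a ∈ L) (ha1 : W.valuation a < 1) : ∃ y ∈ L, y ^ p = 1 + (ζ - 1) ^ p * a := by
  have hp : p.Prime := Fact.out
  have := hk.finite
  by_cases hb0 : 1 + (ζ - 1) ^ p * a = 0
  · exact ⟨0, zero_mem L, by rw [hb0, zero_pow hp.ne_zero]⟩
  by_cases ha0 : a = 0
  · exact ⟨1, one_mem L, by simp [ha0]⟩
  have hζL := h.le hζk
  have hζ1 : ζ - 1 ≠ 0 := sub_ne_zero.2 (hζ.ne_one hp.one_lt)
  obtain ⟨c, hc, l, hl, hc0, hl0, e⟩ := h.exists_eq_mul_pow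
    (add_mem (one_mem L) (mul_mem (pow_mem (sub_mem hζL (one_mem L)) p) ha)) hb0 hp.ne_zero
  obtain ⟨γ, hγ⟩ := IsAlgClosed.exists_pow_nat_eq c hp.pos
  by_cases hγk : γ ∈ k
  · exact ⟨γ * l, mul_mem (h.le hγk) hl, by rw [e, mul_pow, hγ]⟩
  exfalso
  have hγQ : γ ∈ Qbar p Ω := mem_Qbar_of_pow_mem hp.ne_zero (hγ ▸ h.le_Qbar hc)
  obtain ⟨N, σ, ξ, hσ, hξ, hξp, hσγ, -, hNL, hNk, hN, hN0, -, hNn⟩ :=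
    h.exists_norm hp hζ hζk (hγ ▸ hc) hγk
  have hγint : IsIntegral ℚ_[p] γ := (mem_algebraicClosure_iff.1 hγQ).isIntegral
  have : FiniteDimensional ℚ_[p] (IntermediateField.adjoin ℚ_[p] {γ}) :=
    IntermediateField.adjoin.finiteDimensional hγint
  have hfin : FiniteDimensional ℚ_[p] ↥(k ⊔ IntermediateField.adjoin ℚ_[p] {γ}) :=
    IntermediateField.finiteDimensional_sup _ _
  have hle : IntermediateField.adjoin ℚ_[p] {γ} ≤ Qbar p Ω :=
    IntermediateField.adjoin_le_iff.2 (by simpa using hγQ)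
  have hG : Good (k ⊔ IntermediateField.adjoin ℚ_[p] {γ})
      (L ⊔ IntermediateField.adjoin ℚ_[p] {γ}) := by
    have := h.extend (k' := k ⊔ IntermediateField.adjoin ℚ_[p] {γ}) le_sup_left
      (sup_le h.le_Qbar hle)
    rwa [← sup_assoc, sup_eq_left.2 h.le] at this
  obtain ⟨W', hW'⟩ := hG.exists_valuationSubring (hk.mono le_sup_left hfin)
  have ha1' : W'.valuation a < 1 := by
    rw [valuation_lt_one_iff_inv_not_mem _ ha0] at ha1 ⊢
    refine fun hc => ha1 ((hW _ (inv_mem ha)).2 (h.oSet_of_oSet_adjoin hk hNL hNk hN hN0 hNn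
      hG (inv_mem ha) ((hW' _ ?_).1 hc)))
    exact le_sup_left (a := L) (inv_mem ha)
  have hγL : γ ∈ L ⊔ IntermediateField.adjoin ℚ_[p] {γ} :=
    le_sup_right (a := L) (IntermediateField.mem_adjoin_simple_self ℚ_[p] γ)
  -- move to the power of `σ` which multiplies `γ` by `ζ`
  obtain ⟨τ, hτ, hτγ⟩ : ∃ τ : Ω ≃ₐ[ℚ_[p]] Ω, Fixes L τ ∧ τ γ = ζ * γ := by
    have : NeZero p := ⟨hp.ne_zero⟩
    obtain ⟨j, -, hj⟩ := hξp.eq_pow_of_pow_eq_one hζ.pow_eq_one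
    have hpow : ∀ j : ℕ, Fixes L (σ ^ j) ∧ (σ ^ j) γ = ξ ^ j * γ := by
      intro j
      induction j with
      | zero => exact ⟨fun x _ => rfl, by simp⟩
      | succ j ih =>
        refine ⟨fun x hx => ?_, ?_⟩
        · rw [pow_succ, AlgEquiv.mul_apply, hσ x hx, ih.1 x hx]
        · rw [pow_succ, AlgEquiv.mul_apply, hσγ, map_mul, ih.1 ξ (h.le hξ), ih.2, pow_succ]
          ring
    exact ⟨σ ^ j, (hpow j).1, by rw [(hpow j).2, hj]⟩
  have hfix : ∀ {E : IntermediateField ℚ_[p] Ω}, E ≤ L → ζ ∈ E → ∀ x,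
      τ x ∈ E ⊔ IntermediateField.adjoin ℚ_[p] {γ} ↔
        x ∈ E ⊔ IntermediateField.adjoin ℚ_[p] {γ} := by
    intro E hE hζE
    have hγE : γ ∈ E ⊔ IntermediateField.adjoin ℚ_[p] {γ} :=
      le_sup_right (a := E) (IntermediateField.mem_adjoin_simple_self ℚ_[p] γ)
    have hζE' : ζ ∈ E ⊔ IntermediateField.adjoin ℚ_[p] {γ} := le_sup_left (a := E) hζE
    have key : ∀ τ' : Ω ≃ₐ[ℚ_[p]] Ω, Fixes L τ' →
        τ' γ ∈ E ⊔ IntermediateField.adjoin ℚ_[p] {γ} →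
        ∀ x ∈ E ⊔ IntermediateField.adjoin ℚ_[p] {γ},
          τ' x ∈ E ⊔ IntermediateField.adjoin ℚ_[p] {γ} := by
      intro τ' hτ' hγ' x hx
      have : E ⊔ IntermediateField.adjoin ℚ_[p] {γ} ≤
          (E ⊔ IntermediateField.adjoin ℚ_[p] {γ}).comap (τ' : Ω →ₐ[ℚ_[p]] Ω) := by
        refine sup_le (fun y hy => ?_) (IntermediateField.adjoin_le_iff.2
          (Set.singleton_subset_iff.2 hγ'))
        change τ' y ∈ E ⊔ IntermediateField.adjoin ℚ_[p] {γ}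
        rw [hτ' y (hE hy)]
        exact le_sup_left (a := E) hy
      exact this hx
    refine fun x => ⟨fun hx => ?_, key τ hτ (by rw [hτγ]; exact mul_mem hζE' hγE) x⟩
    have := key τ.symm hτ.symm (by
      have e1 : τ.symm γ = ζ⁻¹ * γ := by
        rw [AlgEquiv.symm_apply_eq, map_mul, hτγ, hτ _ (inv_mem hζL),
          inv_mul_cancel_left₀ (hζ.ne_zero hp.ne_zero)]
      rw [e1]
      exact mul_mem (inv_mem hζE') hγE) _ hx
    rwa [τ.symm_apply_apply] at this
  have hyL : γ * l ∈ L ⊔ IntermediateField.adjoin ℚ_[p] {γ} :=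
    mul_mem hγL (le_sup_left (a := L) hl)
  have hprod : ∏ ω ∈ Polynomial.nthRootsFinset p (1 : Ω), (γ * l - ω) / (ζ - 1) = a := by
    rw [Finset.prod_div_distrib, Finset.prod_const, hζ.card_nthRootsFinset]
    have h1 := hζ.pow_sub_pow_eq_prod_sub_mul (γ * l) 1 hp.pos
    simp only [mul_one, one_pow] at h1
    rw [← h1, mul_pow, hγ, ← e, add_sub_cancel_left,
      mul_div_cancel_left₀ _ (pow_ne_zero _ hζ1)]
  obtain ⟨ω, hω, hω1⟩ : ∃ ω ∈ Polynomial.nthRootsFinset p (1 : Ω),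
      W'.valuation ((γ * l - ω) / (ζ - 1)) < 1 := by
    by_contra! hc
    rw [← hprod, map_prod] at ha1'
    exact absurd (Finset.one_le_prod' hc) (not_le.2 ha1')
  have hωp : ω ^ p = 1 := (Polynomial.mem_nthRootsFinset hp.pos _).1 hω
  have hωk : ω ∈ k := by
    have : NeZero p := ⟨hp.ne_zero⟩
    obtain ⟨j, -, rfl⟩ := hζ.eq_pow_of_pow_eq_one hωp
    exact pow_mem hζk j
  have hZ : (γ * l - ω) / (ζ - 1) ∈ L ⊔ IntermediateField.adjoin ℚ_[p] {γ} :=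
    div_mem (sub_mem hyL (le_sup_left (a := L) (h.le hωk)))
      (le_sup_left (a := L) (sub_mem hζL (one_mem L)))
  have hτZ : τ ((γ * l - ω) / (ζ - 1)) = ζ * ((γ * l - ω) / (ζ - 1)) + ω := by
    rw [map_div₀, map_sub, map_sub, map_mul, map_one, hτγ, hτ l hl, hτ ω (h.le hωk), hτ ζ hζL]
    field_simp
    ring
  generalize (γ * l - ω) / (ζ - 1) = Z at *
  have hτZ1 : W'.valuation (τ Z) < 1 := by
    by_cases hZ0 : Z = 0
    · rw [hZ0, map_zero, map_zero]; exact zero_lt_one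
    rw [valuation_lt_one_iff_inv_not_mem _ (by simpa using hZ0), ← map_inv₀, hW' _
      ((hfix le_rfl hζL _).2 (inv_mem hZ)), map_oSet_iff (hfix le_rfl hζL) (hfix h.le hζk),
      ← hW' _ (inv_mem hZ), ← valuation_lt_one_iff_inv_not_mem _ hZ0]
    exact hω1
  have hk' := hk.mono (k' := k ⊔ IntermediateField.adjoin ℚ_[p] {γ}) le_sup_left hfin
  have hunit : ∀ z : Ω, z ∈ k → z ^ p = 1 → W'.valuation z = 1 := fun z hz hzp =>
    hG.valuation_unit hk' hW' (le_sup_left (a := k) hz) (nrm_eq_one_of_pow_eq_one hp.ne_zero hzp)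
  have h1 : W'.valuation (τ Z - ζ * Z) < 1 :=
    W'.valuation.map_sub_lt hτZ1 (by rw [map_mul, hunit ζ hζk hζ.pow_eq_one, one_mul]; exact hω1)
  rw [hτZ, add_sub_cancel_left, hunit ω hωk hωp] at h1
  exact lt_irrefl _ h1
end CanonicalValuation

section ArtinSchreier
variable {p : ℕ} [Fact p.Prime] {Ω : Type*} [Field Ω]

/-- The polynomial function `Z ↦ ((1 + (ζ - 1) Z) ^ p - 1) / (ζ - 1) ^ p` in factored form; it
lifts the Artin–Schreier map. -/
noncomputable def artinSchreier (p : ℕ) (ζ Z : Ω) : Ω :=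
  ∏ ω ∈ Polynomial.nthRootsFinset p (1 : Ω), (Z - (ω - 1) / (ζ - 1))

theorem pow_mul_artinSchreier {ζ : Ω} (hζ : IsPrimitiveRoot ζ p) (Z : Ω) :
    (ζ - 1) ^ p * artinSchreier p ζ Z = (1 + (ζ - 1) * Z) ^ p - 1 := by
  have hp : p.Prime := Fact.out
  have hζ1 : ζ - 1 ≠ 0 := sub_ne_zero.2 (hζ.ne_one hp.one_lt)
  have h1 := hζ.pow_sub_pow_eq_prod_sub_mul (1 + (ζ - 1) * Z) 1 hp.pos
  simp only [mul_one, one_pow] at h1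
  have h2 : (ζ - 1) ^ p = ∏ _ω ∈ Polynomial.nthRootsFinset p (1 : Ω), (ζ - 1) := by
    rw [Finset.prod_const, hζ.card_nthRootsFinset]
  rw [h1, artinSchreier, h2, ← Finset.prod_mul_distrib]
  refine Finset.prod_congr rfl fun ω _ => ?_
  field_simp
  ring

variable [Algebra ℚ_[p] Ω]

namespace IsResidueMap
variable {k : IntermediateField ℚ_[p] Ω} {κ : Type*} [Field κ] {res : Ω → κ}

theorem map_prod (h : IsResidueMap k res) (hk : k ≤ Qbar p Ω) {ι : Type*} (s : Finset ι)
    {f : ι → Ω} (hf : ∀ i ∈ s, f i ∈ k ∧ nrm p (f i) ≤ 1) :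
    nrm p (∏ i ∈ s, f i) ≤ 1 ∧ res (∏ i ∈ s, f i) = ∏ i ∈ s, res (f i) := by
  classical
  induction s using Finset.induction_on with
  | empty => exact ⟨by simp [nrm_one], by simpa using h.map_one⟩
  | insert a s ha ih =>
    have hs := fun i hi => hf i (Finset.mem_insert_of_mem hi)
    have hfa := hf a (Finset.mem_insert_self _ _)
    have hmem := prod_mem fun i hi => (hs i hi).1
    rw [Finset.prod_insert ha, Finset.prod_insert ha, nrm_mul (hk hfa.1) (hk hmem)]
    exact ⟨mul_le_one₀ hfa.2 (nrm_nonneg _) (ih hs).1,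
      by rw [h.map_mul hfa.1 hmem hfa.2 (ih hs).1, (ih hs).2]⟩

end IsResidueMap

variable {ζ : Ω} {k : IntermediateField ℚ_[p] Ω}

theorem root_sub_one_div_mem (hζ : IsPrimitiveRoot ζ p) (hζk : ζ ∈ k) (hk : k ≤ Qbar p Ω) {ω : Ω}
    (hω : ω ∈ Polynomial.nthRootsFinset p (1 : Ω)) :
    (ω - 1) / (ζ - 1) ∈ k ∧ nrm p ((ω - 1) / (ζ - 1)) ≤ 1 := by
  have hp : p.Prime := Fact.out
  have hζ1 : ζ - 1 ≠ 0 := sub_ne_zero.2 (hζ.ne_one hp.one_lt)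
  have : NeZero p := ⟨hp.ne_zero⟩
  obtain ⟨j, -, rfl⟩ := hζ.eq_pow_of_pow_eq_one ((Polynomial.mem_nthRootsFinset hp.pos _).1 hω)
  refine ⟨div_mem (sub_mem (pow_mem hζk j) (one_mem _)) (sub_mem hζk (one_mem _)), ?_⟩
  rw [← geom_sum_mul, mul_div_cancel_right₀ _ hζ1]
  refine nrm_sum_le _ zero_le_one (fun i _ => pow_mem (hk hζk) i) fun i _ => ?_
  rw [nrm_pow (hk hζk), nrm_eq_one_of_pow_eq_one hp.ne_zero hζ.pow_eq_one, one_pow]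

theorem artinSchreier_mem (hζ : IsPrimitiveRoot ζ p) (hζk : ζ ∈ k) (hk : k ≤ Qbar p Ω)
    {L : IntermediateField ℚ_[p] Ω} (hkL : k ≤ L) {Z : Ω} (hZ : Z ∈ L) :
    artinSchreier p ζ Z ∈ L :=
  prod_mem fun _ hω => sub_mem hZ (hkL (root_sub_one_div_mem hζ hζk hk hω).1)

theorem IsResidueMap.map_artinSchreier {κ : Type*} [Field κ] {res : Ω → κ}
    (h : IsResidueMap k res) (hk : k ≤ Qbar p Ω) (hζ : IsPrimitiveRoot ζ p) (hζk : ζ ∈ k) {Z : Ω}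
    (hZ : Z ∈ k) (hZ1 : nrm p Z ≤ 1) : nrm p (artinSchreier p ζ Z) ≤ 1 ∧
    res (artinSchreier p ζ Z) =
      ∏ ω ∈ Polynomial.nthRootsFinset p (1 : Ω), (res Z - res ((ω - 1) / (ζ - 1))) := by
  have hr := fun ω hω => root_sub_one_div_mem (ω := ω) hζ hζk hk hω
  have := h.map_prod hk (Polynomial.nthRootsFinset p (1 : Ω))
    (f := fun ω => Z - (ω - 1) / (ζ - 1)) fun ω hω =>
    ⟨sub_mem hZ (hr ω hω).1, (nrm_sub_le (hk hZ) (hk (hr ω hω).1)).trans (max_le hZ1 (hr ω hω).2)⟩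
  refine ⟨this.1, this.2.trans (Finset.prod_congr rfl fun ω hω => ?_)⟩
  exact h.map_sub hk hZ (hr ω hω).1 hZ1 (hr ω hω).2

theorem nrm_artinSchreier_sub_lt [FiniteDimensional ℚ_[p] k] (hζ : IsPrimitiveRoot ζ p)
    (hζk : ζ ∈ k) {x y : Ω} (hx : x ∈ k) (hy : y ∈ k) (hx1 : nrm p x ≤ 1) (hy1 : nrm p y ≤ 1)
    (hxy : nrm p (x - y) < 1) : nrm p (artinSchreier p ζ x - artinSchreier p ζ y) < 1 := by
  obtain ⟨κ, _, _, res, hres⟩ := exists_residueMap k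
  have hk := le_Qbar_of_finiteDimensional k
  have hX := hres.map_artinSchreier hk hζ hζk hx hx1
  have hY := hres.map_artinSchreier hk hζ hζk hy hy1
  have hXk := artinSchreier_mem hζ hζk hk le_rfl hx
  have hYk := artinSchreier_mem hζ hζk hk le_rfl hy
  rw [← hres.eq_zero_iff (sub_mem hx hy) ((nrm_sub_le (hk hx) (hk hy)).trans (max_le hx1 hy1)),
    hres.map_sub hk hx hy hx1 hy1, sub_eq_zero] at hxy
  rw [← hres.eq_zero_iff (sub_mem hXk hYk) ((nrm_sub_le (hk hXk) (hk hYk)).trans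
    (max_le hX.1 hY.1)), hres.map_sub hk hXk hYk hX.1 hY.1, hX.2, hY.2, hxy, sub_self]

/-- The Artin–Schreier map is not surjective on the residue field. -/
theorem exists_nrm_artinSchreier_sub_eq_one [FiniteDimensional ℚ_[p] k]
    (hζ : IsPrimitiveRoot ζ p) (hζk : ζ ∈ k) :
    ∃ a ∈ k, nrm p a = 1 ∧ ∀ x ∈ k, nrm p x ≤ 1 → nrm p (artinSchreier p ζ x - a) = 1 := by
  have hp : p.Prime := Fact.out
  obtain ⟨κ, _, _, res, hres⟩ := exists_residueMap k
  have hk := le_Qbar_of_finiteDimensional k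
  have hζ1 : ζ - 1 ≠ 0 := sub_ne_zero.2 (hζ.ne_one hp.one_lt)
  let φ : κ → κ := fun c =>
    ∏ ω ∈ Polynomial.nthRootsFinset p (1 : Ω), (c - res ((ω - 1) / (ζ - 1)))
  have hres0 : res 0 = 0 := (hres.eq_zero_iff (zero_mem k) (by simp [nrm_zero])).2
    (by simp [nrm_zero])
  have h0 : φ 0 = 0 := Finset.prod_eq_zero ((Polynomial.mem_nthRootsFinset hp.pos _).2
    (one_pow p)) (by rw [sub_self, zero_div, hres0, sub_zero])
  have h1 : φ 1 = 0 := Finset.prod_eq_zero ((Polynomial.mem_nthRootsFinset hp.pos _).2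
    hζ.pow_eq_one) (by rw [div_self hζ1, hres.map_one, sub_self])
  have hns : ¬ Function.Surjective φ := fun hs =>
    zero_ne_one ((Finite.injective_iff_surjective.2 hs) (h0.trans h1.symm))
  obtain ⟨a, ha⟩ := not_forall.1 hns
  obtain ⟨a', ha', ha1, rfl⟩ := hres.surj a
  have key : ∀ x ∈ k, nrm p x ≤ 1 → nrm p (artinSchreier p ζ x - a') = 1 := by
    intro x hx hx1
    have hX := hres.map_artinSchreier hk hζ hζk hx hx1
    have hXk := artinSchreier_mem hζ hζk hk le_rfl hx
    rw [← hres.ne_zero_iff (sub_mem hXk ha') ((nrm_sub_le (hk hXk) (hk ha')).trans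
      (max_le hX.1 ha1)), hres.map_sub hk hXk ha' hX.1 ha1, hX.2, sub_ne_zero]
    exact fun e => ha ⟨_, e⟩
  refine ⟨a', ha', (hres.ne_zero_iff ha' ha1).1 fun e => ha ⟨0, h0.trans e.symm⟩, key⟩

theorem nrm_le_one_of_artinSchreier (hζ : IsPrimitiveRoot ζ p) (hζk : ζ ∈ Qbar p Ω) {Z : Ω}
    (hZ : Z ∈ Qbar p Ω) (h : nrm p (artinSchreier p ζ Z) ≤ 1) : nrm p Z ≤ 1 := by
  have hp : p.Prime := Fact.out
  by_contra! hc
  have hr := fun ω hω => root_sub_one_div_mem (ω := ω) hζ hζk le_rfl hω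
  rw [artinSchreier, nrm_prod _ fun ω hω => sub_mem hZ (hr ω hω).1,
    Finset.prod_congr rfl (g := fun _ => nrm p Z), Finset.prod_const,
    hζ.card_nthRootsFinset] at h
  · exact absurd h (not_le.2 (one_lt_pow₀ hc hp.ne_zero))
  · intro ω hω
    refine nrm_eq_of_sub_lt (sub_mem hZ (hr ω hω).1) hZ ?_
    rw [sub_sub_cancel_left, nrm_neg _ (hr ω hω).1]
    exact (hr ω hω).2.trans_lt hc

/-- A nontrivial linear relation between `n + 1` elements of the span of `1, γ, …, γ ^ (n - 1)`. -/
theorem exists_linear_relation {n : ℕ} (hn : n ≠ 0) {γ : Ω} (hγ : γ ^ n ∈ k) (x : Fin (n + 1) → Ω)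
    (hx : ∀ j, x j ∈ k ⊔ IntermediateField.adjoin ℚ_[p] {γ}) :
    ∃ b : Fin (n + 1) → Ω, (∀ j, b j ∈ k) ∧ (∃ j, b j ≠ 0) ∧ ∑ j, b j * x j = 0 := by
  choose a ha hxa using fun j => exists_eq_sum_pow hn hγ (hx j)
  obtain ⟨f, hf, j, hj⟩ := Fintype.not_linearIndependent_iff.1 fun hli =>
    absurd (LinearIndependent.fintype_card_le_finrank (R := k)
      (b := fun j (i : Fin n) => (⟨a j i, ha j i⟩ : k)) hli) (by simp)
  refine ⟨fun j => f j, fun j => (f j).2, ⟨j, fun e => hj (Subtype.ext e)⟩, ?_⟩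
  simp only [hxa, Finset.mul_sum]
  rw [Finset.sum_comm]
  refine Finset.sum_eq_zero fun i hi => ?_
  have := congrArg (Subtype.val (p := (· ∈ k))) (congrFun hf ⟨i, Finset.mem_range.1 hi⟩)
  simp only [Finset.sum_apply, Pi.smul_apply, smul_eq_mul] at this
  rw [AddSubmonoidClass.coe_finsetSum] at this
  simp only [MulMemClass.coe_mul] at this
  simp only [← mul_assoc, ← Finset.sum_mul, this]
  simp

variable [IsAlgClosed Ω] {L : IntermediateField ℚ_[p] Ω}

/-- Adjoining a non-integral-residue Artin–Schreier root does not enlarge the value group. -/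
theorem Good.exists_nrm_eq_of_artinSchreier (h : Good k L) [FiniteDimensional ℚ_[p] k]
    (hζ : IsPrimitiveRoot ζ p)
    (hζk : ζ ∈ k) {a θ : Ω} (ha1 : nrm p a = 1)
    (ha : ∀ x ∈ k, nrm p x ≤ 1 → nrm p (artinSchreier p ζ x - a) = 1) (hθk : θ ^ p ∈ k)
    (hθ : artinSchreier p ζ ((θ - 1) / (ζ - 1)) = a) {e : Ω}
    (he : e ∈ k ⊔ IntermediateField.adjoin ℚ_[p] {θ}) (he0 : e ≠ 0) :
    ∃ d ∈ k, d ≠ 0 ∧ nrm p e = nrm p d := by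
  have hp : p.Prime := Fact.out
  have hkQ := h.le_Qbar
  have hθQ : θ ∈ Qbar p Ω := mem_Qbar_of_pow_mem hp.ne_zero (hkQ hθk)
  have hfin : FiniteDimensional ℚ_[p] ↥(k ⊔ IntermediateField.adjoin ℚ_[p] {θ}) := by
    have : FiniteDimensional ℚ_[p] (IntermediateField.adjoin ℚ_[p] {θ}) :=
      IntermediateField.adjoin.finiteDimensional (mem_algebraicClosure_iff.1 hθQ).isIntegral
    exact IntermediateField.finiteDimensional_sup _ _
  have hQ := le_Qbar_of_finiteDimensional (k ⊔ IntermediateField.adjoin ℚ_[p] {θ})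
  have hkk : k ≤ k ⊔ IntermediateField.adjoin ℚ_[p] {θ} := le_sup_left
  have hζθ := hkk hζk
  have hΘ : (θ - 1) / (ζ - 1) ∈ k ⊔ IntermediateField.adjoin ℚ_[p] {θ} :=
    div_mem (sub_mem (le_sup_right (a := k) (IntermediateField.mem_adjoin_simple_self _ _))
      (one_mem _)) (sub_mem hζθ (one_mem _))
  have hΘ1 := nrm_le_one_of_artinSchreier hζ (hkQ hζk) (hQ hΘ) (hθ ▸ ha1.le)
  have hno : ∀ b ∈ k, nrm p b ≤ 1 → ¬ nrm p ((θ - 1) / (ζ - 1) - b) < 1 := by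
    intro b hb hb1 hlt
    have h1 := nrm_artinSchreier_sub_lt hζ hζθ hΘ (hkk hb) hΘ1 hb1 hlt
    rw [hθ, nrm_sub_comm (hθ ▸ artinSchreier_mem hζ hζk hkQ hkQ (hQ hΘ))
      (artinSchreier_mem hζ hζk hkQ hkQ (hkQ hb)), ha b hb hb1] at h1
    exact lt_irrefl _ h1
  have hΘe : nrm p ((θ - 1) / (ζ - 1)) = 1 := by
    refine le_antisymm hΘ1 (not_lt.1 fun hlt => hno 0 (zero_mem k) ?_ ?_)
    · rw [nrm_zero]; exact zero_le_one
    · rwa [sub_zero]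
  have hθnk : θ ∉ k := by
    intro hc
    refine hno _ (div_mem (sub_mem hc (one_mem _)) (sub_mem hζk (one_mem _))) hΘ1 ?_
    rw [sub_self, nrm_zero]
    exact one_pos
  obtain ⟨N, -, -, -, -, -, -, -, -, hNk, -, hN0, -, hNnrm⟩ := h.exists_norm hp hζ hζk hθk hθnk
  by_contra! hev
  have hpow : ∃ d ∈ k, d ≠ 0 ∧ nrm p e ^ p = nrm p d :=
    ⟨N e, hNk e he, hN0 e he0, (hNnrm e (hQ he)).symm⟩
  obtain ⟨b, hb, ⟨j, hj⟩, hsum⟩ := exists_linear_relation hp.ne_zero hθk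
    (Fin.snoc (fun i : Fin p => e ^ (i : ℕ)) ((θ - 1) / (ζ - 1))) (fun j => by
      refine Fin.lastCases ?_ (fun i => ?_) j
      · rw [Fin.snoc_last]; exact hΘ
      · rw [Fin.snoc_castSucc]; exact pow_mem he _)
  rw [Fin.sum_univ_castSucc] at hsum
  simp only [Fin.snoc_castSucc, Fin.snoc_last] at hsum
  -- rewrite the relation with coefficients indexed by naturals
  let c : ℕ → Ω := fun i => if hi : i < p then b (Fin.castSucc ⟨i, hi⟩) else 0
  have hc : ∀ i, c i ∈ k := fun i => by
    by_cases hi : i < p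
    · simp only [c, dif_pos hi]; exact hb _
    · simp only [c, dif_neg hi]; exact zero_mem _
  have hcs : ∑ i : Fin p, b i.castSucc * e ^ (i : ℕ) = ∑ i ∈ Finset.range p, c i * e ^ i := by
    rw [Finset.sum_range]
    exact Finset.sum_congr rfl fun i _ => by rw [show c i = b i.castSucc from dif_pos i.2]
  rw [hcs] at hsum
  have hbl : b (Fin.last p) ≠ 0 := by
    intro hbl
    rw [hbl, zero_mul, add_zero] at hsum
    have hex : ∃ i < p, c i ≠ 0 := by
      revert hj
      refine Fin.lastCases (fun h => absurd hbl h) (fun i hi => ⟨i, i.2, ?_⟩) j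
      rwa [show c i = b i.castSucc from dif_pos i.2]
    obtain ⟨i, -, -, hlt, -⟩ := exists_dominant hkQ hp (hQ he) he0 hpow hev hc hex
    rw [hsum, zero_sub, nrm_neg _ (mul_mem (hkQ (hc i)) (pow_mem (hQ he) _))] at hlt
    exact lt_irrefl _ hlt
  have hΘs : (θ - 1) / (ζ - 1) = ∑ i ∈ Finset.range p, (-c i / b (Fin.last p)) * e ^ i := by
    have : ∀ i, (-c i / b (Fin.last p)) * e ^ i = (-1 / b (Fin.last p)) * (c i * e ^ i) :=
      fun i => by ring
    simp only [this, ← Finset.mul_sum]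
    rw [eq_neg_of_add_eq_zero_left hsum]
    field_simp
  have hd : ∀ i, -c i / b (Fin.last p) ∈ k := fun i => div_mem (neg_mem (hc i)) (hb _)
  obtain ⟨i, hi, hdi, hlt, -⟩ := exists_dominant hkQ hp (hQ he) he0 hpow hev hd (by
    by_contra! hcon
    rw [hΘs, Finset.sum_eq_zero fun i hi => by rw [hcon i (Finset.mem_range.1 hi), zero_mul],
      nrm_zero] at hΘe
    exact zero_ne_one hΘe)
  rw [← hΘs] at hlt
  have hdQ : -c i / b (Fin.last p) * e ^ i ∈ Qbar p Ω := mul_mem (hkQ (hd i)) (pow_mem (hQ he) _)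
  have heq := nrm_eq_of_sub_lt (hQ hΘ) hdQ hlt
  rw [hΘe] at heq
  rcases Nat.eq_zero_or_pos i with rfl | hi0
  · rw [← heq, pow_zero, mul_one] at hlt
    rw [pow_zero, mul_one] at heq
    exact hno _ (hd 0) heq.ge hlt
  · obtain ⟨d, hdk, hd0, hde⟩ := exists_nrm_eq_pow hkQ hp (hQ he) he0 hpow hi0 hi
      (inv_mem (hd i)) (inv_ne_zero hdi) (by
        rw [nrm_mul (hkQ (hd i)) (pow_mem (hQ he) _), nrm_pow (hQ he)] at heq
        rw [nrm_inv (hkQ (hd i)), inv_eq_of_mul_eq_one_right heq.symm])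
    exact hev d hdk hd0 hde

/-- Shifted Artin–Schreier values are units of `k` times `p`-th powers. -/
theorem Good.exists_artinSchreier_sub_mem (h : Good k L) [FiniteDimensional ℚ_[p] k]
    (hζ : IsPrimitiveRoot ζ p) (hζk : ζ ∈ k) :
    ∃ a ∈ k, nrm p a = 1 ∧ ∀ Z ∈ L, artinSchreier p ζ Z - a ∈ unitPowSet k L p := by
  have hp : p.Prime := Fact.out
  have hkQ := h.le_Qbar
  have hζ1 : ζ - 1 ≠ 0 := sub_ne_zero.2 (hζ.ne_one hp.one_lt)
  obtain ⟨a, hak, ha1, ha⟩ := exists_nrm_artinSchreier_sub_eq_one hζ hζk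
  refine ⟨a, hak, ha1, fun Z hZ => ?_⟩
  obtain ⟨θ, hθ⟩ := IsAlgClosed.exists_pow_nat_eq (1 + (ζ - 1) ^ p * a) hp.pos
  have hθk : θ ^ p ∈ k := hθ ▸ add_mem (one_mem k)
    (mul_mem (pow_mem (sub_mem hζk (one_mem k)) p) hak)
  have hΘ : artinSchreier p ζ ((θ - 1) / (ζ - 1)) = a := by
    have := pow_mul_artinSchreier hζ ((θ - 1) / (ζ - 1))
    rw [mul_div_cancel₀ _ hζ1, add_sub_cancel, hθ, add_sub_cancel_left] at this
    exact mul_left_cancel₀ (pow_ne_zero _ hζ1) this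
  have hθQ : θ ∈ Qbar p Ω := mem_Qbar_of_pow_mem hp.ne_zero (hkQ hθk)
  have hθnk : θ ∉ k := by
    intro hc
    have hm : (θ - 1) / (ζ - 1) ∈ k :=
      div_mem (sub_mem hc (one_mem _)) (sub_mem hζk (one_mem _))
    have := ha _ hm (nrm_le_one_of_artinSchreier hζ (hkQ hζk) (hkQ hm) (hΘ ▸ ha1.le))
    rw [hΘ, sub_self, nrm_zero] at this
    exact zero_ne_one this
  obtain ⟨N, -, -, -, -, -, -, -, hNL, hNk, -, hN0, hNsub, hNnrm⟩ :=
    h.exists_norm hp hζ hζk hθk hθnk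
  have hadj : IntermediateField.adjoin ℚ_[p] {θ} ≤ Qbar p Ω :=
    IntermediateField.adjoin_simple_le_iff.2 hθQ
  have h' := h.extend (le_sup_left : k ≤ k ⊔ IntermediateField.adjoin ℚ_[p] {θ})
    (sup_le hkQ hadj)
  have hLL : L ⊔ (k ⊔ IntermediateField.adjoin ℚ_[p] {θ}) =
      L ⊔ IntermediateField.adjoin ℚ_[p] {θ} := by rw [← sup_assoc, sup_eq_left.2 h.le]
  rw [hLL] at h'
  have hζL := h.le hζk
  have hX : 1 + (ζ - 1) * Z ∈ L := add_mem (one_mem L) (mul_mem (sub_mem hζL (one_mem L)) hZ)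
  have hθL : θ ∈ L ⊔ IntermediateField.adjoin ℚ_[p] {θ} :=
    le_sup_right (a := L) (IntermediateField.mem_adjoin_simple_self _ _)
  have hne : 1 + (ζ - 1) * Z - θ ≠ 0 := fun e => hθnk (h.mem_k (sub_eq_zero.1 e ▸ hX) hθQ)
  obtain ⟨e, he, u, hu, he0, hu0, heu⟩ := h'.exists_eq_mul_pow
    (sub_mem (le_sup_left (a := L) hX) hθL) hne hp.ne_zero
  obtain ⟨d, hd, hd0, hde⟩ := h.exists_nrm_eq_of_artinSchreier hζ hζk ha1 ha hθk hΘ he he0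
  have hNe : N (1 + (ζ - 1) * Z - θ) = (ζ - 1) ^ p * (artinSchreier p ζ Z - a) := by
    have := hNsub _ hX 1 (one_mem L)
    rw [mul_one, hθ] at this
    rw [this, mul_sub, pow_mul_artinSchreier hζ]
    ring
  refine ⟨N e / d ^ p, div_mem (hNk e he) (pow_mem hd _), d * N u / (ζ - 1),
    div_mem (mul_mem (h.le hd) (hNL u hu)) (sub_mem hζL (one_mem L)),
    div_ne_zero (mul_ne_zero hd0 (hN0 u hu0)) hζ1, ?_, ?_⟩
  · rw [nrm_div (hkQ (hNk e he)) (pow_mem (hkQ hd) _), hNnrm e (h'.le_Qbar he), hde,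
      nrm_pow (hkQ hd), div_self (pow_ne_zero _ (nrm_pos (hkQ hd) hd0).ne')]
  · rw [heu, map_mul, map_pow] at hNe
    refine mul_left_cancel₀ (pow_ne_zero p hζ1) (Eq.trans ?_ hNe)
    rw [div_pow, mul_pow]
    field_simp
end ArtinSchreier

theorem valuation_prod_sub_le {R ι Γ : Type*} [CommRing R] [LinearOrderedCommGroupWithZero Γ]
    (v : Valuation R Γ) (s : Finset ι) (r : ι → R) (hr : ∀ i ∈ s, v (r i) ≤ 1) {Z : R}
    (hZ : v Z ≤ 1) :
    v (∏ i ∈ s, (Z - r i)) ≤ 1 ∧ v (∏ i ∈ s, (Z - r i) - ∏ i ∈ s, -r i) ≤ v Z := by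
  classical
  induction s using Finset.induction_on with
  | empty => simp
  | insert a s ha ih =>
    obtain ⟨h1, h2⟩ := ih fun i hi => hr i (Finset.mem_insert_of_mem hi)
    have hra := hr a (Finset.mem_insert_self _ _)
    have h3 : v (Z - r a) ≤ 1 := (v.map_sub _ _).trans (max_le hZ hra)
    rw [Finset.prod_insert ha, Finset.prod_insert ha]
    refine ⟨by rw [map_mul]; exact mul_le_one' h3 h1, ?_⟩
    have e : (Z - r a) * ∏ i ∈ s, (Z - r i) - -r a * ∏ i ∈ s, -r i =
      Z * ∏ i ∈ s, (Z - r i) - r a * (∏ i ∈ s, (Z - r i) - ∏ i ∈ s, -r i) := by ring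
    rw [e]
    refine (v.map_sub _ _).trans (max_le ?_ ?_)
    · rw [map_mul]; exact mul_le_of_le_one_right' h1
    · rw [map_mul]; exact (mul_le_of_le_one_left' hra).trans h2

section PHenselian
variable {p : ℕ} [Fact p.Prime] {Ω : Type*} [Field Ω] [Algebra ℚ_[p] Ω]
  {k L : IntermediateField ℚ_[p] Ω} {ζ : Ω} {W : ValuationSubring Ω}

/-- `W` restricts to the usual valuation of `k`, and its restriction to `L` is `p`-henselian. -/
structure IsPHenselian (k L : IntermediateField ℚ_[p] Ω) (ζ : Ω) (W : ValuationSubring Ω) :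
    Prop where
  good : Good k L
  finite : FiniteDimensional ℚ_[p] k
  root : IsPrimitiveRoot ζ p
  root_mem : ζ ∈ k
  val_unit : ∀ x ∈ k, nrm p x = 1 → W.valuation x = 1
  val_lt : ∀ x ∈ k, nrm p x < 1 → W.valuation x < 1
  exists_root : ∀ a ∈ L, W.valuation a < 1 → ∃ y ∈ L, y ^ p = 1 + (ζ - 1) ^ p * a

theorem IsPHenselian.val_le (h : IsPHenselian k L ζ W) {x : Ω} (hx : x ∈ k) (hx1 : nrm p x ≤ 1) :
    W.valuation x ≤ 1 :=
  hx1.lt_or_eq.elim (fun hl => (h.val_lt x hx hl).le) fun he => (h.val_unit x hx he).le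

theorem mul_mem_unitPowSet (hk : k ≤ Qbar p Ω) {n : ℕ} {x y : Ω} (hx : x ∈ unitPowSet k L n)
    (hy : y ∈ unitPowSet k L n) : x * y ∈ unitPowSet k L n := by
  obtain ⟨c, hc, l, hl, hl0, hc1, rfl⟩ := hx
  obtain ⟨c', hc', l', hl', hl0', hc1', rfl⟩ := hy
  exact ⟨c * c', mul_mem hc hc', l * l', mul_mem hl hl', mul_ne_zero hl0 hl0',
    by rw [nrm_mul (hk hc) (hk hc'), hc1, hc1', one_mul], by ring⟩

theorem inv_mem_unitPowSet (hk : k ≤ Qbar p Ω) {n : ℕ} {x : Ω} (hx : x ∈ unitPowSet k L n) :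
    x⁻¹ ∈ unitPowSet k L n := by
  obtain ⟨c, hc, l, hl, hl0, hc1, rfl⟩ := hx
  exact ⟨c⁻¹, inv_mem hc, l⁻¹, inv_mem hl, inv_ne_zero hl0,
    by rw [nrm_inv (hk hc), hc1, inv_one], by rw [mul_inv, inv_pow]⟩

theorem unit_mem_unitPowSet {n : ℕ} {x : Ω} (hx : x ∈ k) (hx1 : nrm p x = 1) :
    x ∈ unitPowSet k L n :=
  ⟨x, hx, 1, one_mem L, one_ne_zero, hx1, by simp⟩

theorem pow_mem_unitPowSet {n : ℕ} {l : Ω} (hl : l ∈ L) (hl0 : l ≠ 0) :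
    l ^ n ∈ unitPowSet k L n :=
  ⟨1, one_mem k, l, hl, hl0, nrm_one, one_mul _⟩

theorem nrm_root_sub_one_div (hζ : IsPrimitiveRoot ζ p) (hζk : ζ ∈ k) (hk : k ≤ Qbar p Ω) {ω : Ω}
    (hω : ω ∈ Polynomial.nthRootsFinset p (1 : Ω)) (hω1 : ω ≠ 1) :
    nrm p ((ω - 1) / (ζ - 1)) = 1 := by
  have hp : p.Prime := Fact.out
  have hωp := (Polynomial.mem_nthRootsFinset hp.pos _).1 hω
  have : NeZero p := ⟨hp.ne_zero⟩
  obtain ⟨j, -, hj⟩ := hζ.eq_pow_of_pow_eq_one hωp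
  have hωk : ω ∈ k := hj ▸ pow_mem hζk j
  have hprim : IsPrimitiveRoot ω p := by
    have := IsPrimitiveRoot.orderOf ω
    rwa [(orderOf_eq_prime hωp hω1)] at this
  refine le_antisymm (root_sub_one_div_mem hζ hζk hk hω).2 ?_
  have h1 := (root_sub_one_div_mem hprim hωk hk
    ((Polynomial.mem_nthRootsFinset hp.pos _).2 hζ.pow_eq_one)).2
  have hdk : (ω - 1) / (ζ - 1) ∈ k :=
    div_mem (sub_mem hωk (one_mem _)) (sub_mem hζk (one_mem _))
  have hd0 : (ω - 1) / (ζ - 1) ≠ 0 :=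
    div_ne_zero (sub_ne_zero.2 hω1) (sub_ne_zero.2 (hζ.ne_one hp.one_lt))
  rw [← inv_div, nrm_inv (hk hdk)] at h1
  exact (inv_le_one₀ (nrm_pos (hk hdk) hd0)).1 h1

variable [IsAlgClosed Ω]

theorem IsPHenselian.exists_quadratic (h : IsPHenselian k L ζ W) {x : Ω} (hx : x ∈ L)
    (hx1 : W.valuation x < 1) : ∃ t ∈ unitPowSet k L p, ∃ x' ∈ L,
      W.valuation x' ≤ W.valuation x ^ 2 ∧ 1 + x = t * (1 + x') := by
  classical
  have hp : p.Prime := Fact.out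
  have := h.finite
  have hkQ := h.good.le_Qbar
  obtain ⟨a, hak, ha1, ha⟩ := h.good.exists_artinSchreier_sub_mem h.root h.root_mem
  have ha0 := ne_zero_of_nrm_eq_one ha1
  have hr := fun ω hω => root_sub_one_div_mem (ω := ω) h.root h.root_mem hkQ hω
  let s := (Polynomial.nthRootsFinset p (1 : Ω)).erase 1
  have hs : ∀ ω ∈ s, (ω - 1) / (ζ - 1) ∈ k ∧ nrm p ((ω - 1) / (ζ - 1)) = 1 := fun ω hω =>
    ⟨(hr ω (Finset.mem_of_mem_erase hω)).1, nrm_root_sub_one_div h.root h.root_mem hkQ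
      (Finset.mem_of_mem_erase hω) (Finset.ne_of_mem_erase hω)⟩
  have hck : ∏ ω ∈ s, -((ω - 1) / (ζ - 1)) ∈ k := prod_mem fun ω hω => neg_mem (hs ω hω).1
  have hc1 : nrm p (∏ ω ∈ s, -((ω - 1) / (ζ - 1))) = 1 := by
    rw [nrm_prod _ fun ω hω => neg_mem (hkQ (hs ω hω).1)]
    exact Finset.prod_eq_one fun ω hω => by rw [nrm_neg _ (hkQ (hs ω hω).1), (hs ω hω).2]
  have hG := fun Z hZ => valuation_prod_sub_le W.valuation s (fun ω => (ω - 1) / (ζ - 1))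
    (fun ω hω => (h.val_unit _ (hs ω hω).1 (hs ω hω).2).le) (Z := Z) hZ
  have hAS : ∀ Z, artinSchreier p ζ Z = Z * ∏ ω ∈ s, (Z - (ω - 1) / (ζ - 1)) := fun Z => by
    rw [artinSchreier, ← Finset.mul_prod_erase _ _
      ((Polynomial.mem_nthRootsFinset hp.pos (1 : Ω)).2 (one_pow p)), sub_self, zero_div, sub_zero]
  have hGL : ∀ Z ∈ L, ∏ ω ∈ s, (Z - (ω - 1) / (ζ - 1)) ∈ L := fun Z hZ =>
    prod_mem fun ω hω => sub_mem hZ (h.good.le (hs ω hω).1)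
  generalize ∏ ω ∈ s, -((ω - 1) / (ζ - 1)) = c at *
  have hc0 := ne_zero_of_nrm_eq_one hc1
  have hαk : -a / c ∈ k := div_mem (neg_mem hak) hck
  have hα1 : nrm p (-a / c) = 1 := by
    rw [nrm_div (neg_mem (hkQ hak)) (hkQ hck), nrm_neg _ (hkQ hak), ha1, hc1, div_one]
  have hvZ : W.valuation (-a / c * x) = W.valuation x := by
    rw [map_mul, h.val_unit _ hαk hα1, one_mul]
  have hZL : -a / c * x ∈ L := mul_mem (h.good.le hαk) hx
  have hT := ha _ hZL
  obtain ⟨-, hG2⟩ := hG (-a / c * x) (hvZ ▸ hx1.le)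
  have hgL := hGL _ hZL
  rw [hAS] at hT
  generalize ∏ ω ∈ s, (-a / c * x - (ω - 1) / (ζ - 1)) = G at *
  rw [hvZ] at hG2
  have hgL' : (G - c) / c ∈ L := div_mem (sub_mem hgL (h.good.le hck)) (h.good.le hck)
  have hg1 : W.valuation ((G - c) / c) ≤ W.valuation x := by
    rwa [map_div₀, h.val_unit c hck hc1, div_one]
  have htT : 1 + x + x * ((G - c) / c) ∈ unitPowSet k L p := by
    have h1 : (-1 / a) ∈ unitPowSet k L p := unit_mem_unitPowSet
      (div_mem (neg_mem (one_mem k)) hak) (by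
        rw [nrm_div (neg_mem (one_mem _)) (hkQ hak), nrm_neg _ (one_mem _), nrm_one, ha1, div_one])
    have h2 := mul_mem_unitPowSet hkQ h1 hT
    convert h2 using 1
    field_simp
    ring
  have hsmall : W.valuation (x + x * ((G - c) / c)) < 1 := by
    refine W.valuation.map_add_lt hx1 ?_
    rw [map_mul]
    exact mul_lt_one_of_lt_of_le hx1 (hg1.trans hx1.le)
  have ht1 : W.valuation (1 + x + x * ((G - c) / c)) = 1 := by
    rw [add_assoc]
    exact W.valuation.map_one_add_of_lt hsmall
  have ht0 : 1 + x + x * ((G - c) / c) ≠ 0 := by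
    intro e
    rw [e, map_zero] at ht1
    exact zero_ne_one ht1
  refine ⟨_, htT, -(x * ((G - c) / c)) / (1 + x + x * ((G - c) / c)), div_mem (neg_mem (mul_mem hx
    hgL')) (add_mem (add_mem (one_mem L) hx) (mul_mem hx hgL')), ?_, ?_⟩
  · rw [map_div₀, ht1, div_one, Valuation.map_neg, map_mul, sq]
    exact mul_le_mul_right hg1 _
  · generalize (G - c) / c = g at *
    field_simp
    ring

theorem IsPHenselian.one_add_mem (h : IsPHenselian k L ζ W) {x ϖ : Ω} (hx : x ∈ L)
    (hϖ : ϖ ∈ k) (hϖ0 : ϖ ≠ 0) (hϖ1 : nrm p ϖ < 1)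
    (huni : ∀ x ∈ k, x ≠ 0 → ∃ j : ℤ, nrm p x = nrm p ϖ ^ j) {N : ℕ}
    (hxN : W.valuation x ^ N ≤ W.valuation ϖ) : 1 + x ∈ unitPowSet k L p := by
  have hp : p.Prime := Fact.out
  have hkQ := h.good.le_Qbar
  have hv1 := h.val_lt ϖ hϖ hϖ1
  have hv0 : W.valuation ϖ ≠ 0 := by simpa using hϖ0
  have hζ1 : ζ - 1 ≠ 0 := sub_ne_zero.2 (h.root.ne_one hp.one_lt)
  have hx1 : W.valuation x < 1 := lt_of_not_ge fun hc =>
    absurd (hxN.trans_lt hv1) (not_lt.2 (one_le_pow₀ hc))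
  have hiter : ∀ n : ℕ, ∃ t ∈ unitPowSet k L p, ∃ x' ∈ L,
      W.valuation x' ≤ W.valuation x ^ (2 ^ n) ∧ 1 + x = t * (1 + x') := by
    intro n
    induction n with
    | zero => exact ⟨1, unit_mem_unitPowSet (one_mem k) nrm_one, x, hx, by simp, by simp⟩
    | succ n ih =>
      obtain ⟨t, ht, x', hx', hle, e⟩ := ih
      obtain ⟨t', ht', x'', hx'', hle', e'⟩ := h.exists_quadratic hx'
        (hle.trans_lt (pow_lt_one₀ zero_le hx1 (by positivity)))
      refine ⟨t * t', mul_mem_unitPowSet hkQ ht ht', x'', hx'', hle'.trans ?_, by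
        rw [e, e', mul_assoc]⟩
      rw [pow_succ 2, pow_mul]
      exact pow_le_pow_left₀ zero_le hle 2
  obtain ⟨M, hM⟩ : ∃ M : ℕ, W.valuation x ^ M < W.valuation ((ζ - 1) ^ p) := by
    have hlamk : (ζ - 1) ^ p ∈ k := pow_mem (sub_mem h.root_mem (one_mem k)) p
    have hlam0 : (ζ - 1) ^ p ≠ 0 := pow_ne_zero _ hζ1
    obtain ⟨j, hj⟩ := huni _ hlamk hlam0
    have hu := h.val_unit ((ζ - 1) ^ p / ϖ ^ j) (div_mem hlamk (zpow_mem hϖ j)) (by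
      rw [nrm_div (hkQ hlamk) (hkQ (zpow_mem hϖ j)), hj, nrm_zpow (hkQ hϖ), div_self]
      exact zpow_ne_zero _ (nrm_pos (hkQ hϖ) hϖ0).ne')
    rw [map_div₀, map_zpow₀, div_eq_one_iff_eq (zpow_ne_zero _ hv0)] at hu
    refine ⟨N * (j.toNat + 1), ?_⟩
    rw [hu, pow_mul]
    refine (pow_le_pow_left₀ zero_le hxN _).trans_lt ?_
    rw [← zpow_natCast]
    exact zpow_lt_zpow_right_of_lt_one₀ (zero_lt_iff.2 hv0) hv1 (by
      push_cast
      have := Int.self_le_toNat j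
      omega)
  obtain ⟨t, ht, x', hx', hle, e⟩ := hiter M
  rw [e]
  refine mul_mem_unitPowSet hkQ ht ?_
  have hlt : W.valuation x' < W.valuation ((ζ - 1) ^ p) :=
    (hle.trans (pow_le_pow_of_le_one zero_le hx1.le Nat.lt_two_pow_self.le)).trans_lt hM
  obtain ⟨y, hy, hye⟩ := h.exists_root (x' / (ζ - 1) ^ p) (div_mem hx' (pow_mem (sub_mem
    (h.good.le h.root_mem) (one_mem L)) p)) (by
      rw [map_div₀]
      exact (div_lt_one₀ (zero_le.trans_lt hlt)).2 hlt)
  rw [mul_div_cancel₀ _ (pow_ne_zero _ hζ1)] at hye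
  rw [← hye]
  refine pow_mem_unitPowSet hy ?_
  rintro rfl
  rw [zero_pow hp.ne_zero] at hye
  have h2 := W.valuation.map_one_add_of_lt (x := x') (hle.trans_lt
    (pow_lt_one₀ zero_le hx1 (by positivity)))
  rw [← hye, map_zero] at h2
  exact zero_ne_one h2
end PHenselian

section Coarsening
variable {Ω : Type*} [Field Ω]

/-- The coarsening of `W` in which the elements all of whose powers are bounded by `ϖ⁻¹` are
integral. -/
def coarsening (W : ValuationSubring Ω) {ϖ : Ω} (hϖ : W.valuation ϖ ≤ 1) : ValuationSubring Ω where
  carrier := {x | ∀ n : ℕ, W.valuation ϖ * W.valuation x ^ n ≤ 1}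
  mul_mem' := by
    intro x y hx hy n
    rcases le_total (W.valuation x) (W.valuation y) with hle | hle
    · rw [map_mul]
      refine le_trans ?_ (hy (2 * n))
      rw [mul_comm 2 n, pow_mul', sq]
      gcongr
    · rw [map_mul]
      refine le_trans ?_ (hx (2 * n))
      rw [mul_comm 2 n, pow_mul', sq]
      gcongr
  one_mem' n := by simpa using hϖ
  add_mem' := by
    intro x y hx hy n
    rcases le_total (W.valuation x) (W.valuation y) with hle | hle
    · refine le_trans ?_ (hy n)
      gcongr
      exact (W.valuation.map_add _ _).trans (max_le hle le_rfl)
    · refine le_trans ?_ (hx n)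
      gcongr
      exact (W.valuation.map_add _ _).trans (max_le le_rfl hle)
  zero_mem' n := by
    rcases n with - | n
    · simpa using hϖ
    · simp
  neg_mem' := by
    intro x hx n
    rw [Valuation.map_neg]
    exact hx n
  mem_or_inv_mem' x := by
    have key : ∀ y : Ω, W.valuation y ≤ 1 → ∀ n : ℕ, W.valuation ϖ * W.valuation y ^ n ≤ 1 :=
      fun y hy n => mul_le_one' hϖ (pow_le_one₀ zero_le hy)
    rcases le_total (W.valuation x) 1 with hx | hx
    · exact Or.inl (key x hx)
    · refine Or.inr (key x⁻¹ ?_)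
      rw [map_inv₀]
      exact inv_le_one_of_one_le₀ hx

variable {W : ValuationSubring Ω} {ϖ : Ω} (hϖ : W.valuation ϖ ≤ 1)

theorem mem_coarsening {x : Ω} :
    x ∈ coarsening W hϖ ↔ ∀ n : ℕ, W.valuation ϖ * W.valuation x ^ n ≤ 1 := Iff.rfl

theorem le_coarsening : W ≤ coarsening W hϖ := fun _ hx _ =>
  mul_le_one' hϖ (pow_le_one₀ zero_le ((W.valuation_le_one_iff _).2 hx))

theorem exists_pow_lt_of_coarsening {x : Ω} (hx0 : x ≠ 0)
    (hx : (coarsening W hϖ).valuation x < 1) : ∃ n : ℕ, W.valuation x ^ n < W.valuation ϖ := by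
  rw [valuation_lt_one_iff_inv_not_mem _ hx0, mem_coarsening] at hx
  push Not at hx
  obtain ⟨n, hn⟩ := hx
  refine ⟨n, ?_⟩
  rw [map_inv₀, inv_pow, ← div_eq_mul_inv] at hn
  exact (one_lt_div₀ (pow_pos (zero_lt_iff.2 (by simpa using hx0)) n)).1 hn

theorem coarsening_valuation_lt_one (hϖ1 : W.valuation ϖ < 1) :
    (coarsening W hϖ).valuation ϖ < 1 := by
  by_cases h0 : ϖ = 0
  · rw [(map_eq_zero _).2 h0]
    exact zero_lt_one
  rw [valuation_lt_one_iff_inv_not_mem _ h0, mem_coarsening]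
  intro h
  have h2 := h 2
  have hv : W.valuation ϖ ≠ 0 := by simpa using h0
  rw [map_inv₀, sq, ← mul_assoc, mul_inv_cancel₀ hv, one_mul] at h2
  exact absurd hϖ1 (not_lt.2 ((inv_le_one₀ (zero_lt_iff.2 hv)).1 h2))

theorem valuation_eq_one_iff_inv_mem {U : ValuationSubring Ω} {x : Ω} (hx : x ≠ 0) :
    U.valuation x = 1 ↔ x ∈ U ∧ x⁻¹ ∈ U := by
  have h0 : U.valuation x ≠ 0 := by simpa using hx
  rw [← U.valuation_le_one_iff, ← U.valuation_le_one_iff, map_inv₀,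
    inv_le_one₀ (zero_lt_iff.2 h0)]
  exact ⟨fun h => ⟨h.le, h.ge⟩, fun h => le_antisymm h.1 h.2⟩

/-- The localization of `W` obtained by inverting `a`. -/
def awayRing (W : ValuationSubring Ω) (a : W) : ValuationSubring Ω where
  carrier := {x | ∃ n : ℕ, (a : Ω) ^ n * x ∈ W}
  mul_mem' := by
    rintro x y ⟨n, hn⟩ ⟨m, hm⟩
    refine ⟨n + m, ?_⟩
    have := mul_mem hn hm
    rwa [mul_mul_mul_comm, ← pow_add] at this
  one_mem' := ⟨0, by simp⟩
  add_mem' := by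
    rintro x y ⟨n, hn⟩ ⟨m, hm⟩
    refine ⟨n + m, ?_⟩
    have h1 := mul_mem (pow_mem a.2 m) hn
    have h2 := mul_mem (pow_mem a.2 n) hm
    have := add_mem h1 h2
    convert this using 1
    ring
  zero_mem' := ⟨0, by simp⟩
  neg_mem' := by
    rintro x ⟨n, hn⟩
    exact ⟨n, by rw [mul_neg]; exact neg_mem hn⟩
  mem_or_inv_mem' x := (W.mem_or_inv_mem x).imp (fun h => ⟨0, by simpa using h⟩)
    fun h => ⟨0, by simpa using h⟩

theorem mem_awayRing {W : ValuationSubring Ω} {a : W} {x : Ω} :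
    x ∈ awayRing W a ↔ ∃ n : ℕ, (a : Ω) ^ n * x ∈ W := Iff.rfl

end Coarsening

section Frobenius
variable {p : ℕ} [Fact p.Prime] {Ω : Type*} [Field Ω]

theorem valuation_add_pow_sub_le (U : ValuationSubring Ω) {x y : Ω} (hx : x ∈ U) (hy : y ∈ U) :
    U.valuation ((x + y) ^ p - (x ^ p + y ^ p)) ≤ U.valuation (p * x * y) := by
  obtain ⟨r, hr⟩ := exists_add_pow_prime_eq (Fact.out : p.Prime) (⟨x, hx⟩ : U) ⟨y, hy⟩
  have := congrArg (Subtype.val (p := (· ∈ U))) hr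
  push_cast at this
  rw [this, add_sub_cancel_left, map_mul _ _ (r : Ω)]
  exact mul_le_of_le_one_right' (U.valuation_le_one r)

theorem valuation_sub_lt_one_of_pow {U : ValuationSubring Ω} (hp : U.valuation (p : Ω) < 1)
    {x y : Ω} (hx : x ∈ U) (hy : y ∈ U) :
    U.valuation (x ^ p - y ^ p) < 1 ↔ U.valuation (x - y) < 1 := by
  have hpp : p.Prime := Fact.out
  have h0 : U.valuation (p * (x - y) * y) < 1 := by
    rw [map_mul, map_mul]
    exact mul_lt_one_of_lt_of_le (mul_lt_one_of_lt_of_le hp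
      ((U.valuation_le_one_iff _).2 (sub_mem hx hy))) ((U.valuation_le_one_iff _).2 hy)
  have h1 := (valuation_add_pow_sub_le (p := p) U (sub_mem hx hy) hy).trans_lt h0
  rw [sub_add_cancel] at h1
  constructor
  · intro h
    have h2 := U.valuation.map_sub_lt h h1
    rw [show x ^ p - y ^ p - (x ^ p - ((x - y) ^ p + y ^ p)) = (x - y) ^ p by ring, map_pow] at h2
    exact (pow_lt_one_iff hpp.ne_zero).1 h2
  · intro h
    have h2 := U.valuation.map_add_lt h1 (x := x ^ p - ((x - y) ^ p + y ^ p)) (y := (x - y) ^ p)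
      (by rw [map_pow]; exact pow_lt_one₀ zero_le h hpp.ne_zero)
    rwa [show x ^ p - ((x - y) ^ p + y ^ p) + (x - y) ^ p = x ^ p - y ^ p by ring] at h2

end Frobenius

section PRigid
variable {p : ℕ} [Fact p.Prime] {Ω : Type*} [Field Ω] [Algebra ℚ_[p] Ω]
  {k L : IntermediateField ℚ_[p] Ω} {ζ ϖ : Ω} {U W : ValuationSubring Ω}

/-- `U` restricts to the usual valuation of `k`, and the principal units of `L` are products of
units of `k` and `p`-th powers. -/
structure IsPRigid (k L : IntermediateField ℚ_[p] Ω) (U : ValuationSubring Ω) : Prop where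
  good : Good k L
  finite : FiniteDimensional ℚ_[p] k
  val_unit : ∀ x ∈ k, nrm p x = 1 → U.valuation x = 1
  val_lt : ∀ x ∈ k, nrm p x < 1 → U.valuation x < 1
  one_add_mem : ∀ x ∈ L, U.valuation x < 1 → 1 + x ∈ unitPowSet k L p

/-- `ϖ` is a uniformizer of `k`. -/
structure IsUnif (k : IntermediateField ℚ_[p] Ω) (ϖ : Ω) : Prop where
  mem : ϖ ∈ k
  ne_zero : ϖ ≠ 0
  lt_one : nrm p ϖ < 1
  exists_zpow : ∀ x ∈ k, x ≠ 0 → ∃ j : ℤ, nrm p x = nrm p ϖ ^ j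

theorem IsUnif.exists_eq_mul (hϖ : IsUnif k ϖ) (hk : k ≤ Qbar p Ω) {x : Ω} (hx : x ∈ k)
    (hx1 : nrm p x < 1) : ∃ c ∈ k, nrm p c ≤ 1 ∧ x = ϖ * c := by
  refine ⟨x / ϖ, div_mem hx hϖ.mem, ?_, (mul_div_cancel₀ x hϖ.ne_zero).symm⟩
  rcases eq_or_ne x 0 with rfl | hx0
  · simp [nrm_zero]
  have hpos := nrm_pos (hk hϖ.mem) hϖ.ne_zero
  obtain ⟨j, hj⟩ := hϖ.exists_zpow x hx hx0
  rw [nrm_div (hk hx) (hk hϖ.mem), hj]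
  refine (div_le_one hpos).2 ?_
  have hj1 : 1 ≤ j := by
    by_contra! h
    have : j ≤ 0 := by lia
    rw [hj] at hx1
    exact absurd hx1 (not_lt.2 (one_le_zpow_of_nonpos₀ hpos hϖ.lt_one.le this))
  calc nrm p ϖ ^ j ≤ nrm p ϖ ^ (1 : ℤ) := zpow_le_zpow_right_of_le_one₀ hpos hϖ.lt_one.le hj1
    _ = nrm p ϖ := zpow_one _

theorem exists_isUnif [FiniteDimensional ℚ_[p] k] : ∃ ϖ, IsUnif k ϖ := by
  obtain ⟨ϖ, h1, h2, h3, h4⟩ := exists_uniformizer k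
  exact ⟨ϖ, h1, h2, h3, h4⟩

namespace IsPRigid

theorem val_le (h : IsPRigid k L U) {x : Ω} (hx : x ∈ k) (hx1 : nrm p x ≤ 1) :
    U.valuation x ≤ 1 :=
  hx1.lt_or_eq.elim (fun hl => (h.val_lt x hx hl).le) fun he => (h.val_unit x hx he).le

theorem val_lt_iff (h : IsPRigid k L U) {x : Ω} (hx : x ∈ k) :
    U.valuation x < 1 ↔ nrm p x < 1 := by
  refine ⟨fun hw => ?_, h.val_lt x hx⟩
  by_contra! hn
  have hxQ := h.good.le_Qbar hx
  have hx0 : x ≠ 0 := by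
    rintro rfl
    rw [nrm_zero] at hn
    linarith
  have := h.val_le (inv_mem hx) (by rw [nrm_inv hxQ]; exact inv_le_one_of_one_le₀ hn)
  rw [map_inv₀] at this
  exact absurd hw (not_lt.2 ((inv_le_one₀ (zero_lt_iff.2 (by simpa using hx0))).1 this))

theorem val_prime_le (h : IsPRigid k L U) (hϖ : IsUnif k ϖ) :
    U.valuation (p : Ω) ≤ U.valuation ϖ := by
  obtain ⟨c, hc, hc1, e⟩ := hϖ.exists_eq_mul h.good.le_Qbar (natCast_mem k p) nrm_p_lt_one
  rw [e, map_mul]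
  exact mul_le_of_le_one_right' (h.val_le hc hc1)

theorem val_prime_lt (h : IsPRigid k L U) : U.valuation (p : Ω) < 1 :=
  h.val_lt _ (natCast_mem k p) nrm_p_lt_one

theorem mem_of_val_sub_lt (h : IsPRigid k L U) {x y : Ω} (hx : x ∈ L) (hy : y ∈ L)
    (hyT : y ∈ unitPowSet k L p) (hxy : U.valuation (x - y) < U.valuation x) :
    x ∈ unitPowSet k L p := by
  have hxv : U.valuation y = U.valuation x := by
    have := U.valuation.map_sub_eq_of_lt_left hxy
    rwa [sub_sub_cancel] at this
  have hx0 : 0 < U.valuation x := zero_le.trans_lt hxy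
  have hy0 : y ≠ 0 := by
    rintro rfl
    rw [map_zero] at hxv
    exact hx0.ne hxv
  have hm := mul_mem_unitPowSet h.good.le_Qbar hyT (h.one_add_mem ((x - y) / y)
    (div_mem (sub_mem hx hy) hy) (by rw [map_div₀, hxv]; exact (div_lt_one₀ hx0).2 hxy))
  rwa [mul_add, mul_one, mul_div_cancel₀ _ hy0, add_sub_cancel] at hm

theorem exists_pow_sub_lt (h : IsPRigid k L U) {c : Ω} (hc : c ∈ k) (hc1 : nrm p c ≤ 1) :
    ∃ b ∈ k, nrm p b ≤ 1 ∧ U.valuation (b ^ p - c) < 1 := by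
  have := h.finite
  have hk := h.good.le_Qbar
  obtain ⟨κ, _, _, res, hres⟩ := exists_residueMap k
  have hpow : ∀ {x : Ω}, x ∈ k → nrm p x ≤ 1 → x ^ p ∈ k ∧ nrm p (x ^ p) ≤ 1 := fun hx hx1 =>
    ⟨pow_mem hx p, by rw [nrm_pow (hk hx)]; exact pow_le_one₀ (nrm_nonneg _) hx1⟩
  have hsub : ∀ {x y : Ω}, x ∈ k → y ∈ k → nrm p x ≤ 1 → nrm p y ≤ 1 →
      (res x = res y ↔ U.valuation (x - y) < 1) := fun {x y} hx hy hx1 hy1 => by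
    rw [h.val_lt_iff (sub_mem hx hy), ← hres.eq_zero_iff (sub_mem hx hy)
      ((nrm_sub_le (hk hx) (hk hy)).trans (max_le hx1 hy1)), hres.map_sub hk hx hy hx1 hy1,
      sub_eq_zero]
  have hinj : Function.Injective fun a : κ => a ^ p := fun a b hab => by
    obtain ⟨x, hx, hx1, rfl⟩ := hres.surj a
    obtain ⟨y, hy, hy1, rfl⟩ := hres.surj b
    simp only at hab
    rw [← hres.map_pow hk hx hx1, ← hres.map_pow hk hy hy1,
      hsub (hpow hx hx1).1 (hpow hy hy1).1 (hpow hx hx1).2 (hpow hy hy1).2,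
      valuation_sub_lt_one_of_pow h.val_prime_lt
        ((U.valuation_le_one_iff _).1 (h.val_le hx hx1))
        ((U.valuation_le_one_iff _).1 (h.val_le hy hy1))] at hab
    exact (hsub hx hy hx1 hy1).2 hab
  obtain ⟨a, ha⟩ := Finite.injective_iff_surjective.1 hinj (res c)
  obtain ⟨b, hb, hb1, rfl⟩ := hres.surj a
  refine ⟨b, hb, hb1, (hsub (hpow hb hb1).1 hc (hpow hb hb1).2 hc1).1 ?_⟩
  rw [hres.map_pow hk hb hb1]
  exact ha

theorem exists_one_add_eq (h : IsPRigid k L U) (hϖ : IsUnif k ϖ) {x : Ω} (hx : x ∈ L)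
    (hx1 : U.valuation x < 1) : ∃ c ∈ k, nrm p c ≤ 1 ∧ ∃ z ∈ L, U.valuation z < 1 ∧
      1 + x = (1 + ϖ * c) * (1 + z) ^ p := by
  have hpp : p.Prime := Fact.out
  have hkQ := h.good.le_Qbar
  obtain ⟨c, hc, y, hy, hy0, hc1, e⟩ := h.one_add_mem x hx hx1
  have hc0 := ne_zero_of_nrm_eq_one hc1
  have hcv := h.val_unit c hc hc1
  obtain ⟨b, hb, hb1, hbc⟩ := h.exists_pow_sub_lt (inv_mem hc)
    (by rw [nrm_inv (hkQ hc), hc1, inv_one])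
  have h1 : U.valuation (y ^ p - c⁻¹) < 1 := by
    have : y ^ p - c⁻¹ = c⁻¹ * x := by
      field_simp
      linear_combination e
    rw [this, map_mul, map_inv₀, hcv, inv_one, one_mul]
    exact hx1
  have hyv : U.valuation y = 1 := by
    have h2 := U.valuation.map_one_add_of_lt hx1
    rw [← e, map_mul, hcv, one_mul, map_pow] at h2
    exact (pow_eq_one_iff.1 h2).resolve_right hpp.ne_zero
  have hbv : U.valuation b = 1 := by
    have h2 : U.valuation (c⁻¹ + (b ^ p - c⁻¹)) = U.valuation c⁻¹ :=
      U.valuation.map_add_eq_of_lt_left (by rw [map_inv₀, hcv, inv_one]; exact hbc)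
    rw [add_sub_cancel, map_inv₀, hcv, inv_one, map_pow] at h2
    exact (pow_eq_one_iff.1 h2).resolve_right hpp.ne_zero
  have hb0 : b ≠ 0 := by
    rintro rfl
    simp at hbv
  have hyb : U.valuation (y - b) < 1 := by
    rw [← valuation_sub_lt_one_of_pow h.val_prime_lt ((U.valuation_le_one_iff _).1 hyv.le)
      ((U.valuation_le_one_iff _).1 hbv.le)]
    have := U.valuation.map_sub_lt h1 hbc
    rwa [sub_sub_sub_cancel_right] at this
  have hcb : c * b ^ p - 1 ∈ k := sub_mem (mul_mem hc (pow_mem hb p)) (one_mem _)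
  obtain ⟨d, hd, hd1, hde⟩ := hϖ.exists_eq_mul hkQ hcb (by
    rw [← h.val_lt_iff hcb, show c * b ^ p - 1 = c * (b ^ p - c⁻¹) by field_simp, map_mul, hcv,
      one_mul]
    exact hbc)
  refine ⟨d, hd, hd1, (y - b) / b, div_mem (sub_mem hy (h.good.le hb)) (h.good.le hb), ?_, ?_⟩
  · rw [map_div₀, hbv, div_one]
    exact hyb
  · rw [← hde, add_sub_cancel, ← e, sub_div, div_self hb0, add_sub_cancel, div_pow]
    field_simp

theorem exists_sub_eq (h : IsPRigid k L U) (hϖ : IsUnif k ϖ) {x : Ω} (hx : x ∈ L)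
    (hx1 : U.valuation x < 1) : ∃ c ∈ k, nrm p c ≤ 1 ∧ ∃ z ∈ L, U.valuation z < 1 ∧
      U.valuation (x - ϖ * c - z ^ p) < U.valuation ϖ := by
  obtain ⟨c, hc, hc1, z, hz, hz1, e⟩ := h.exists_one_add_eq hϖ hx hx1
  refine ⟨c, hc, hc1, z, hz, hz1, ?_⟩
  have hϖv := h.val_lt ϖ hϖ.mem hϖ.lt_one
  have hϖ0 : 0 < U.valuation ϖ := zero_lt_iff.2 (by simpa using hϖ.ne_zero)
  have h1 := valuation_add_pow_sub_le (p := p) U (one_mem U) ((U.valuation_le_one_iff z).1 hz1.le)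
  rw [one_pow, mul_one, map_mul] at h1
  replace h1 : U.valuation ((1 + z) ^ p - (1 + z ^ p)) < U.valuation ϖ :=
    (h1.trans (mul_le_mul_left (h.val_prime_le hϖ) _)).trans_lt (mul_lt_of_lt_one_right hϖ0 hz1)
  have h2 : U.valuation (ϖ * c * ((1 + z) ^ p - 1)) < U.valuation ϖ := by
    rw [map_mul, map_mul, mul_assoc]
    refine mul_lt_of_lt_one_right hϖ0 ((mul_le_of_le_one_left' (h.val_le hc hc1)).trans_lt ?_)
    have h3 := U.valuation.map_add_lt (h1.trans hϖv) (y := z ^ p)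
      (by rw [map_pow]; exact pow_lt_one₀ zero_le hz1 (Fact.out : p.Prime).ne_zero)
    rwa [sub_add_eq_sub_sub, sub_add_cancel] at h3
  have h4 := U.valuation.map_add_lt h1 h2
  convert h4 using 2
  linear_combination e

variable [IsAlgClosed Ω]

theorem pow_ne_uniformizer (h : IsPRigid k L U) (hϖ : IsUnif k ϖ) {z : Ω} (hz : z ∈ L) :
    U.valuation (z ^ p) ≠ U.valuation ϖ := by
  intro hzϖ
  have hpp : p.Prime := Fact.out
  have hkQ := h.good.le_Qbar
  have hϖL := h.good.le hϖ.mem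
  have hϖ0 : U.valuation ϖ ≠ 0 := by simpa using hϖ.ne_zero
  have hz0 : z ≠ 0 := by
    rintro rfl
    rw [zero_pow hpp.ne_zero, map_zero] at hzϖ
    exact hϖ0 hzϖ.symm
  set g := z ^ p / ϖ with hg
  have hgL : g ∈ L := div_mem (pow_mem hz p) hϖL
  have hgv : U.valuation g = 1 := by rw [hg, map_div₀, hzϖ, div_self hϖ0]
  have hgU := (U.valuation_le_one_iff g).1 hgv.le
  suffices hgT : g ∈ unitPowSet k L p by
    refine h.good.uniformizer_not_mem hpp.one_lt hϖ.mem hϖ.ne_zero hϖ.lt_one hϖ.exists_zpow ?_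
    have := mul_mem_unitPowSet hkQ (pow_mem_unitPowSet (k := k) (n := p) hz hz0)
      (inv_mem_unitPowSet hkQ hgT)
    rwa [hg, inv_div, mul_div_cancel₀ _ (pow_ne_zero _ hz0)] at this
  obtain ⟨c, hc, hc1, y, hy, hy1, hcy⟩ := h.exists_sub_eq hϖ (mul_mem hϖL (pow_mem hgL p)) (by
    rw [map_mul, map_pow, hgv, one_pow, mul_one]
    exact h.val_lt ϖ hϖ.mem hϖ.lt_one)
  obtain ⟨b, hb, hb1, hbc⟩ := h.exists_pow_sub_lt hc hc1
  have hbU := (U.valuation_le_one_iff b).1 (h.val_le hb hb1)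
  set t := y / z with ht
  have htL : t ∈ L := div_mem hy hz
  have h1 : U.valuation (g ^ p - c - g * t ^ p) < 1 := by
    have : ϖ * g ^ p - ϖ * c - y ^ p = ϖ * (g ^ p - c - g * t ^ p) := by
      have hϖn := hϖ.ne_zero
      rw [show y = t * z by rw [ht, div_mul_cancel₀ _ hz0]]
      rw [mul_pow, show z ^ p = g * ϖ by rw [hg, div_mul_cancel₀ _ hϖn]]
      ring
    rw [this, map_mul] at hcy
    exact (mul_lt_iff_lt_one_right (zero_lt_iff.2 hϖ0)).1 hcy
  have h2 : U.valuation ((g - b) ^ p - g * t ^ p) < 1 := by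
    have h3 : U.valuation (p * (g - b) * b) < 1 := by
      rw [map_mul, map_mul, mul_assoc]
      exact mul_lt_one_of_lt_of_le h.val_prime_lt (mul_le_one'
        ((U.valuation_le_one_iff _).2 (sub_mem hgU hbU)) ((U.valuation_le_one_iff _).2 hbU))
    have h4 := (valuation_add_pow_sub_le (p := p) U (sub_mem hgU hbU) hbU).trans_lt h3
    rw [sub_add_cancel] at h4
    have h5 := U.valuation.map_sub_lt (U.valuation.map_sub_lt h1 h4) hbc
    convert h5 using 2
    ring
  have htv : U.valuation t ≤ 1 := by
    have h3 : U.valuation (g * t ^ p) ≤ 1 := by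
      rw [U.valuation_le_one_iff]
      have := sub_mem (pow_mem (sub_mem hgU hbU) p) ((U.valuation_le_one_iff _).1 h2.le)
      rwa [sub_sub_cancel] at this
    rw [map_mul, hgv, one_mul, map_pow] at h3
    exact (pow_le_one_iff hpp.ne_zero).1 h3
  rcases htv.lt_or_eq with htv | htv
  · have h3 : U.valuation (g * t ^ p) < 1 := by
      rw [map_mul, hgv, one_mul, map_pow]
      exact pow_lt_one₀ zero_le htv hpp.ne_zero
    have h4 := U.valuation.map_add_lt h2 h3
    rw [sub_add_cancel, map_pow] at h4
    have h5 := (pow_lt_one_iff hpp.ne_zero).1 h4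
    have hbv : U.valuation b = 1 := by
      rw [← hgv, ← U.valuation.map_sub_eq_of_lt_left (h5.trans_eq hgv.symm), sub_sub_cancel]
    have hbn : nrm p b = 1 := hb1.lt_or_eq.resolve_left fun hlt =>
      (h.val_lt b hb hlt).ne hbv
    exact h.mem_of_val_sub_lt hgL (h.good.le hb) (unit_mem_unitPowSet hb hbn)
      (h5.trans_eq hgv.symm)
  · have ht0 : t ≠ 0 := by
      rintro h0
      rw [h0, map_zero] at htv
      exact zero_ne_one htv
    have hsL : (g - b) / t ∈ L := div_mem (sub_mem hgL (h.good.le hb)) htL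
    have h3 : U.valuation (g - ((g - b) / t) ^ p) < U.valuation g := by
      have : g - ((g - b) / t) ^ p = -((g - b) ^ p - g * t ^ p) / t ^ p := by
        rw [div_pow]
        field_simp
        ring
      rw [this, map_div₀, Valuation.map_neg, map_pow, htv, one_pow, div_one, hgv]
      exact h2
    have hs0 : (g - b) / t ≠ 0 := by
      intro h0
      rw [h0, zero_pow hpp.ne_zero, sub_zero] at h3
      exact lt_irrefl _ h3
    exact h.mem_of_val_sub_lt hgL (pow_mem hsL p) (pow_mem_unitPowSet hsL hs0) h3

theorem exists_val_sub_lt (h : IsPRigid k L U) (hϖ : IsUnif k ϖ) {u : Ω} (hu : u ∈ L)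
    (hu1 : U.valuation u ≤ 1) : ∃ c ∈ k, nrm p c ≤ 1 ∧ U.valuation (u - c) < 1 := by
  have hϖv := h.val_lt ϖ hϖ.mem hϖ.lt_one
  have hϖ0 : 0 < U.valuation ϖ := zero_lt_iff.2 (by simpa using hϖ.ne_zero)
  obtain ⟨c, hc, hc1, z, hz, hz1, hcz⟩ := h.exists_sub_eq hϖ (mul_mem (h.good.le hϖ.mem) hu) (by
    rw [map_mul]
    exact mul_lt_one_of_lt_of_le hϖv hu1)
  refine ⟨c, hc, hc1, ?_⟩
  by_contra! hn
  have h1 : U.valuation (ϖ * u - ϖ * c) = U.valuation ϖ := by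
    rw [← mul_sub, map_mul, le_antisymm ?_ hn, mul_one]
    exact (U.valuation.map_sub _ _).trans (max_le hu1 (h.val_le hc hc1))
  refine h.pow_ne_uniformizer hϖ hz ?_
  rw [← h1] at hcz ⊢
  rw [← U.valuation.map_sub_eq_of_lt_left hcz, sub_sub_cancel]

theorem val_le_uniformizer (h : IsPRigid k L U) (hϖ : IsUnif k ϖ) {x : Ω} (hx : x ∈ L)
    (hx1 : U.valuation x < 1) : U.valuation x ≤ U.valuation ϖ := by
  have hpp : p.Prime := Fact.out
  have hkQ := h.good.le_Qbar
  have hϖL := h.good.le hϖ.mem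
  have key : ∀ y ∈ L, U.valuation y < 1 → U.valuation ϖ < U.valuation y →
      y ∈ unitPowSet k L p := fun y hy hy1 hϖy => by
    obtain ⟨c, hc, hc1, z, hz, hz1, hcz⟩ := h.exists_sub_eq hϖ hy hy1
    have h1 : U.valuation (ϖ * c) < U.valuation y := by
      rw [map_mul]
      exact (mul_le_of_le_one_right' (h.val_le hc hc1)).trans_lt hϖy
    have h2 : U.valuation (y - z ^ p) < U.valuation y := by
      have := U.valuation.map_add_lt (hcz.trans hϖy) h1
      rwa [show y - ϖ * c - z ^ p + ϖ * c = y - z ^ p by ring] at this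
    refine h.mem_of_val_sub_lt hy (pow_mem hz p) (pow_mem_unitPowSet hz ?_) h2
    rintro rfl
    rw [zero_pow hpp.ne_zero, sub_zero] at h2
    exact lt_irrefl _ h2
  by_contra! hn
  have hxv : 0 < U.valuation x := zero_le.trans_lt hn
  have hx0 : x ≠ 0 := by
    rintro rfl
    simp at hxv
  refine h.good.uniformizer_not_mem hpp.one_lt hϖ.mem hϖ.ne_zero hϖ.lt_one hϖ.exists_zpow ?_
  rw [← mul_div_cancel₀ ϖ hx0]
  refine mul_mem_unitPowSet hkQ (key x hx hx1 hn) (key _ (div_mem hϖL hx) ?_ ?_)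
  · rw [map_div₀]
    exact (div_lt_one₀ hxv).2 hn
  · rw [map_div₀, lt_div_iff₀ hxv]
    exact mul_lt_of_lt_one_right (zero_lt_iff.2 (by simpa using hϖ.ne_zero)) hx1

theorem exists_limit (h : IsPRigid k L U) (hϖ : IsUnif k ϖ) {y : Ω} (hy : y ∈ L)
    (hy1 : U.valuation y ≤ 1) : ∃ c ∈ k, ∀ m, U.valuation (y - c) ≤ U.valuation ϖ ^ m := by
  have := h.finite
  have hkQ := h.good.le_Qbar
  have hϖL := h.good.le hϖ.mem
  have hϖ0 : U.valuation ϖ ≠ 0 := by simpa using hϖ.ne_zero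
  have step : ∀ u : {u : Ω // u ∈ L ∧ U.valuation u ≤ 1}, ∃ c : {c : Ω // c ∈ k ∧ nrm p c ≤ 1},
      ∃ v : {v : Ω // v ∈ L ∧ U.valuation v ≤ 1}, (u : Ω) = c + ϖ * v := fun ⟨u, hu, hu1⟩ => by
    obtain ⟨c, hc, hc1, hcu⟩ := h.exists_val_sub_lt hϖ hu hu1
    have hucL : u - c ∈ L := sub_mem hu (h.good.le hc)
    refine ⟨⟨c, hc, hc1⟩, ⟨(u - c) / ϖ, div_mem hucL hϖL, ?_⟩, ?_⟩
    · rw [map_div₀]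
      exact (div_le_one₀ (zero_lt_iff.2 hϖ0)).2 (h.val_le_uniformizer hϖ hucL hcu)
    · simp only
      rw [mul_div_cancel₀ _ hϖ.ne_zero, add_sub_cancel]
  choose d nxt hd using step
  let r : ℕ → {u : Ω // u ∈ L ∧ U.valuation u ≤ 1} := fun n => nxt^[n] ⟨y, hy, hy1⟩
  let c : ℕ → Ω := fun n => ∑ i ∈ Finset.range n, ϖ ^ i * d (r i)
  have hc : ∀ n, c n ∈ k := fun n =>
    sum_mem fun i _ => mul_mem (pow_mem hϖ.mem i) (d (r i)).2.1
  have hyc : ∀ n, y - c n = ϖ ^ n * r n := fun n => by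
    induction n with
    | zero => simp [c, r]
    | succ n ih =>
      have e := hd (r n)
      have e2 : r (n + 1) = nxt (r n) := Function.iterate_succ_apply' nxt n _
      rw [← e2] at e
      simp only [c] at ih ⊢
      rw [Finset.sum_range_succ, ← sub_sub, ih, e]
      ring
  obtain ⟨a, ha, hac⟩ := _root_.exists_limit k c hc hϖ.lt_one fun n => by
    have : c (n + 1) - c n = ϖ ^ n * d (r n) := by
      simp only [c]
      rw [Finset.sum_range_succ, add_sub_cancel_left]
    rw [this, nrm_mul (pow_mem (hkQ hϖ.mem) n) (hkQ (d (r n)).2.1), nrm_pow (hkQ hϖ.mem)]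
    exact mul_le_of_le_one_right (pow_nonneg (nrm_nonneg _) _) (d (r n)).2.2
  refine ⟨a, ha, fun m => ?_⟩
  have h1 : U.valuation (y - c m) ≤ U.valuation ϖ ^ m := by
    rw [hyc, map_mul, map_pow]
    exact mul_le_of_le_one_right' (r m).2.2
  have h2 : U.valuation (a - c m) ≤ U.valuation ϖ ^ m := by
    have hmem : (a - c m) / ϖ ^ m ∈ k := div_mem (sub_mem ha (hc m)) (pow_mem hϖ.mem m)
    have hϖm := pow_mem (hkQ hϖ.mem) m
    have := h.val_le hmem (by
      rw [nrm_div (sub_mem (hkQ ha) (hkQ (hc m))) hϖm, nrm_pow (hkQ hϖ.mem)]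
      exact (div_le_one (pow_pos (nrm_pos (hkQ hϖ.mem) hϖ.ne_zero) m)).2 (hac m))
    rw [map_div₀, map_pow] at this
    exact (div_le_one₀ (zero_lt_iff.2 (pow_ne_zero m hϖ0))).1 this
  have h3 := U.valuation.map_sub_le h1 h2
  rwa [sub_sub_sub_cancel_right] at h3

theorem exists_awayRing_val_sub_lt (h : IsPRigid k L U) (hWU : W ≤ U)
    (hkW : ∀ x ∈ k, nrm p x ≤ 1 → x ∈ W) : ∃ V : ValuationSubring Ω,
      (∀ x, x ∈ V ↔ ∃ n : ℕ, (p : Ω) ^ n * x ∈ W) ∧ (∀ x ∈ k, x ∈ V) ∧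
        ∀ x ∈ L, x ∈ V → ∃ c ∈ k, V.valuation (x - c) < 1 := by
  have := h.finite
  have hkQ := h.good.le_Qbar
  have hpk : (p : Ω) ∈ k := natCast_mem k p
  have hp0 : (p : Ω) ≠ 0 := fun h0 => by
    have := nrm_p_pos (p := p) (Ω := Ω)
    rw [h0, nrm_zero] at this
    exact lt_irrefl _ this
  have hpL := h.good.le hpk
  obtain ⟨ϖ, hϖ⟩ := exists_isUnif (k := k)
  refine ⟨awayRing W ⟨p, hkW _ hpk nrm_p_lt_one.le⟩, fun x => Iff.rfl, fun x hx => ?_,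
    fun x hx hxV => ?_⟩
  · rw [mem_awayRing]
    obtain ⟨n, hn⟩ := exists_pow_lt_of_lt_one (inv_pos.2 (zero_lt_one.trans_le
      (le_max_right (nrm p x) 1))) (nrm_p_lt_one (p := p) (Ω := Ω))
    refine ⟨n, hkW _ (mul_mem (pow_mem hpk n) hx) ?_⟩
    rw [nrm_mul (pow_mem (hkQ hpk) n) (hkQ hx), nrm_pow (hkQ hpk)]
    calc _ ≤ (max (nrm p x) 1)⁻¹ * max (nrm p x) 1 :=
          mul_le_mul hn.le (le_max_left _ _) (nrm_nonneg _) (by positivity)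
      _ = 1 := inv_mul_cancel₀ (by positivity)
  · obtain ⟨n, hn⟩ := mem_awayRing.1 hxV
    obtain ⟨c, hc, hcm⟩ := h.exists_limit hϖ (mul_mem (pow_mem hpL n) hx)
      ((U.valuation_le_one_iff _).2 (hWU hn))
    refine ⟨c / p ^ n, div_mem hc (pow_mem hpk n), ?_⟩
    by_cases h0 : x - c / p ^ n = 0
    · rw [h0, map_zero]
      exact zero_lt_one
    rw [valuation_lt_one_iff_inv_not_mem _ h0, mem_awayRing]
    rintro ⟨j, hj⟩
    have hj' := (U.valuation_le_one_iff _).2 (hWU hj)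
    rw [show x - c / (p : Ω) ^ n = ((p : Ω) ^ n * x - c) / (p : Ω) ^ n by field_simp, inv_div,
      mul_div_assoc', ← pow_add, map_div₀] at hj'
    have ht0 : (p : Ω) ^ n * x - c ≠ 0 := fun e => h0 (by
      rw [show x - c / (p : Ω) ^ n = ((p : Ω) ^ n * x - c) / (p : Ω) ^ n by field_simp, e,
        zero_div])
    rw [div_le_one₀ (zero_lt_iff.2 (by simpa using ht0))] at hj'
    obtain ⟨m, hm⟩ := exists_pow_lt_of_lt_one (pow_pos (nrm_p_pos (p := p) (Ω := Ω)) (j + n))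
      hϖ.lt_one
    have h1 := hj'.trans (hcm m)
    have hmem : ϖ ^ m / (p : Ω) ^ (j + n) ∈ k := div_mem (pow_mem hϖ.mem m) (pow_mem hpk _)
    have h2 := h.val_lt _ hmem (by
      rw [nrm_div (pow_mem (hkQ hϖ.mem) m) (pow_mem (hkQ hpk) _), nrm_pow (hkQ hϖ.mem),
        nrm_pow (hkQ hpk)]
      exact (div_lt_one (pow_pos nrm_p_pos _)).2 hm)
    rw [map_div₀, map_pow, div_lt_one₀ (zero_lt_iff.2 (by simp [hp0]))] at h2
    exact absurd h2 (not_lt.2 h1)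

end IsPRigid

theorem IsPHenselian.isPRigid [IsAlgClosed Ω] (h : IsPHenselian k L ζ W) (hϖ : IsUnif k ϖ) :
    IsPRigid k L (coarsening W (h.val_lt ϖ hϖ.mem hϖ.lt_one).le) where
  good := h.good
  finite := h.finite
  val_unit x hx hx1 := by
    have hm : ∀ y : Ω, W.valuation y = 1 → y ∈ coarsening W (h.val_lt ϖ hϖ.mem hϖ.lt_one).le :=
      fun y hy => le_coarsening _ ((W.valuation_le_one_iff y).1 hy.le)
    have hv := h.val_unit x hx hx1
    rw [valuation_eq_one_iff_inv_mem (ne_zero_of_nrm_eq_one hx1)]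
    exact ⟨hm x hv, hm _ (by rw [map_inv₀, hv, inv_one])⟩
  val_lt x hx hx1 := by
    have hϖv := h.val_lt ϖ hϖ.mem hϖ.lt_one
    obtain ⟨c, hc, hc1, rfl⟩ := hϖ.exists_eq_mul h.good.le_Qbar hx hx1
    rw [map_mul]
    exact mul_lt_one_of_lt_of_le (coarsening_valuation_lt_one _ hϖv)
      ((ValuationSubring.valuation_le_one_iff _ _).2
        (le_coarsening _ ((W.valuation_le_one_iff c).1 (h.val_le hc hc1))))
  one_add_mem x hx hx1 := by
    rcases eq_or_ne x 0 with rfl | hx0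
    · rw [add_zero]
      exact unit_mem_unitPowSet (one_mem k) nrm_one
    obtain ⟨N, hN⟩ := exists_pow_lt_of_coarsening _ hx0 hx1
    exact h.one_add_mem hx hϖ.mem hϖ.ne_zero hϖ.lt_one hϖ.exists_zpow hN.le

end PRigid

section Place
variable {p : ℕ} [Fact p.Prime] {Ω : Type*} [Field Ω] [Algebra ℚ_[p] Ω]
  {k L : IntermediateField ℚ_[p] Ω}

theorem Fixes.map_mem_sup_adjoin {F : IntermediateField ℚ_[p] Ω} {σ : Ω ≃ₐ[ℚ_[p]] Ω}
    (hσ : Fixes F σ) {η : Ω} (hη : σ η ∈ IntermediateField.adjoin ℚ_[p] {η}) {x : Ω}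
    (hx : x ∈ F ⊔ IntermediateField.adjoin ℚ_[p] {η}) :
    σ x ∈ F ⊔ IntermediateField.adjoin ℚ_[p] {η} := by
  have : F ⊔ IntermediateField.adjoin ℚ_[p] {η} ≤
      (F ⊔ IntermediateField.adjoin ℚ_[p] {η}).comap (σ : Ω →ₐ[ℚ_[p]] Ω) := by
    refine sup_le (fun y hy => ?_) (IntermediateField.adjoin_le_iff.2 ?_)
    · change σ y ∈ F ⊔ _
      rw [hσ y hy]
      exact le_sup_left (a := F) hy
    · rintro _ rfl
      exact le_sup_right (a := F) hη
  exact this hx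

theorem Fixes.map_mem_sup_adjoin_iff {F : IntermediateField ℚ_[p] Ω} {σ : Ω ≃ₐ[ℚ_[p]] Ω}
    (hσ : Fixes F σ) {η : Ω} {n : ℕ} (hη : IsPrimitiveRoot η n) (hn : n ≠ 0) (x : Ω) :
    σ x ∈ F ⊔ IntermediateField.adjoin ℚ_[p] {η} ↔
      x ∈ F ⊔ IntermediateField.adjoin ℚ_[p] {η} := by
  have : NeZero n := ⟨hn⟩
  have key : ∀ τ : Ω ≃ₐ[ℚ_[p]] Ω, τ η ∈ IntermediateField.adjoin ℚ_[p] {η} := fun τ => by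
    obtain ⟨i, -, hi⟩ := hη.eq_pow_of_pow_eq_one (ξ := τ η)
      (by rw [← map_pow, hη.pow_eq_one, map_one])
    rw [← hi]
    exact pow_mem (IntermediateField.mem_adjoin_simple_self _ η) i
  refine ⟨fun h => ?_, hσ.map_mem_sup_adjoin (key σ)⟩
  have := hσ.symm.map_mem_sup_adjoin (key σ.symm) h
  rwa [AlgEquiv.symm_apply_apply] at this

variable [IsAlgClosed Ω]

theorem exists_tameRoots (k : IntermediateField ℚ_[p] Ω) [FiniteDimensional ℚ_[p] k] :
    ∃ (η ζ : Ω) (n ℓ : ℕ), n ≠ 0 ∧ IsPrimitiveRoot η n ∧ IsPrimitiveRoot ζ p ∧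
      ζ ∈ k ⊔ IntermediateField.adjoin ℚ_[p] {η} ∧
      TameRoots (k ⊔ IntermediateField.adjoin ℚ_[p] {η}) ℓ := by
  have hp : p.Prime := Fact.out
  have := charZero_of_padic p Ω
  have hn : 12 * p ≠ 0 := mul_ne_zero (by norm_num) hp.ne_zero
  have : NeZero ((12 * p : ℕ) : Ω) := ⟨by exact_mod_cast hn⟩
  obtain ⟨η, hη⟩ := HasEnoughRootsOfUnity.exists_primitiveRoot Ω (12 * p)
  have hηk : ∀ i, η ^ i ∈ k ⊔ IntermediateField.adjoin ℚ_[p] {η} := fun i =>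
    pow_mem (le_sup_right (a := k) (IntermediateField.mem_adjoin_simple_self _ η)) i
  have hint : IsIntegral ℚ_[p] η := by
    refine ⟨Polynomial.X ^ (12 * p) - 1, Polynomial.monic_X_pow_sub_C 1 hn, ?_⟩
    simp [hη.pow_eq_one]
  have := IntermediateField.adjoin.finiteDimensional hint
  have hfin : FiniteDimensional ℚ_[p] ↥(k ⊔ IntermediateField.adjoin ℚ_[p] {η}) :=
    IntermediateField.finiteDimensional_sup _ _
  have hζ : IsPrimitiveRoot (η ^ 12) p := hη.pow (Nat.pos_of_ne_zero hn) rfl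
  rcases eq_or_ne p 2 with h2 | h2
  · refine ⟨η, η ^ 12, 12 * p, 3, hn, hη, hζ, hηk 12, hfin, Nat.prime_three, ?_,
      ⟨η ^ (4 * p), hηk _, hη.pow (Nat.pos_of_ne_zero hn) (by ring)⟩,
      ⟨-1, neg_mem (one_mem _), by norm_num⟩, Or.inr ⟨rfl, h2⟩⟩
    rw [h2]
    norm_num
  · refine ⟨η, η ^ 12, 12 * p, 2, hn, hη, hζ, hηk 12, hfin, Nat.prime_two,
      (Nat.coprime_primes hp Nat.prime_two).2 h2,
      ⟨η ^ (6 * p), hηk _, hη.pow (Nat.pos_of_ne_zero hn) (by ring)⟩,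
      ⟨η ^ (3 * p), hηk _, ?_⟩, Or.inl rfl⟩
    rw [← pow_mul]
    exact (hη.pow (Nat.pos_of_ne_zero hn)
      (show 12 * p = 3 * p * 2 * 2 by ring)).eq_neg_one_of_two_right

/-- The field `L` has a place with residue field `k`. -/
theorem Good.exists_place (h : Good k L) [FiniteDimensional ℚ_[p] k] :
    ∃ V : ValuationSubring Ω, (∀ x ∈ k, x ∈ V) ∧
      ∀ x ∈ L, x ∈ V → ∃ c ∈ k, V.valuation (x - c) < 1 := by
  obtain ⟨η, ζ, n, ℓ, hn, hη, hζ, hζk, ht⟩ := exists_tameRoots k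
  set k' := k ⊔ IntermediateField.adjoin ℚ_[p] {η} with hk'
  have := ht.finite
  have hkk' : k ≤ k' := le_sup_left
  have hG := h.extend hkk' (le_Qbar_of_finiteDimensional k')
  have hL' : L ⊔ k' = L ⊔ IntermediateField.adjoin ℚ_[p] {η} := by
    rw [hk', ← sup_assoc, sup_eq_left.2 h.le]
  obtain ⟨W, hW⟩ := hG.exists_valuationSubring ht
  have hP : IsPHenselian k' (L ⊔ k') ζ W :=
    ⟨hG, ht.finite, hζ, hζk, fun x hx => hG.valuation_unit ht hW hx,
      fun x hx => hG.valuation_lt_one ht hW hx,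
      fun a ha => hG.exists_root_of_valuation_lt ht hW hζ hζk ha⟩
  obtain ⟨ϖ, hϖ⟩ := exists_isUnif (k := k')
  obtain ⟨V, hV, hkV, hVc⟩ := (hP.isPRigid hϖ).exists_awayRing_val_sub_lt (le_coarsening _)
    fun x hx hx1 => (W.valuation_le_one_iff x).1 (hP.val_le hx hx1)
  refine ⟨V, fun x hx => hkV x (hkk' hx), fun x hx hxV => ?_⟩
  obtain ⟨c, hc, hxc⟩ := hVc x (le_sup_left (b := k') hx) hxV
  refine ⟨c, h.mem_k_of_fixed (hG.le_Qbar hc) fun σ hσ => ?_, hxc⟩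
  have hσk : ∀ y, σ y ∈ k' ↔ y ∈ k' := (hσ.mono h.le).map_mem_sup_adjoin_iff hη hn
  have hσL : ∀ y, σ y ∈ L ⊔ k' ↔ y ∈ L ⊔ k' := by
    rw [hL']
    exact hσ.map_mem_sup_adjoin_iff hη hn
  have hσV : ∀ y ∈ L ⊔ k', σ y ∈ V ↔ y ∈ V := fun y hy => by
    rw [hV, hV]
    refine exists_congr fun n => ?_
    have hpy : (p : Ω) ^ n * y ∈ L ⊔ k' := mul_mem (pow_mem (natCast_mem _ p) n) hy
    have e : σ ((p : Ω) ^ n * y) = (p : Ω) ^ n * σ y := by simp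
    rw [hW _ hpy, ← map_oSet_iff (L := L ⊔ k') hσL hσk, ← hW _ ((hσL _).2 hpy), e]
  have hxcσ : V.valuation (x - σ c) < 1 := by
    rcases eq_or_ne (x - c) 0 with h0 | h0
    · have : x - σ c = 0 := by
        rw [← hσ x hx, ← map_sub, h0, map_zero]
      rw [this, map_zero]
      exact zero_lt_one
    · have hmem : x - c ∈ L ⊔ k' := sub_mem (le_sup_left (b := k') hx) (hG.le hc)
      have e : x - σ c = σ (x - c) := by rw [map_sub, hσ x hx]
      rw [e, valuation_lt_one_iff_inv_not_mem V ((map_ne_zero σ).2 h0), ← map_inv₀,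
        hσV _ (inv_mem hmem), ← valuation_lt_one_iff_inv_not_mem V h0]
      exact hxc
  have h1 := V.valuation.map_sub_lt hxc hxcσ
  rw [sub_sub_sub_cancel_left] at h1
  by_contra hne
  rw [valuation_lt_one_iff_inv_not_mem V (sub_ne_zero.2 hne)] at h1
  exact h1 (hkV _ (inv_mem (sub_mem ((hσk c).2 hc) hc)))

end Place

section PlaceExtension
variable {p : ℕ} [Fact p.Prime] {Ω : Type*} [Field Ω] [Algebra ℚ_[p] Ω]

/-- `V` induces on `L` a `k`-rational place, where `k` and `L` have the same absolute Galois
group. -/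
structure IsPlace (k L : IntermediateField ℚ_[p] Ω) (V : ValuationSubring Ω) : Prop where
  good : Good k L
  mem : ∀ x ∈ k, x ∈ V
  exists_sub_lt : ∀ x ∈ L, x ∈ V → ∃ c ∈ k, V.valuation (x - c) < 1

theorem ValuationSubring.mem_of_isIntegral {F : Type*} [Field F] (V : ValuationSubring F) {x : F}
    (hx : IsIntegral V x) : x ∈ V := by
  obtain ⟨y, hy⟩ := IsIntegrallyClosed.isIntegral_iff.1 hx
  exact hy ▸ y.2

namespace IsPlace
variable {k L : IntermediateField ℚ_[p] Ω} {V : ValuationSubring Ω}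

theorem Qbar_mem (h : IsPlace k L V) {x : Ω} (hx : x ∈ Qbar p Ω) : x ∈ V := by
  apply V.mem_of_isIntegral
  have h1 : IsIntegral ℚ_[p] x := (mem_algebraicClosure_iff.1 hx).isIntegral
  obtain ⟨f, hf, hfx⟩ := h1
  let φ : ℚ_[p] →+* V := (algebraMap ℚ_[p] Ω).codRestrict V.toSubring
    fun a => h.mem _ (k.algebraMap_mem a)
  refine ⟨f.map φ, hf.map _, ?_⟩
  rw [Polynomial.eval₂_map]
  exact hfx

theorem valuation_Qbar (h : IsPlace k L V) {x : Ω} (hx : x ∈ Qbar p Ω) (h0 : x ≠ 0) :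
    V.valuation x = 1 :=
  (valuation_eq_one_iff_inv_mem h0).2 ⟨h.Qbar_mem hx, h.Qbar_mem (inv_mem hx)⟩

theorem eq_zero_of_valuation_lt_one (h : IsPlace k L V) {x : Ω} (hx : x ∈ Qbar p Ω)
    (h1 : V.valuation x < 1) : x = 0 := by
  by_contra h0
  exact h1.ne (h.valuation_Qbar hx h0)

theorem exists_integral_coeffs (h : IsPlace k L V) {ι : Type*} (s : Finset ι) (l e : ι → Ω)
    (hl : ∀ i ∈ s, l i ∈ L) (he : ∀ i ∈ s, e i ∈ Qbar p Ω) (hV : ∑ i ∈ s, l i * e i ∈ V) :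
    ∃ (t : Finset ι) (l' : ι → Ω), t ⊆ s ∧ (∀ i ∈ t, l' i ∈ L ∧ l' i ∈ V) ∧
      ∑ i ∈ s, l i * e i = ∑ i ∈ t, l' i * e i := by
  classical
  induction s using Finset.strongInduction generalizing l with
  | H s ih =>
    by_cases hs : ∀ i ∈ s, l i ∈ V
    · exact ⟨s, l, subset_rfl, fun i hi => ⟨hl i hi, hs i hi⟩, rfl⟩
    push Not at hs
    obtain ⟨i₀, hi₀, hi₀V⟩ := hs
    obtain ⟨j, hj, hmax⟩ := s.exists_max_image (fun i => V.valuation (l i)) ⟨i₀, hi₀⟩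
    have hjV : 1 < V.valuation (l j) := by
      refine lt_of_lt_of_le ?_ (hmax i₀ hi₀)
      rwa [← not_le, V.valuation_le_one_iff]
    have hj0 : l j ≠ 0 := by
      rintro h0
      rw [h0, map_zero] at hjV
      exact not_lt_zero hjV
    have hc : ∀ i ∈ s, ∃ c ∈ k, V.valuation (l i / l j - c) < 1 := fun i hi =>
      h.exists_sub_lt _ (div_mem (hl i hi) (hl j hj)) (by
        rw [← V.valuation_le_one_iff, map_div₀]
        exact div_le_one_of_le₀ (hmax i hi) zero_le)
    choose! c hck hc using hc
    have hcj : c j = 1 := by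
      have h1 := hc j hj
      rw [div_self hj0] at h1
      exact (sub_eq_zero.1 (h.eq_zero_of_valuation_lt_one
        (sub_mem (one_mem _) (h.good.le_Qbar (hck j hj))) h1)).symm
    have hsum : ∑ i ∈ s, c i * e i = 0 := by
      refine h.eq_zero_of_valuation_lt_one
        (sum_mem fun i hi => mul_mem (h.good.le_Qbar (hck i hi)) (he i hi)) ?_
      have h1 : ∑ i ∈ s, c i * e i =
          (∑ i ∈ s, l i * e i) / l j - ∑ i ∈ s, (l i / l j - c i) * e i := by
        rw [Finset.sum_div, ← Finset.sum_sub_distrib]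
        exact Finset.sum_congr rfl fun i _ => by ring
      rw [h1]
      refine (V.valuation.map_sub _ _).trans_lt (max_lt ?_ ?_)
      · rw [map_div₀]
        exact (div_lt_one₀ (zero_lt_one.trans hjV)).2
          (((V.valuation_le_one_iff _).2 hV).trans_lt hjV)
      · refine V.valuation.map_sum_lt one_ne_zero fun i hi => ?_
        rw [map_mul]
        exact mul_lt_one_of_lt_of_le (hc i hi)
          ((V.valuation_le_one_iff _).2 (h.Qbar_mem (he i hi)))
    have hej : e j = -∑ i ∈ s.erase j, c i * e i := by
      rw [← Finset.add_sum_erase s _ hj, hcj, one_mul] at hsum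
      exact eq_neg_of_add_eq_zero_left hsum
    have hnew : ∑ i ∈ s, l i * e i = ∑ i ∈ s.erase j, (l i - l j * c i) * e i := by
      rw [← Finset.add_sum_erase s _ hj, hej, mul_neg, Finset.mul_sum, neg_add_eq_sub,
        ← Finset.sum_sub_distrib]
      exact Finset.sum_congr rfl fun i _ => by ring
    obtain ⟨t, l', ht, hl', h'⟩ := ih (s.erase j) (Finset.erase_ssubset hj)
      (fun i => l i - l j * c i)
      (fun i hi => sub_mem (hl i (Finset.mem_of_mem_erase hi))
        (mul_mem (hl j hj) (h.good.le (hck i (Finset.mem_of_mem_erase hi)))))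
      (fun i hi => he i (Finset.mem_of_mem_erase hi)) (hnew ▸ hV)
    exact ⟨t, l', ht.trans (Finset.erase_subset _ _), hl', hnew.trans h'⟩

/-- The elements of `V` are the `Qbar`-linear combinations of elements of `L ∩ V`. -/
theorem exists_repr (h : IsPlace k L V) {x : Ω} (hx : x ∈ V) :
    ∃ (t : Finset ℕ) (l e : ℕ → Ω), (∀ i ∈ t, l i ∈ L ∧ l i ∈ V) ∧
      (∀ i ∈ t, e i ∈ Qbar p Ω) ∧ x = ∑ i ∈ t, l i * e i := by
  obtain ⟨s, hs, hxs⟩ := h.good.exists_sum x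
  let l : ℕ → Ω := fun i => (s.getD i 0).1
  let e : ℕ → Ω := fun i => (s.getD i 0).2
  have hsum : x = ∑ i ∈ Finset.range s.length, l i * e i := by
    rw [hxs, Finset.sum_range, ← List.sum_ofFn]
    congr 1
    refine List.ext_getElem (by simp) fun i h1 h2 => ?_
    have : i < s.length := by simpa using h1
    simp [l, e]
  have hmem : ∀ i ∈ Finset.range s.length, l i ∈ L ∧ e i ∈ Qbar p Ω := fun i hi => by
    have hi' := Finset.mem_range.1 hi
    simp only [l, e, List.getD_eq_getElem _ _ hi']
    exact hs _ (List.getElem_mem hi')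
  obtain ⟨t, l', ht, hl', h'⟩ := h.exists_integral_coeffs _ l e (fun i hi => (hmem i hi).1)
    (fun i hi => (hmem i hi).2) (hsum ▸ hx)
  exact ⟨t, l', e, hl', fun i hi => (hmem i (ht hi)).2, hsum.trans h'⟩

/-- The residue field of `V` is `Qbar`. -/
theorem exists_residue (h : IsPlace k L V) {x : Ω} (hx : x ∈ V) :
    ∃ e ∈ Qbar p Ω, V.valuation (x - e) < 1 := by
  obtain ⟨t, l, e, hl, he, rfl⟩ := h.exists_repr hx
  choose! c hck hc using fun i (hi : i ∈ t) => h.exists_sub_lt _ (hl i hi).1 (hl i hi).2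
  refine ⟨∑ i ∈ t, c i * e i,
    sum_mem fun i hi => mul_mem (h.good.le_Qbar (hck i hi)) (he i hi), ?_⟩
  rw [← Finset.sum_sub_distrib]
  refine V.valuation.map_sum_lt one_ne_zero fun i hi => ?_
  rw [← sub_mul, map_mul]
  exact mul_lt_one_of_lt_of_le (hc i hi) ((V.valuation_le_one_iff _).2 (h.Qbar_mem (he i hi)))

theorem map_mem (h : IsPlace k L V) {σ : Ω ≃ₐ[ℚ_[p]] Ω} (hσ : Fixes L σ) {x : Ω} (hx : x ∈ V) :
    σ x ∈ V := by
  obtain ⟨t, l, e, hl, he, rfl⟩ := h.exists_repr hx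
  rw [map_sum]
  refine sum_mem fun i hi => ?_
  rw [map_mul, hσ _ (hl i hi).1]
  exact mul_mem (hl i hi).2 (h.Qbar_mem (map_mem_Qbar σ (he i hi)))

theorem map_mem_iff (h : IsPlace k L V) {σ : Ω ≃ₐ[ℚ_[p]] Ω} (hσ : Fixes L σ) {x : Ω} :
    σ x ∈ V ↔ x ∈ V := by
  refine ⟨fun hx => ?_, h.map_mem hσ⟩
  simpa using h.map_mem hσ.symm hx

theorem valuation_map_lt_one (h : IsPlace k L V) {σ : Ω ≃ₐ[ℚ_[p]] Ω} (hσ : Fixes L σ) {x : Ω} :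
    V.valuation (σ x) < 1 ↔ V.valuation x < 1 := by
  rcases eq_or_ne x 0 with rfl | h0
  · simp
  rw [valuation_lt_one_iff_inv_not_mem V h0,
    valuation_lt_one_iff_inv_not_mem V ((map_ne_zero σ).2 h0), ← map_inv₀, h.map_mem_iff hσ]

end IsPlace
end PlaceExtension

section Conjugation
variable {K N : Type*} [Field K] [Field N] [Algebra K N]

theorem isIntegral_of_forall_valuationSubring {R : Type*} [CommRing R] [Algebra R N] {x : N}
    (h : ∀ W : ValuationSubring N, (∀ r : R, algebraMap R N r ∈ W) → x ∈ W) :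
    IsIntegral R x := by
  by_contra hx
  obtain ⟨W, hW, hxW⟩ := (integralClosure R N).toSubring.exists_le_valuationSubring_of_isIntegrallyClosedIn
    (x := x) hx
  exact hxW (h W fun r => hW ((integralClosure R N).algebraMap_mem r))

/-- Every element of a valuation ring of an algebraic extension `N/K` is a quotient of two
elements integral over the trace of the valuation ring on `K`, with a unit as denominator. -/
theorem exists_isIntegral_mul (A : ValuationSubring N) {t : N} (ht : t ∈ A)
    (halg : IsAlgebraic K t) :
    ∃ u : N, IsIntegral (A.comap (algebraMap K N)) u ∧
      IsIntegral (A.comap (algebraMap K N)) (u * t) ∧ A.valuation u = 1 := by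
  rcases eq_or_ne t 0 with rfl | ht0
  · exact ⟨1, isIntegral_one, by rw [mul_zero]; exact isIntegral_zero, map_one _⟩
  obtain ⟨f, hf0, hft⟩ := halg
  let v : K → A.ValueGroup := fun a => A.valuation (algebraMap K N a)
  obtain ⟨i₀, hi₀, hmax⟩ := (Finset.range (f.natDegree + 1)).exists_max_image
    (fun i => v (f.coeff i)) ⟨0, by simp⟩
  have hv0 : ∀ a, v a = 0 ↔ a = 0 := fun a => by simp [v]
  have ha0 : f.coeff i₀ ≠ 0 := by
    intro h0
    have h1 := hmax f.natDegree (by simp)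
    rw [h0, (hv0 0).2 rfl, nonpos_iff_eq_zero, hv0, Polynomial.coeff_natDegree,
      Polynomial.leadingCoeff_eq_zero] at h1
    exact hf0 h1
  let b : ℕ → K := fun i => f.coeff i / f.coeff i₀
  have hb : ∀ i, v (b i) ≤ 1 := fun i => by
    simp only [v, b, map_div₀]
    refine div_le_one_of_le₀ ?_ zero_le
    by_cases hi : i ∈ Finset.range (f.natDegree + 1)
    · exact hmax i hi
    · rw [Polynomial.coeff_eq_zero_of_natDegree_lt (by simpa using hi)]
      simp
  have hbsum : ∑ i ∈ Finset.range (f.natDegree + 1), algebraMap K N (b i) * t ^ i = 0 := by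
    have h1 : Polynomial.aeval t f / algebraMap K N (f.coeff i₀) = 0 := by rw [hft, zero_div]
    rw [Polynomial.aeval_eq_sum_range, Finset.sum_div] at h1
    rw [← h1]
    refine Finset.sum_congr rfl fun i _ => ?_
    simp only [b, map_div₀, Algebra.smul_def]
    ring
  obtain ⟨k, hk, hkmax⟩ := ((Finset.range (f.natDegree + 1)).filter fun i => v (b i) = 1).exists_max_image
    id ⟨i₀, by simp only [Finset.mem_filter, hi₀, true_and, v, b, div_self ha0, map_one]⟩
  rw [Finset.mem_filter, Finset.mem_range] at hk
  obtain ⟨n, hn⟩ : ∃ n, f.natDegree + 1 = k + (n + 1) :=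
    ⟨f.natDegree - k, by omega⟩
  have hlt : ∀ j, v (b (k + (j + 1))) < 1 := fun j => by
    refine lt_of_le_of_ne (hb _) fun h1 => ?_
    by_cases hj : k + (j + 1) < f.natDegree + 1
    · have := hkmax (k + (j + 1)) (by simp [hj, h1])
      simp at this
    · simp only [v, b] at h1
      rw [Polynomial.coeff_eq_zero_of_natDegree_lt (by omega)] at h1
      simp at h1
  let u : N := ∑ j ∈ Finset.range (n + 1), algebraMap K N (b (k + j)) * t ^ j
  have hut : u * t = -∑ j ∈ Finset.range k, algebraMap K N (b (k - 1 - j)) * t⁻¹ ^ j := by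
    rw [hn, Finset.sum_range_add, ← Finset.sum_range_reflect] at hbsum
    have h2 : t ^ k * u + t ^ k * t⁻¹ * ∑ j ∈ Finset.range k,
        algebraMap K N (b (k - 1 - j)) * t⁻¹ ^ j = 0 := by
      rw [← hbsum, add_comm, Finset.mul_sum, Finset.mul_sum]
      congr 1
      · refine Finset.sum_congr rfl fun j hj => ?_
        have hj' := Finset.mem_range.1 hj
        obtain ⟨m, rfl⟩ : ∃ m, k = m + 1 + j := ⟨k - 1 - j, by omega⟩
        have : m + 1 + j - 1 - j = m := by omega
        rw [this, pow_add, pow_succ, inv_pow]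
        field_simp
      · exact Finset.sum_congr rfl fun j _ => by rw [pow_add]; ring
    have h3 : t ^ k * (u + t⁻¹ * ∑ j ∈ Finset.range k,
        algebraMap K N (b (k - 1 - j)) * t⁻¹ ^ j) = 0 := by rw [← h2]; ring
    have h4 := (mul_eq_zero.1 h3).resolve_left (pow_ne_zero _ ht0)
    rw [eq_neg_of_add_eq_zero_left h4, neg_mul, mul_right_comm, inv_mul_cancel₀ ht0, one_mul]
  have hbW : ∀ W : ValuationSubring N,
      (∀ r : A.comap (algebraMap K N), algebraMap (A.comap (algebraMap K N)) N r ∈ W) →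
      ∀ i, algebraMap K N (b i) ∈ W := fun W hW i =>
    hW ⟨b i, (A.valuation_le_one_iff _).1 (hb i)⟩
  have key : ∀ W : ValuationSubring N,
      (∀ r : A.comap (algebraMap K N), algebraMap (A.comap (algebraMap K N)) N r ∈ W) →
      u ∈ W ∧ u * t ∈ W := fun W hW => by
    by_cases htW : t ∈ W
    · have hu : u ∈ W := sum_mem fun j _ => mul_mem (hbW W hW _) (pow_mem htW _)
      exact ⟨hu, mul_mem hu htW⟩
    · have htW' := (W.mem_or_inv_mem t).resolve_left htW
      have hu : u * t ∈ W := by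
        rw [hut]
        exact neg_mem (sum_mem fun j _ => mul_mem (hbW W hW _) (pow_mem htW' _))
      refine ⟨?_, hu⟩
      have := mul_mem hu htW'
      rwa [mul_assoc, mul_inv_cancel₀ ht0, mul_one] at this
  refine ⟨u, isIntegral_of_forall_valuationSubring fun W hW => (key W hW).1,
    isIntegral_of_forall_valuationSubring fun W hW => (key W hW).2, ?_⟩
  have hu : u = (∑ j ∈ Finset.range n, algebraMap K N (b (k + (j + 1))) * t ^ (j + 1)) +
      algebraMap K N (b k) := by
    simp only [u]
    rw [Finset.sum_range_succ', add_zero, pow_zero, mul_one]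
  rw [hu, Valuation.map_add_eq_of_lt_right]
  · exact hk.2
  · refine lt_of_lt_of_eq ?_ hk.2.symm
    refine A.valuation.map_sum_lt one_ne_zero fun j _ => ?_
    rw [map_mul]
    refine mul_lt_one_of_lt_of_le (hlt j) ?_
    rw [map_pow]
    exact pow_le_one₀ zero_le ((A.valuation_le_one_iff _).2 ht)

/-- Two valuation rings of a Galois extension `N/K` with the same trace on `K` are conjugate. -/
theorem exists_conj_valuationSubring [IsGalois K N] (A B : ValuationSubring N)
    (h : A.comap (algebraMap K N) = B.comap (algebraMap K N)) :
    ∃ σ : N ≃ₐ[K] N, ∀ x, x ∈ A ↔ σ x ∈ B := by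
  let O := A.comap (algebraMap K N)
  let C := integralClosure O N
  have : SMulCommClass (N ≃ₐ[K] N) O N := ⟨fun σ r x => by
    simp only [AlgEquiv.smul_def]
    exact map_smul σ (r : K) x⟩
  let : TopologicalSpace C := ⊥
  have : DiscreteTopology C := ⟨rfl⟩
  have : ContinuousSMul (N ≃ₐ[K] N) C := by
    rw [continuousSMul_iff_stabilizer_isOpen]
    intro x
    convert stabilizer_isOpen_of_isIntegral (K := K) (x : N) using 1
    ext σ
    simp only [SetLike.mem_coe, MulAction.mem_stabilizer_iff, Subtype.ext_iff]
    rfl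
  have : Algebra.IsInvariant O C (N ≃ₐ[K] N) := ⟨fun x hx => by
    have h1 : (x : N) ∈ (⊥ : IntermediateField K N) := by
      rw [InfiniteGalois.mem_bot_iff_fixed]
      intro σ
      exact congrArg Subtype.val (hx σ)
    obtain ⟨a, ha⟩ := IntermediateField.mem_bot.1 h1
    have h2 : IsIntegral O (algebraMap K N a) := by rw [ha]; exact x.2
    have h3 : IsIntegral O a := (isIntegral_algebraMap_iff (algebraMap K N).injective).1 h2
    exact ⟨⟨a, O.mem_of_isIntegral h3⟩, Subtype.ext ha⟩⟩
  have hmem : ∀ W : ValuationSubring N, W.comap (algebraMap K N) = O → ∀ x : C, (x : N) ∈ W := by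
    intro W hW x
    refine W.mem_of_isIntegral ?_
    have : IsIntegral O (x : N) := x.2
    refine IsIntegral.map_of_comp_eq (((algebraMap K N).comp O.subtype).codRestrict W.toSubring
      fun a => ?_) (RingHom.id N) ?_ this
    · exact (SetLike.ext_iff.1 hW (a : K)).2 a.2
    · rfl
  let P : ∀ W : ValuationSubring N, W.comap (algebraMap K N) = O → Ideal C := fun W hW =>
    (IsLocalRing.maximalIdeal W).comap
      ((algebraMap C N).codRestrict W.toSubring (hmem W hW))
  have hP : ∀ W hW (x : C), x ∈ P W hW ↔ W.valuation (x : N) < 1 := fun W hW x =>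
    W.valuation_lt_one_iff ⟨x, hmem W hW x⟩
  have hPO : ∀ W hW (a : O), algebraMap O C a ∈ P W hW ↔ (a : K) = 0 ∨ (a : K)⁻¹ ∉ O := by
    intro W hW a
    rw [hP W hW]
    rcases eq_or_ne (a : K) 0 with h0 | h0
    · have : ((algebraMap O C a : C) : N) = 0 := by
        change algebraMap K N a = 0
        rw [h0, map_zero]
      rw [this]
      simp [h0]
    · change W.valuation (algebraMap K N a) < 1 ↔ _
      rw [valuation_lt_one_iff_inv_not_mem W ((map_ne_zero _).2 h0), ← map_inv₀]
      simp only [h0, false_or]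
      exact not_congr (SetLike.ext_iff.1 hW (a : K)⁻¹)
  have hPprime : ∀ W hW, (P W hW).IsPrime := fun W hW => Ideal.comap_isPrime _ _
  have := hPprime A rfl
  have := hPprime B h.symm
  obtain ⟨σ, hσ⟩ := Algebra.IsInvariant.exists_smul_of_under_eq_of_profinite (A := O)
    (G := N ≃ₐ[K] N) (P A rfl) (P B h.symm) (by
      ext a
      exact (hPO A rfl a).trans (hPO B h.symm a).symm)
  have hσmem : ∀ x : C, A.valuation (x : N) < 1 ↔ B.valuation (σ (x : N)) < 1 := fun x => by
    have h1 : σ • x ∈ P B h.symm ↔ x ∈ P A rfl := by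
      rw [hσ]
      exact Ideal.smul_mem_pointwise_smul_iff
    rw [← hP A rfl, ← h1, hP B h.symm]
    rfl
  have hone : ∀ W : ValuationSubring N, W.comap (algebraMap K N) = O → ∀ x : C,
      W.valuation (x : N) = 1 ↔ ¬ W.valuation (x : N) < 1 := fun W hW x =>
    ⟨fun h1 => by rw [h1]; exact lt_irrefl _, fun h1 =>
      le_antisymm ((W.valuation_le_one_iff _).2 (hmem W hW x)) (not_lt.1 h1)⟩
  have halg : ∀ t : N, IsAlgebraic K t := Algebra.IsAlgebraic.isAlgebraic
  refine ⟨σ, fun t => ⟨fun ht => ?_, fun ht => ?_⟩⟩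
  · obtain ⟨u, hu, hut, hu1⟩ := exists_isIntegral_mul A ht (halg t)
    have h1 : B.valuation (σ u) = 1 :=
      (hone B h.symm (σ • (⟨u, hu⟩ : C))).2 fun h1 =>
        (hone A rfl ⟨u, hu⟩).1 hu1 ((hσmem ⟨u, hu⟩).2 h1)
    have h2 : σ (u * t) ∈ B := hmem B h.symm (σ • (⟨u * t, hut⟩ : C))
    rw [← B.valuation_le_one_iff, map_mul, map_mul, h1, one_mul] at h2
    exact (B.valuation_le_one_iff _).1 h2
  · obtain ⟨u, hu, hut, hu1⟩ := exists_isIntegral_mul B ht (halg _)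
    rw [← h] at hu hut
    have h1 : A.valuation (σ.symm u) = 1 :=
      (hone A rfl (σ.symm • (⟨u, hu⟩ : C))).2 fun h1 =>
        (hone B h.symm ⟨u, hu⟩).1 hu1 (by
          have := (hσmem (σ.symm • (⟨u, hu⟩ : C))).1 h1
          change B.valuation (σ (σ.symm u)) < 1 at this
          rwa [AlgEquiv.apply_symm_apply] at this)
    have h2 : σ.symm (u * σ t) ∈ A := hmem A rfl (σ.symm • (⟨u * σ t, hut⟩ : C))
    rw [map_mul, AlgEquiv.symm_apply_apply, ← A.valuation_le_one_iff, map_mul, h1, one_mul] at h2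
    exact (A.valuation_le_one_iff _).1 h2

end Conjugation

section Ultrapower
variable {I : Type*} (𝒰 : Ultrafilter I)

theorem isAlgClosed_germ (F : Type*) [Field F] [IsAlgClosed F] :
    IsAlgClosed ((𝒰 : Filter I).Germ F) := by
  refine IsAlgClosed.of_exists_root _ fun f hf hirr => ?_
  have hsurj : Function.Surjective (Filter.Germ.coeRingHom (𝒰 : Filter I) : (I → F) →+* _) :=
    Quotient.mk_surjective
  let φ : (I → F) →+* (𝒰 : Filter I).Germ F := Filter.Germ.coeRingHom _
  obtain ⟨g, hgf, hdeg, hg⟩ := Polynomial.lifts_and_natDegree_eq_and_monic (f := φ)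
    ((Polynomial.lifts_iff_coeff_lifts f).2 fun n => hsurj (f.coeff n)) hf
  have hroot : ∀ i, ∃ r, (g.map (Pi.evalRingHom (fun _ => F) i)).eval r = 0 := fun i => by
    refine IsAlgClosed.exists_root _ fun h0 => ?_
    have h1 := Polynomial.natDegree_eq_zero_iff_degree_le_zero.2 h0.le
    rw [hg.natDegree_map, hdeg] at h1
    exact hirr.natDegree_pos.ne' h1
  choose r hr using hroot
  refine ⟨φ r, ?_⟩
  rw [← hgf, Polynomial.eval_map, Polynomial.eval₂_hom]
  have : g.eval r = 0 := by
    funext i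
    have h1 := hr i
    rw [Polynomial.eval_map] at h1
    have h2 := Polynomial.hom_eval₂ g (RingHom.id _) (Pi.evalRingHom (fun _ => F) i) r
    rw [RingHom.comp_id] at h2
    exact h2.trans h1
  rw [this, map_zero]

variable {p : ℕ} [Fact p.Prime] {Ω : Type*} [Field Ω] [Algebra ℚ_[p] Ω]

/-- The residue of `t` has absolute value at most `C`. -/
def ResidueLE (V : ValuationSubring Ω) (C : ℝ) (t : Ω) : Prop :=
  ∃ e ∈ Qbar p Ω, nrm p e ≤ C ∧ V.valuation (t - e) < 1

namespace ResidueLE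
variable {V : ValuationSubring Ω} {C D : ℝ} {s t : Ω}

theorem mono (h : ResidueLE (p := p) V C t) (hCD : C ≤ D) : ResidueLE (p := p) V D t := by
  obtain ⟨e, he, hC, hV⟩ := h
  exact ⟨e, he, hC.trans hCD, hV⟩

theorem of_mem_Qbar (ht : t ∈ Qbar p Ω) (hC : nrm p t ≤ C) : ResidueLE (p := p) V C t :=
  ⟨t, ht, hC, by simp⟩

theorem of_valuation_lt_one (ht : V.valuation t < 1) (hC : 0 ≤ C) : ResidueLE (p := p) V C t :=
  ⟨0, zero_mem _, nrm_zero.trans_le hC, by rwa [sub_zero]⟩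

theorem add (hs : ResidueLE (p := p) V C s) (ht : ResidueLE (p := p) V D t) :
    ResidueLE (p := p) V (max C D) (s + t) := by
  obtain ⟨e, he, hC, hV⟩ := hs
  obtain ⟨e', he', hC', hV'⟩ := ht
  refine ⟨e + e', add_mem he he', (nrm_add_le he he').trans (max_le_max hC hC'), ?_⟩
  rw [add_sub_add_comm]
  exact (V.valuation.map_add _ _).trans_lt (max_lt hV hV')

theorem neg (hs : ResidueLE (p := p) V C s) : ResidueLE (p := p) V C (-s) := by
  obtain ⟨e, he, hC, hV⟩ := hs
  exact ⟨-e, neg_mem he, (nrm_neg _ he).trans_le hC, by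
    rwa [neg_sub_neg, Valuation.map_sub_swap]⟩

end ResidueLE

namespace IsPlace
variable {k L : IntermediateField ℚ_[p] Ω} {V : ValuationSubring Ω}

theorem residueLE_mul (h : IsPlace k L V) {C D : ℝ} {s t : Ω}
    (hs : ResidueLE (p := p) V C s) (ht : ResidueLE (p := p) V D t) :
    ResidueLE (p := p) V (C * D) (s * t) := by
  obtain ⟨e, he, hC, hV⟩ := hs
  obtain ⟨e', he', hC', hV'⟩ := ht
  refine ⟨e * e', mul_mem he he', ?_, ?_⟩
  · rw [nrm_mul he he']
    exact mul_le_mul hC hC' (nrm_nonneg _) ((nrm_nonneg _).trans hC)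
  have h1 : s * t - e * e' = (s - e) * (t - e') + ((s - e) * e' + e * (t - e')) := by ring
  have hle : ∀ x ∈ Qbar p Ω, V.valuation x ≤ 1 := fun x hx =>
    (V.valuation_le_one_iff x).2 (h.Qbar_mem hx)
  rw [h1]
  refine (V.valuation.map_add _ _).trans_lt (max_lt ?_
    ((V.valuation.map_add _ _).trans_lt (max_lt ?_ ?_))) <;> rw [map_mul]
  · exact mul_lt_one_of_lt_of_le hV hV'.le
  · exact mul_lt_one_of_lt_of_le hV (hle _ he')
  · exact (mul_comm _ _).trans_lt (mul_lt_one_of_lt_of_le hV' (hle _ he))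

theorem le_of_residueLE_one (h : IsPlace k L V) {C : ℝ} (h1 : ResidueLE (p := p) V C 1) :
    1 ≤ C := by
  obtain ⟨e, he, hC, hV⟩ := h1
  have := h.eq_zero_of_valuation_lt_one (sub_mem (one_mem _) he) hV
  rwa [← sub_eq_zero.1 this, nrm_one] at hC

theorem residueLE_inv (h : IsPlace k L V) {t : Ω} (ht : ¬ ResidueLE (p := p) V 1 t) :
    ResidueLE (p := p) V 1 t⁻¹ := by
  have ht0 : t ≠ 0 := by
    rintro rfl
    exact ht (.of_mem_Qbar (zero_mem _) (nrm_zero.trans_le zero_le_one))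
  by_cases htV : t ∈ V
  · obtain ⟨e, he, hV⟩ := h.exists_residue htV
    have hC : 1 < nrm p e := not_le.1 fun hC => ht ⟨e, he, hC, hV⟩
    have he0 : e ≠ 0 := by
      rintro rfl
      rw [nrm_zero] at hC
      exact absurd hC (by norm_num)
    refine ⟨e⁻¹, inv_mem he, ?_, ?_⟩
    · rw [nrm_inv he]
      exact inv_le_one_of_one_le₀ hC.le
    · have hv := h.valuation_Qbar he he0
      have hvt : V.valuation t = 1 := by
        rw [← hv, ← sub_add_cancel t e]
        exact Valuation.map_add_eq_of_lt_right _ (by rwa [hv])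
      rw [inv_sub_inv ht0 he0, map_div₀, map_mul, hv, hvt, mul_one, div_one,
        Valuation.map_sub_swap]
      exact hV
  · refine .of_valuation_lt_one ?_ zero_le_one
    rwa [valuation_lt_one_iff_inv_not_mem V (inv_ne_zero ht0), inv_inv]

theorem residueLE_map (h : IsPlace k L V) {σ : Ω ≃ₐ[ℚ_[p]] Ω} (hσ : Fixes L σ) {C : ℝ} {t : Ω}
    (ht : ResidueLE (p := p) V C t) : ResidueLE (p := p) V C (σ t) := by
  obtain ⟨e, he, hC, hV⟩ := ht
  refine ⟨σ e, map_mem_Qbar σ he, (nrm_map σ e).trans_le hC, ?_⟩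
  rw [← map_sub, h.valuation_map_lt_one hσ]
  exact hV

/-- The valuation ring of the ultrapower of `Ω` consisting of the elements with bounded
residues. -/
def germRing (h : IsPlace k L V) : ValuationSubring ((𝒰 : Filter I).Germ Ω) where
  carrier := {f | ∃ C, f.LiftPred (ResidueLE (p := p) V C)}
  mul_mem' := by
    rintro f g ⟨C, hC⟩ ⟨D, hD⟩
    induction f using Filter.Germ.inductionOn with | _ f
    induction g using Filter.Germ.inductionOn with | _ g
    exact ⟨C * D, (Filter.Eventually.and hC hD).mono fun i hi => h.residueLE_mul hi.1 hi.2⟩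
  one_mem' := ⟨1, Filter.Germ.liftPred_const (.of_mem_Qbar (one_mem _) nrm_one.le)⟩
  add_mem' := by
    rintro f g ⟨C, hC⟩ ⟨D, hD⟩
    induction f using Filter.Germ.inductionOn with | _ f
    induction g using Filter.Germ.inductionOn with | _ g
    exact ⟨max C D, (Filter.Eventually.and hC hD).mono fun i hi => hi.1.add hi.2⟩
  zero_mem' := ⟨0, Filter.Germ.liftPred_const (.of_mem_Qbar (zero_mem _) nrm_zero.le)⟩
  neg_mem' := by
    rintro f ⟨C, hC⟩
    induction f using Filter.Germ.inductionOn with | _ f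
    exact ⟨C, Filter.Eventually.mono hC fun i hi => hi.neg⟩
  mem_or_inv_mem' f := by
    induction f using Filter.Germ.inductionOn with | _ f
    rcases Ultrafilter.em 𝒰 (fun i => ResidueLE (p := p) V 1 (f i)) with h1 | h1
    · exact Or.inl ⟨1, h1⟩
    · exact Or.inr ⟨1, Filter.Eventually.mono h1 fun i hi => h.residueLE_inv hi⟩

variable {𝒰}

theorem mem_germRing (h : IsPlace k L V) {f : I → Ω} :
    (f : (𝒰 : Filter I).Germ Ω) ∈ h.germRing 𝒰 ↔
      ∃ C, ∀ᶠ i in (𝒰 : Filter I), ResidueLE (p := p) V C (f i) := Iff.rfl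

theorem valuation_germRing_lt_one (h : IsPlace k L V) {f : I → Ω}
    (hf : ∀ ε : ℝ, 0 < ε → ∀ᶠ i in (𝒰 : Filter I), ResidueLE (p := p) V ε (f i)) :
    (h.germRing 𝒰).valuation (f : (𝒰 : Filter I).Germ Ω) < 1 := by
  rcases eq_or_ne (f : (𝒰 : Filter I).Germ Ω) 0 with h0 | h0
  · rw [h0, map_zero]
    exact zero_lt_one
  rw [valuation_lt_one_iff_inv_not_mem _ h0]
  rintro ⟨C, hC⟩
  have hC' : ∀ᶠ i in (𝒰 : Filter I), ResidueLE (p := p) V C (f i)⁻¹ := hC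
  have hne : ∀ᶠ i in (𝒰 : Filter I), f i ≠ 0 := by
    rcases Ultrafilter.em 𝒰 (fun i => f i = 0) with h1 | h1
    · exact absurd (Filter.Germ.coe_eq.2 h1) h0
    · exact h1
  have hpos : 0 < (|C| + 2)⁻¹ := by positivity
  obtain ⟨i, ⟨hi1, hi2⟩, hi3⟩ := ((hC'.and hne).and (hf _ hpos)).exists
  have h1 := h.residueLE_mul (hi1.mono (le_abs_self C)) hi3
  rw [inv_mul_cancel₀ hi2] at h1
  have h2 := h.le_of_residueLE_one h1
  rw [← div_eq_mul_inv, le_div_iff₀ (by positivity)] at h2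
  linarith

end IsPlace
end Ultrapower

theorem exists_ringHom_mem_iff {K N Γ : Type*} [Field K] [Field N] [Algebra K N] [IsGalois K N]
    [Field Γ] [IsAlgClosed Γ] (φ : K →+* Γ) (A : ValuationSubring N) (O : ValuationSubring Γ)
    (hφ : ∀ t, algebraMap K N t ∈ A ↔ φ t ∈ O) :
    ∃ ψ : N →+* Γ, (∀ t, ψ (algebraMap K N t) = φ t) ∧ ∀ t, t ∈ A ↔ ψ t ∈ O := by
  let : Algebra K Γ := φ.toAlgebra
  let ψ : N →ₐ[K] Γ := IsAlgClosed.lift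
  obtain ⟨σ, hσ⟩ := exists_conj_valuationSubring (K := K) A (O.comap ψ.toRingHom) (by
      ext t
      change _ ↔ ψ (algebraMap K N t) ∈ O
      rw [ψ.commutes]
      exact hφ t)
  refine ⟨ψ.toRingHom.comp (RingEquiv.toRingHom σ.toRingEquiv), fun t => ?_, hσ⟩
  change ψ (σ (algebraMap K N t)) = _
  rw [σ.commutes, ψ.commutes]
  rfl

section Specialization
open scoped Polynomial
open Polynomial (aeval)
variable {p : ℕ} [Fact p.Prime] {Ω : Type*} [Field Ω] [Algebra ℚ_[p] Ω]
  {I : Type*}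

/-- Evaluation at `x'` approximates evaluation at `x` along `𝒰`. -/
def Approximates (𝒰 : Ultrafilter I) (V : ValuationSubring Ω) (M : IntermediateField ℚ_[p] Ω)
    (x : Ω) (x' : I → Ω) : Prop :=
  ∀ f g : M[X], V.valuation (aeval x f) < V.valuation (aeval x g) → ∀ ε : ℝ, 0 < ε →
    ∀ᶠ i in (𝒰 : Filter I), aeval (x' i) g ≠ 0 ∧
      ResidueLE (p := p) V ε (aeval (x' i) f / aeval (x' i) g)

variable {𝒰 : Ultrafilter I} {k L M : IntermediateField ℚ_[p] Ω} {V : ValuationSubring Ω} {x : Ω}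
  {x' : I → Ω}

theorem Approximates.eventually_ne_zero (h : Approximates 𝒰 V M x x') {g : M[X]}
    (hg : aeval x g ≠ 0) : ∀ᶠ i in (𝒰 : Filter I), aeval (x' i) g ≠ 0 :=
  (h 0 g (by rw [map_zero, map_zero]; exact zero_lt_iff.2 ((_root_.map_ne_zero _).2 hg)) 1
    one_pos).mono fun i hi => hi.1

theorem Approximates.exists_ringHom (h : Approximates 𝒰 V M x x') (hx : Transcendental M x) :
    ∃ φ : (IntermediateField.adjoin M {x}).restrictScalars ℚ_[p] →+* (𝒰 : Filter I).Germ Ω,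
      ∀ (t : (IntermediateField.adjoin M {x}).restrictScalars ℚ_[p]) (f g : M[X]),
        (t : Ω) = aeval x f / aeval x g →
        φ t = ↑(fun i => aeval (x' i) f / aeval (x' i) g) := by
  let φ₀ : M[X] →+* (𝒰 : Filter I).Germ Ω := (Filter.Germ.coeRingHom (𝒰 : Filter I)).comp
    (RingHom.pi fun i => (aeval (R := M) (x' i)).toRingHom)
  have hφ₀ : ∀ f, φ₀ f = ↑(fun i => aeval (x' i) f) := fun f => rfl
  have hinj : Function.Injective φ₀ := by
    rw [injective_iff_map_eq_zero]
    intro f hf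
    by_contra hf0
    have h1 := h.eventually_ne_zero ((transcendental_iff_injective.1 hx).ne_iff' (map_zero _)|>.2 hf0)
    rw [hφ₀] at hf
    have h2 : ∀ᶠ i in (𝒰 : Filter I), aeval (x' i) f = 0 := Filter.Germ.coe_eq.1 hf
    obtain ⟨i, hi, hi'⟩ := (h1.and h2).exists
    exact hi hi'
  let e := RatFunc.algEquivOfTranscendental x hx
  have hle := nonZeroDivisors_le_comap_nonZeroDivisors_of_injective _ hinj
  refine ⟨(RatFunc.liftRingHom φ₀ hle).comp (RingEquiv.toRingHom e.symm.toRingEquiv),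
    fun t f g hfg => ?_⟩
  have he : ∀ f : M[X], ((e (algebraMap _ _ f) : IntermediateField.adjoin M {x}) : Ω) = aeval x f :=
    fun f => by simp [e]
  have h1 : e.symm t = algebraMap _ _ f / algebraMap _ _ g := by
    refine (AlgEquiv.symm_apply_eq e).2 (Subtype.ext ?_)
    rw [map_div₀, IntermediateField.coe_div, he, he]
    exact hfg
  change RatFunc.liftRingHom φ₀ hle (e.symm t) = _
  rw [h1, RatFunc.liftRingHom_apply_div, hφ₀, hφ₀]
  rfl

theorem adjoin_restrictScalars_le (hM : M ≤ L) (hxL : x ∈ L) :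
    (IntermediateField.adjoin M {x}).restrictScalars ℚ_[p] ≤ L := by
  rw [IntermediateField.restrictScalars_adjoin, IntermediateField.adjoin_le_iff]
  rintro t (ht | rfl)
  · exact hM ht
  · exact hxL

theorem IsPlace.mem_iff_of_approximates (hV : IsPlace k L V) (hk : k ≤ M) (hM : M ≤ L)
    (hxL : x ∈ L) (h : Approximates 𝒰 V M x x')
    {φ : (IntermediateField.adjoin M {x}).restrictScalars ℚ_[p] →+* (𝒰 : Filter I).Germ Ω}
    (hφ : ∀ (t : (IntermediateField.adjoin M {x}).restrictScalars ℚ_[p]) (f g : M[X]),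
        (t : Ω) = aeval x f / aeval x g →
        φ t = ↑(fun i => aeval (x' i) f / aeval (x' i) g))
    (t : (IntermediateField.adjoin M {x}).restrictScalars ℚ_[p]) :
    (t : Ω) ∈ V ↔ φ t ∈ hV.germRing 𝒰 := by
  have hlt : ∀ t : (IntermediateField.adjoin M {x}).restrictScalars ℚ_[p], V.valuation (t : Ω) < 1 → (hV.germRing 𝒰).valuation (φ t) < 1 := by
    intro t ht
    obtain ⟨f, g, hfg⟩ := (IntermediateField.mem_adjoin_simple_iff M _).1 t.2
    rw [hφ t f g hfg]
    by_cases hg : aeval x g = 0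
    · rw [hg, div_zero] at hfg
      have : φ t = 0 := by
        rw [(Subtype.ext hfg : t = 0), map_zero]
      rw [← hφ t f g (by rw [hg, div_zero, hfg]), this, map_zero]
      exact zero_lt_one
    rw [hfg, map_div₀, div_lt_one₀ (zero_lt_iff.2 ((_root_.map_ne_zero _).2 hg))] at ht
    exact hV.valuation_germRing_lt_one fun ε hε => (h f g ht ε hε).mono fun i hi => hi.2
  constructor
  · intro ht
    obtain ⟨c, hc, hct⟩ := hV.exists_sub_lt t (adjoin_restrictScalars_le hM hxL t.2) ht
    let c' : (IntermediateField.adjoin M {x}).restrictScalars ℚ_[p] :=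
      ⟨c, (IntermediateField.adjoin M {x}).algebraMap_mem ⟨c, hk hc⟩⟩
    have h1 : φ c' ∈ hV.germRing 𝒰 := by
      rw [hφ c' (Polynomial.C ⟨c, hk hc⟩) 1 (by simp [c', IntermediateField.algebraMap_apply]),
        hV.mem_germRing]
      refine ⟨nrm p c, Filter.Eventually.of_forall fun i => ?_⟩
      refine .of_mem_Qbar ?_ ?_ <;> simp [IntermediateField.algebraMap_apply]
      exact hV.good.le_Qbar hc
    have h2 : φ (t - c') ∈ hV.germRing 𝒰 :=
      ((hV.germRing 𝒰).valuation_le_one_iff _).1 (hlt (t - c') hct).le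
    rw [map_sub] at h2
    simpa using add_mem h2 h1
  · contrapose!
    intro ht h'
    have ht0 : t ≠ 0 := by
      rintro rfl
      exact ht V.zero_mem
    have ht0' : (t : Ω) ≠ 0 := fun h0 => ht0 (Subtype.ext h0)
    have h1 := hlt t⁻¹ (by
      change V.valuation (t : Ω)⁻¹ < 1
      rw [valuation_lt_one_iff_inv_not_mem V (inv_ne_zero ht0'), inv_inv]
      exact ht)
    rw [map_inv₀, valuation_lt_one_iff_inv_not_mem _ (inv_ne_zero ((_root_.map_ne_zero φ).2 ht0)),
      inv_inv] at h1
    exact h1 h'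

end Specialization

section Orbit
variable {K N Γ : Type*} [Field K] [Field N] [Algebra K N] [Field Γ]

theorem exists_algEquiv_of_ringHom [Normal K N] (ψ : N →+* Γ) (G : Γ →+* Γ)
    (hG : ∀ t : K, G (ψ (algebraMap K N t)) = ψ (algebraMap K N t)) :
    ∃ τ : N ≃ₐ[K] N, ∀ t, ψ (τ t) = G (ψ t) := by
  let : Algebra N Γ := ψ.toAlgebra
  let : Algebra K Γ := (ψ.comp (algebraMap K N)).toAlgebra
  have : IsScalarTower K N Γ := .of_algebraMap_eq fun _ => rfl
  let G' : Γ →ₐ[K] Γ := { G with commutes' := hG }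
  exact ⟨G'.restrictNormal' N, G'.restrictNormal_commutes N⟩

theorem map_eq_self_of_finite_orbit [CharZero N] (A : ValuationSubring N) (τ : N ≃ₐ[K] N)
    (hτ : ∀ t, A.valuation t < 1 → A.valuation (τ t) < 1)
    (hA : ∀ n : ℕ, n ≠ 0 → A.valuation n = 1)
    (hres : ∀ u, A.valuation u = 1 → ∃ e, τ e = e ∧ A.valuation (u - e) < 1) {y : N}
    {S : Finset N} (hS : (S : Set N) = Set.range fun j : ℕ => (τ ^ j) y)
    (hZ : y - (S.card : N)⁻¹ * ∑ s ∈ S, s ≠ 0 →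
      ∃ h : K, A.valuation (algebraMap K N h) = A.valuation (y - (S.card : N)⁻¹ * ∑ s ∈ S, s)) :
    τ y = y := by
  classical
  have hmem : ∀ s, s ∈ S ↔ ∃ j : ℕ, (τ ^ j) y = s := fun s => by
    rw [← Finset.mem_coe, hS, Set.mem_range]
  have hyS : y ∈ S := (hmem y).2 ⟨0, rfl⟩
  have hcard : S.card ≠ 0 := Finset.card_ne_zero.2 ⟨y, hyS⟩
  have himg : S.image τ = S := by
    refine Finset.eq_of_subset_of_card_le (fun s hs => ?_)
      (Finset.card_image_of_injective _ τ.injective).ge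
    obtain ⟨t, ht, rfl⟩ := Finset.mem_image.1 hs
    obtain ⟨j, rfl⟩ := (hmem t).1 ht
    exact (hmem _).2 ⟨j + 1, by rw [pow_succ']; rfl⟩
  set a := (S.card : N)⁻¹ * ∑ s ∈ S, s with ha
  have hsum : ∑ s ∈ S, τ s = ∑ s ∈ S, s := by
    conv_rhs => rw [← himg]
    rw [Finset.sum_image τ.injective.injOn]
  have hτa : τ a = a := by
    rw [ha, map_mul, map_inv₀, map_natCast, map_sum, hsum]
  by_cases hz : y - a = 0
  · rw [sub_eq_zero.1 hz, hτa]
  exfalso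
  obtain ⟨h, hh⟩ := hZ hz
  set d := algebraMap K N h
  have hd : A.valuation d ≠ 0 := by
    rw [hh]
    exact (map_ne_zero _).2 hz
  obtain ⟨e, he, hue⟩ := hres ((y - a) / d) (by rw [map_div₀, ← hh, div_self hd])
  have he1 : A.valuation e = 1 := by
    have h1 : A.valuation ((y - a) / d) = 1 := by rw [map_div₀, ← hh, div_self hd]
    rw [← h1, Valuation.map_sub_swap] at hue
    rw [← h1, ← Valuation.map_add_eq_of_lt_left _ hue]
    simp
  have key : ∀ s ∈ S, A.valuation ((s - a) / d - e) < 1 := by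
    intro s hs
    obtain ⟨j, rfl⟩ := (hmem s).1 hs
    clear hs
    induction j with
    | zero => exact hue
    | succ j ih =>
      have h1 := hτ _ ih
      rw [map_sub τ, map_div₀ τ, map_sub τ, hτa, he, τ.commutes] at h1
      rw [pow_succ']
      exact h1
  have h2 : ∑ s ∈ S, ((s - a) / d - e) = -(S.card * e) := by
    rw [Finset.sum_sub_distrib, ← Finset.sum_div, Finset.sum_sub_distrib, Finset.sum_const,
      Finset.sum_const, nsmul_eq_mul, nsmul_eq_mul, ha, mul_inv_cancel_left₀
      (Nat.cast_ne_zero.2 hcard), sub_self, zero_div, zero_sub]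
  have h3 := A.valuation.map_sum_lt one_ne_zero key
  rw [h2, Valuation.map_neg, map_mul, hA _ hcard, he1, one_mul] at h3
  exact h3.ne rfl
end Orbit

section GermMap
variable {I : Type*} {Ω : Type*} [Field Ω]

/-- The coordinatewise action of a family of endomorphisms on the ultrapower. -/
def germMap (𝒰 : Ultrafilter I) (g : I → Ω →+* Ω) :
    (𝒰 : Filter I).Germ Ω →+* (𝒰 : Filter I).Germ Ω where
  toFun := Quotient.map' (fun w i => g i (w i)) fun _ _ h =>
    Filter.Eventually.mono h fun i hi => congrArg (g i) hi
  map_one' := Filter.Germ.coe_eq.2 (.of_forall fun i => map_one (g i))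
  map_zero' := Filter.Germ.coe_eq.2 (.of_forall fun i => map_zero (g i))
  map_mul' a b := by
    induction a using Filter.Germ.inductionOn with | _ a
    induction b using Filter.Germ.inductionOn with | _ b
    exact Filter.Germ.coe_eq.2 (.of_forall fun i => map_mul (g i) _ _)
  map_add' a b := by
    induction a using Filter.Germ.inductionOn with | _ a
    induction b using Filter.Germ.inductionOn with | _ b
    exact Filter.Germ.coe_eq.2 (.of_forall fun i => map_add (g i) _ _)

theorem germMap_coe (𝒰 : Ultrafilter I) (g : I → Ω →+* Ω) (w : I → Ω) :
    germMap 𝒰 g w = ↑(fun i => g i (w i)) := rfl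
end GermMap

section Specialization
variable {p : ℕ} [Fact p.Prime] {Ω : Type*} [Field Ω] [Algebra ℚ_[p] Ω]
  {I : Type*} {𝒰 : Ultrafilter I} {k L H : IntermediateField ℚ_[p] Ω} {V : ValuationSubring Ω}

theorem valuation_comap_le_iff {E F : Type*} [Field E] [Field F] (A : ValuationSubring F)
    (f : E →+* F) {a b : E} : (A.comap f).valuation a ≤ (A.comap f).valuation b ↔
      A.valuation (f a) ≤ A.valuation (f b) := by
  rcases eq_or_ne b 0 with rfl | hb
  · simp
  rw [← div_le_one₀ (zero_lt_iff.2 ((map_ne_zero _).2 hb)), ← map_div₀,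
    ValuationSubring.valuation_le_one_iff, ValuationSubring.mem_comap, map_div₀,
    ← A.valuation_le_one_iff, map_div₀,
    div_le_one₀ (zero_lt_iff.2 ((map_ne_zero _).2 ((map_ne_zero f).2 hb)))]

theorem valuation_comap_lt_iff {E F : Type*} [Field E] [Field F] (A : ValuationSubring F)
    (f : E →+* F) {a b : E} : (A.comap f).valuation a < (A.comap f).valuation b ↔
      A.valuation (f a) < A.valuation (f b) := by
  rw [← not_le, valuation_comap_le_iff, not_le]

theorem valuation_comap_eq_iff {E F : Type*} [Field E] [Field F] (A : ValuationSubring F)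
    (f : E →+* F) {a b : E} : (A.comap f).valuation a = (A.comap f).valuation b ↔
      A.valuation (f a) = A.valuation (f b) := by
  rw [le_antisymm_iff, le_antisymm_iff, valuation_comap_le_iff, valuation_comap_le_iff]

theorem mem_algebraicClosure_of_mem_Qbar (H : IntermediateField ℚ_[p] Ω) {e : Ω}
    (he : e ∈ Qbar p Ω) : e ∈ algebraicClosure H Ω :=
  mem_algebraicClosure_iff.2 ((mem_algebraicClosure_iff.1 he).tower_top H)

theorem valuation_lt_one_iff_of_mem_iff {F : Type*} [Field F] (A : ValuationSubring F) (τ : F ≃+* F)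
    (h : ∀ t, t ∈ A ↔ τ t ∈ A) (t : F) : A.valuation t < 1 ↔ A.valuation (τ t) < 1 := by
  rcases eq_or_ne t 0 with rfl | h0
  · simp
  rw [valuation_lt_one_iff_inv_not_mem A h0,
    valuation_lt_one_iff_inv_not_mem A ((map_ne_zero τ).2 h0), ← map_inv₀, ← h]

variable [IsAlgClosed Ω]

/-- An automorphism of the algebraic closure of `H` agrees on `Qbar` with an automorphism
over `L`. -/
theorem Good.exists_fixes_eq (h : Good k L) (hk : k ≤ H)
    (τ : algebraicClosure H Ω ≃ₐ[H] algebraicClosure H Ω) :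
    ∃ σ : Ω ≃ₐ[ℚ_[p]] Ω, Fixes L σ ∧
      ∀ t : algebraicClosure H Ω, (t : Ω) ∈ Qbar p Ω → σ t = τ t := by
  let ι : Qbar p Ω →ₐ[ℚ_[p]] algebraicClosure H Ω :=
    { toFun := fun e => ⟨e, mem_algebraicClosure_of_mem_Qbar H e.2⟩
      map_one' := rfl
      map_zero' := rfl
      map_mul' := fun _ _ => rfl
      map_add' := fun _ _ => rfl
      commutes' := fun _ => rfl }
  let f : Qbar p Ω →ₐ[ℚ_[p]] Ω :=
    ((algebraicClosure H Ω).val.restrictScalars ℚ_[p]).comp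
      ((τ.toAlgHom.restrictScalars ℚ_[p]).comp ι)
  have : Normal ℚ_[p] (Qbar p Ω) := IsAlgClosure.normal _ _
  have hf : ∀ e, ((f.restrictNormal' (Qbar p Ω) e : Qbar p Ω) : Ω) = τ (ι e) := fun e =>
    f.restrictNormal_commutes (Qbar p Ω) e
  obtain ⟨σ, hσ, hσe⟩ := h.exists_lift (f.restrictNormal' (Qbar p Ω)) fun e he => by
    apply Subtype.ext
    rw [hf]
    have : ι e = algebraMap H _ ⟨e, hk he⟩ := rfl
    rw [this, τ.commutes]
    rfl
  exact ⟨σ, hσ, fun t ht => (hσe ⟨t, ht⟩).trans (hf _)⟩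

/-- If no proper orbit average of `y` obstructs it, the specialization of `y` stays in `L`. -/
theorem IsPlace.eventually_mem (hV : IsPlace k L V) (hk : k ≤ H) (hH : H ≤ L)
    {ψ : algebraicClosure H Ω →+* (𝒰 : Filter I).Germ Ω}
    (hψ : ∀ t : H, ∃ q : I → Ω, (∀ i, q i ∈ L) ∧ ψ (algebraMap H _ t) = ↑q)
    (hψV : ∀ t : algebraicClosure H Ω, (t : Ω) ∈ V ↔ ψ t ∈ hV.germRing 𝒰)
    {y : algebraicClosure H Ω} (hy : (y : Ω) ∈ L) {R : Finset Ω}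
    (hR : ∀ τ : algebraicClosure H Ω ≃ₐ[H] algebraicClosure H Ω, (τ y : Ω) ∈ R)
    (hZ : ∀ S ⊆ R, y - (S.card : Ω)⁻¹ * ∑ s ∈ S, s ≠ 0 →
      ∃ h ∈ H, V.valuation h = V.valuation (y - (S.card : Ω)⁻¹ * ∑ s ∈ S, s))
    {w : I → Ω} (hw : ψ y = ↑w) : ∀ᶠ i in (𝒰 : Filter I), w i ∈ L := by
  classical
  let N := algebraicClosure H Ω
  rcases Ultrafilter.em 𝒰 (fun i => w i ∈ L) with h1 | h1
  · exact h1
  exfalso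
  have := charZero_of_padic p Ω
  have : CharZero H := charZero_of_injective_algebraMap (algebraMap ℚ_[p] H).injective
  have : CharZero N := charZero_of_injective_algebraMap (algebraMap ℚ_[p] N).injective
  have : Normal H N := IsAlgClosure.normal _ _
  have hg : ∀ i, ∃ σ : Ω ≃ₐ[ℚ_[p]] Ω, Fixes L σ ∧ (w i ∉ L → σ (w i) ≠ w i) := by
    intro i
    by_cases hi : w i ∈ L
    · exact ⟨.refl, fun _ _ => rfl, fun h => absurd hi h⟩
    · by_contra! hcon
      exact hi (hV.good.mem_of_fixed fun σ hσ => (hcon σ hσ).2)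
  choose g hgL hgw using hg
  obtain ⟨τ, hτ⟩ := exists_algEquiv_of_ringHom (K := H) ψ
    (germMap 𝒰 fun i => RingEquiv.toRingHom (g i).toRingEquiv) (by
      intro t
      obtain ⟨q, hq, hqt⟩ := hψ t
      rw [hqt, germMap_coe]
      congr 1
      funext i
      exact hgL i _ (hq i))
  have hτy : τ y ≠ y := by
    intro h0
    have h2 := hτ y
    rw [h0, hw, germMap_coe] at h2
    have h3 : ∀ᶠ i in (𝒰 : Filter I), w i = g i (w i) := Filter.Germ.coe_eq.1 h2
    obtain ⟨i, hi, hi'⟩ := (h1.and h3).exists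
    exact hgw i hi hi'.symm
  have hτV : ∀ t : N, (t : Ω) ∈ V ↔ (τ t : Ω) ∈ V := by
    intro t
    rw [hψV, hψV, hτ]
    induction ψ t using Filter.Germ.inductionOn with | _ f
    rw [germMap_coe, hV.mem_germRing, hV.mem_germRing]
    refine exists_congr fun C => Filter.eventually_congr (.of_forall fun i => ?_)
    refine ⟨hV.residueLE_map (hgL i), fun h => ?_⟩
    have h2 : ResidueLE (p := p) V C ((g i).symm (g i (f i))) := hV.residueLE_map (hgL i).symm h
    rwa [AlgEquiv.symm_apply_apply] at h2
  obtain ⟨σ, hσL, hσ⟩ := hV.good.exists_fixes_eq hk τ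
  obtain ⟨ρ, hρ⟩ := exists_algEquiv_of_ringHom (K := H) (algebraMap N Ω)
    (RingEquiv.toRingHom σ.toRingEquiv) fun t => hσL _ (hH t.2)
  have hρ' : ∀ t : N, (ρ t : Ω) = σ t := hρ
  have hτ' : ∀ t, (σ ((τ.trans ρ.symm) t : N) : Ω) = τ t := fun t => by
    rw [← hρ']
    change ((ρ (ρ.symm (τ t)) : N) : Ω) = _
    rw [ρ.apply_symm_apply]
  have hne : (τ.trans ρ.symm) y ≠ y := by
    intro h0
    have h2 := hτ' y
    rw [h0, hσL _ hy] at h2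
    exact hτy (Subtype.ext h2.symm)
  let A : ValuationSubring N := V.comap (algebraMap N Ω)
  have hσV : ∀ t : N, V.valuation (t : Ω) < 1 ↔ V.valuation ((τ.trans ρ.symm) t : Ω) < 1 := by
    intro t
    rw [← hV.valuation_map_lt_one hσL (x := ((τ.trans ρ.symm) t : N)), hτ']
    have h2 := valuation_lt_one_iff_of_mem_iff A τ.toRingEquiv hτV t
    rwa [← map_one A.valuation, valuation_comap_lt_iff, valuation_comap_lt_iff, map_one,
      map_one] at h2
  have hσQ : ∀ t : N, (t : Ω) ∈ Qbar p Ω → (τ.trans ρ.symm) t = t := by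
    intro t ht
    have h2 := hτ' t
    rw [← hσ t ht] at h2
    exact Subtype.ext (σ.injective h2)
  have hRj : ∀ j : ℕ, ((((τ.trans ρ.symm) ^ j) y : N) : Ω) ∈ R := fun j => hR _
  generalize τ.trans ρ.symm = μ at hne hσV hσQ hRj
  have hfin : (Set.range fun j : ℕ => (μ ^ j) y).Finite := by
    refine Set.Finite.of_finite_image (f := fun t : N => (t : Ω))
      (R.finite_toSet.subset ?_) Subtype.val_injective.injOn
    rintro _ ⟨_, ⟨j, rfl⟩, rfl⟩
    exact hRj j
  refine hne (map_eq_self_of_finite_orbit A μ (fun t ht => ?_) (fun n hn => ?_) (fun u hu => ?_)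
    hfin.coe_toFinset fun hz => ?_)
  · rw [← map_one A.valuation, valuation_comap_lt_iff, map_one, map_one] at ht ⊢
    exact (hσV t).1 ht
  · rw [← map_one A.valuation, valuation_comap_eq_iff, map_one, map_one, map_natCast]
    exact hV.valuation_Qbar (natCast_mem_Qbar n) (Nat.cast_ne_zero.2 hn)
  · rw [← map_one A.valuation, valuation_comap_eq_iff, map_one, map_one] at hu
    obtain ⟨e, he, hue⟩ := hV.exists_residue ((V.valuation_le_one_iff _).1 hu.le)
    refine ⟨⟨e, mem_algebraicClosure_of_mem_Qbar H he⟩, hσQ _ he, ?_⟩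
    rw [← map_one A.valuation, valuation_comap_lt_iff, map_one, map_one]
    exact hue
  · set S := hfin.toFinset with hS
    have hcoe : (((y - (S.card : N)⁻¹ * ∑ s ∈ S, s : N)) : Ω) =
        y - ((S.map ⟨_, Subtype.val_injective⟩ : Finset Ω).card : Ω)⁻¹ *
          ∑ s ∈ S.map ⟨_, Subtype.val_injective⟩, s := by
      rw [Finset.card_map, Finset.sum_map]
      change algebraMap N Ω (y - (S.card : N)⁻¹ * ∑ s ∈ S, s) = _
      rw [map_sub, map_mul, map_inv₀, map_natCast, map_sum]
      rfl
    obtain ⟨h, hh, hval⟩ := hZ (S.map ⟨_, Subtype.val_injective⟩) (fun r hr => by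
      obtain ⟨t, ht, rfl⟩ := Finset.mem_map.1 hr
      obtain ⟨j, rfl⟩ := hfin.mem_toFinset.1 ht
      exact hRj j) (by
        rw [← hcoe]
        exact fun h0 => hz (Subtype.ext h0))
    refine ⟨⟨h, hh⟩, (valuation_comap_eq_iff V (algebraMap N Ω)).2 ?_⟩
    rw [← hcoe] at hval
    exact hval

end Specialization

section Specialization
open scoped Polynomial
open Polynomial (aeval)
variable {p : ℕ} [Fact p.Prime] {Ω : Type*} [Field Ω] [Algebra ℚ_[p] Ω]
  {I : Type*} {𝒰 : Ultrafilter I} {k L M : IntermediateField ℚ_[p] Ω} {V : ValuationSubring Ω}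

theorem eventually_isAlgebraic {H N : Type*} [Field H] [Field N] [Algebra H N]
    {ψ : N →+* (𝒰 : Filter I).Germ Ω}
    (hψ : ∀ t : H, ∃ q : I → M, ψ (algebraMap H N t) = ↑(fun i => (q i : Ω))) {y : N}
    (hy : IsAlgebraic H y) {w : I → Ω} (hw : ψ y = ↑w) :
    ∀ᶠ i in (𝒰 : Filter I), IsAlgebraic M (w i) := by
  obtain ⟨P, hP0, hPy⟩ := hy
  choose q hq using hψ
  have h1 : ∀ᶠ i in (𝒰 : Filter I), (q P.leadingCoeff i : Ω) ≠ 0 := by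
    rcases Ultrafilter.em 𝒰 (fun i => (q P.leadingCoeff i : Ω) = 0) with h1 | h1
    · exfalso
      have h2 : ψ (algebraMap H N P.leadingCoeff) = 0 := by
        rw [hq]
        exact Filter.Germ.coe_eq.2 h1
      exact hP0 (by simpa using h2)
    · exact h1
  have h2 : ∀ᶠ i in (𝒰 : Filter I),
      ∑ m ∈ Finset.range (P.natDegree + 1), (q (P.coeff m) i : Ω) * w i ^ m = 0 := by
    refine Filter.Germ.coe_eq.1 (?_ : ((fun i => ∑ m ∈ Finset.range (P.natDegree + 1),
      (q (P.coeff m) i : Ω) * w i ^ m : I → Ω) : (𝒰 : Filter I).Germ Ω) = 0)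
    have h3 := congrArg ψ hPy
    rw [Polynomial.aeval_eq_sum_range, map_zero, map_sum] at h3
    rw [← h3]
    have h4 := map_sum (Filter.Germ.coeRingHom (𝒰 : Filter I) : (I → Ω) →+* _)
      (fun m i => (q (P.coeff m) i : Ω) * w i ^ m) (Finset.range (P.natDegree + 1))
    rw [Finset.sum_fn] at h4
    refine h4.trans (Finset.sum_congr rfl fun m _ => ?_)
    rw [Algebra.smul_def, map_mul, map_pow, hq, hw]
    rfl
  filter_upwards [h1, h2] with i hi1 hi2
  refine ⟨∑ m ∈ Finset.range (P.natDegree + 1),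
    Polynomial.C (q (P.coeff m) i) * Polynomial.X ^ m, fun h0 => hi1 ?_, ?_⟩
  · have h3 := congrArg (fun f => Polynomial.coeff f P.natDegree) h0
    simp only [Polynomial.finsetSum_coeff, Polynomial.coeff_C_mul_X_pow,
      Polynomial.coeff_zero] at h3
    rw [Finset.sum_ite_eq, if_pos (Finset.self_mem_range_succ _)] at h3
    rw [Polynomial.leadingCoeff, h3, ZeroMemClass.coe_zero]
  · rw [map_sum, ← hi2]
    refine Finset.sum_congr rfl fun m _ => ?_
    rw [map_mul, map_pow, Polynomial.aeval_C, Polynomial.aeval_X]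
    rfl

theorem exists_mem_of_eventually {n : ℕ} {y : Fin n → Ω} {w : Fin n → I → Ω}
    (hw : ∀ j, ∀ᶠ i in (𝒰 : Filter I), w j i ∈ M)
    (h : ∀ f : MvPolynomial (Fin n) M, MvPolynomial.aeval y f = 0 →
      ∀ᶠ i in (𝒰 : Filter I), MvPolynomial.aeval (fun j => w j i) f = 0) :
    ∃ y' : Fin n → Ω, (∀ j, y' j ∈ M) ∧
      ∀ f : MvPolynomial (Fin n) M, MvPolynomial.aeval y f = 0 → MvPolynomial.aeval y' f = 0 := by
  obtain ⟨S, hS⟩ : (RingHom.ker (MvPolynomial.aeval (R := M) y)).FG :=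
    IsNoetherian.noetherian _
  have h1 : ∀ᶠ i in (𝒰 : Filter I), ∀ f ∈ S, MvPolynomial.aeval (fun j => w j i) f = 0 := by
    rw [Filter.eventually_all_finset]
    exact fun f hf => h f (by
      have : f ∈ RingHom.ker (MvPolynomial.aeval (R := M) y) := hS ▸ Submodule.subset_span hf
      exact this)
  obtain ⟨i, hi1, hi2⟩ := (h1.and (Filter.eventually_all.2 hw)).exists
  refine ⟨fun j => w j i, hi2, fun f hf => ?_⟩
  have h2 : RingHom.ker (MvPolynomial.aeval (R := M) y) ≤
      RingHom.ker (MvPolynomial.aeval (R := M) fun j => w j i) := by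
    rw [← hS, Submodule.span_le]
    exact hi1
  exact h2 hf

theorem IsPlace.exists_specialization_of_ringHom [IsAlgClosed Ω] (hV : IsPlace k L V)
    {H : IntermediateField ℚ_[p] Ω} (hk : k ≤ H) (hMH : M ≤ H) (hH : H ≤ L)
    (hrac : ∀ t ∈ L, IsAlgebraic M t → t ∈ M) {φ : H →+* (𝒰 : Filter I).Germ Ω}
    (hφV : ∀ t : H, (t : Ω) ∈ V ↔ φ t ∈ hV.germRing 𝒰)
    (hφ : ∀ t : H, ∃ q : I → M, φ t = ↑(fun i => (q i : Ω)))
    (hφM : ∀ c : M, φ ⟨c, hMH c.2⟩ = ↑(fun _ : I => (c : Ω)))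
    {n : ℕ} {y : Fin n → Ω} (hyL : ∀ j, y j ∈ L) (hy : ∀ j, IsAlgebraic H (y j))
    {R : Fin n → Finset Ω} (hR : ∀ j, ∀ t ∈ (minpoly H (y j)).rootSet Ω, t ∈ R j)
    (hZ : ∀ j, ∀ S ⊆ R j, y j - (S.card : Ω)⁻¹ * ∑ s ∈ S, s ≠ 0 →
      ∃ h ∈ H, V.valuation h = V.valuation (y j - (S.card : Ω)⁻¹ * ∑ s ∈ S, s)) :
    ∃ y' : Fin n → Ω, (∀ j, y' j ∈ M) ∧
      ∀ f : MvPolynomial (Fin n) M, MvPolynomial.aeval y f = 0 → MvPolynomial.aeval y' f = 0 := by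
  let N := algebraicClosure H Ω
  have := isAlgClosed_germ 𝒰 Ω
  have := charZero_of_padic p Ω
  have : CharZero H := charZero_of_injective_algebraMap (algebraMap ℚ_[p] H).injective
  have : IsGalois H N := IsAlgClosure.isGalois _ _
  obtain ⟨ψ, hψ, hψV⟩ := exists_ringHom_mem_iff (N := N) φ (V.comap (algebraMap N Ω))
    (hV.germRing 𝒰) hφV
  let yN : Fin n → N := fun j => ⟨y j, mem_algebraicClosure_iff.2 (hy j)⟩
  have hw : ∀ j, ∃ w : I → Ω, ψ (yN j) = ↑w := fun j => by
    induction ψ (yN j) using Filter.Germ.inductionOn with | _ f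
    exact ⟨f, rfl⟩
  choose w hw using hw
  have hφ' : ∀ t : H, ∃ q : I → M, ψ (algebraMap H N t) = ↑(fun i => (q i : Ω)) := fun t => by
    obtain ⟨q, hq⟩ := hφ t
    exact ⟨q, (hψ t).trans hq⟩
  have hwM : ∀ j, ∀ᶠ i in (𝒰 : Filter I), w j i ∈ M := by
    intro j
    have hwL := hV.eventually_mem hk hH (fun t => by
      obtain ⟨q, hq⟩ := hφ' t
      exact ⟨_, fun i => hH (hMH (q i).2), hq⟩) hψV (hyL j) (R := R j) (fun τ => hR j _ (by
        rw [Polynomial.mem_rootSet]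
        refine ⟨minpoly.ne_zero (hy j).isIntegral, ?_⟩
        have h1 : Polynomial.aeval (yN j) (minpoly H (y j)) = 0 := by
          apply Subtype.ext
          have := Polynomial.aeval_algebraMap_apply Ω (yN j) (minpoly H (y j))
          exact this.symm.trans (minpoly.aeval H (y j))
        have h2 := Polynomial.aeval_algebraMap_apply Ω (τ (yN j)) (minpoly H (y j))
        refine h2.trans ?_
        have h3 := Polynomial.aeval_algHom_apply τ.toAlgHom (yN j) (minpoly H (y j))
        rw [h1, map_zero] at h3
        exact (congrArg _ h3).trans (map_zero _))) (hZ j) (hw j)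
    have halg : IsAlgebraic H (yN j) :=
      (isAlgebraic_algebraMap_iff (algebraMap N Ω).injective).1 (hy j)
    filter_upwards [hwL, eventually_isAlgebraic hφ' halg (hw j)] with i hi1 hi2
    exact hrac _ hi1 hi2
  refine exists_mem_of_eventually hwM fun f hf => ?_
  let a : MvPolynomial (Fin n) M →+* (𝒰 : Filter I).Germ Ω :=
    ψ.comp (MvPolynomial.eval₂Hom
      ((algebraMap H N).comp (IntermediateField.inclusion hMH).toRingHom) yN)
  let b : MvPolynomial (Fin n) M →+* (𝒰 : Filter I).Germ Ω :=
    (Filter.Germ.coeRingHom (𝒰 : Filter I)).comp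
      (RingHom.pi fun i => (MvPolynomial.aeval (R := M) fun j => w j i).toRingHom)
  have hab : a = b := by
    refine MvPolynomial.ringHom_ext (fun c => ?_) fun j => ?_
    · change ψ (MvPolynomial.eval₂Hom _ _ (MvPolynomial.C c)) =
        ↑(fun i : I => MvPolynomial.aeval (fun j => w j i) (MvPolynomial.C (σ := Fin n) c))
      rw [MvPolynomial.eval₂Hom_C]
      simp only [MvPolynomial.aeval_C]
      exact (hψ _).trans (hφM c)
    · change ψ (MvPolynomial.eval₂Hom _ _ (MvPolynomial.X j)) =
        ↑(fun i : I => MvPolynomial.aeval (R := M) (fun j => w j i) (MvPolynomial.X j))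
      rw [MvPolynomial.eval₂Hom_X']
      simp only [MvPolynomial.aeval_X]
      exact hw j
  have h1 : a f = 0 := by
    refine (congrArg ψ (?_ : _ = (0 : N))).trans (map_zero ψ)
    apply Subtype.ext
    have h2 := MvPolynomial.hom_eval₂ f
      ((algebraMap H N).comp (IntermediateField.inclusion hMH).toRingHom) (algebraMap N Ω) yN
    exact h2.trans hf
  rw [hab] at h1
  exact Filter.Germ.coe_eq.1 h1

/-- The elements of `L` algebraic over `M(x)` specialize into `M`. -/
theorem IsPlace.exists_specialization [IsAlgClosed Ω] (hV : IsPlace k L V) (hk : k ≤ M)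
    (hM : M ≤ L)
    (hrac : ∀ t ∈ L, IsAlgebraic M t → t ∈ M) {x : Ω} (hxL : x ∈ L) (hx : Transcendental M x)
    {x' : I → Ω} (hx' : ∀ i, x' i ∈ M) (h : Approximates 𝒰 V M x x') {n : ℕ} {y : Fin n → Ω}
    (hyL : ∀ j, y j ∈ L)
    (hy : ∀ j, IsAlgebraic ((IntermediateField.adjoin M {x}).restrictScalars ℚ_[p]) (y j))
    {R : Fin n → Finset Ω}
    (hR : ∀ j, ∀ t ∈ (minpoly ((IntermediateField.adjoin M {x}).restrictScalars ℚ_[p])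
      (y j)).rootSet Ω, t ∈ R j)
    (hZ : ∀ j, ∀ S ⊆ R j, y j - (S.card : Ω)⁻¹ * ∑ s ∈ S, s ≠ 0 →
      ∃ h ∈ IntermediateField.adjoin M {x},
        V.valuation h = V.valuation (y j - (S.card : Ω)⁻¹ * ∑ s ∈ S, s)) :
    ∃ y' : Fin n → Ω, (∀ j, y' j ∈ M) ∧
      ∀ f : MvPolynomial (Fin n) M, MvPolynomial.aeval y f = 0 → MvPolynomial.aeval y' f = 0 := by
  obtain ⟨φ, hφ⟩ := h.exists_ringHom hx
  have hMH : M ≤ (IntermediateField.adjoin M {x}).restrictScalars ℚ_[p] := fun c hc =>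
    (IntermediateField.adjoin M {x}).algebraMap_mem ⟨c, hc⟩
  refine hV.exists_specialization_of_ringHom (hk.trans hMH) hMH
    (adjoin_restrictScalars_le hM hxL) hrac (hV.mem_iff_of_approximates hk hM hxL h hφ)
    (fun t => ?_) (fun c => ?_) hyL hy hR hZ
  · obtain ⟨f, g, hfg⟩ := (IntermediateField.mem_adjoin_simple_iff M _).1 t.2
    refine ⟨fun i => aeval (⟨x' i, hx' i⟩ : M) f / aeval (⟨x' i, hx' i⟩ : M) g, ?_⟩
    rw [hφ t f g hfg]
    congr 1
    funext i
    rw [IntermediateField.coe_div]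
    congr 1 <;> exact Polynomial.aeval_algebraMap_apply Ω (⟨x' i, hx' i⟩ : M) _
  · rw [hφ _ (Polynomial.C c) 1 (by simp [IntermediateField.algebraMap_apply])]
    simp [IntermediateField.algebraMap_apply]

end Specialization

section MonomialDomination
open scoped Polynomial
open Polynomial (aeval)
variable {K Ω Γ : Type*} [Field K] [Field Ω] [Algebra K Ω] [LinearOrderedCommGroupWithZero Γ]
  (v : Valuation Ω Γ)

theorem exists_dominant_or_exists_eq {f : K[X]} (hf : f ≠ 0) {t : Ω} (ht : t ≠ 0) :
    (∃ j, f.coeff j ≠ 0 ∧ ∀ i, i ≠ j →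
      v (algebraMap K Ω (f.coeff i) * t ^ i) < v (algebraMap K Ω (f.coeff j) * t ^ j)) ∨
    ∃ i j, i < j ∧ f.coeff i ≠ 0 ∧ f.coeff j ≠ 0 ∧
      v (algebraMap K Ω (f.coeff i) * t ^ i) = v (algebraMap K Ω (f.coeff j) * t ^ j) := by
  obtain ⟨j, hj, hmax⟩ := f.support.exists_max_image
    (fun i => v (algebraMap K Ω (f.coeff i) * t ^ i)) (Polynomial.support_nonempty.2 hf)
  have hj0 := Polynomial.mem_support_iff.1 hj
  have hpos : 0 < v (algebraMap K Ω (f.coeff j) * t ^ j) :=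
    zero_lt_iff.2 ((_root_.map_ne_zero _).2
      (mul_ne_zero ((_root_.map_ne_zero _).2 hj0) (pow_ne_zero _ ht)))
  by_cases h : ∀ i, i ≠ j →
      v (algebraMap K Ω (f.coeff i) * t ^ i) < v (algebraMap K Ω (f.coeff j) * t ^ j)
  · exact Or.inl ⟨j, hj0, h⟩
  push Not at h
  obtain ⟨i, hij, hle⟩ := h
  have hi0 : f.coeff i ≠ 0 := by
    intro h0
    rw [h0, map_zero, zero_mul, map_zero] at hle
    exact hle.not_gt hpos
  have heq := le_antisymm (hmax i (Polynomial.mem_support_iff.2 hi0)) hle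
  rcases lt_or_gt_of_ne hij with hlt | hlt
  · exact Or.inr ⟨i, j, hlt, hi0, hj0, heq⟩
  · exact Or.inr ⟨j, i, hlt, hj0, hi0, heq.symm⟩

theorem valuation_aeval_eq_of_dominant {f : K[X]} {t : Ω} {j : ℕ} (hj : f.coeff j ≠ 0)
    (h : ∀ i, i ≠ j →
      v (algebraMap K Ω (f.coeff i) * t ^ i) < v (algebraMap K Ω (f.coeff j) * t ^ j)) :
    v (aeval t f) = v (algebraMap K Ω (f.coeff j) * t ^ j) := by
  rw [Polynomial.aeval_eq_sum_range]
  simp only [Algebra.smul_def]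
  refine v.map_sum_eq_of_lt (Finset.mem_range_succ_iff.2 (Polynomial.le_natDegree_of_ne_zero hj))
    fun i hi => h i ?_
  simpa using (Finset.mem_sdiff.1 hi).2

theorem valuation_pow_sub_eq {a b t : Ω} (hb : b ≠ 0) (ht : t ≠ 0) {i j : ℕ}
    (hij : i < j) (h : v (a * t ^ i) = v (b * t ^ j)) : v t ^ (j - i) = v (a / b) := by
  rw [map_div₀, eq_div_iff ((_root_.map_ne_zero _).2 hb),
    ← mul_right_inj' (pow_ne_zero i ((_root_.map_ne_zero v).2 ht)), ← mul_assoc, ← pow_add,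
    Nat.add_sub_cancel' hij.le, mul_comm _ (v b), mul_comm _ (v a), ← map_pow, ← map_pow,
    ← map_mul, ← map_mul, h]

/-- Algebraic extensions are torsion on value groups. -/
theorem exists_valuation_pow_eq {z : Ω} (hz : z ≠ 0) (halg : IsAlgebraic K z) :
    ∃ m, m ≠ 0 ∧ ∃ h : K, h ≠ 0 ∧ v z ^ m = v (algebraMap K Ω h) := by
  obtain ⟨f, hf, hfz⟩ := halg
  rcases exists_dominant_or_exists_eq v hf hz with ⟨j, hj, h⟩ | ⟨i, j, hij, hi, hj, h⟩
  · have h1 := valuation_aeval_eq_of_dominant v hj h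
    rw [hfz, map_zero] at h1
    exact absurd h1.symm ((_root_.map_ne_zero _).2
      (mul_ne_zero ((_root_.map_ne_zero _).2 hj) (pow_ne_zero _ hz)))
  · refine ⟨j - i, (Nat.sub_pos_of_lt hij).ne', f.coeff i / f.coeff j, div_ne_zero hi hj, ?_⟩
    rw [map_div₀]
    exact valuation_pow_sub_eq v ((_root_.map_ne_zero _).2 hj) hz
      hij h

end MonomialDomination

namespace IsPlace
variable {p : ℕ} [Fact p.Prime] {Ω : Type*} [Field Ω] [Algebra ℚ_[p] Ω]
  {k L M : IntermediateField ℚ_[p] Ω} {V : ValuationSubring Ω}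

theorem valuation_map_le_iff (hV : IsPlace k L V) {σ : Ω ≃ₐ[ℚ_[p]] Ω} (hσ : Fixes L σ) {a b : Ω} :
    V.valuation (σ a) ≤ V.valuation (σ b) ↔ V.valuation a ≤ V.valuation b := by
  have : V.comap (σ : Ω →+* Ω) = V := by
    ext u
    exact hV.map_mem_iff hσ
  have h := valuation_comap_le_iff V (σ : Ω →+* Ω) (a := a) (b := b)
  rw [this] at h
  exact h.symm

theorem not_valuation_map_lt (hV : IsPlace k L V) {σ : Ω ≃ₐ[ℚ_[p]] Ω} (hσ : Fixes L σ) (u : Ω) :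
    ¬ V.valuation (σ u) < V.valuation u := by
  intro hlt
  have hanti : StrictAnti fun n : ℕ => V.valuation ((σ : Ω → Ω)^[n] u) := by
    refine strictAnti_nat_of_succ_lt fun n => ?_
    induction n with
    | zero => exact hlt
    | succ n ih =>
      simp only [Function.iterate_succ_apply' _ (n + 1), Function.iterate_succ_apply' _ n]
        at ih ⊢
      rw [← not_le, hV.valuation_map_le_iff hσ, not_le]
      exact ih
  obtain ⟨f, hf, hfu⟩ := hV.good.isAlgebraic u
  refine Set.infinite_range_of_injective (f := fun n : ℕ => (σ : Ω → Ω)^[n] u)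
    (fun a b hab => hanti.injective (congrArg V.valuation hab))
    ((f.rootSet_finite Ω).subset ?_)
  rintro _ ⟨n, rfl⟩
  rw [Polynomial.mem_rootSet_of_ne hf]
  have hstep : ∀ w : Ω, Polynomial.aeval w f = 0 → Polynomial.aeval (σ w) f = 0 := by
    intro w hw
    let σ' : Ω →ₐ[L] Ω := { (σ : Ω →+* Ω) with commutes' := fun l => hσ l l.2 }
    exact (Polynomial.aeval_algHom_apply σ' w f).trans (by rw [hw, map_zero])
  induction n with
  | zero => exact hfu
  | succ n ih =>
    simp only [Function.iterate_succ_apply']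
    exact hstep _ ih

theorem valuation_map (hV : IsPlace k L V) {σ : Ω ≃ₐ[ℚ_[p]] Ω} (hσ : Fixes L σ) (u : Ω) :
    V.valuation (σ u) = V.valuation u := by
  refine le_antisymm (not_lt.1 fun h => ?_) (not_lt.1 (hV.not_valuation_map_lt hσ u))
  refine hV.not_valuation_map_lt hσ.symm (σ u) ?_
  rwa [AlgEquiv.symm_apply_apply]

theorem valuation_natCast (hV : IsPlace k L V) {n : ℕ} (hn : n ≠ 0) :
    V.valuation (n : Ω) = 1 := by
  have := charZero_of_padic p Ω
  exact hV.valuation_Qbar (natCast_mem_Qbar n) (Nat.cast_ne_zero.2 hn)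

variable [IsAlgClosed Ω]

/-- The value group of a relatively algebraically closed subfield of `L` is divisible. -/
theorem exists_valuation_pow_eq_of_mem (hV : IsPlace k L V) (hk : k ≤ M) (hM : M ≤ L)
    (hrac : ∀ t ∈ L, IsAlgebraic M t → t ∈ M) {b : Ω} (hb : b ∈ M) (hb0 : b ≠ 0) {m : ℕ}
    (hm : m ≠ 0) : ∃ l ∈ M, l ≠ 0 ∧ V.valuation l ^ m = V.valuation b := by
  obtain ⟨c, hc, l, hl, hc0, hl0, rfl⟩ := hV.good.exists_eq_mul_pow (hM hb) hb0 hm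
  have hlm : l ^ m ∈ M := by
    have := div_mem hb (hk hc)
    rwa [mul_div_cancel_left₀ _ hc0] at this
  refine ⟨l, hrac l hl (IsAlgebraic.of_pow (Nat.pos_of_ne_zero hm)
    (isAlgebraic_algebraMap (⟨_, hlm⟩ : M))), hl0, ?_⟩
  rw [map_mul, map_pow, hV.valuation_Qbar (hV.good.le_Qbar hc) hc0, one_mul]

theorem exists_valuation_eq_of_pow_eq (hV : IsPlace k L V) (hk : k ≤ M) (hM : M ≤ L)
    (hrac : ∀ t ∈ L, IsAlgebraic M t → t ∈ M) {b z : Ω} (hb : b ∈ M) (hb0 : b ≠ 0) {m : ℕ}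
    (hm : m ≠ 0) (h : V.valuation z ^ m = V.valuation b) :
    ∃ l ∈ M, l ≠ 0 ∧ V.valuation l = V.valuation z := by
  obtain ⟨l, hl, hl0, hlb⟩ := hV.exists_valuation_pow_eq_of_mem hk hM hrac hb hb0 hm
  exact ⟨l, hl, hl0, (pow_left_inj₀ zero_le zero_le hm).1 (hlb.trans h.symm)⟩

/-- Elements of `L` are approximated by elements of `M` at least as well as by elements algebraic
over `M`. -/
theorem exists_valuation_sub_le (hV : IsPlace k L V) (hM : M ≤ L)
    (hrac : ∀ t ∈ L, IsAlgebraic M t → t ∈ M) {x : Ω} (hx : x ∈ L) {a : Ω}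
    (ha : IsAlgebraic M a) : ∃ b ∈ M, V.valuation (x - b) ≤ V.valuation (x - a) := by
  have := charZero_of_padic p Ω
  have hint : IsIntegral L a := (hV.good.isAlgebraic a).isIntegral
  have hnorm : Normal L Ω := by
    refine normal_iff.2 fun u => ⟨(hV.good.isAlgebraic u).isIntegral, IsAlgClosed.splits _⟩
  set P := (minpoly L a).map (algebraMap L Ω) with hP
  have hPm : P.Monic := (minpoly.monic hint).map _
  set n := (minpoly L a).natDegree with hn
  have hn0 : n ≠ 0 := (minpoly.natDegree_pos hint).ne'
  have hroots : ∀ r ∈ P.roots, IsAlgebraic M r ∧ V.valuation (x - r) = V.valuation (x - a) := by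
    intro r hr
    have hr' : Polynomial.aeval r (minpoly L a) = 0 := by
      rw [Polynomial.mem_roots hPm.ne_zero, Polynomial.IsRoot, Polynomial.eval_map] at hr
      exact hr
    obtain ⟨σ, hσ⟩ := minpoly.exists_algEquiv_of_root' (hV.good.isAlgebraic a) hr'
    let σ' : Ω ≃ₐ[ℚ_[p]] Ω := σ.restrictScalars ℚ_[p]
    have hσ' : Fixes L σ' := fun l hl => σ.commutes ⟨l, hl⟩
    constructor
    · obtain ⟨f, hf, hfa⟩ := ha
      refine ⟨f, hf, ?_⟩
      let σM : Ω →ₐ[M] Ω := { (σ : Ω →+* Ω) with commutes' := fun l => hσ' l (hM l.2) }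
      rw [← hσ]
      exact (Polynomial.aeval_algHom_apply σM a f).trans (by rw [hfa, map_zero])
    · rw [← hV.valuation_map hσ' (x - a), map_sub σ', hσ' x hx]
      exact congrArg (fun t => V.valuation (x - t)) hσ.symm
  have hcard : P.roots.card = n := by
    rw [← (IsAlgClosed.splits P).natDegree_eq_card_roots, hP, Polynomial.natDegree_map]
  have hsumL : P.roots.sum ∈ L := by
    have h1 := (IsAlgClosed.splits P).nextCoeff_eq_neg_sum_roots_of_monic hPm
    rw [hP, Polynomial.nextCoeff_map (algebraMap L Ω).injective, ← hP] at h1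
    rw [← neg_neg P.roots.sum, ← h1]
    exact neg_mem (Subtype.prop _)
  have hsumA : IsAlgebraic M P.roots.sum := by
    refine mem_algebraicClosure_iff.1 (multiset_sum_mem _ fun r hr => ?_)
    exact mem_algebraicClosure_iff.2 (hroots r hr).1
  refine ⟨P.roots.sum / n, div_mem (hrac _ hsumL hsumA) (natCast_mem _ n), ?_⟩
  have hn0' : (n : Ω) ≠ 0 := Nat.cast_ne_zero.2 hn0
  have h1 : x - P.roots.sum / n = (P.roots.map fun r => x - r).sum / n := by
    rw [Multiset.sum_map_sub, Multiset.map_const', Multiset.sum_replicate, hcard,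
      Multiset.map_id', sub_div, nsmul_eq_mul, mul_div_cancel_left₀ _ hn0']
  rw [h1, map_div₀, hV.valuation_natCast hn0, div_one]
  have h2 : ∀ s : Multiset Ω, (∀ r ∈ s, V.valuation (x - r) = V.valuation (x - a)) →
      V.valuation (s.map fun r => x - r).sum ≤ V.valuation (x - a) := by
    intro s
    induction s using Multiset.induction_on with
    | empty => simp
    | cons r s ih =>
      intro hs
      rw [Multiset.map_cons, Multiset.sum_cons]
      exact (V.valuation.map_add _ _).trans (max_le (hs r (Multiset.mem_cons_self _ _)).le
        (ih fun r hr => hs r (Multiset.mem_cons_of_mem hr)))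
  exact h2 _ fun r hr => (hroots r hr).2

end IsPlace

section ImmediateApproximation
open scoped Polynomial
open Polynomial (aeval)

theorem Valuation.mul_sub_one_lt_one {R Γ : Type*} [Ring R] [LinearOrderedCommMonoidWithZero Γ]
    (v : Valuation R Γ) {s t : R} (hs : v (s - 1) < 1) (ht : v (t - 1) < 1) :
    v (s * t - 1) < 1 := by
  have ht1 : v t ≤ 1 := by
    rw [← sub_add_cancel t 1]
    exact (v.map_add _ _).trans (max_le ht.le v.map_one.le)
  have : s * t - 1 = (s - 1) * t + (t - 1) := by rw [sub_mul, one_mul, sub_add_sub_cancel]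
  rw [this]
  exact (v.map_add _ _).trans_lt (max_lt (by
    rw [map_mul]
    exact (mul_le_of_le_one_right' ht1).trans_lt hs) ht)

theorem Valuation.eq_of_div_sub_one_lt_one {R Γ : Type*} [Field R]
    [LinearOrderedCommGroupWithZero Γ] (v : Valuation R Γ) {s t : R} (ht : t ≠ 0)
    (h : v (s / t - 1) < 1) : v s = v t := by
  have h1 := v.map_one_add_of_lt h
  rw [add_sub_cancel, map_div₀] at h1
  exact (div_eq_one_iff_eq ((_root_.map_ne_zero v).2 ht)).1 h1

variable {p : ℕ} [Fact p.Prime] {Ω : Type*} [Field Ω] [Algebra ℚ_[p] Ω]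
  {k L M : IntermediateField ℚ_[p] Ω} {V : ValuationSubring Ω} {x : Ω}

/-- The filter of better and better approximations of `x` by elements of `M`. -/
def approxFilter (V : ValuationSubring Ω) (M : IntermediateField ℚ_[p] Ω) (x : Ω) : Filter M :=
  ⨅ b₀ : M, Filter.principal {b : M | V.valuation (x - b) < V.valuation (x - b₀)}

theorem eventually_approxFilter (b₀ : M) :
    ∀ᶠ b : M in approxFilter V M x, V.valuation (x - b) < V.valuation (x - b₀) :=
  Filter.mem_iInf_of_mem b₀ (Filter.mem_principal_self _)

theorem approxFilter_neBot
    (hA : ∀ b ∈ M, ∃ b' ∈ M, V.valuation (x - b') < V.valuation (x - b)) :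
    (approxFilter V M x).NeBot := by
  refine Filter.iInf_neBot_of_directed (fun a b => ?_) fun b => ?_
  · have key : ∀ a b : M, V.valuation (x - a) ≤ V.valuation (x - b) →
        Filter.principal {c : M | V.valuation (x - c) < V.valuation (x - a)} ≤
          Filter.principal {c : M | V.valuation (x - c) < V.valuation (x - b)} := fun a b hab =>
      Filter.principal_mono.2 fun c hc => lt_of_lt_of_le hc hab
    rcases le_total (V.valuation (x - a)) (V.valuation (x - b)) with h | h
    · exact ⟨a, le_rfl, key a b h⟩
    · exact ⟨b, key b a h, le_rfl⟩
  · obtain ⟨b', hb', h⟩ := hA b b.2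
    exact Filter.principal_neBot_iff.2 ⟨⟨b', hb'⟩, h⟩

theorem not_mem_of_no_best
    (hA : ∀ b ∈ M, ∃ b' ∈ M, V.valuation (x - b') < V.valuation (x - b)) : x ∉ M := by
  intro hx
  obtain ⟨b', -, h⟩ := hA x hx
  rw [sub_self, map_zero] at h
  exact not_lt_zero h

variable [IsAlgClosed Ω]

theorem IsPlace.eventually_aeval (hV : IsPlace k L V) (hM : M ≤ L)
    (hrac : ∀ t ∈ L, IsAlgebraic M t → t ∈ M) (hx : x ∈ L) (hxM : x ∉ M) {f : M[X]}
    (hf : f ≠ 0) : ∀ᶠ b : M in approxFilter V M x,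
      V.valuation (aeval (b : Ω) f) = V.valuation (aeval x f) := by
  have hne : ∀ a, IsAlgebraic M a → x - a ≠ 0 := fun a ha h0 =>
    hxM (hrac x hx (sub_eq_zero.1 h0 ▸ ha))
  have hlin : ∀ a, IsAlgebraic M a → ∀ᶠ b : M in approxFilter V M x,
      V.valuation ((b - a) / (x - a) - 1) < 1 := by
    intro a ha
    obtain ⟨b₀, hb₀, hle⟩ := hV.exists_valuation_sub_le hM hrac hx ha
    filter_upwards [eventually_approxFilter (⟨b₀, hb₀⟩ : M)] with b hb
    rw [div_sub_one (hne a ha), sub_sub_sub_cancel_right, map_div₀, V.valuation.map_sub_swap]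
    exact (div_lt_one₀ (zero_lt_iff.2 ((_root_.map_ne_zero _).2 (hne a ha)))).2
      (hb.trans_le hle)
  have hprod : ∀ s : Multiset Ω, (∀ a ∈ s, IsAlgebraic M a) → ∀ᶠ b : M in approxFilter V M x,
      V.valuation ((s.map fun a => ((b : Ω) - a) / (x - a)).prod - 1) < 1 := by
    intro s
    induction s using Multiset.induction_on with
    | empty => simp
    | cons a s ih =>
      intro hs
      filter_upwards [hlin a (hs a (Multiset.mem_cons_self _ _)),
        ih fun a ha => hs a (Multiset.mem_cons_of_mem ha)] with b h1 h2
      rw [Multiset.map_cons, Multiset.prod_cons]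
      exact V.valuation.mul_sub_one_lt_one h1 h2
  have hev : ∀ t : Ω, aeval t f = algebraMap M Ω f.leadingCoeff *
      (((f.map (algebraMap M Ω)).roots).map fun a => t - a).prod := by
    intro t
    have h1 := (IsAlgClosed.splits (f.map (algebraMap M Ω))).eval_eq_prod_roots t
    rwa [Polynomial.eval_map, Polynomial.leadingCoeff_map] at h1
  have halg : ∀ a ∈ (f.map (algebraMap M Ω)).roots, IsAlgebraic M a := by
    intro a ha
    refine ⟨f, hf, ?_⟩
    rw [Polynomial.mem_roots (Polynomial.map_ne_zero hf), Polynomial.IsRoot,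
      Polynomial.eval_map] at ha
    exact ha
  have hx0 : aeval x f ≠ 0 := fun h0 => hxM (hrac x hx ⟨f, hf, h0⟩)
  filter_upwards [hprod _ halg] with b hb
  refine V.valuation.eq_of_div_sub_one_lt_one hx0 ?_
  rwa [hev, hev, mul_div_mul_left _ _
    ((_root_.map_ne_zero _).2 (Polynomial.leadingCoeff_ne_zero.2 hf)), ← Multiset.prod_map_div]

theorem IsPlace.approximates_approxFilter (hV : IsPlace k L V) (hM : M ≤ L)
    (hrac : ∀ t ∈ L, IsAlgebraic M t → t ∈ M) (hx : x ∈ L) (hxM : x ∉ M)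
    {𝒰 : Ultrafilter M} (h𝒰 : (𝒰 : Filter M) ≤ approxFilter V M x) :
    Approximates 𝒰 V M x fun b => b := by
  intro f g hfg ε hε
  have hg0 : g ≠ 0 := by
    rintro rfl
    rw [map_zero, map_zero] at hfg
    exact not_lt_zero hfg
  have hgx : V.valuation (aeval x g) ≠ 0 := fun h0 => not_lt_zero (h0 ▸ hfg)
  have hf : ∀ᶠ b : M in approxFilter V M x,
      V.valuation (aeval (b : Ω) f) = V.valuation (aeval x f) := by
    rcases eq_or_ne f 0 with rfl | hf
    · simp
    · exact hV.eventually_aeval hM hrac hx hxM hf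
  filter_upwards [h𝒰 hf, h𝒰 (hV.eventually_aeval hM hrac hx hxM hg0)] with b h1 h2
  refine ⟨(_root_.map_ne_zero V.valuation).1 (h2 ▸ hgx), .of_valuation_lt_one ?_ hε.le⟩
  rw [map_div₀, h1, h2]
  exact (div_lt_one₀ (zero_lt_iff.2 hgx)).2 hfg

theorem IsPlace.exists_valuation_eq_of_no_best (hV : IsPlace k L V) (hk : k ≤ M) (hM : M ≤ L)
    (hrac : ∀ t ∈ L, IsAlgebraic M t → t ∈ M) (hx : x ∈ L)
    (hA : ∀ b ∈ M, ∃ b' ∈ M, V.valuation (x - b') < V.valuation (x - b)) {z : Ω} (hz : z ≠ 0)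
    (halg : IsAlgebraic ((IntermediateField.adjoin M {x}).restrictScalars ℚ_[p]) z) :
    ∃ l ∈ M, V.valuation l = V.valuation z := by
  have hxM := not_mem_of_no_best hA
  have := approxFilter_neBot hA
  obtain ⟨m, hm, h, h0, hzh⟩ := exists_valuation_pow_eq V.valuation hz halg
  obtain ⟨f, g, hfg⟩ := (IntermediateField.mem_adjoin_simple_iff M _).1 h.2
  have h0' : (h : Ω) ≠ 0 := fun h1 => h0 (Subtype.ext h1)
  have hf : f ≠ 0 := by
    rintro rfl
    exact h0' (by rw [hfg, map_zero, zero_div])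
  have hg : g ≠ 0 := by
    rintro rfl
    exact h0' (by rw [hfg, map_zero, div_zero])
  obtain ⟨b, hb1, hb2⟩ := ((hV.eventually_aeval hM hrac hx hxM hf).and
    (hV.eventually_aeval hM hrac hx hxM hg)).exists
  have hmem : ∀ q : M[X], aeval (b : Ω) q ∈ M := fun q => by
    rw [show (b : Ω) = algebraMap M Ω b from rfl, Polynomial.aeval_algebraMap_apply]
    exact Subtype.prop _
  have hval : V.valuation z ^ m = V.valuation (aeval (b : Ω) f / aeval (b : Ω) g) := by
    rw [hzh, map_div₀, hb1, hb2, ← map_div₀, ← hfg]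
    rfl
  obtain ⟨l, hl, -, hlz⟩ := hV.exists_valuation_eq_of_pow_eq hk hM hrac
    (div_mem (hmem f) (hmem g)) (fun h1 => pow_ne_zero m ((_root_.map_ne_zero V.valuation).2 hz) (by
      rw [hval, h1, map_zero])) hm hval
  exact ⟨l, hl, hlz⟩

end ImmediateApproximation

section RamifiedApproximation
open scoped Polynomial
open Polynomial (aeval)
variable {p : ℕ} [Fact p.Prime] {Ω : Type*} [Field Ω] [Algebra ℚ_[p] Ω]
  {k L M : IntermediateField ℚ_[p] Ω} {V : ValuationSubring Ω} {x : Ω}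

namespace IsPlace

theorem ne_zero_and_residueLE_inv_one_add (hV : IsPlace k L V) {s : Ω} {C : ℝ} (hC : C < 1)
    (hs : ResidueLE (p := p) V C s) : 1 + s ≠ 0 ∧ ResidueLE (p := p) V 1 (1 + s)⁻¹ := by
  obtain ⟨e, he, heC, hse⟩ := hs
  have he1 : nrm p (1 + e) = 1 := by
    rw [nrm_add_eq_left (one_mem _) he (by rw [nrm_one]; exact heC.trans_lt hC), nrm_one]
  have hmem : 1 + e ∈ Qbar p Ω := add_mem (one_mem _) he
  have hne : 1 + e ≠ 0 := by
    intro h0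
    rw [h0, nrm_zero] at he1
    exact zero_ne_one he1
  have hv := hV.valuation_Qbar hmem hne
  have hsub : V.valuation (1 + s - (1 + e)) < 1 := by rwa [add_sub_add_left_eq_sub]
  have hvs : V.valuation (1 + s) = 1 := by
    rw [← hv]
    exact V.valuation.map_eq_of_sub_lt (by rwa [hv])
  have hs0 : 1 + s ≠ 0 := by
    intro h0
    rw [h0, map_zero] at hvs
    exact zero_ne_one hvs
  refine ⟨hs0, (1 + e)⁻¹, inv_mem hmem, by rw [nrm_inv hmem, he1, inv_one], ?_⟩
  rwa [inv_sub_inv hs0 hne, map_div₀, map_mul, hv, hvs, mul_one, div_one, Valuation.map_sub_swap]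

theorem residueLE_sum {ι : Type*} (t : Finset ι) {f : ι → Ω} {C : ℝ} (hC : 0 ≤ C)
    (hf : ∀ i ∈ t, ResidueLE (p := p) V C (f i)) : ResidueLE (p := p) V C (∑ i ∈ t, f i) := by
  classical
  induction t using Finset.induction_on with
  | empty => exact .of_mem_Qbar (zero_mem _) (nrm_zero.trans_le hC)
  | insert a t ha ih =>
    rw [Finset.sum_insert ha, ← max_self C]
    exact (hf a (Finset.mem_insert_self _ _)).add
      (ih fun i hi => hf i (Finset.mem_insert_of_mem hi))

end IsPlace

/-- The filter of elements of `M` of valuation close to that of `x`, from above. -/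
def aboveFilter (V : ValuationSubring Ω) (M : IntermediateField ℚ_[p] Ω) (x : Ω) : Filter M :=
  ⨅ c₀ : {c : M // V.valuation x < V.valuation (c : Ω)}, Filter.principal
    {c : M | V.valuation x < V.valuation (c : Ω) ∧ V.valuation (c : Ω) ≤ V.valuation (c₀ : Ω)}

theorem eventually_aboveFilter {c₀ : Ω} (hc₀ : c₀ ∈ M) (h : V.valuation x < V.valuation c₀) :
    ∀ᶠ c : M in aboveFilter V M x, V.valuation (c : Ω) ≤ V.valuation c₀ :=
  Filter.mem_iInf_of_mem (⟨⟨c₀, hc₀⟩, h⟩ : {c : M // V.valuation x < V.valuation (c : Ω)})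
    fun _ hc => hc.2

theorem eventually_lt_aboveFilter (hx : V.valuation x < 1) :
    ∀ᶠ c : M in aboveFilter V M x, V.valuation x < V.valuation (c : Ω) :=
  Filter.mem_iInf_of_mem ⟨1, by simpa using hx⟩ fun _ hc => hc.1

theorem aboveFilter_neBot (hx : V.valuation x < 1) : (aboveFilter V M x).NeBot := by
  have : Nonempty {c : M // V.valuation x < V.valuation (c : Ω)} := ⟨1, by simpa using hx⟩
  refine Filter.iInf_neBot_of_directed' (fun a b => ?_) fun c =>
    Filter.principal_neBot_iff.2 ⟨c, c.2, le_rfl⟩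
  have key : ∀ a b : {c : M // V.valuation x < V.valuation (c : Ω)},
      V.valuation (a : Ω) ≤ V.valuation (b : Ω) →
      Filter.principal {c : M | V.valuation x < V.valuation (c : Ω) ∧
        V.valuation (c : Ω) ≤ V.valuation (a : Ω)} ≤
      Filter.principal {c : M | V.valuation x < V.valuation (c : Ω) ∧
        V.valuation (c : Ω) ≤ V.valuation (b : Ω)} := fun a b hab =>
    Filter.principal_mono.2 fun c hc => ⟨hc.1, hc.2.trans hab⟩
  rcases le_total (V.valuation (a : Ω)) (V.valuation (b : Ω)) with h | h
  · exact ⟨a, le_rfl, key a b h⟩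
  · exact ⟨b, key b a h, le_rfl⟩

theorem curry_atTop_neBot {α : Type*} (l : Filter α) [l.NeBot] :
    (l.curry (Filter.atTop : Filter ℕ)).NeBot := by
  refine Filter.neBot_iff.2 fun h => ?_
  have h1 : ∀ᶠ x in l.curry (Filter.atTop : Filter ℕ), False := by
    rw [h]
    exact Filter.eventually_bot
  rw [Filter.eventually_curry_iff] at h1
  simp only [Filter.eventually_const] at h1

variable [IsAlgClosed Ω]

theorem IsPlace.eventually_residueLE_monomial (hV : IsPlace k L V) (hk : k ≤ M) (hM : M ≤ L)
    (hrac : ∀ t ∈ L, IsAlgebraic M t → t ∈ M) (hx0 : x ≠ 0) (hx1 : V.valuation x < 1)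
    {a b : Ω} (ha : a ∈ M) (hb : b ∈ M) (hb0 : b ≠ 0)
    {i j : ℕ} (hlt : V.valuation (a * x ^ i) < V.valuation (b * x ^ j)) {ε : ℝ} (hε : 0 < ε) :
    ∀ᶠ c : M in aboveFilter V M x, ∀ᶠ n : ℕ in Filter.atTop, ResidueLE (p := p) V ε
      (a * ((c : Ω) * (p : Ω) ^ n) ^ i / (b * ((c : Ω) * (p : Ω) ^ n) ^ j)) := by
  have hp0 : (p : Ω) ≠ 0 := by
    have := charZero_of_padic p Ω
    exact Nat.cast_ne_zero.2 (Fact.out : p.Prime).ne_zero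
  have hvp : V.valuation (p : Ω) = 1 := hV.valuation_natCast (Fact.out : p.Prime).ne_zero
  have hvb : 0 < V.valuation b := zero_lt_iff.2 ((_root_.map_ne_zero _).2 hb0)
  have hvx : 0 < V.valuation x := zero_lt_iff.2 ((_root_.map_ne_zero _).2 hx0)
  rcases le_or_gt i j with hij | hij
  · filter_upwards [eventually_lt_aboveFilter hx1] with c hc
    refine .of_forall fun n => .of_valuation_lt_one ?_ hε.le
    have hvc : 0 < V.valuation (c : Ω) := hvx.trans hc
    obtain ⟨d, rfl⟩ := Nat.exists_eq_add_of_le hij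
    have h1 : V.valuation a < V.valuation b * V.valuation x ^ d := by
      rw [map_mul, map_mul, map_pow, map_pow, pow_add, mul_left_comm, mul_comm] at hlt
      exact lt_of_mul_lt_mul_left hlt zero_le
    have h2 : V.valuation a < V.valuation b * V.valuation (c : Ω) ^ d :=
      h1.trans_le (mul_le_mul_right (pow_le_pow_left₀ zero_le hc.le d) _)
    rw [map_div₀]
    refine (div_lt_one₀ ?_).2 ?_
    · simp only [map_mul, map_pow, hvp, one_pow, mul_one]
      exact mul_pos hvb (pow_pos hvc _)
    · simp only [map_mul, map_pow, hvp, one_pow, mul_one]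
      rw [pow_add, mul_left_comm, mul_comm]
      exact (mul_lt_mul_iff_right₀ (pow_pos hvc _)).2 h2
  · obtain ⟨d, hd0, rfl⟩ : ∃ d, d ≠ 0 ∧ i = j + d := ⟨i - j, by omega, by omega⟩
    rcases eq_or_ne a 0 with rfl | ha0
    · refine .of_forall fun c => .of_forall fun n => .of_valuation_lt_one ?_ hε.le
      simp
    obtain ⟨c₀, hc₀, hc₀0, hvc₀⟩ := hV.exists_valuation_pow_eq_of_mem hk hM hrac (div_mem hb ha)
      (div_ne_zero hb0 ha0) hd0
    have hva : 0 < V.valuation a := zero_lt_iff.2 ((_root_.map_ne_zero _).2 ha0)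
    have hxc₀ : V.valuation x < V.valuation c₀ := by
      refine (pow_lt_pow_iff_left₀ zero_le zero_le hd0).1 ?_
      rw [hvc₀, map_div₀, lt_div_iff₀ hva, mul_comm]
      rw [map_mul, map_mul, map_pow, map_pow, pow_add, mul_left_comm, mul_comm (V.valuation b)]
        at hlt
      exact lt_of_mul_lt_mul_left hlt zero_le
    filter_upwards [eventually_lt_aboveFilter hx1, eventually_aboveFilter hc₀ hxc₀] with c hc hc'
    have hc0 : (c : Ω) ≠ 0 := by
      intro h0
      rw [h0, map_zero] at hc
      exact not_lt_zero hc
    have ht : a / b * (c : Ω) ^ d ∈ V := by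
      rw [← V.valuation_le_one_iff, map_mul, map_div₀, map_pow]
      calc V.valuation a / V.valuation b * V.valuation (c : Ω) ^ d
          ≤ V.valuation a / V.valuation b * V.valuation c₀ ^ d :=
            mul_le_mul_right (pow_le_pow_left₀ zero_le hc' d) _
        _ = 1 := by
            rw [hvc₀, map_div₀, div_mul_div_cancel₀ hvb.ne', div_self hva.ne']
    obtain ⟨e, he, hte⟩ := hV.exists_residue ht
    have htend : Filter.Tendsto (fun n : ℕ => nrm p e * (nrm p (p : Ω) ^ d) ^ n) Filter.atTop
        (nhds (nrm p e * 0)) :=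
      (tendsto_pow_atTop_nhds_zero_of_lt_one (pow_nonneg (nrm_nonneg _) _)
        (pow_lt_one₀ (nrm_nonneg _) nrm_p_lt_one hd0)).const_mul _
    rw [mul_zero] at htend
    filter_upwards [htend.eventually (ge_mem_nhds hε)] with n hn
    have h1 : a * ((c : Ω) * (p : Ω) ^ n) ^ (j + d) / (b * ((c : Ω) * (p : Ω) ^ n) ^ j) =
        a / b * (c : Ω) ^ d * ((p : Ω) ^ d) ^ n := by
      have := pow_ne_zero j (mul_ne_zero hc0 (pow_ne_zero n hp0))
      rw [pow_add, mul_left_comm, mul_comm b, mul_div_mul_left _ _ this]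
      ring
    rw [h1]
    have hpm : (p : Ω) ∈ Qbar p Ω := natCast_mem_Qbar p
    refine (hV.residueLE_mul (C := nrm p e) (D := (nrm p (p : Ω) ^ d) ^ n) ⟨e, he, le_rfl, hte⟩
      (.of_mem_Qbar (pow_mem (pow_mem hpm d) n) ?_)).mono hn
    rw [nrm_pow (pow_mem hpm d), nrm_pow hpm]

theorem IsPlace.approximates_aboveFilter (hV : IsPlace k L V) (hk : k ≤ M) (hM : M ≤ L)
    (hrac : ∀ t ∈ L, IsAlgebraic M t → t ∈ M) (hx1 : V.valuation x < 1)
    (hB : ∀ m, m ≠ 0 → ∀ b ∈ M, V.valuation x ^ m ≠ V.valuation b) {𝒰 : Ultrafilter (M × ℕ)}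
    (h𝒰 : (𝒰 : Filter (M × ℕ)) ≤ (aboveFilter V M x).curry Filter.atTop) :
    Approximates 𝒰 V M x fun c => (c.1 : Ω) * (p : Ω) ^ c.2 := by
  have hx0 : x ≠ 0 := by
    rintro rfl
    exact hB 1 one_ne_zero 0 (zero_mem _) (pow_one _)
  have hdom : ∀ f : M[X], f ≠ 0 → ∃ j, f.coeff j ≠ 0 ∧ ∀ i, i ≠ j →
      V.valuation (algebraMap M Ω (f.coeff i) * x ^ i) <
        V.valuation (algebraMap M Ω (f.coeff j) * x ^ j) := by
    intro f hf
    refine (exists_dominant_or_exists_eq V.valuation hf hx0).resolve_right ?_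
    rintro ⟨i, j, hij, hi, hj, h⟩
    refine hB (j - i) (Nat.sub_pos_of_lt hij).ne' _ (div_mem (f.coeff i).2 (f.coeff j).2)
      (valuation_pow_sub_eq V.valuation ((_root_.map_ne_zero _).2 hj) hx0 hij h)
  intro f g hfg ε hε
  have hg0 : g ≠ 0 := by
    rintro rfl
    rw [map_zero, map_zero] at hfg
    exact not_lt_zero hfg
  obtain ⟨j, hj, hgj⟩ := hdom g hg0
  have hj0 : algebraMap M Ω (g.coeff j) ≠ 0 := (_root_.map_ne_zero _).2 hj
  rw [valuation_aeval_eq_of_dominant V.valuation hj hgj] at hfg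
  have hf : ∀ i, V.valuation (algebraMap M Ω (f.coeff i) * x ^ i) <
      V.valuation (algebraMap M Ω (g.coeff j) * x ^ j) := by
    rcases eq_or_ne f 0 with rfl | hf0
    · rw [map_zero, map_zero] at hfg
      intro i
      rwa [Polynomial.coeff_zero, map_zero, zero_mul, map_zero]
    obtain ⟨l, hl, hfl⟩ := hdom f hf0
    rw [valuation_aeval_eq_of_dominant V.valuation hl hfl] at hfg
    intro i
    rcases eq_or_ne i l with rfl | hi
    · exact hfg
    · exact (hfl i hi).trans hfg
  have key : ∀ (a : M) (i : ℕ), V.valuation (algebraMap M Ω a * x ^ i) <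
      V.valuation (algebraMap M Ω (g.coeff j) * x ^ j) → ∀ δ : ℝ, 0 < δ →
      ∀ᶠ c in (𝒰 : Filter (M × ℕ)), ResidueLE (p := p) V δ
        (algebraMap M Ω a * ((c.1 : Ω) * (p : Ω) ^ c.2) ^ i /
          (algebraMap M Ω (g.coeff j) * ((c.1 : Ω) * (p : Ω) ^ c.2) ^ j)) :=
    fun a i h δ hδ => h𝒰 (Filter.eventually_curry_iff.2
      (hV.eventually_residueLE_monomial hk hM hrac hx0 hx1 a.2 (g.coeff j).2 hj0 h hδ))
  have hp0 : (p : Ω) ≠ 0 := by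
    have := charZero_of_padic p Ω
    exact Nat.cast_ne_zero.2 (Fact.out : p.Prime).ne_zero
  have hne : ∀ᶠ c in (𝒰 : Filter (M × ℕ)), (c.1 : Ω) ≠ 0 := by
    refine h𝒰 (Filter.eventually_curry_iff.2 ?_)
    filter_upwards [eventually_lt_aboveFilter hx1] with c hc
    refine .of_forall fun n h0 => ?_
    rw [h0, map_zero] at hc
    exact not_lt_zero hc
  have hF := (Filter.eventually_all_finset (Finset.range (f.natDegree + 1))).2
    fun i _ => key (f.coeff i) i (hf i) ε hε
  have hG := (Filter.eventually_all_finset ((Finset.range (g.natDegree + 1)).erase j)).2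
    fun i hi => key (g.coeff i) i (hgj i (Finset.ne_of_mem_erase hi)) 2⁻¹ (by norm_num)
  filter_upwards [hF, hG, hne] with c hF hG hc
  set w : Ω := (c.1 : Ω) * (p : Ω) ^ c.2 with hw
  set D : Ω := algebraMap M Ω (g.coeff j) * w ^ j with hD
  have hD0 : D ≠ 0 := mul_ne_zero hj0 (pow_ne_zero _ (mul_ne_zero hc (pow_ne_zero _ hp0)))
  have h1 := residueLE_sum _ hε.le hF
  have h2 := residueLE_sum _ (by norm_num) hG
  have hfD : ∑ i ∈ Finset.range (f.natDegree + 1), algebraMap M Ω (f.coeff i) * w ^ i / D =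
      aeval w f / D := by
    rw [Polynomial.aeval_eq_sum_range, Finset.sum_div]
    simp only [Algebra.smul_def]
  have hgD : 1 + ∑ i ∈ (Finset.range (g.natDegree + 1)).erase j,
      algebraMap M Ω (g.coeff i) * w ^ i / D = aeval w g / D := by
    rw [Polynomial.aeval_eq_sum_range, Finset.sum_div, ← Finset.add_sum_erase _ _
      (Finset.mem_range_succ_iff.2 (Polynomial.le_natDegree_of_ne_zero hj))]
    simp only [Algebra.smul_def]
    rw [← hD, div_self hD0]
  obtain ⟨h3, h4⟩ := hV.ne_zero_and_residueLE_inv_one_add (by norm_num) h2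
  rw [hfD] at h1
  rw [hgD] at h3 h4
  refine ⟨fun h0 => h3 (by rw [h0, zero_div]), ?_⟩
  have h5 := hV.residueLE_mul h1 h4
  rwa [mul_one, ← div_eq_mul_inv, div_div_div_cancel_right₀ hD0] at h5

end RamifiedApproximation

section OneStep
universe u
variable {p : ℕ} [Fact p.Prime] {Ω : Type u} [Field Ω] [Algebra ℚ_[p] Ω]
  {k L M : IntermediateField ℚ_[p] Ω} {V : ValuationSubring Ω}

theorem IsAlgebraic.mono_of_le {H H' : IntermediateField ℚ_[p] Ω} (h : H ≤ H') {z : Ω}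
    (hz : IsAlgebraic H z) : IsAlgebraic H' z := by
  obtain ⟨f, hf, hfz⟩ := hz
  refine ⟨f.map (IntermediateField.inclusion h).toRingHom, Polynomial.map_ne_zero hf, ?_⟩
  rw [Polynomial.aeval_def, Polynomial.eval₂_map]
  exact hfz

theorem minpoly_rootSet_subset_of_le {H H' : IntermediateField ℚ_[p] Ω} (h : H ≤ H') {z : Ω}
    (hz : IsAlgebraic H z) : (minpoly H' z).rootSet Ω ⊆ (minpoly H z).rootSet Ω := by
  intro s hs
  have hdvd : minpoly H' z ∣ (minpoly H z).map (IntermediateField.inclusion h).toRingHom := by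
    refine minpoly.dvd _ _ ?_
    rw [Polynomial.aeval_def, Polynomial.eval₂_map]
    exact minpoly.aeval H z
  have h1 := Polynomial.aeval_eq_zero_of_dvd_aeval_eq_zero hdvd (Polynomial.mem_rootSet.1 hs).2
  rw [Polynomial.aeval_def, Polynomial.eval₂_map] at h1
  exact (Polynomial.mem_rootSet_of_ne (minpoly.ne_zero hz.isIntegral)).2 h1

theorem isAlgebraic_sub_average {H : IntermediateField ℚ_[p] Ω} {z : Ω} (hz : IsAlgebraic H z)
    {S : Finset Ω} (hS : ∀ s ∈ S, s ∈ (minpoly H z).rootSet Ω) :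
    IsAlgebraic H (z - (S.card : Ω)⁻¹ * ∑ s ∈ S, s) :=
  mem_algebraicClosure_iff.1 (sub_mem (mem_algebraicClosure_iff.2 hz)
    (mul_mem (inv_mem (natCast_mem _ _)) (sum_mem fun s hs =>
      mem_algebraicClosure_iff.2 ⟨_, Polynomial.mem_rootSet.1 (hS s hs)⟩)))

theorem adjoin_restrictScalars_le_of_mem {x y : Ω} (h : x ∈ IntermediateField.adjoin M {y}) :
    (IntermediateField.adjoin M {x}).restrictScalars ℚ_[p] ≤
      (IntermediateField.adjoin M {y}).restrictScalars ℚ_[p] := by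
  have : IntermediateField.adjoin M {x} ≤ IntermediateField.adjoin M {y} :=
    IntermediateField.adjoin_simple_le_iff.2 h
  exact this

theorem exists_valuation_eq_mul_zpow {x : Ω}
    (hB : ∀ m, m ≠ 0 → ∀ b ∈ M, V.valuation x ^ m ≠ V.valuation b) {z : Ω} (hz : z ≠ 0)
    (halg : IsAlgebraic ((IntermediateField.adjoin M {x}).restrictScalars ℚ_[p]) z) :
    ∃ m, m ≠ 0 ∧ ∃ a ∈ M, ∃ j : ℤ, V.valuation z ^ m = V.valuation (a * x ^ j) := by
  have hx0 : x ≠ 0 := by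
    rintro rfl
    exact hB 1 one_ne_zero 0 (zero_mem _) (pow_one _)
  have hdom : ∀ f : Polynomial M, f ≠ 0 → ∃ a : M, ∃ i : ℕ,
      V.valuation (Polynomial.aeval x f) = V.valuation ((a : Ω) * x ^ i) := by
    intro f hf
    obtain ⟨j, hj, h⟩ := (exists_dominant_or_exists_eq V.valuation hf hx0).resolve_right (by
      rintro ⟨i, j, hij, hi, hj, h⟩
      exact hB (j - i) (Nat.sub_pos_of_lt hij).ne' _ (div_mem (f.coeff i).2 (f.coeff j).2)
        (valuation_pow_sub_eq V.valuation ((_root_.map_ne_zero _).2 hj) hx0 hij h))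
    exact ⟨_, j, valuation_aeval_eq_of_dominant V.valuation hj h⟩
  obtain ⟨m, hm, h, h0, hzh⟩ := exists_valuation_pow_eq V.valuation hz halg
  obtain ⟨f, g, hfg⟩ := (IntermediateField.mem_adjoin_simple_iff M _).1 h.2
  have h0' : (h : Ω) ≠ 0 := fun h1 => h0 (Subtype.ext h1)
  obtain ⟨a, i, ha⟩ := hdom f (by
    rintro rfl
    exact h0' (by rw [hfg, map_zero, zero_div]))
  obtain ⟨b, j, hb⟩ := hdom g (by
    rintro rfl
    exact h0' (by rw [hfg, map_zero, div_zero]))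
  refine ⟨m, hm, a / b, div_mem a.2 b.2, i - j, ?_⟩
  rw [hzh, show (algebraMap _ Ω h : Ω) = h from rfl, hfg, map_div₀, ha, hb, ← map_div₀,
    zpow_sub₀ hx0, zpow_natCast, zpow_natCast, mul_div_mul_comm]

namespace IsPlace
variable [IsAlgClosed Ω]

/-- If the valuation of `x` is not torsion over the value group of `M`, then replacing `x` by a
root of it up to a constant makes finitely many given valuations integral combinations of the
valuation of `x` and the value group of `M`. -/
theorem exists_root_valuation_eq (hV : IsPlace k L V) (hk : k ≤ M) (hM : M ≤ L)
    (hrac : ∀ t ∈ L, IsAlgebraic M t → t ∈ M) {x : Ω} (hxL : x ∈ L)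
    (hB : ∀ m, m ≠ 0 → ∀ b ∈ M, V.valuation x ^ m ≠ V.valuation b) (hx1 : V.valuation x < 1)
    (Z : Finset Ω)
    (hZ : ∀ z ∈ Z, IsAlgebraic ((IntermediateField.adjoin M {x}).restrictScalars ℚ_[p]) z) :
    ∃ y ∈ L, x ∈ IntermediateField.adjoin M {y} ∧
      (∀ m, m ≠ 0 → ∀ b ∈ M, V.valuation y ^ m ≠ V.valuation b) ∧ V.valuation y < 1 ∧
      ∀ z ∈ Z, z ≠ 0 → ∃ h ∈ IntermediateField.adjoin M {y}, V.valuation h = V.valuation z := by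
  have hx0 : x ≠ 0 := by
    rintro rfl
    exact hB 1 one_ne_zero 0 (zero_mem _) (pow_one _)
  have hex : ∀ z : Ω, ∃ m, m ≠ 0 ∧ (z ∈ Z → z ≠ 0 → ∃ a ∈ M, ∃ j : ℤ,
      V.valuation z ^ m = V.valuation (a * x ^ j)) := by
    intro z
    by_cases hz : z ∈ Z ∧ z ≠ 0
    · obtain ⟨m, hm, h⟩ := exists_valuation_eq_mul_zpow hB hz.2 (hZ z hz.1)
      exact ⟨m, hm, fun _ _ => h⟩
    · exact ⟨1, one_ne_zero, fun h1 h2 => absurd ⟨h1, h2⟩ hz⟩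
  choose m hm hma using hex
  set N := ∏ z ∈ Z, m z with hN
  have hN0 : N ≠ 0 := Finset.prod_ne_zero_iff.2 fun z _ => hm z
  obtain ⟨c, hc, y, hy, hc0, hy0, hxy⟩ := hV.good.exists_eq_mul_pow hxL hx0 hN0
  have hvx : V.valuation x = V.valuation y ^ N := by
    rw [hxy, map_mul, hV.valuation_Qbar (hV.good.le_Qbar hc) hc0, one_mul, map_pow]
  have hyM : y ∈ IntermediateField.adjoin M {y} := IntermediateField.mem_adjoin_simple_self M y
  have hMy : ∀ b ∈ M, b ∈ IntermediateField.adjoin M {y} := fun b hb =>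
    (IntermediateField.adjoin M {y}).algebraMap_mem ⟨b, hb⟩
  refine ⟨y, hy, ?_, fun d hd b hb h => hB d hd (b ^ N) (pow_mem hb _) ?_, ?_, fun z hz hz0 => ?_⟩
  · rw [hxy]
    exact mul_mem (hMy c (hk hc)) (pow_mem hyM _)
  · rw [hvx, ← pow_mul, mul_comm, pow_mul, h, map_pow]
  · rw [hvx] at hx1
    exact lt_of_pow_lt_pow_left₀ N zero_le (by rwa [one_pow])
  · obtain ⟨a, ha, j, hj⟩ := hma z hz hz0
    obtain ⟨d, hd⟩ : m z ∣ N := Finset.dvd_prod_of_mem m hz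
    have hd0 : d ≠ 0 := by
      rintro rfl
      exact hN0 (by rw [hd, mul_zero])
    have hyj : y ^ (j * d) ≠ 0 := zpow_ne_zero _ hy0
    have hval : V.valuation (z / y ^ (j * d)) ^ N = V.valuation (a ^ d) := by
      rw [map_div₀, div_pow, div_eq_iff (pow_ne_zero _ ((_root_.map_ne_zero _).2 hyj)), hd, pow_mul,
        hj, ← hd, map_mul, mul_pow, map_pow, map_zpow₀, map_zpow₀, hvx, ← zpow_natCast _ N,
        ← zpow_natCast _ N, ← zpow_natCast _ d, ← zpow_natCast _ d, ← zpow_mul, ← zpow_mul,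
        ← zpow_mul]
      congr 2
      ring
    have ha0 : a ^ d ≠ 0 := fun h0 => by
      rw [h0, map_zero] at hval
      exact pow_ne_zero _ ((_root_.map_ne_zero _).2 (div_ne_zero hz0 hyj)) hval
    obtain ⟨l, hl, -, hlz⟩ := hV.exists_valuation_eq_of_pow_eq hk hM hrac (pow_mem ha d) ha0 hN0
      hval
    refine ⟨l * y ^ (j * d), mul_mem (hMy l hl) (zpow_mem hyM _), ?_⟩
    rw [map_mul, hlz, ← map_mul, div_mul_cancel₀ _ hyj]

theorem exists_pow_ne_of_best (hV : IsPlace k L V) (hk : k ≤ M) (hM : M ≤ L)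
    (hrac : ∀ t ∈ L, IsAlgebraic M t → t ∈ M) {x : Ω} (hxL : x ∈ L) {b : Ω} (hb : b ∈ M)
    (hxb : x ≠ b) (hbest : ∀ b' ∈ M, V.valuation (x - b) ≤ V.valuation (x - b')) {m : ℕ}
    (hm : m ≠ 0) {c : Ω} (hc : c ∈ M) : V.valuation (x - b) ^ m ≠ V.valuation c := by
  intro h
  have hx0 : x - b ≠ 0 := sub_ne_zero.2 hxb
  have hc0 : c ≠ 0 := by
    rintro rfl
    rw [map_zero] at h
    exact pow_ne_zero _ ((_root_.map_ne_zero _).2 hx0) h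
  obtain ⟨l, hl, hl0, hlx⟩ := hV.exists_valuation_eq_of_pow_eq hk hM hrac hc hc0 hm h
  obtain ⟨e, he, hlt⟩ := hV.exists_sub_lt ((x - b) / l)
    (div_mem (sub_mem hxL (hM hb)) (hM hl)) (by
      rw [← V.valuation_le_one_iff, map_div₀, hlx,
        div_self ((_root_.map_ne_zero V.valuation).2 hx0)])
  refine (hbest (b + e * l) (add_mem hb (mul_mem (hk he) hl))).not_gt ?_
  have h1 : x - (b + e * l) = ((x - b) / l - e) * l := by
    rw [sub_mul, div_mul_cancel₀ _ hl0, sub_add_eq_sub_sub]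
  rw [h1, map_mul, hlx]
  exact (mul_lt_mul_iff_left₀ (zero_lt_iff.2 ((_root_.map_ne_zero _).2 hx0))).2 hlt |>.trans_eq
    (one_mul _)

/-- After replacing an element of `L` outside `M` by a suitable generator, it can be approximated
by elements of `M`. -/
theorem exists_approximates (hV : IsPlace k L V) (hk : k ≤ M) (hM : M ≤ L)
    (hrac : ∀ t ∈ L, IsAlgebraic M t → t ∈ M) {x : Ω} (hxL : x ∈ L) (hxM : x ∉ M) (Z : Finset Ω)
    (hZ : ∀ z ∈ Z, IsAlgebraic ((IntermediateField.adjoin M {x}).restrictScalars ℚ_[p]) z) :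
    ∃ y ∈ L, y ∉ M ∧ x ∈ IntermediateField.adjoin M {y} ∧
      (∀ z ∈ Z, z ≠ 0 → ∃ h ∈ IntermediateField.adjoin M {y}, V.valuation h = V.valuation z) ∧
      ∃ (I : Type u) (𝒰 : Ultrafilter I) (y' : I → Ω), (∀ i, y' i ∈ M) ∧
        Approximates 𝒰 V M y y' := by
  by_cases hA : ∀ b ∈ M, ∃ b' ∈ M, V.valuation (x - b') < V.valuation (x - b)
  · have := approxFilter_neBot hA
    refine ⟨x, hxL, hxM, IntermediateField.mem_adjoin_simple_self M x, fun z hz hz0 => ?_, M,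
      Ultrafilter.of (approxFilter V M x), fun b => b, fun b => b.2,
      hV.approximates_approxFilter hM hrac hxL hxM (Ultrafilter.of_le _)⟩
    obtain ⟨l, hl, hlz⟩ := hV.exists_valuation_eq_of_no_best hk hM hrac hxL hA hz0 (hZ z hz)
    exact ⟨l, (IntermediateField.adjoin M {x}).algebraMap_mem ⟨l, hl⟩, hlz⟩
  push Not at hA
  obtain ⟨b, hb, hbest⟩ := hA
  have hxb : x ≠ b := fun h => hxM (h ▸ hb)
  obtain ⟨x₁, hx₁L, hxx₁, hx₁lt, hB⟩ : ∃ x₁ ∈ L, x ∈ IntermediateField.adjoin M {x₁} ∧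
      V.valuation x₁ < 1 ∧ ∀ m, m ≠ 0 → ∀ c ∈ M, V.valuation x₁ ^ m ≠ V.valuation c := by
    have hB : ∀ m, m ≠ 0 → ∀ c ∈ M, V.valuation (x - b) ^ m ≠ V.valuation c := fun m hm c hc =>
      hV.exists_pow_ne_of_best hk hM hrac hxL hb hxb hbest hm hc
    have hxbL : x - b ∈ L := sub_mem hxL (hM hb)
    have hbM : ∀ t, b ∈ IntermediateField.adjoin M {t} := fun t =>
      (IntermediateField.adjoin M {t}).algebraMap_mem ⟨b, hb⟩
    have hself : ∀ t : Ω, t ∈ IntermediateField.adjoin M {t} :=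
      IntermediateField.mem_adjoin_simple_self M
    rcases lt_trichotomy (V.valuation (x - b)) 1 with h | h | h
    · refine ⟨x - b, hxbL, ?_, h, hB⟩
      rw [← sub_add_cancel x b]
      exact add_mem (by simpa using hself (x - b)) (hbM _)
    · exact absurd (by rw [pow_one, h, map_one]) (hB 1 one_ne_zero 1 (one_mem _))
    · refine ⟨(x - b)⁻¹, inv_mem hxbL, ?_, ?_, fun m hm c hc hmc =>
        hB m hm c⁻¹ (inv_mem hc) ?_⟩
      · have h1 := add_mem (inv_mem (hself (x - b)⁻¹)) (hbM (x - b)⁻¹)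
        rwa [inv_inv, sub_add_cancel] at h1
      · rw [map_inv₀]
        exact inv_lt_one_of_one_lt₀ h
      · rw [map_inv₀, inv_pow] at hmc
        rw [map_inv₀, ← hmc, inv_inv]
  obtain ⟨y, hyL, hxy, hBy, hylt, hyZ⟩ := hV.exists_root_valuation_eq hk hM hrac hx₁L hB hx₁lt Z
    fun z hz => (hZ z hz).mono_of_le (adjoin_restrictScalars_le_of_mem hxx₁)
  have := aboveFilter_neBot (M := M) hylt
  have := curry_atTop_neBot (aboveFilter V M y)
  refine ⟨y, hyL, fun hyM => hBy 1 one_ne_zero y hyM (pow_one _), ?_, hyZ, M × ℕ,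
    Ultrafilter.of ((aboveFilter V M y).curry Filter.atTop), _,
    fun c => mul_mem c.1.2 (pow_mem (natCast_mem _ p) _),
    hV.approximates_aboveFilter hk hM hrac hylt hBy (Ultrafilter.of_le _)⟩
  exact adjoin_restrictScalars_le_of_mem hxy hxx₁

/-- Finitely many elements of `L` algebraic over `M(x)` specialize into `M`. -/
theorem exists_specialization_adjoin (hV : IsPlace k L V) (hk : k ≤ M) (hM : M ≤ L)
    (hrac : ∀ t ∈ L, IsAlgebraic M t → t ∈ M) {x : Ω} (hxL : x ∈ L) (hxM : x ∉ M) {n : ℕ}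
    {y : Fin n → Ω} (hyL : ∀ j, y j ∈ L)
    (hy : ∀ j, IsAlgebraic ((IntermediateField.adjoin M {x}).restrictScalars ℚ_[p]) (y j)) :
    ∃ y' : Fin n → Ω, (∀ j, y' j ∈ M) ∧
      ∀ f : MvPolynomial (Fin n) M, MvPolynomial.aeval y f = 0 → MvPolynomial.aeval y' f = 0 := by
  classical
  let R : Fin n → Finset Ω := fun j => ((minpoly ((IntermediateField.adjoin M {x}).restrictScalars
    ℚ_[p]) (y j)).rootSet_finite Ω).toFinset
  let Z : Finset Ω := Finset.univ.biUnion fun j => (R j).powerset.image fun S =>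
    y j - (S.card : Ω)⁻¹ * ∑ s ∈ S, s
  have hZ : ∀ z ∈ Z, IsAlgebraic ((IntermediateField.adjoin M {x}).restrictScalars ℚ_[p]) z := by
    intro z hz
    obtain ⟨j, -, hz⟩ := Finset.mem_biUnion.1 hz
    obtain ⟨S, hS, rfl⟩ := Finset.mem_image.1 hz
    exact isAlgebraic_sub_average (hy j) fun s hs =>
      (Set.Finite.mem_toFinset _).1 (Finset.mem_powerset.1 hS hs)
  obtain ⟨t, htL, htM, hxt, hZt, I, 𝒰, t', ht', happ⟩ :=
    hV.exists_approximates hk hM hrac hxL hxM Z hZ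
  have hle := adjoin_restrictScalars_le_of_mem hxt
  exact hV.exists_specialization hk hM hrac htL (fun h => htM (hrac t htL h)) ht' happ hyL
    (fun j => (hy j).mono_of_le hle) (R := R)
    (fun j s hs => (Set.Finite.mem_toFinset _).2 (minpoly_rootSet_subset_of_le hle (hy j) hs))
    fun j S hS h0 => hZt _ (Finset.mem_biUnion.2 ⟨j, Finset.mem_univ _, Finset.mem_image.2
      ⟨S, Finset.mem_powerset.2 hS, rfl⟩⟩) h0

end IsPlace
end OneStep

theorem mem_algebraicClosure_of_isAlgebraic {F E : Type*} [Field F] [Field E] [Algebra F E] {s : E}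
    (h : IsAlgebraic (algebraicClosure F E) s) : s ∈ algebraicClosure F E :=
  mem_algebraicClosure_iff.2 (isIntegral_trans (R := F) s h.isIntegral).isAlgebraic

namespace IsPlace
universe u
variable {p : ℕ} [Fact p.Prime] {Ω : Type u} [Field Ω] [Algebra ℚ_[p] Ω]
  {k L M : IntermediateField ℚ_[p] Ω} {V : ValuationSubring Ω} [IsAlgClosed Ω]

theorem exists_specialization_of_list (hV : IsPlace k L V) (l : List Ω) (hl : ∀ t ∈ l, t ∈ L)
    (M : IntermediateField ℚ_[p] Ω) (hk : k ≤ M) (hM : M ≤ L)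
    (hrac : ∀ t ∈ L, IsAlgebraic M t → t ∈ M) {n : ℕ} (y : Fin n → Ω)
    (hy : ∀ j, ∀ E : IntermediateField ℚ_[p] Ω, M ≤ E → (∀ t ∈ l, t ∈ E) → y j ∈ E) :
    ∃ y' : Fin n → Ω, (∀ j, y' j ∈ M) ∧
      ∀ f : MvPolynomial (Fin n) M, MvPolynomial.aeval y f = 0 → MvPolynomial.aeval y' f = 0 := by
  induction l generalizing M with
  | nil => exact ⟨y, fun j => hy j M le_rfl (by simp), fun f hf => hf⟩
  | cons t l ih =>
    rw [List.forall_mem_cons] at hl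
    by_cases htM : t ∈ M
    · refine ih hl.2 M hk hM hrac fun j E hE hlE => hy j E hE ?_
      exact List.forall_mem_cons.2 ⟨hE htM, hlE⟩
    let H := (IntermediateField.adjoin M {t}).restrictScalars ℚ_[p]
    have hMH : M ≤ H := fun c hc => (IntermediateField.adjoin M {t}).algebraMap_mem ⟨c, hc⟩
    let N : IntermediateField ℚ_[p] Ω := (algebraicClosure H Ω).restrictScalars ℚ_[p]
    have hHN : H ≤ N := fun c hc => (algebraicClosure H Ω).algebraMap_mem ⟨c, hc⟩
    have htH : t ∈ H := IntermediateField.mem_adjoin_simple_self M t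
    obtain ⟨y', hy', hyy'⟩ := ih hl.2 (L ⊓ N) (hk.trans (le_inf hM (hMH.trans hHN))) inf_le_left
      (fun s hs hsalg => ⟨hs, mem_algebraicClosure_of_isAlgebraic
        (hsalg.mono_of_le inf_le_right : IsAlgebraic N s)⟩)
      fun j E hE hlE => hy j E ((le_inf hM (hMH.trans hHN)).trans hE)
        (List.forall_mem_cons.2 ⟨hE ⟨hl.1, hHN htH⟩, hlE⟩)
    obtain ⟨y'', hy'', hyy''⟩ := hV.exists_specialization_adjoin hk hM hrac hl.1 htM
      (fun j => (hy' j).1) fun j => mem_algebraicClosure_iff.1 (hy' j).2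
    refine ⟨y'', hy'', fun f hf => hyy'' f ?_⟩
    have h1 : ∀ w : Fin n → Ω, MvPolynomial.aeval w (MvPolynomial.map
        (IntermediateField.inclusion (le_inf hM (hMH.trans hHN))).toRingHom f) =
        MvPolynomial.aeval w f := fun w => by
      rw [MvPolynomial.aeval_def, MvPolynomial.eval₂_map]
      rfl
    rw [← h1]
    exact hyy' _ (by rw [h1, hf])

/-- Every tuple in `L` specializes to a `k`-rational tuple. -/
theorem exists_rational_specialization (hV : IsPlace k L V) {n : ℕ} (y : Fin n → Ω)
    (hy : ∀ j, y j ∈ L) : ∃ y' : Fin n → Ω, (∀ j, y' j ∈ k) ∧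
      ∀ f : MvPolynomial (Fin n) k, MvPolynomial.aeval y f = 0 → MvPolynomial.aeval y' f = 0 := by
  refine hV.exists_specialization_of_list (List.ofFn y) (List.forall_mem_ofFn_iff.2 hy) k le_rfl
    hV.good.le (fun t ht htk => hV.good.mem_k ht ?_) y
    fun j E _ hE => hE _ (List.mem_ofFn.2 ⟨j, rfl⟩)
  exact mem_algebraicClosure_of_isAlgebraic (htk.mono_of_le hV.good.le_Qbar)

end IsPlace

section GaloisSection
variable {k F Ω : Type*} [Field k] [Field F] [Field Ω] [Algebra k F] [Algebra F Ω] [Algebra k Ω]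
  [IsScalarTower k F Ω] [IsAlgClosed Ω]

theorem resHom_apply_coe (σ : Ω ≃ₐ[F] Ω) (x : algebraicClosure k Ω) :
    (resHom k F Ω σ x : Ω) = σ x :=
  AlgEquiv.restrictNormal_commutes (σ.restrictScalars k) (algebraicClosure k Ω) x

theorem eq_top_of_fixed_subset [CharZero k] [Algebra.IsAlgebraic F Ω]
    {s : (algebraicClosure k Ω ≃ₐ[k] algebraicClosure k Ω) →* (Ω ≃ₐ[F] Ω)} (hs : Continuous s)
    (hres : ∀ g, resHom k F Ω (s g) = g) (E : IntermediateField F Ω)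
    (hfix : ∀ x, (∀ g, s g x = x) → x ∈ E) (halg : ∀ x ∈ algebraicClosure k Ω, x ∈ E) :
    E = ⊤ := by
  have : CharZero F := charZero_of_injective_algebraMap (algebraMap k F).injective
  have : IsAlgClosure F Ω := ⟨‹_›, ‹_›⟩
  have : IsGalois F Ω := IsAlgClosure.isGalois F Ω
  have : IsAlgClosure k (algebraicClosure k Ω) := inferInstance
  have : IsGalois k (algebraicClosure k Ω) := IsAlgClosure.isGalois k _
  let H : ClosedSubgroup (Ω ≃ₐ[F] Ω) :=
    { s.range with isClosed' := (isCompact_range hs).isClosed }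
  rw [← InfiniteGalois.fixedField_fixingSubgroup E, ← IntermediateField.fixedField_bot]
  congr 1
  rw [eq_bot_iff]
  intro σ hσ
  rw [IntermediateField.mem_fixingSubgroup_iff] at hσ
  have h1 : σ ∈ (IntermediateField.fixedField H.toSubgroup).fixingSubgroup := by
    refine (IntermediateField.mem_fixingSubgroup_iff _ _).2 fun x hx => hσ x (hfix x fun g => ?_)
    exact hx ⟨s g, g, rfl⟩
  rw [InfiniteGalois.fixingSubgroup_fixedField] at h1
  obtain ⟨g, rfl⟩ := h1
  have hg : g = 1 := by
    rw [← hres g]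
    ext x
    rw [resHom_apply_coe]
    exact hσ x (halg x x.2)
  rw [hg, map_one]
  exact one_mem _

theorem exists_good_of_section {p : ℕ} [Fact p.Prime] [Algebra ℚ_[p] k] [Algebra ℚ_[p] Ω]
    [IsScalarTower ℚ_[p] k Ω] [FiniteDimensional ℚ_[p] k] [Algebra.IsAlgebraic F Ω]
    {s : (algebraicClosure k Ω ≃ₐ[k] algebraicClosure k Ω) →* (Ω ≃ₐ[F] Ω)} (hs : Continuous s)
    (hres : ∀ g, resHom k F Ω (s g) = g) :
    ∃ L : IntermediateField ℚ_[p] Ω, (∀ x : F, algebraMap F Ω x ∈ L) ∧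
      Good (IsScalarTower.toAlgHom ℚ_[p] k Ω).fieldRange L := by
  have hk0 : CharZero k := charZero_of_padic p k
  have hcoe : ∀ c : ℚ_[p], algebraMap ℚ_[p] Ω c = algebraMap F Ω (algebraMap k F
      (algebraMap ℚ_[p] k c)) := fun c => by
    rw [← IsScalarTower.algebraMap_apply k F Ω, ← IsScalarTower.algebraMap_apply ℚ_[p] k Ω]
  have hQ : ∀ x, x ∈ algebraicClosure k Ω ↔ x ∈ Qbar p Ω := fun x => by
    rw [mem_algebraicClosure_iff, mem_algebraicClosure_iff]
    exact ⟨fun h => h.restrictScalars ℚ_[p], fun h => h.tower_top k⟩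
  let L : IntermediateField ℚ_[p] Ω :=
    { carrier := {x | ∀ g, s g x = x}
      mul_mem' := fun hx hy g => by rw [map_mul, hx g, hy g]
      add_mem' := fun hx hy g => by rw [map_add, hx g, hy g]
      inv_mem' := fun x hx g => by rw [map_inv₀, hx g]
      algebraMap_mem' := fun c g => by rw [hcoe, AlgEquiv.commutes] }
  have hFL : ∀ x : F, algebraMap F Ω x ∈ L := fun x g => (s g).commutes x
  have hle : (IsScalarTower.toAlgHom ℚ_[p] k Ω).fieldRange ≤ L := by
    rintro _ ⟨c, rfl⟩
    change algebraMap k Ω c ∈ L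
    rw [IsScalarTower.algebraMap_apply k F Ω]
    exact hFL _
  refine ⟨L, hFL, hle, ?_, ?_, fun x => ?_, fun τ hτ => ?_⟩
  · rintro _ ⟨c, rfl⟩
    exact (hQ _).1 ((algebraicClosure k Ω).algebraMap_mem c)
  · have htop := eq_top_of_fixed_subset hs hres
      ((L ⊔ Qbar p Ω).toSubfield.toIntermediateField fun x =>
        (le_sup_left : L ≤ L ⊔ Qbar p Ω) (hFL x))
      (fun x hx => (le_sup_left : L ≤ L ⊔ Qbar p Ω) hx)
      fun x hx => (le_sup_right : Qbar p Ω ≤ L ⊔ Qbar p Ω) ((hQ x).1 hx)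
    refine eq_top_iff.2 fun x _ => ?_
    have hx : x ∈ (⊤ : IntermediateField F Ω) := trivial
    rwa [← htop] at hx
  · obtain ⟨q, hq, hqx⟩ := Algebra.IsAlgebraic.isAlgebraic (R := F) x
    let i : F →+* L := (algebraMap F Ω).codRestrict L.toSubfield hFL
    refine ⟨q.map i, (Polynomial.map_ne_zero_iff i.injective).2 hq, ?_⟩
    rw [Polynomial.aeval_def, Polynomial.eval₂_map]
    exact hqx
  · let e : algebraicClosure k Ω ≃+* Qbar p Ω :=
      { toFun := fun x => ⟨x, (hQ x).1 x.2⟩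
        invFun := fun x => ⟨x, (hQ x).2 x.2⟩
        map_mul' := fun _ _ => rfl
        map_add' := fun _ _ => rfl }
    let g : algebraicClosure k Ω ≃ₐ[k] algebraicClosure k Ω :=
      AlgEquiv.ofRingEquiv (f := (e.trans τ.toRingEquiv).trans e.symm) fun c => by
        have := hτ (e (algebraMap k _ c)) ⟨c, rfl⟩
        change e.symm (τ (e (algebraMap k _ c))) = _
        rw [this, RingEquiv.symm_apply_apply]
    refine ⟨AlgEquiv.ofRingEquiv (f := (s g).toRingEquiv) fun c => ?_, fun x hx => hx g,
      fun x => ?_⟩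
    · change s g _ = _
      rw [hcoe, AlgEquiv.commutes]
    · change s g (e.symm x : Ω) = _
      rw [← resHom_apply_coe, hres]
      rfl

/-- A finitely generated `k`-algebra with an `F`-rational point has a `k`-rational point as soon
as `Gal_F → Gal_k` has a section. -/
theorem nonempty_algHom_of_section (p : ℕ) [Fact p.Prime] [Algebra ℚ_[p] k]
    [FiniteDimensional ℚ_[p] k] [Algebra.IsAlgebraic F Ω]
    {s : (algebraicClosure k Ω ≃ₐ[k] algebraicClosure k Ω) →* (Ω ≃ₐ[F] Ω)} (hs : Continuous s)
    (hres : ∀ g, resHom k F Ω (s g) = g) {A : Type*} [CommRing A] [Algebra k A]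
    [Algebra.FiniteType k A] (φ : A →ₐ[k] F) :
    Nonempty (A →ₐ[k] k) := by
  let : Algebra ℚ_[p] Ω := ((algebraMap k Ω).comp (algebraMap ℚ_[p] k)).toAlgebra
  have : IsScalarTower ℚ_[p] k Ω := .of_algebraMap_eq fun _ => rfl
  obtain ⟨L, hFL, hL⟩ := exists_good_of_section (p := p) hs hres
  let k₀ := (IsScalarTower.toAlgHom ℚ_[p] k Ω).fieldRange
  have : FiniteDimensional ℚ_[p] k₀ :=
    Module.Finite.equiv (AlgEquiv.ofInjectiveField (IsScalarTower.toAlgHom ℚ_[p] k Ω)).toLinearEquiv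
  obtain ⟨V, hkV, hV⟩ := hL.exists_place
  obtain ⟨n, π, hπ⟩ := Algebra.FiniteType.iff_quotient_mvPolynomial''.1
    (inferInstance : Algebra.FiniteType k A)
  obtain ⟨y, hy, hyf⟩ := (IsPlace.mk hL hkV hV).exists_rational_specialization
    (fun j => algebraMap F Ω (φ (π (MvPolynomial.X j)))) fun j => hFL _
  choose z hz using hy
  change ∀ j, algebraMap k Ω (z j) = y j at hz
  let i : k →+* k₀ := (algebraMap k Ω).codRestrict k₀.toSubfield fun c => ⟨c, rfl⟩
  have hker : ∀ q ∈ RingHom.ker π, q ∈ RingHom.ker (MvPolynomial.aeval (R := k) z) := by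
    intro q hq
    rw [RingHom.mem_ker] at hq ⊢
    have hi : ∀ w : Fin n → Ω,
        MvPolynomial.aeval w (q.map i) = MvPolynomial.aeval (R := k) w q := fun w => by
      rw [MvPolynomial.aeval_def, MvPolynomial.eval₂_map]
      rfl
    have h2 := hyf (q.map i)
    rw [hi, hi] at h2
    have h3 : (MvPolynomial.aeval (R := k) fun j => algebraMap F Ω (φ (π (MvPolynomial.X j)))) =
        (IsScalarTower.toAlgHom k F Ω).comp (φ.comp π) := by
      ext j
      simp
    have h4 : MvPolynomial.aeval (R := k) y =
        (Algebra.ofId k Ω).comp (MvPolynomial.aeval (R := k) z) := by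
      ext j
      simp [← hz, Algebra.ofId_apply]
    rw [h3, h4, AlgHom.comp_apply, AlgHom.comp_apply, AlgHom.comp_apply, hq, map_zero, map_zero,
      Algebra.ofId_apply] at h2
    exact (map_eq_zero_iff _ (algebraMap k Ω).injective).1 (h2 rfl)
  exact ⟨(Ideal.Quotient.liftₐ _ (MvPolynomial.aeval z) hker).comp
    (Ideal.quotientKerAlgEquivOfSurjective hπ).symm.toAlgHom⟩

end GaloisSection

/-- **Koenigsmann's Lemma, `p`-adic case.**  Let `k/ℚ_p` be finite and let
`X` be an integral scheme of finite type over `k` such that `k` is relatively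
algebraically closed in `K = k(X)`.  If there is a birational Galois section
`s : Gal_k → Gal_K`, then `X` has a `k`-rational point. -/
theorem exists_rational_point_of_birational_section
    (p : ℕ) [Fact p.Prime]
    (k : Type) [Field k] [Algebra ℚ_[p] k] [FiniteDimensional ℚ_[p] k]
    (X : Scheme) [IsIntegral X]
    (f : X ⟶ Spec (CommRingCat.of k)) [LocallyOfFiniteType f] [QuasiCompact f]
    [Algebra k X.functionField]
    -- the `k`-algebra structure on the function field `K = k(X)` is the one induced by `f`
    (halg : ∀ a : k, algebraMap k X.functionField a =
      (@Scheme.germToFunctionField X _ ⊤ ⟨⟨Nonempty.some inferInstance, trivial⟩⟩)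
        (f.appTop ((Scheme.ΓSpecIso (CommRingCat.of k)).inv a)))
    -- `k` is relatively algebraically closed in `K` (geometric irreducibility)
    (hrac : ∀ x : X.functionField, IsAlgebraic k x → x ∈ (algebraMap k X.functionField).range)
    (Kbar : Type) [Field Kbar] [Algebra X.functionField Kbar] [Algebra k Kbar]
    [IsScalarTower k X.functionField Kbar] [IsAlgClosed Kbar]
    [Algebra.IsAlgebraic X.functionField Kbar]
    -- a birational Galois section
    (s : ((algebraicClosure k Kbar) ≃ₐ[k] (algebraicClosure k Kbar)) →*
      (Kbar ≃ₐ[X.functionField] Kbar))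
    (hs_cont : Continuous s)
    (hs_sec : ∀ g, resHom k X.functionField Kbar (s g) = g) :
    ∃ g : Spec (CommRingCat.of k) ⟶ X, g ≫ f = 𝟙 _ := by
  obtain ⟨_, ⟨U, hU, rfl⟩, hxU, -⟩ :=
    X.isBasis_affineOpens.exists_subset_of_mem_open (Set.mem_univ (genericPoint X)) isOpen_univ
  change IsAffineOpen U at hU
  have hUne : Nonempty U := ⟨⟨_, hxU⟩⟩
  let φ : CommRingCat.of k ⟶ Γ(X, U) := Spec.preimage (hU.fromSpec ≫ f)
  have hφ : Spec.map φ = hU.fromSpec ≫ f := Spec.map_preimage _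
  have hfin : φ.hom.FiniteType := HasRingHomProperty.Spec_iff (P := @LocallyOfFiniteType).1
    (by rw [hφ]; infer_instance)
  have hφ' : φ = (Scheme.ΓSpecIso (CommRingCat.of k)).inv ≫ f.appTop ≫
      X.presheaf.map (homOfLE le_top : U ⟶ ⊤).op := by
    have h : hU.fromSpec.appTop = X.presheaf.map (homOfLE le_top : U ⟶ ⊤).op ≫
        (Scheme.ΓSpecIso Γ(X, U)).inv := by
      refine (hU.fromSpec_app_of_le ⊤ le_top).trans (congrArg (_ ≫ ·) ?_)
      exact (congrArg (_ ≫ ·) ((Spec Γ(X, U)).presheaf.map_id _)).trans (Category.comp_id _)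
    rw [← cancel_mono (Scheme.ΓSpecIso Γ(X, U)).inv, Scheme.ΓSpecIso_inv_naturality, hφ,
      Scheme.Hom.comp_appTop, h, Category.assoc, Category.assoc]
  let : Algebra k Γ(X, U) := φ.hom.toAlgebra
  have : Algebra.FiniteType k Γ(X, U) := hfin
  let ψ : Γ(X, U) →ₐ[k] X.functionField :=
    { (X.germToFunctionField U).hom with
      commutes' := fun a => by
        change (X.germToFunctionField U) (φ a) = _
        rw [halg, hφ']
        exact X.presheaf.germ_res_apply (homOfLE le_top) _ hxU _ }
  obtain ⟨χ⟩ := nonempty_algHom_of_section p hs_cont hs_sec ψ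
  refine ⟨Spec.map (CommRingCat.ofHom χ.toRingHom) ≫ hU.fromSpec, ?_⟩
  rw [Category.assoc, ← hφ, ← Spec.map_comp, ← Spec.map_id]
  congr 1
  ext a
  exact χ.commutes a
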